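/- Let ε ∈ (0,1], let Ω be a bounded domain in ℂⁿ whose closure admits a Stein neighborhood basis, and let p be a strictly pseudoconvex boundary point of Ω of class C^{2,ε}. Then there exist a constant C > 0 and a neighborhood U of p such that σ_Ω(z) ≥ 1 − C·δ_Ω(z)^{ε/2} for every z ∈ Ω ∩ U. -/

import Mathlib

section
open Metric MeasureTheory Set
open scoped NNReal ENNReal

noncomputable section

/-- Complex Euclidean `n`-space. -/
abbrev Cn (n : ℕ) := EuclideanSpace ℂ (Fin n)

variable {n : ℕ}

instance : MeasurableSpace (Cn n) := borel _
instance : BorelSpace (Cn n) := ⟨rfl⟩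
instance : InnerProductSpace ℝ (Cn n) := InnerProductSpace.rclikeToReal ℂ _

/-- `δ_Ω(z)`: the Euclidean distance from `z` to the boundary of `Ω`. -/
def bdist (Ω : Set (Cn n)) (z : Cn n) : ℝ := Metric.infDist z (frontier Ω)

/-- The squeezing function `σ_Ω(z)` of a (bounded) domain `Ω`. -/
def squeezing (Ω : Set (Cn n)) (z : Cn n) : ℝ :=
  sSup {r : ℝ | 0 < r ∧ ∃ f : Cn n → Cn n,
    DifferentiableOn ℂ f Ω ∧ Set.InjOn f Ω ∧ Set.MapsTo f Ω (Metric.ball 0 1) ∧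
    f z = 0 ∧ Metric.ball (0 : Cn n) r ⊆ f '' Ω}

/-- The Kobayashi metric `κ_Ω(z;X)`. -/
def kobayashi (Ω : Set (Cn n)) (z X : Cn n) : ℝ :=
  sInf {r : ℝ | ∃ (α : ℂ) (φ : ℂ → Cn n),
    DifferentiableOn ℂ φ (Metric.ball 0 1) ∧ Set.MapsTo φ (Metric.ball 0 1) Ω ∧
    φ 0 = z ∧ α • deriv φ 0 = X ∧ r = ‖α‖}

/-- The Carathéodory metric `γ_Ω(z;X)`. -/
def caratheodory (Ω : Set (Cn n)) (z X : Cn n) : ℝ :=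
  sSup {r : ℝ | ∃ f : Cn n → ℂ,
    DifferentiableOn ℂ f Ω ∧ Set.MapsTo f Ω (Metric.ball 0 1) ∧
    r = ‖fderiv ℂ f z X‖}

/-- `⟨∂ρ(q),X⟩ = Σ_j (∂ρ/∂z_j)(q) X_j`, expressed via the real differential:
`⟨∂ρ(q),X⟩ = (Dρ(q)X - i·Dρ(q)(iX))/2`. -/
def cderiv (ρ : Cn n → ℝ) (q X : Cn n) : ℂ :=
  (((fderiv ℝ ρ q X : ℝ) : ℂ) - Complex.I * ((fderiv ℝ ρ q (Complex.I • X) : ℝ) : ℂ)) / 2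

/-- The Levi form `L_ρ(q;X) = Σ_{j,k} (∂²ρ/∂z_j∂z̄_k)(q) X_j X̄_k`, expressed via the real
second differential: `L_ρ(q;X) = (D²ρ(q)[X,X] + D²ρ(q)[iX,iX])/4`. -/
def leviForm (ρ : Cn n → ℝ) (q X : Cn n) : ℝ :=
  (fderiv ℝ (fun w => fderiv ℝ ρ w X) q X
    + fderiv ℝ (fun w => fderiv ℝ ρ w (Complex.I • X)) q (Complex.I • X)) / 4

/-- `p` is a strictly pseudoconvex boundary point of `Ω` of class `C^{m,ε}`. -/
def IsStrictPscPtHolder (Ω : Set (Cn n)) (p : Cn n) (m : ℕ) (ε : ℝ) : Prop :=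
  p ∈ frontier Ω ∧ ∃ W : Set (Cn n), IsOpen W ∧ p ∈ W ∧ ∃ ρ : Cn n → ℝ,
    ContDiffOn ℝ m ρ W ∧
    (∃ C : ℝ≥0, HolderOnWith C ε.toNNReal (iteratedFDeriv ℝ m ρ) W) ∧
    Ω ∩ W = {z ∈ W | ρ z < 0} ∧
    (∀ q ∈ frontier Ω ∩ W, fderiv ℝ ρ q ≠ 0) ∧
    (∀ q ∈ frontier Ω ∩ W, ∀ X : Cn n, X ≠ 0 → cderiv ρ q X = 0 → 0 < leviForm ρ q X)

/-- `p` is a strictly pseudoconvex boundary point of `Ω` of class `C²`. -/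
def IsStrictPscPtC2 (Ω : Set (Cn n)) (p : Cn n) : Prop :=
  p ∈ frontier Ω ∧ ∃ W : Set (Cn n), IsOpen W ∧ p ∈ W ∧ ∃ ρ : Cn n → ℝ,
    ContDiffOn ℝ 2 ρ W ∧
    Ω ∩ W = {z ∈ W | ρ z < 0} ∧
    (∀ q ∈ frontier Ω ∩ W, fderiv ℝ ρ q ≠ 0) ∧
    (∀ q ∈ frontier Ω ∩ W, ∀ X : Cn n, X ≠ 0 → cderiv ρ q X = 0 → 0 < leviForm ρ q X)

/-- An open set `D ⊆ ℂⁿ` is pseudoconvex: `u = -log dist(·, Dᶜ)` is plurisubharmonic on `D`. -/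
def IsPseudoconvex (D : Set (Cn n)) : Prop :=
  IsOpen D ∧
  UpperSemicontinuousOn (fun z => -Real.log (Metric.infDist z Dᶜ)) D ∧
  ∀ a ∈ D, ∀ w : Cn n, ∀ r : ℝ, 0 < r →
    (∀ l : ℂ, ‖l‖ ≤ r → a + l • w ∈ D) →
    -Real.log (Metric.infDist a Dᶜ) ≤
      (1 / (2 * Real.pi)) * ∫ θ in (0:ℝ)..(2 * Real.pi),
        -Real.log (Metric.infDist (a + ((r : ℂ) * Complex.exp (θ * Complex.I)) • w) Dᶜ)

/-- `cl(Ω)` admits a Stein neighborhood basis. -/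
def HasSteinBasis (Ω : Set (Cn n)) : Prop :=
  ∀ W : Set (Cn n), IsOpen W → closure Ω ⊆ W →
    ∃ U : Set (Cn n), IsPseudoconvex U ∧ closure Ω ⊆ U ∧ U ⊆ W

/-- The squared `L²`-norm of `f` on `D` (as an extended nonnegative real). -/
def L2normSq (D : Set (Cn n)) (f : Cn n → ℂ) : ℝ≥0∞ := ∫⁻ w in D, (‖f w‖₊ : ℝ≥0∞) ^ 2

/-- `J⁰_D(z) = sup {|f(z)|² : f ∈ L²_h(D), ‖f‖_D ≤ 1}`; equals the Bergman kernel on the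
diagonal. -/
def J0 (D : Set (Cn n)) (z : Cn n) : ℝ :=
  sSup {v : ℝ | ∃ f : Cn n → ℂ, DifferentiableOn ℂ f D ∧ L2normSq D f ≤ 1 ∧ v = ‖f z‖ ^ 2}

/-- `J¹_D(z;X) = sup {|f'(z)X|² : f ∈ L²_h(D), ‖f‖_D ≤ 1, f(z) = 0}`. -/
def J1 (D : Set (Cn n)) (z X : Cn n) : ℝ :=
  sSup {v : ℝ | ∃ f : Cn n → ℂ, DifferentiableOn ℂ f D ∧ L2normSq D f ≤ 1 ∧ f z = 0 ∧
    v = ‖fderiv ℂ f z X‖ ^ 2}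

/-- `J²_D(z;X,Y) = sup {|Σ_{j,k} f_{ζ_jζ_k}(z) X_j Y_k|² : f ∈ L²_h(D), ‖f‖_D ≤ 1,
f(z) = 0, f'(z) = 0}`. -/
def J2 (D : Set (Cn n)) (z X Y : Cn n) : ℝ :=
  sSup {v : ℝ | ∃ f : Cn n → ℂ, DifferentiableOn ℂ f D ∧ L2normSq D f ≤ 1 ∧ f z = 0 ∧
    fderiv ℂ f z = 0 ∧ v = ‖fderiv ℂ (fun w => fderiv ℂ f w Y) z X‖ ^ 2}

/-- The Bergman metric `β_D(z;X) = (J¹_D(z;X)/J⁰_D(z))^{1/2}`. -/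
def bergman (D : Set (Cn n)) (z X : Cn n) : ℝ := Real.sqrt (J1 D z X / J0 D z)

/-- The bisectional curvature of the Bergman metric. -/
def bisect (D : Set (Cn n)) (z X Y : Cn n) : ℝ :=
  2 - J0 D z * J2 D z X Y / (J1 D z X * J1 D z Y)

/-- The holomorphic sectional curvature `s_D(z;X)` of the Bergman metric. -/
def sectCurv (D : Set (Cn n)) (z X : Cn n) : ℝ := bisect D z X X

/-- The Ricci curvature `r_D(z;X)` of the Bergman metric (w.r.t. the standard basis). -/
def ricciCurv (D : Set (Cn n)) (z X : Cn n) : ℝ :=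
  ∑ j : Fin n, bisect D z (EuclideanSpace.single j 1) X

/-- The scalar curvature `t_D(z)` of the Bergman metric. -/
def scalarCurv (D : Set (Cn n)) (z : Cn n) : ℝ :=
  ∑ j : Fin n, ricciCurv D z (EuclideanSpace.single j 1)

/-- `M(z;X) = ( |⟨∂δ_Ω(z),X⟩|²/δ_Ω(z)² + L(z;X)/δ_Ω(z) )^{1/2}`, where `L` is the Levi form
of `-δ_Ω`. -/
def Mfun (Ω : Set (Cn n)) (z X : Cn n) : ℝ :=
  Real.sqrt (‖cderiv (bdist Ω) z X‖ ^ 2 / (bdist Ω z) ^ 2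
    + leviForm (fun w => -(bdist Ω w)) z X / bdist Ω z)

/-- The sesquilinear form of the Bergman metric, recovered from `β²` by polarization. -/
def bergForm (D : Set (Cn n)) (z X Y : Cn n) : ℂ :=
  (((J1 D z (X + Y) / J0 D z : ℝ) : ℂ) - ((J1 D z (X - Y) / J0 D z : ℝ) : ℂ)
    + Complex.I * ((J1 D z (X + Complex.I • Y) / J0 D z : ℝ) : ℂ)
    - Complex.I * ((J1 D z (X - Complex.I • Y) / J0 D z : ℝ) : ℂ)) / 4

/-- The Hermitian matrix `(B_{jk}(z))` of the Bergman metric in the standard coordinates. -/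
def bergMat (D : Set (Cn n)) (z : Cn n) : Matrix (Fin n) (Fin n) ℂ :=
  fun j k => bergForm D z (EuclideanSpace.single j 1) (EuclideanSpace.single k 1)

/-- The canonical Bergman invariant `J_D(z) = Δ_D(z)/K_D(z)`. -/
def canonInvariant (D : Set (Cn n)) (z : Cn n) : ℂ :=
  (bergMat D z).det / ((J0 D z : ℝ) : ℂ)

end
end

notation:max "c%" f:max => fun y => ((f y : ℝ) : ℂ)
notation "p%" => by positivity
notation "l%" => by linarith
notation "n%" => by norm_num
notation "s%" => by simp

theorem mll {a b c : ℝ} (h : b ≤ c) (h0 : 0 ≤ a) : a * b ≤ a * c := mul_le_mul_of_nonneg_left h h0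
theorem mlr {a b c : ℝ} (h : b ≤ c) (h0 : 0 ≤ a) : b * a ≤ c * a := mul_le_mul_of_nonneg_right h h0
theorem ex_eq {α : Type*} (a : α) : ∃ x, x = a := ⟨a, rfl⟩

section
open Complex ContDiff MeasureTheory
variable {E : Type*} [NormedAddCommGroup E] [NormedSpace ℂ E] [NormedSpace ℝ E]

noncomputable def wd (c : ℂ) (e : E) (f : E → ℂ) (x : E) : ℂ :=
  (1/2) * (fderiv ℝ f x e + c * fderiv ℝ f x (I • e))

notation "wb" => wd (-I)

lemma wd_mul (c : ℂ) (e : E) {f g : E → ℂ} {x : E} (hf : DifferentiableAt ℝ f x)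
    (hg : DifferentiableAt ℝ g x) :
    wd c e (fun y => f y * g y) x = wd c e f x * g x + f x * wd c e g x := by
  simp only [wd]
  rw [fderiv_fun_mul hf hg]
  simp; ring

lemma wd_add (c : ℂ) (e : E) {f g : E → ℂ} {x : E} (hf : DifferentiableAt ℝ f x)
    (hg : DifferentiableAt ℝ g x) :
    wd c e (fun y => f y + g y) x = wd c e f x + wd c e g x := by
  simp only [wd]
  rw [fderiv_fun_add hf hg]
  simp; ring

lemma wd_sub (c : ℂ) (e : E) {f g : E → ℂ} {x : E} (hf : DifferentiableAt ℝ f x)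
    (hg : DifferentiableAt ℝ g x) :
    wd c e (fun y => f y - g y) x = wd c e f x - wd c e g x := by
  simp only [wd]
  rw [fderiv_fun_sub hf hg]
  simp; ring

lemma wd_conj (c : ℂ) (e : E) {f : E → ℂ} {x : E} (hf : DifferentiableAt ℝ f x) :
    wd c e (fun y => (starRingEnd ℂ) (f y)) x
      = (starRingEnd ℂ) (wd ((starRingEnd ℂ) c) e f x) := by
  have : HasFDerivAt (fun y => (starRingEnd ℂ) (f y))
      ((conjCLE : ℂ →L[ℝ] ℂ).comp (fderiv ℝ f x)) x :=
    (conjCLE : ℂ →L[ℝ] ℂ).hasFDerivAt.comp x hf.hasFDerivAt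
  simp only [wd]
  rw [this.fderiv]
  have h2 : (starRingEnd ℂ) 2 = 2 := Complex.conj_ofNat 2
  simp [h2]

lemma wd_cexp (c : ℂ) (e : E) {f : E → ℂ} {x : E} (hf : DifferentiableAt ℝ f x) :
    wd c e (fun y => cexp (f y)) x = cexp (f x) * wd c e f x := by
  have := hf.hasFDerivAt.cexp
  simp only [wd]
  rw [this.fderiv]
  simp; ring

lemma wd_neg (c : ℂ) (e : E) {f : E → ℂ} {x : E} :
    wd c e (fun y => - (f y)) x = - wd c e f x := by
  simp only [wd, fderiv_fun_neg]
  simp; ring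

lemma wd_congr (c : ℂ) (e : E) {f g : E → ℂ} {x : E} (h : f =ᶠ[nhds x] g) :
    wd c e f x = wd c e g x := by
  simp only [wd, h.fderiv_eq]

lemma wd_contDiff (c : ℂ) (e : E) {f : E → ℂ} (hf : ContDiff ℝ ∞ f) :
    ContDiff ℝ ∞ (wd c e f) := by
  have h : ∀ v : E, ContDiff ℝ ∞ (fun x => fderiv ℝ f x v) := fun v =>
    (hf.fderiv_right (m := ∞) s%).clm_apply contDiff_const
  exact contDiff_const.mul ((h e).add (contDiff_const.mul (h _)))

lemma wd_tsupport (c : ℂ) (e : E) (f : E → ℂ) : tsupport (wd c e f) ⊆ tsupport f := by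
  refine (closure_minimal ?_ (isClosed_tsupport f))
  intro x hx
  by_contra h
  apply hx
  have : f =ᶠ[nhds x] fun _ => 0 := notMem_tsupport_iff_eventuallyEq.mp h
  rw [wd_congr c e this]; simp [wd]

lemma wd_hcs (c : ℂ) (e : E) {f : E → ℂ} (hf : HasCompactSupport f) :
    HasCompactSupport (wd c e f) :=
  hf.mono' (subset_closure.trans (wd_tsupport c e f))

lemma wd_comm (c c' : ℂ) (e e' : E) {f : E → ℂ} (hf : ContDiff ℝ ∞ f) (x : E) :
    wd c e (wd c' e' f) x = wd c' e' (wd c e f) x := by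
  have hs : IsSymmSndFDerivAt ℝ f x :=
    (hf.contDiffAt (x := x)).isSymmSndFDerivAt (by simp only [minSmoothness_of_isRCLikeNormedField]; exact WithTop.coe_le_coe.2 (le_top : (2:ℕ∞) ≤ ⊤))
  have hd : ∀ y, DifferentiableAt ℝ (fderiv ℝ f) y := fun y =>
    ((hf.fderiv_right (m := ∞) s%).differentiable s%) y
  have key : ∀ (c' : ℂ) (e' v : E), fderiv ℝ (wd c' e' f) x v =
      (1/2) * (fderiv ℝ (fderiv ℝ f) x v e' + c' * fderiv ℝ (fderiv ℝ f) x v (I • e')) := by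
    intro c' e' v
    have h : ∀ u : E, HasFDerivAt (fun y => fderiv ℝ f y u)
        ((fderiv ℝ (fderiv ℝ f) x).flip u) x := fun u => by
      simpa using (hd x).hasFDerivAt.clm_apply (hasFDerivAt_const u x)
    have := ((h e').add ((h (I • e')).const_mul c')).const_mul (1/2 : ℂ)
    have h2 : wd c' e' f = fun y => (1/2 : ℂ) * (fderiv ℝ f y e' + c' * fderiv ℝ f y (I • e')) := rfl
    rw [h2, show fderiv ℝ (fun y => (1/2 : ℂ) * (fderiv ℝ f y e' + c' * fderiv ℝ f y (I • e'))) x = _ from HasFDerivAt.fderiv this]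
    simp; ring
  have hs' : ∀ u v, fderiv ℝ (fderiv ℝ f) x u v = fderiv ℝ (fderiv ℝ f) x v u := fun u v => hs u v
  have hu : ∀ (c : ℂ) (e : E) (g : E → ℂ), wd c e g x = (1/2) * (fderiv ℝ g x e + c * fderiv ℝ g x (I • e)) := fun _ _ _ => rfl
  rw [hu, hu]
  simp only [key]
  rw [hs' e e', hs' e (I • e'), hs' (I • e) e', hs' (I • e) (I • e')]
  ring

variable [FiniteDimensional ℝ E] [MeasurableSpace E] [BorelSpace E] (μ : Measure E)
  [μ.IsAddHaarMeasure]

lemma integral_wd (c : ℂ) (e : E) {f : E → ℂ} (hf : ContDiff ℝ ∞ f) (hc : HasCompactSupport f) :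
    ∫ x, wd c e f x ∂μ = 0 := by
  have hv : ∀ v : E, Integrable (fun x => fderiv ℝ f x v) μ := fun v => by
    have h1 : Continuous (fun x => fderiv ℝ f x v) :=
      (hf.continuous_fderiv s%).clm_apply continuous_const
    exact h1.integrable_of_hasCompactSupport (hc.fderiv_apply ℝ v)
  have h0 : ∀ v : E, ∫ x, fderiv ℝ f x v ∂μ = 0 := fun v => by
    have := integral_mul_fderiv_eq_neg_fderiv_mul_of_integrable (𝕜 := ℂ) (μ := μ)
      (f := fun _ => (1:ℂ)) (g := f) (v := v) s% (by simpa using hv v)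
      (by simpa using hf.continuous.integrable_of_hasCompactSupport hc)
      (fun x _ => differentiableAt_const _) (fun x _ => hf.differentiable s% x)
    simpa using this
  simp only [wd]
  rw [integral_const_mul, integral_add (hv e) ((hv _).const_mul c), integral_const_mul, h0, h0]
  simp

lemma integral_wd_mul (c : ℂ) (e : E) {f g : E → ℂ} (hf : ContDiff ℝ ∞ f) (hg : ContDiff ℝ ∞ g)
    (hc : HasCompactSupport f) :
    ∫ x, f x * wd c e g x ∂μ = - ∫ x, wd c e f x * g x ∂μ := by
  have h := integral_wd μ c e (hf.mul hg) hc.mul_right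
  have h2 : ∀ x, wd c e (fun y => f y * g y) x = wd c e f x * g x + f x * wd c e g x := fun x =>
    wd_mul c e (hf.differentiable s% x) (hg.differentiable s% x)
  simp only [h2] at h
  rw [integral_add] at h
  · linear_combination h
  · exact ((wd_contDiff c e hf).continuous.mul hg.continuous).integrable_of_hasCompactSupport
      (wd_hcs c e hc).mul_right
  · exact (hf.continuous.mul (wd_contDiff c e hg).continuous).integrable_of_hasCompactSupport
      hc.mul_right
end

section
open Complex ContDiff MeasureTheory
open scoped ComplexConjugate
variable {E : Type*} [NormedAddCommGroup E] [NormedSpace ℂ E] [NormedSpace ℝ E]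

noncomputable def dlt (φ : E → ℝ) (e : E) (f : E → ℂ) (x : E) : ℂ :=
  wb e f x - wb e c% φ x * f x

lemma dlt_contDiff {φ : E → ℝ} (hφ : ContDiff ℝ ∞ φ) (e : E) {f : E → ℂ} (hf : ContDiff ℝ ∞ f) :
    ContDiff ℝ ∞ (dlt φ e f) :=
  (wd_contDiff _ _ hf).sub ((wd_contDiff _ _ (ofRealCLM.contDiff.comp hφ)).mul hf)

lemma conj_contDiff {f : E → ℂ} (hf : ContDiff ℝ ∞ f) : ContDiff ℝ ∞ (fun x => conj (f x)) :=
  conjCLE.contDiff.comp hf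

lemma ofReal_contDiff {φ : E → ℝ} (hφ : ContDiff ℝ ∞ φ) : ContDiff ℝ ∞ c% φ :=
  ofRealCLM.contDiff.comp hφ

lemma wt_contDiff {φ : E → ℝ} (hφ : ContDiff ℝ ∞ φ) : ContDiff ℝ ∞ (fun x => cexp (-(φ x : ℂ))) :=
  (ofReal_contDiff hφ).neg.cexp

lemma hcs_conj {f : E → ℂ} (hc : HasCompactSupport f) : HasCompactSupport (fun x => conj (f x)) :=
  hc.comp_left (g := fun z => conj z) s%

lemma hcs_sum {ι R : Type*} [Fintype ι] [AddCommMonoid R] {f : ι → E → R} (hc : ∀ j, HasCompactSupport (f j)) :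
    HasCompactSupport (fun x => ∑ j, f j x) := by
  refine HasCompactSupport.intro (isCompact_iUnion fun j => (hc j)) fun x hx => ?_
  simp only [Set.mem_iUnion, not_exists] at hx
  exact Finset.sum_eq_zero fun j _ => image_eq_zero_of_notMem_tsupport (hx j)

lemma dbar_dlt {φ : E → ℝ} (hφ : ContDiff ℝ ∞ φ) (e e' : E) {f : E → ℂ} (hf : ContDiff ℝ ∞ f)
    (x : E) : wd I e' (dlt φ e f) x = dlt φ e (wd I e' f) x
      - wd I e' (wb e c% φ) x * f x := by
  have hφ' := ofReal_contDiff hφ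
  have h1 : DifferentiableAt ℝ (wb e f) x := (wd_contDiff _ _ hf).differentiable s% x
  have h2 : DifferentiableAt ℝ (wb e c% φ) x :=
    (wd_contDiff _ _ hφ').differentiable s% x
  have h3 := hf.differentiable s% x
  have : wd I e' (dlt φ e f) x = _ := wd_sub I e' h1 (h2.mul h3)
  rw [this]
  have : wd I e' (fun y => wb e c% φ y * f y) x = _ := wd_mul I e' h2 h3
  rw [this, wd_comm I (-I) e' e hf]
  simp only [dlt]; ring

variable [FiniteDimensional ℝ E] [MeasurableSpace E] [BorelSpace E] (μ : Measure E)
  [μ.IsAddHaarMeasure]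

lemma dlt_adj {φ : E → ℝ} (hφ : ContDiff ℝ ∞ φ) (e : E) {f g : E → ℂ} (hf : ContDiff ℝ ∞ f)
    (hg : ContDiff ℝ ∞ g) (hc : HasCompactSupport g) :
    ∫ x, dlt φ e f x * conj (g x) * cexp (-(φ x : ℂ)) + f x * conj (wd I e g x) * cexp (-(φ x : ℂ)) ∂μ
      = 0 := by
  have hφ' := ofReal_contDiff hφ
  have := integral_wd μ (-I) e ((hf.mul (conj_contDiff hg)).mul (wt_contDiff hφ))
    ((hcs_conj hc).mul_left.mul_right)
  rw [← this]
  congr 1; ext x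
  have h1 := hf.differentiable s% x
  have h2 := hg.differentiable s% x
  have h3 := (conj_contDiff hg).differentiable s% x
  have h4 := (wt_contDiff hφ).differentiable s% x
  rw [wd_mul (-I) e (h1.fun_mul h3) h4, wd_mul (-I) e h1 h3, wd_conj _ _ h2,
    wd_cexp _ _ (hφ'.neg.differentiable s% x), wd_neg]
  simp [dlt]; ring

theorem basic_ineq {ι : Type*} [Fintype ι] {φ : E → ℝ} (hφ : ContDiff ℝ ∞ φ) (e : ι → E)
    {f : ι → E → ℂ} (hf : ∀ j, ContDiff ℝ ∞ (f j)) (hc : ∀ j, HasCompactSupport (f j)) :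
    ∫ x, (∑ j, ∑ k, wd I (e k) (wb (e j) c% φ) x * f j x * conj (f k x)).re
        * Real.exp (-(φ x)) ∂μ ≤
    ∫ x, ‖∑ j, dlt φ (e j) (f j) x‖ ^ 2 * Real.exp (-(φ x)) ∂μ
    + ∫ x, (1/2) * (∑ j, ∑ k, ‖wd I (e k) (f j) x - wd I (e j) (f k) x‖ ^ 2)
        * Real.exp (-(φ x)) ∂μ := by
  have hφ' := ofReal_contDiff hφ
  have hw := wt_contDiff hφ
  have hdl : ∀ j, HasCompactSupport (dlt φ (e j) (f j)) := fun j =>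
    (wd_hcs _ _ (hc j)).sub (hc j).mul_left
  set A : ι → ι → E → ℂ := fun j k x =>
    dlt φ (e j) (f j) x * conj (dlt φ (e k) (f k) x) * cexp (-(φ x : ℂ))
    - wd I (e k) (f j) x * conj (wd I (e j) (f k) x) * cexp (-(φ x : ℂ))
    - wd I (e k) (wb (e j) c% φ) x * f j x * conj (f k x) * cexp (-(φ x : ℂ))
    with hA
  have hAc : ∀ j k, Continuous (A j k) := fun j k =>
    (((((dlt_contDiff hφ _ (hf j)).mul (conj_contDiff (dlt_contDiff hφ _ (hf k)))).mul hw).sub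
    (((wd_contDiff _ _ (hf j)).mul (conj_contDiff (wd_contDiff _ _ (hf k)))).mul hw)).sub
    ((((wd_contDiff _ _ (wd_contDiff _ _ hφ')).mul (hf j)).mul (conj_contDiff (hf k))).mul hw)).continuous
  have hAs : ∀ j k, HasCompactSupport (A j k) := fun j k =>
    (((hdl j).mul_right.mul_right).sub ((wd_hcs _ _ (hc j)).mul_right.mul_right)).sub
      ((hc j).mul_left.mul_right.mul_right)
  have hAi : ∀ j k, Integrable (A j k) μ := fun j k =>
    (hAc j k).integrable_of_hasCompactSupport (hAs j k)
  have hA0 : ∀ j k, ∫ x, A j k x ∂μ = 0 := by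
    intro j k
    have h1 := dlt_adj μ hφ (e k) (hf k) (dlt_contDiff hφ (e j) (hf j)) (hdl j)
    have h2 := dlt_adj μ hφ (e j) (wd_contDiff I (e k) (hf j)) (hf k) (hc k)
    have i1 : Integrable (fun x => conj (dlt φ (e k) (f k) x * conj (dlt φ (e j) (f j) x) * cexp (-(φ x : ℂ))
        + f k x * conj (wd I (e k) (dlt φ (e j) (f j)) x) * cexp (-(φ x : ℂ)))) μ := by
      refine Continuous.integrable_of_hasCompactSupport ?_ ?_
      · exact (conj_contDiff ((((dlt_contDiff hφ _ (hf k)).mul (conj_contDiff (dlt_contDiff hφ _ (hf j)))).mul hw).add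
          (((hf k).mul (conj_contDiff (wd_contDiff _ _ (dlt_contDiff hφ _ (hf j))))).mul hw))).continuous
      · exact hcs_conj (((hdl k).mul_right.mul_right).add ((hc k).mul_right.mul_right))
    have i2 : Integrable (fun x => dlt φ (e j) (wd I (e k) (f j)) x * conj (f k x) * cexp (-(φ x : ℂ))
        + wd I (e k) (f j) x * conj (wd I (e j) (f k) x) * cexp (-(φ x : ℂ))) μ := by
      refine Continuous.integrable_of_hasCompactSupport ?_ ?_
      · exact ((((dlt_contDiff hφ _ (wd_contDiff _ _ (hf j))).mul (conj_contDiff (hf k))).mul hw).add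
          (((wd_contDiff _ _ (hf j)).mul (conj_contDiff (wd_contDiff _ _ (hf k)))).mul hw)).continuous
      · exact ((hcs_conj (hc k)).mul_left.mul_right).add ((wd_hcs _ _ (hc j)).mul_right.mul_right)
    have h1' := congrArg conj h1
    rw [← integral_conj] at h1'
    have h3 := integral_sub i1 i2
    rw [h1', h2] at h3
    rw [map_zero, sub_zero] at h3
    rw [← h3]
    congr 1; ext x
    have hr : conj (cexp (-(φ x : ℂ))) = cexp (-(φ x : ℂ)) := by
      rw [← exp_conj]; simp
    simp only [hA, map_add, map_mul, conj_conj, hr]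
    rw [dbar_dlt hφ _ _ (hf j)]
    ring
  have hsum : ∫ x, (∑ j, ∑ k, A j k x).re ∂μ = 0 := by
    have : ∫ x, (∑ j, ∑ k, A j k x) ∂μ = 0 := by
      rw [integral_finsetSum _ (fun j _ => integrable_finsetSum _ (fun k _ => hAi j k))]
      refine Finset.sum_eq_zero fun j _ => ?_
      rw [integral_finsetSum _ (fun k _ => hAi j k)]
      exact Finset.sum_eq_zero fun k _ => hA0 j k
    have h2 := integral_re (𝕜 := ℂ) (f := fun x => ∑ j, ∑ k, A j k x) (μ := μ)
      (integrable_finsetSum _ (fun j _ => integrable_finsetSum _ (fun k _ => hAi j k)))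
    simp only [this] at h2
    simpa using h2
  have hcd : ∀ (c : ℂ) j k, Continuous (wd c (e k) (f j)) := fun c j k =>
    (wd_contDiff _ _ (hf j)).continuous
  have hfc := fun j => (hf j).continuous
  have hdc := fun j => (dlt_contDiff hφ (e j) (hf j)).continuous
  have hφc := hφ.continuous
  have hLc : ∀ j k, Continuous (wd I (e k) (wb (e j) c% φ)) := fun j k =>
    (wd_contDiff _ _ (wd_contDiff _ _ hφ')).continuous
  have ie : Integrable (fun x => (∑ j, ∑ k, A j k x).re) μ :=
    (integrable_finsetSum _ (fun j _ => integrable_finsetSum _ (fun k _ => hAi j k))).re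
  have i1 : Integrable (fun x => ‖∑ j, dlt φ (e j) (f j) x‖ ^ 2 * Real.exp (-(φ x))) μ := by
    refine Continuous.integrable_of_hasCompactSupport (by fun_prop) ?_
    refine HasCompactSupport.mul_right ?_
    refine HasCompactSupport.comp_left (g := fun z : ℂ => ‖z‖ ^ 2) ?_ s%
    exact hcs_sum hdl
  have hcurl : HasCompactSupport (fun x => (1/2) * (∑ j, ∑ k, ‖wd I (e k) (f j) x - wd I (e j) (f k) x‖ ^ 2)) := by
    refine HasCompactSupport.mul_left ?_
    refine hcs_sum fun j => hcs_sum fun k => ?_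
    exact HasCompactSupport.comp_left (g := fun z : ℂ => ‖z‖ ^ 2)
      ((wd_hcs I (e k) (hc j)).sub (wd_hcs I (e j) (hc k))) s%
  have i2 : Integrable (fun x => (1/2) * (∑ j, ∑ k, ‖wd I (e k) (f j) x - wd I (e j) (f k) x‖ ^ 2)
        * Real.exp (-(φ x))) μ :=
    Continuous.integrable_of_hasCompactSupport (by fun_prop) hcurl.mul_right
  have i3 : Integrable (fun x => (∑ j, ∑ k, wd I (e k) (wb (e j) c% φ) x * f j x * conj (f k x)).re
        * Real.exp (-(φ x))) μ := by
    refine Continuous.integrable_of_hasCompactSupport (by fun_prop) ?_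
    refine HasCompactSupport.mul_right ?_
    refine HasCompactSupport.comp_left (g := fun z : ℂ => z.re) ?_ s%
    exact hcs_sum fun j => hcs_sum fun k =>
      (hc j).mul_left.mul_right
  rw [← integral_add i1 i2]
  have := integral_mono (i3.add ie) (i1.add i2) ?_
  · rw [integral_add' i3 ie, hsum, add_zero] at this
    exact this
  intro x
  simp only [Pi.add_apply]
  have hexp : cexp (-(φ x : ℂ)) = ((Real.exp (-(φ x)) : ℝ) : ℂ) := by push_cast; rfl
  have hnn : ∀ z : ℂ, ‖z‖ ^ 2 = z.re * z.re + z.im * z.im := fun z => by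
    rw [← normSq_apply, ← normSq_eq_norm_sq]
  have hr : (∑ j, ∑ k, A j k x).re = (‖∑ j, dlt φ (e j) (f j) x‖ ^ 2
      - ∑ j, ∑ k, (wd I (e k) (f j) x * conj (wd I (e j) (f k) x)).re
      - (∑ j, ∑ k, wd I (e k) (wb (e j) c% φ) x * f j x * conj (f k x)).re)
      * Real.exp (-(φ x)) := by
    have h1 : (‖∑ j, dlt φ (e j) (f j) x‖ ^ 2 : ℝ) =
        (∑ j, ∑ k, dlt φ (e j) (f j) x * conj (dlt φ (e k) (f k) x)).re := by
      rw [← Finset.sum_mul_sum, ← map_sum, mul_conj, normSq_eq_norm_sq, ofReal_re]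
    rw [h1]
    simp only [hA, hexp, re_sum, sub_re, re_mul_ofReal, ← Finset.sum_sub_distrib, Finset.sum_mul, sub_mul]
  rw [hr]
  have hR : 0 < Real.exp (-(φ x)) := Real.exp_pos _
  have hk : (1/2) * (∑ j, ∑ k, ‖wd I (e k) (f j) x - wd I (e j) (f k) x‖ ^ 2)
      + ∑ j, ∑ k, (wd I (e k) (f j) x * conj (wd I (e j) (f k) x)).re ≥ 0 := by
    have h1 : ∀ j k, ‖wd I (e k) (f j) x - wd I (e j) (f k) x‖ ^ 2 = ‖wd I (e k) (f j) x‖ ^ 2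
        + ‖wd I (e j) (f k) x‖ ^ 2 - 2 * (wd I (e k) (f j) x * conj (wd I (e j) (f k) x)).re := by
      intro j k
      simp only [hnn, sub_re, sub_im, mul_re, conj_re, conj_im]; ring
    simp only [h1, Finset.sum_sub_distrib, Finset.sum_add_distrib, ← Finset.mul_sum]
    have : 0 ≤ ∑ j, ∑ k, ‖wd I (e k) (f j) x‖ ^ 2 :=
      Finset.sum_nonneg fun j _ => Finset.sum_nonneg fun k _ => by positivity
    have : 0 ≤ ∑ j, ∑ k, ‖wd I (e j) (f k) x‖ ^ 2 :=
      Finset.sum_nonneg fun j _ => Finset.sum_nonneg fun k _ => by positivity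
    linarith
  nlinarith
end

section
open Complex ContDiff MeasureTheory Filter Topology
open scoped ComplexConjugate Convolution ENNReal
variable {E : Type*} [NormedAddCommGroup E] [NormedSpace ℂ E] [NormedSpace ℝ E]
variable [FiniteDimensional ℝ E] [MeasurableSpace E] [BorelSpace E] (μ : Measure E)
  [μ.IsAddHaarMeasure]

noncomputable def moll (ρ : E → ℝ) (f : E → ℂ) (x : E) : ℂ := ∫ t, f t * (ρ (x - t) : ℂ) ∂μ

lemma moll_eq (ρ : E → ℝ) (f : E → ℂ) :
    moll μ ρ f = (f ⋆[ContinuousLinearMap.mul ℝ ℂ, μ] c% ρ) := rfl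

lemma moll_swap (ρ : E → ℝ) (f : E → ℂ) (x : E) :
    moll μ ρ f x = ∫ t, f (x - t) * (ρ t : ℂ) ∂μ := by
  rw [moll_eq, convolution_eq_swap]; rfl

lemma hcs_ofReal {ρ : E → ℝ} (hc : HasCompactSupport ρ) : HasCompactSupport c% ρ :=
  hc.comp_left (g := fun z : ℝ => (z : ℂ)) s%

lemma moll_contDiff {ρ : E → ℝ} (hρ : ContDiff ℝ ∞ ρ) (hc : HasCompactSupport ρ) {f : E → ℂ}
    (hf : LocallyIntegrable f μ) : ContDiff ℝ ∞ (moll μ ρ f) := by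
  rw [moll_eq]
  exact (hcs_ofReal hc).contDiff_convolution_right _ hf (ofReal_contDiff hρ)

lemma moll_wd {ρ : E → ℝ} (hρ : ContDiff ℝ ∞ ρ) (hc : HasCompactSupport ρ) {f : E → ℂ}
    (hf : LocallyIntegrable f μ) (c : ℂ) (e x : E) :
    wd c e (moll μ ρ f) x = - ∫ t, f t * wd c e (fun y => (ρ (x - y) : ℂ)) t ∂μ := by
  have hρ' := ofReal_contDiff hρ
  have hc' := hcs_ofReal hc
  have hD : ∀ v, fderiv ℝ (moll μ ρ f) x v = ∫ t, f t * fderiv ℝ c% ρ (x - t) v ∂μ := by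
    intro v
    rw [moll_eq, (hc'.hasFDerivAt_convolution_right _ hf (hρ'.of_le s%) x).fderiv,
      convolution_precompR_apply _ hf (hc'.fderiv ℝ) (hρ'.continuous_fderiv s%)]
    rfl
  have hD2 : ∀ t v, fderiv ℝ (fun y => (ρ (x - y) : ℂ)) t v = - fderiv ℝ c% ρ (x - t) v := by
    intro t v
    have h1 : HasFDerivAt (fun y : E => x - y) (-(ContinuousLinearMap.id ℝ E)) t :=
      (hasFDerivAt_id t).const_sub x
    have h2 := ((hρ'.differentiable s% (x - t)).hasFDerivAt).comp t h1
    have h3 : fderiv ℝ (fun y => (ρ (x - y) : ℂ)) t = _ := h2.fderiv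
    rw [h3]; simp
  have hi : ∀ v, Integrable (fun t => f t * fderiv ℝ c% ρ (x - t) v) μ := fun v =>
    ((hc'.fderiv_apply ℝ v).convolutionExists_right (ContinuousLinearMap.mul ℝ ℂ) hf
      ((hρ'.continuous_fderiv s%).clm_apply continuous_const) x)
  simp only [wd, hD2, hD]
  rw [← integral_neg, ← integral_const_mul, ← integral_add (hi e) ((hi _).const_mul c),
    ← integral_const_mul]
  congr 1; ext t; ring

lemma moll_supp {ρ : E → ℝ} {r : ℝ} (hr : ∀ x, r < ‖x‖ → ρ x = 0) {f : E → ℂ} {K : Set E}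
    (hf : ∀ x ∉ K, f x = 0) {x : E} (hx : ∀ y ∈ K, r < ‖x - y‖) : moll μ ρ f x = 0 := by
  rw [moll]
  refine integral_eq_zero_of_ae (ae_of_all _ fun t => ?_)
  by_cases ht : t ∈ K
  · simp [hr _ (hx t ht)]
  · simp [hf t ht]

lemma moll_hcs {ρ : E → ℝ} {r : ℝ} (hr : ∀ x, r < ‖x‖ → ρ x = 0) {f : E → ℂ} {K : Set E}
    (hK : Bornology.IsBounded K) (hf : ∀ x ∉ K, f x = 0) : HasCompactSupport (moll μ ρ f) := by
  obtain ⟨R, hR⟩ := hK.exists_norm_le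
  have : ProperSpace E := FiniteDimensional.proper ℝ E
  refine HasCompactSupport.intro (isCompact_closedBall (0:E) (R + r)) fun x hx => ?_
  refine moll_supp μ hr hf fun y hy => ?_
  simp at hx
  have := norm_sub_norm_le x y
  have := hR y hy
  linarith

lemma tendsto_translate {f : E → ℂ} (hf : MemLp f 2 μ) :
    Tendsto (fun s : E => eLpNorm (fun x => f (x - s) - f x) 2 μ) (𝓝 0) (𝓝 0) := by
  have : ProperSpace E := FiniteDimensional.proper ℝ E
  let g : E → C(E, E) := fun s => ⟨fun x => x - s, by fun_prop⟩
  have hg : Continuous g := by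
    have : Continuous (Function.uncurry (fun (s x : E) => x - s)) := by
      simp only [Function.uncurry_def]; fun_prop
    exact (ContinuousMap.curry ⟨_, this⟩).continuous
  have hgm : ∀ s, MeasurePreserving (g s) μ μ := fun s => measurePreserving_sub_right μ s
  have h := Filter.Tendsto.compMeasurePreservingLp (p := 2) (f := fun _ : E => hf.toLp f)
    tendsto_const_nhds (hg.tendsto 0) hgm (hgm 0) s%
  have h2 := (tendsto_iff_edist_tendsto_0).1 h
  refine h2.congr fun s => ?_
  rw [Lp.edist_def]
  refine eLpNorm_congr_ae ?_
  have a1 : ∀ s, Lp.compMeasurePreserving (g s) (hgm s) (hf.toLp f) =ᵐ[μ] fun x => f (x - s) := fun s =>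
    (Lp.coeFn_compMeasurePreserving _ (hgm s)).trans
      ((hgm s).quasiMeasurePreserving.ae_eq_comp hf.coeFn_toLp)
  filter_upwards [a1 s, a1 0] with x h1 h2
  rw [Pi.sub_apply, h1, h2, sub_zero]

lemma moll_L2_le {ρ : E → ℝ} (hρ : Continuous ρ) (hc : HasCompactSupport ρ) (h0 : ∀ x, 0 ≤ ρ x)
    (h1 : ∫ x, ρ x ∂μ = 1) {f : E → ℂ} (hf : MemLp f 2 μ) {δ : ℝ≥0∞} {r : ℝ}
    (hr : ∀ x, r < ‖x‖ → ρ x = 0)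
    (hd : ∀ s : E, ‖s‖ ≤ r → eLpNorm (fun x => f (x - s) - f x) 2 μ ≤ δ) :
    eLpNorm (fun x => moll μ ρ f x - f x) 2 μ ≤ δ := by
  have : ProperSpace E := FiniteDimensional.proper ℝ E
  have hloc : LocallyIntegrable f μ := hf.locallyIntegrable n%
  have hρi : Integrable ρ μ := hρ.integrable_of_hasCompactSupport hc
  have hl1 : ∫⁻ x, ENNReal.ofReal (ρ x) ∂μ = 1 := by
    rw [← ofReal_integral_eq_lintegral_ofReal hρi (ae_of_all _ h0), h1, ENNReal.ofReal_one]
  let ν := μ.withDensity (fun x => ENNReal.ofReal (ρ x))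
  have : IsProbabilityMeasure ν := ⟨by
    simp only [ν, withDensity_apply _ MeasurableSet.univ, Measure.restrict_univ, hl1]⟩
  have hm : Measurable (fun x => ENNReal.ofReal (ρ x)) := by fun_prop
 
  obtain ⟨f', hf'm, hff'⟩ := hf.1
  have hmoll : ∀ x, moll μ ρ f x = moll μ ρ f' x := fun x => by
    simp only [moll]; refine integral_congr_ae ?_
    filter_upwards [hff'] with t ht; rw [ht]
  have hf' : MemLp f' 2 μ := hf.ae_eq hff'
  have hd' : ∀ s : E, ‖s‖ ≤ r → eLpNorm (fun x => f' (x - s) - f' x) 2 μ ≤ δ := fun s hs => by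
    rw [← eLpNorm_congr_ae (f := fun x => f (x - s) - f x)]
    · exact hd s hs
    · filter_upwards [hff', (measurePreserving_sub_right μ s).quasiMeasurePreserving.ae_eq_comp hff']
        with x h1 h2
      simp only [Function.comp] at h2
      rw [h1, h2]
  rw [eLpNorm_congr_ae (g := fun x => moll μ ρ f' x - f' x)
    (by filter_upwards [hff'] with x hx; rw [hmoll, hx])]
  have hsq : ∀ (g : E → ℂ) (κ : Measure E), eLpNorm g 2 κ ^ (2:ℝ) = ∫⁻ x, ‖g x‖ₑ ^ (2:ℝ) ∂κ := fun g κ => by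
    rw [eLpNorm_eq_lintegral_rpow_enorm_toReal s% s%]
    rw [← ENNReal.rpow_mul]; simp
  rw [← ENNReal.rpow_le_rpow_iff (z := 2) n%, hsq]
  have hf'meas := hf'm.measurable
  have step : ∀ x, ‖moll μ ρ f' x - f' x‖ₑ ^ (2:ℝ) ≤ ∫⁻ s, ‖f' (x - s) - f' x‖ₑ ^ (2:ℝ) ∂ν := by
    intro x
    have hi1 : Integrable (fun t => f' (x - t) * (ρ t : ℂ)) μ := by
      have := ((hcs_ofReal hc).convolutionExists_right (ContinuousLinearMap.mul ℝ ℂ)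
        (hf'.locallyIntegrable n%) (continuous_ofReal.comp hρ) x).integrable_swap
      exact this
    have hi2 : Integrable (fun t => f' x * (ρ t : ℂ)) μ := (hρi.ofReal).const_mul _
    have : moll μ ρ f' x - f' x = ∫ t, (f' (x - t) - f' x) * (ρ t : ℂ) ∂μ := by
      simp only [sub_mul]
      rw [integral_sub hi1 hi2, moll_swap, integral_const_mul, show ∫ t, (ρ t : ℂ) ∂μ = ((∫ t, ρ t ∂μ : ℝ) : ℂ) from integral_ofReal, h1]; simp
    rw [this]
    have b1 : ‖∫ t, (f' (x - t) - f' x) * (ρ t : ℂ) ∂μ‖ₑ ≤ ∫⁻ s, ‖f' (x - s) - f' x‖ₑ ∂ν := by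
      refine (enorm_integral_le_lintegral_enorm _).trans ?_
      rw [lintegral_withDensity_eq_lintegral_mul _ hm (by fun_prop)]
      refine lintegral_mono fun t => ?_
      simp only [Pi.mul_apply, enorm_mul]
      rw [mul_comm, ← ofReal_norm (ρ t : ℂ), norm_real, Real.norm_of_nonneg (h0 t)]
    have b2 : ∫⁻ s, ‖f' (x - s) - f' x‖ₑ ∂ν ≤ eLpNorm (fun s => f' (x - s) - f' x) 2 ν := by
      rw [← eLpNorm_one_eq_lintegral_enorm]
      exact eLpNorm_le_eLpNorm_of_exponent_le n%
        (by exact (by fun_prop : Measurable _).aestronglyMeasurable)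
    rw [← hsq]
    exact ENNReal.rpow_le_rpow (b1.trans b2) n%
  refine (lintegral_mono step).trans ?_
  rw [lintegral_lintegral_swap (by
    refine Measurable.aemeasurable ?_
    simp only [Function.uncurry_def]; fun_prop)]
  rw [lintegral_withDensity_eq_lintegral_mul _ hm (by
    refine Measurable.lintegral_prod_left' (f := fun p : E × E => ‖f' (p.1 - p.2) - f' p.1‖ₑ ^ (2:ℝ)) ?_
    fun_prop)]
  calc _ ≤ ∫⁻ s, ENNReal.ofReal (ρ s) * δ ^ (2:ℝ) ∂μ := by
        refine lintegral_mono fun s => ?_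
        simp only [Pi.mul_apply]
        by_cases hs : ‖s‖ ≤ r
        · rw [← hsq]
          gcongr
          exact hd' s hs
        · simp [hr s (not_le.1 hs)]
    _ = δ ^ (2:ℝ) := by rw [lintegral_mul_const _ hm, hl1, one_mul]

lemma moll_L2 {ρ : ℕ → E → ℝ} (hρ : ∀ i, Continuous (ρ i)) (hc : ∀ i, HasCompactSupport (ρ i))
    (h0 : ∀ i x, 0 ≤ ρ i x) (h1 : ∀ i, ∫ x, ρ i x ∂μ = 1) {r : ℕ → ℝ}
    (hr : ∀ i x, r i < ‖x‖ → ρ i x = 0) (hr0 : Tendsto r atTop (𝓝 0)) {f : E → ℂ}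
    (hf : MemLp f 2 μ) :
    Tendsto (fun i => eLpNorm (fun x => moll μ (ρ i) f x - f x) 2 μ) atTop (𝓝 0) := by
  rw [ENNReal.tendsto_nhds_zero]
  intro δ hδ
  have := (ENNReal.tendsto_nhds_zero.1 (tendsto_translate μ hf)) δ hδ
  obtain ⟨η, hη, hb⟩ := Metric.eventually_nhds_iff.1 this
  filter_upwards [hr0.eventually (gt_mem_nhds hη)] with i hi
  refine moll_L2_le μ (hρ i) (hc i) (h0 i) (h1 i) hf (hr i) fun s hs => hb ?_
  simpa using lt_of_le_of_lt hs hi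

lemma exists_mollifiers : ∃ (ρ : ℕ → E → ℝ) (r : ℕ → ℝ), (∀ i, ContDiff ℝ ∞ (ρ i)) ∧
    (∀ i, HasCompactSupport (ρ i)) ∧ (∀ i x, 0 ≤ ρ i x) ∧ (∀ i, ∫ x, ρ i x ∂μ = 1) ∧
    (∀ i x, r i < ‖x‖ → ρ i x = 0) ∧ Tendsto r atTop (𝓝 0) := by
  have hp : ∀ i : ℕ, (0:ℝ) < 1 / (i + 1) := fun i => Nat.one_div_pos_of_nat
  let b : ℕ → ContDiffBump (0 : E) := fun i => ⟨1 / (i + 1) / 2, 1 / (i + 1), half_pos (hp i), half_lt_self (hp i)⟩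
  refine ⟨fun i => (b i).normed μ, fun i => 1 / (i + 1), fun i => (b i).contDiff_normed,
    fun i => (b i).hasCompactSupport_normed, fun i x => (b i).nonneg_normed x,
    fun i => (b i).integral_normed, fun i x hx => ?_, tendsto_one_div_add_atTop_nhds_zero_nat⟩
  have : x ∉ Function.support ((b i).normed μ) := by
    rw [(b i).support_normed_eq]; simpa [b] using hx.le
  simpa using this
end

section
open Complex ContDiff MeasureTheory Filter Topology
open scoped ComplexConjugate ENNReal

section
variable {X : Type*} [MeasurableSpace X] {μ : Measure X}

def L2T (μ : Measure X) (u : ℕ → X → ℂ) (v : X → ℂ) : Prop :=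
  (∀ i, MemLp (u i) 2 μ) ∧ MemLp v 2 μ ∧
    Tendsto (fun i => eLpNorm (fun x => u i x - v x) 2 μ) atTop (𝓝 0)

lemma L2T.sub {u u' : ℕ → X → ℂ} {v v' : X → ℂ} (h : L2T μ u v) (h' : L2T μ u' v') :
    L2T μ (fun i x => u i x - u' i x) (fun x => v x - v' x) := by
  refine ⟨fun i => (h.1 i).sub (h'.1 i), h.2.1.sub h'.2.1, ?_⟩
  refine tendsto_of_tendsto_of_tendsto_of_le_of_le tendsto_const_nhds
    (by simpa using h.2.2.add h'.2.2) (fun i => zero_le) fun i => ?_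
  refine le_trans (le_of_eq ?_) (eLpNorm_sub_le ((h.1 i).sub h.2.1).1 ((h'.1 i).sub h'.2.1).1 n%)
  congr 1; ext x; simp; ring

lemma L2T.zero : L2T μ (fun _ _ => 0) (fun _ => 0) :=
  ⟨fun _ => MemLp.zero', MemLp.zero', by simp⟩

lemma L2T.add {u u' : ℕ → X → ℂ} {v v' : X → ℂ} (h : L2T μ u v) (h' : L2T μ u' v') :
    L2T μ (fun i x => u i x + u' i x) (fun x => v x + v' x) := by
  have := h.sub (L2T.zero.sub h')
  simpa using this

lemma L2T.sum {ι : Type*} (s : Finset ι) {u : ι → ℕ → X → ℂ} {v : ι → X → ℂ}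
    (h : ∀ j, L2T μ (u j) (v j)) : L2T μ (fun i x => ∑ j ∈ s, u j i x) (fun x => ∑ j ∈ s, v j x) := by
  classical
  induction s using Finset.induction_on with
  | empty => simpa using L2T.zero
  | insert a s ha ih => simpa [Finset.sum_insert ha] using (h a).add ih

lemma L2T.bmul {b : X → ℂ} {C : ℝ} (hb : AEStronglyMeasurable b μ) (hC : ∀ x, ‖b x‖ ≤ C)
    {u : ℕ → X → ℂ} {v : X → ℂ} (h : L2T μ u v) :
    L2T μ (fun i x => b x * u i x) (fun x => b x * v x) := by
  have key : ∀ g : X → ℂ, MemLp g 2 μ → MemLp (fun x => b x * g x) 2 μ := fun g hg =>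
    hg.of_le_mul (c := C) (hb.mul hg.1) (ae_of_all _ fun x => by
      rw [norm_mul]; gcongr; exact hC x)
  refine ⟨fun i => key _ (h.1 i), key _ h.2.1, ?_⟩
  have := ENNReal.Tendsto.const_mul (a := ENNReal.ofReal C) h.2.2 (Or.inr ENNReal.ofReal_ne_top)
  rw [mul_zero] at this
  refine tendsto_of_tendsto_of_tendsto_of_le_of_le tendsto_const_nhds this (fun i => zero_le) fun i => ?_
  refine eLpNorm_le_mul_eLpNorm_of_ae_le_mul (ae_of_all _ fun x => ?_) 2
  rw [← mul_sub, norm_mul]; gcongr; exact hC x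

lemma L2T.inner {u u' : ℕ → X → ℂ} {v v' : X → ℂ} (h : L2T μ u v) (h' : L2T μ u' v') :
    Tendsto (fun i => ∫ x, u i x * conj (u' i x) ∂μ) atTop (𝓝 (∫ x, v x * conj (v' x) ∂μ)) := by
  have conv : ∀ {u : ℕ → X → ℂ} {v : X → ℂ} (h : L2T μ u v),
      Tendsto (fun i => (h.1 i).toLp (u i)) atTop (𝓝 (h.2.1.toLp v)) := by
    intro u v h
    rw [tendsto_iff_edist_tendsto_0]
    refine h.2.2.congr fun i => ?_
    rw [Lp.edist_def]
    refine eLpNorm_congr_ae ?_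
    filter_upwards [(h.1 i).coeFn_toLp, h.2.1.coeFn_toLp] with x h1 h2
    simp [h1, h2]
  have key : ∀ (f g : X → ℂ) (hf : MemLp f 2 μ) (hg : MemLp g 2 μ),
      Inner.inner ℂ (hg.toLp g) (hf.toLp f) = ∫ x, f x * conj (g x) ∂μ := by
    intro f g hf hg
    rw [L2.inner_def]
    refine integral_congr_ae ?_
    filter_upwards [hf.coeFn_toLp, hg.coeFn_toLp] with x h1 h2
    rw [h1, h2]; rfl
  have := (conv h').inner (𝕜 := ℂ) (conv h)
  rw [key _ _ h.2.1 h'.2.1] at this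
  exact this.congr fun i => key _ _ _ _

lemma int_mul_conj {u v : X → ℂ} (h : MemLp u 2 μ) (h' : MemLp v 2 μ) :
    Integrable (fun x => u x * conj (v x)) μ :=
  h.integrable_mul h'.star
end

variable {E : Type*} [NormedAddCommGroup E] [NormedSpace ℂ E] [NormedSpace ℝ E]
variable [FiniteDimensional ℝ E] [MeasurableSpace E] [BorelSpace E] (μ : Measure E)
  [μ.IsAddHaarMeasure]

def IsTest (w : E → ℂ) : Prop := ContDiff ℝ ∞ w ∧ HasCompactSupport w

lemma hcs_bdd {F : Type*} [NormedAddCommGroup F] {b : E → F} (h : Continuous b)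
    (hc : HasCompactSupport b) : ∃ C, ∀ x, ‖b x‖ ≤ C := by
  obtain ⟨C, hC⟩ := hc.exists_bound_of_continuous h
  exact ⟨C, hC⟩

theorem basic_ineq_weak {ι : Type*} [Fintype ι] {φ : E → ℝ} (hφ : ContDiff ℝ ∞ φ)
    (hφc : HasCompactSupport φ) (e : ι → E) {f : ι → E → ℂ} (hf : ∀ j, MemLp (f j) 2 μ)
    {K : Set E} (hK : Bornology.IsBounded K) (hfK : ∀ j, ∀ x ∉ K, f j x = 0)
    {d : E → ℂ} (hd : MemLp d 2 μ) {c : ι → ι → E → ℂ} (hc : ∀ j k, MemLp (c j k) 2 μ)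
    (hdiv : ∀ w, IsTest w → ∑ j, ∫ x, f j x * wb (e j) w x ∂μ = - ∫ x, d x * w x ∂μ)
    (hcurl : ∀ j k, ∀ w, IsTest w → ∫ x, f j x * wd I (e k) w x ∂μ - ∫ x, f k x * wd I (e j) w x ∂μ
      = - ∫ x, c j k x * w x ∂μ) :
    ∫ x, (∑ j, ∑ k, wd I (e k) (wb (e j) c% φ) x * f j x * conj (f k x)).re
        * Real.exp (-(φ x)) ∂μ ≤
    ∫ x, ‖d x - ∑ j, wb (e j) c% φ x * f j x‖ ^ 2 * Real.exp (-(φ x)) ∂μ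
    + ∫ x, (1/2) * (∑ j, ∑ k, ‖c j k x‖ ^ 2) * Real.exp (-(φ x)) ∂μ := by
  obtain ⟨ρ, r, hρ, hρc, h0, h1, hr, hr0⟩ := exists_mollifiers μ
  have hφ' := ofReal_contDiff hφ
  have hφc' := hcs_ofReal hφc
  have hloc : ∀ j, LocallyIntegrable (f j) μ := fun j => (hf j).locallyIntegrable n%
  have hbase := fun i => basic_ineq μ hφ e (f := fun j => moll μ (ρ i) (f j))
    (fun j => moll_contDiff μ (hρ i) (hρc i) (hloc j)) (fun j => moll_hcs μ (hr i) hK (hfK j))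
  have htest : ∀ i x, IsTest (fun y => (ρ i (x - y) : ℂ)) := fun i x =>
    ⟨(ofReal_contDiff (hρ i)).comp (contDiff_const.sub contDiff_id),
      (hcs_ofReal (hρc i)).comp_homeomorph (Homeomorph.subLeft x)⟩
  have hdivm : ∀ i x, ∑ j, dlt φ (e j) (moll μ (ρ i) (f j)) x = moll μ (ρ i) d x -
      ∑ j, wb (e j) c% φ x * moll μ (ρ i) (f j) x := by
    intro i x
    simp only [dlt, Finset.sum_sub_distrib]
    congr 1
    have := hdiv _ (htest i x)
    simp only [moll_wd μ (hρ i) (hρc i) (hloc _), Finset.sum_neg_distrib]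
    rw [this, neg_neg]; rfl
  have hcurlm : ∀ i j k x, wd I (e k) (moll μ (ρ i) (f j)) x - wd I (e j) (moll μ (ρ i) (f k)) x
      = moll μ (ρ i) (c j k) x := by
    intro i j k x
    have := hcurl j k _ (htest i x)
    simp only [moll_wd μ (hρ i) (hρc i) (hloc _)]
    rw [neg_sub_neg, ← neg_sub, this, neg_neg]; rfl
  simp only [hdivm, hcurlm] at hbase
 
  have hT : ∀ {g : E → ℂ}, MemLp g 2 μ → L2T μ (fun i => moll μ (ρ i) g) g := by
    intro g hg
    have ht := moll_L2 μ (fun i => (hρ i).continuous) hρc h0 h1 hr hr0 hg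
    refine ⟨fun i => ?_, hg, ht⟩
    have hle := moll_L2_le μ (hρ i).continuous (hρc i) (h0 i) (h1 i) hg (δ := 2 * eLpNorm g 2 μ) (hr i)
      (fun s _ => by
        refine (eLpNorm_sub_le (f := fun x => g (x - s)) (g := g) ?_ hg.1 n%).trans ?_
        · exact hg.1.comp_measurePreserving (measurePreserving_sub_right μ s)
        · rw [two_mul]; gcongr
          exact (eLpNorm_comp_measurePreserving hg.1 (measurePreserving_sub_right μ s)).le)
    have hm : MemLp (fun x => moll μ (ρ i) g x - g x) 2 μ :=
      ⟨(moll_contDiff μ (hρ i) (hρc i) (hg.locallyIntegrable n%)).continuous.aestronglyMeasurable.sub hg.1,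
        hle.trans_lt (ENNReal.mul_lt_top s% hg.2)⟩
    have h2 := hm.add hg
    convert h2 using 1; ext x; simp
  obtain ⟨Cφ, hCφ⟩ := hcs_bdd hφ.continuous hφc
  have hWc : Continuous (fun x => cexp (-(φ x : ℂ))) := (wt_contDiff hφ).continuous
  have hWb : ∀ x, ‖cexp (-(φ x : ℂ))‖ ≤ Real.exp Cφ := fun x => by
    rw [norm_exp]; simp only [neg_re, ofReal_re]
    exact Real.exp_le_exp.2 ((neg_le_abs _).trans (hCφ x))
  have hb1 : ∀ j, ∃ C, ∀ x, ‖wb (e j) c% φ x‖ ≤ C := fun j =>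
    hcs_bdd (wd_contDiff _ _ hφ').continuous (wd_hcs _ _ hφc')
  have hb2 : ∀ j k, ∃ C, ∀ x, ‖wd I (e k) (wb (e j) c% φ) x‖ ≤ C := fun j k =>
    hcs_bdd (wd_contDiff _ _ (wd_contDiff _ _ hφ')).continuous (wd_hcs _ _ (wd_hcs _ _ hφc'))
  have hexp : ∀ x, cexp (-(φ x : ℂ)) = ((Real.exp (-(φ x)) : ℝ) : ℂ) := fun x => by push_cast; rfl
 
  have hsq : ∀ u : E → ℂ, MemLp u 2 μ → ∫ x, ‖u x‖ ^ 2 * Real.exp (-(φ x)) ∂μ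
      = (∫ x, cexp (-(φ x : ℂ)) * u x * conj (u x) ∂μ).re := by
    intro u hu
    have hi : Integrable (fun x => cexp (-(φ x : ℂ)) * u x * conj (u x)) μ :=
      int_mul_conj (hu.of_le_mul (c := Real.exp Cφ) (hWc.aestronglyMeasurable.mul hu.1)
        (ae_of_all _ fun x => by rw [norm_mul]; gcongr; exact hWb x)) hu
    have := integral_re (𝕜 := ℂ) hi
    rw [show (∫ x, cexp (-(φ x : ℂ)) * u x * conj (u x) ∂μ).re = _ from this.symm]
    congr 1; ext x
    rw [mul_assoc, mul_conj, hexp, normSq_eq_norm_sq, ← ofReal_mul, mul_comm]; exact (ofReal_re _).symm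
  have hsqT : ∀ {u : ℕ → E → ℂ} {v : E → ℂ}, L2T μ u v →
      Tendsto (fun i => ∫ x, ‖u i x‖ ^ 2 * Real.exp (-(φ x)) ∂μ) atTop
        (𝓝 (∫ x, ‖v x‖ ^ 2 * Real.exp (-(φ x)) ∂μ)) := by
    intro u v h
    rw [hsq v h.2.1]
    have := (continuous_re.tendsto _).comp ((h.bmul hWc.aestronglyMeasurable hWb).inner h)
    exact this.congr fun i => (hsq _ (h.1 i)).symm
  have hfT := fun j => hT (hf j)
  have t2 := hsqT ((hT hd).sub (L2T.sum Finset.univ fun j => (hfT j).bmul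
    (wd_contDiff _ _ hφ').continuous.aestronglyMeasurable (hb1 j).choose_spec))
  have hsplit3 : ∀ u : ι → ι → E → ℂ, (∀ j k, MemLp (u j k) 2 μ) →
      ∫ x, (1/2) * (∑ j, ∑ k, ‖u j k x‖ ^ 2) * Real.exp (-(φ x)) ∂μ =
      (1/2) * ∑ j, ∑ k, ∫ x, ‖u j k x‖ ^ 2 * Real.exp (-(φ x)) ∂μ := by
    intro u hu
    have hi : ∀ j k, Integrable (fun x => ‖u j k x‖ ^ 2 * Real.exp (-(φ x))) μ := fun j k => by
      have := (hu j k).integrable_norm_pow (p := 2) n%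
      refine this.mul_bdd (c := Real.exp Cφ) (by
        have := hφ.continuous
        exact (by fun_prop : Continuous fun x => Real.exp (-(φ x))).aestronglyMeasurable) (ae_of_all _ fun x => ?_)
      have := hWb x
      rwa [hexp, norm_real] at this
    simp only [mul_assoc, Finset.sum_mul]
    rw [integral_const_mul, integral_finsetSum _ (fun j _ => integrable_finsetSum _ (fun k _ => hi j k))]
    congr 1
    refine Finset.sum_congr rfl fun j _ => ?_
    rw [integral_finsetSum _ (fun k _ => hi j k)]
  have t3 : Tendsto (fun i => ∫ x, (1/2) * (∑ j, ∑ k, ‖moll μ (ρ i) (c j k) x‖ ^ 2) * Real.exp (-(φ x)) ∂μ)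
      atTop (𝓝 (∫ x, (1/2) * (∑ j, ∑ k, ‖c j k x‖ ^ 2) * Real.exp (-(φ x)) ∂μ)) := by
    rw [hsplit3 _ hc]
    refine Tendsto.congr (fun i => (hsplit3 _ (fun j k => (hT (hc j k)).1 i)).symm) ?_
    exact (tendsto_finsetSum _ fun j _ => tendsto_finsetSum _ fun k _ => hsqT (hT (hc j k))).const_mul _
  have hbb : ∀ j k, ∃ C, ∀ x, ‖cexp (-(φ x : ℂ)) * wd I (e k) (wb (e j) c% φ) x‖ ≤ C :=
    fun j k => ⟨Real.exp Cφ * (hb2 j k).choose, fun x => by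
      rw [norm_mul]; exact mul_le_mul (hWb x) ((hb2 j k).choose_spec x) (norm_nonneg _) (Real.exp_pos _).le⟩
  have hbm : ∀ j k, AEStronglyMeasurable (fun x => cexp (-(φ x : ℂ)) * wd I (e k) (wb (e j) c% φ) x) μ :=
    fun j k => (hWc.mul (wd_contDiff _ _ (wd_contDiff _ _ hφ')).continuous).aestronglyMeasurable
  have hsplit1 : ∀ u : ι → E → ℂ, (∀ j, MemLp (u j) 2 μ) →
      ∫ x, (∑ j, ∑ k, wd I (e k) (wb (e j) c% φ) x * u j x * conj (u k x)).re
        * Real.exp (-(φ x)) ∂μ = (∑ j, ∑ k, ∫ x, (cexp (-(φ x : ℂ)) *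
          wd I (e k) (wb (e j) c% φ) x) * u j x * conj (u k x) ∂μ).re := by
    intro u hu
    have hi : ∀ j k, Integrable (fun x => (cexp (-(φ x : ℂ)) *
          wd I (e k) (wb (e j) c% φ) x) * u j x * conj (u k x)) μ := fun j k =>
      int_mul_conj ((hu j).of_le_mul (c := (hbb j k).choose) ((hbm j k).mul (hu j).1)
        (ae_of_all _ fun x => by rw [norm_mul]; gcongr; exact (hbb j k).choose_spec x)) (hu k)
    have h2 : ∀ j, ∑ k, ∫ x, (cexp (-(φ x : ℂ)) *
          wd I (e k) (wb (e j) c% φ) x) * u j x * conj (u k x) ∂μ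
        = ∫ x, ∑ k, (cexp (-(φ x : ℂ)) *
          wd I (e k) (wb (e j) c% φ) x) * u j x * conj (u k x) ∂μ := fun j =>
      (integral_finsetSum _ (fun k _ => hi j k)).symm
    simp only [h2]
    rw [← integral_finsetSum _ (fun j _ => integrable_finsetSum _ (fun k _ => hi j k))]
    have := integral_re (𝕜 := ℂ) (integrable_finsetSum Finset.univ
      (fun j _ => integrable_finsetSum Finset.univ (fun k _ => hi j k)))
    refine Eq.trans ?_ this
    congr 1; ext x
    rw [mul_comm, ← re_ofReal_mul, ← hexp, Finset.mul_sum]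
    simp only [Finset.mul_sum, mul_assoc]; rfl
  have t1 : Tendsto (fun i => ∫ x, (∑ j, ∑ k, wd I (e k) (wb (e j) c% φ) x
      * moll μ (ρ i) (f j) x * conj (moll μ (ρ i) (f k) x)).re * Real.exp (-(φ x)) ∂μ) atTop
      (𝓝 (∫ x, (∑ j, ∑ k, wd I (e k) (wb (e j) c% φ) x * f j x * conj (f k x)).re
        * Real.exp (-(φ x)) ∂μ)) := by
    rw [hsplit1 _ hf]
    refine Tendsto.congr (fun i => (hsplit1 _ (fun j => (hfT j).1 i)).symm) ?_
    refine (continuous_re.tendsto _).comp (tendsto_finsetSum _ fun j _ => tendsto_finsetSum _ fun k _ => ?_)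
    exact ((hfT j).bmul (hbm j k) (hbb j k).choose_spec).inner (hfT k)
  exact le_of_tendsto_of_tendsto' t1 (t2.add t3) hbase
end

section
open Complex ContDiff MeasureTheory Filter Topology
open scoped ComplexConjugate ENNReal

lemma cs_sum {ι : Type*} [Fintype ι] (a b : ι → ℂ) :
    ‖∑ j, a j * b j‖ ^ 2 ≤ (∑ j, ‖a j‖ ^ 2) * ∑ j, ‖b j‖ ^ 2 := by
  have h : ‖∑ j, a j * b j‖ ≤ ∑ j, ‖a j‖ * ‖b j‖ := (norm_sum_le _ _).trans s%
  exact (pow_le_pow_left₀ (norm_nonneg _) h 2).trans (Finset.sum_mul_sq_le_sq_mul_sq _ _ _)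

variable {E : Type*} [NormedAddCommGroup E] [NormedSpace ℂ E] [NormedSpace ℝ E]

def DTest (D : Set E) (w : E → ℂ) : Prop := ContDiff ℝ ∞ w ∧ HasCompactSupport w ∧ tsupport w ⊆ D

lemma DTest.wd {D : Set E} {w : E → ℂ} (h : DTest D w) (c : ℂ) (e : E) : DTest D (wd c e w) :=
  ⟨wd_contDiff c e h.1, wd_hcs c e h.2.1, (wd_tsupport c e w).trans h.2.2⟩

lemma DTest.conj {D : Set E} {w : E → ℂ} (h : DTest D w) : DTest D (fun x => conj (w x)) :=
  ⟨conj_contDiff h.1, hcs_conj h.2.1, (tsupport_comp_subset (g := fun z : ℂ => conj z) s% w).trans h.2.2⟩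

lemma DTest.mul {D : Set E} (hD : IsOpen D) {u w : E → ℂ} (hu : ContDiffOn ℝ ∞ u D) (h : DTest D w) :
    DTest D (fun x => u x * w x) := by
  have hs : tsupport (fun x => u x * w x) ⊆ tsupport w := tsupport_mul_subset_right
  refine ⟨?_, h.2.1.mul_left, hs.trans h.2.2⟩
  rw [contDiff_iff_contDiffAt]
  intro x
  by_cases hx : x ∈ tsupport w
  · exact (hu.contDiffAt (hD.mem_nhds (h.2.2 hx))).mul h.1.contDiffAt
  · have : (fun x => u x * w x) =ᶠ[𝓝 x] fun _ => 0 := by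
      filter_upwards [notMem_tsupport_iff_eventuallyEq.mp hx] with y hy
      simp [hy]
    exact contDiffAt_const.congr_of_eventuallyEq this

lemma DTest.mulr {D : Set E} (hD : IsOpen D) {u w : E → ℂ} (hu : ContDiffOn ℝ ∞ u D) (h : DTest D w) :
    DTest D (fun x => w x * u x) := by
  simpa only [mul_comm] using DTest.mul hD hu h

lemma DTest.add {D : Set E} {u w : E → ℂ} (hu : DTest D u) (h : DTest D w) :
    DTest D (fun x => u x + w x) :=
  ⟨hu.1.add h.1, hu.2.1.add h.2.1, (tsupport_add u w).trans (Set.union_subset hu.2.2 h.2.2)⟩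

lemma DTest.zero {D : Set E} : DTest D (fun _ : E => (0:ℂ)) := by
  refine ⟨contDiff_const, HasCompactSupport.zero, ?_⟩
  simp [tsupport, Function.support]

lemma DTest.sum {D : Set E} {ι : Type*} (s : Finset ι) {u : ι → E → ℂ} (hu : ∀ j, DTest D (u j)) :
    DTest D (fun x => ∑ j ∈ s, u j x) := by
  classical
  induction s using Finset.induction_on with
  | empty => simpa using DTest.zero
  | insert a s ha ih => simpa [Finset.sum_insert ha] using (hu a).add ih

lemma DTest.smul {D : Set E} (hD : IsOpen D) (c : ℂ) {w : E → ℂ} (h : DTest D w) :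
    DTest D (fun x => c * w x) := DTest.mul hD (u := fun _ => c) contDiffOn_const h

lemma DTest.off {D : Set E} {w : E → ℂ} (h : DTest D w) {x : E} (hx : x ∉ D) : w x = 0 :=
  image_eq_zero_of_notMem_tsupport fun h' => hx (h.2.2 h')

variable [FiniteDimensional ℝ E] [MeasurableSpace E] [BorelSpace E] (μ : Measure E)
  [μ.IsAddHaarMeasure]

lemma DTest.bdd {D : Set E} {w : E → ℂ} (h : DTest D w) : ∃ C, ∀ x, ‖w x‖ ≤ C :=
  hcs_bdd h.1.continuous h.2.1

lemma DTest.memLp {D : Set E} {w : E → ℂ} (h : DTest D w) (p : ℝ≥0∞) : MemLp w p μ :=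
  h.1.continuous.memLp_of_hasCompactSupport h.2.1

lemma DTest.mul_memLp {D : Set E} {w : E → ℂ} (h : DTest D w) {H : E → ℂ} (hH : MemLp H 2 μ) :
    MemLp (fun x => w x * H x) 2 μ := by
  obtain ⟨C, hC⟩ := h.bdd
  exact hH.of_le_mul (c := C) (h.1.continuous.aestronglyMeasurable.mul hH.1)
    (ae_of_all _ fun x => by rw [norm_mul]; gcongr; exact hC x)

lemma int_l2mul {u v : E → ℂ} (h : MemLp u 2 μ) (h' : MemLp v 2 μ) :
    Integrable (fun x => u x * v x) μ := h.integrable_mul h'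

lemma int_sq_bdd {u : E → ℂ} (h : MemLp u 2 μ) {b : E → ℝ} (hb : Continuous b) {C : ℝ}
    (hC : ∀ x, |b x| ≤ C) : Integrable (fun x => ‖u x‖ ^ 2 * b x) μ :=
  (h.integrable_norm_pow (p := 2) n%).mul_bdd (c := C) hb.aestronglyMeasurable (ae_of_all _ hC)

end

section
open Complex ContDiff MeasureTheory Filter Topology
open scoped ComplexConjugate ENNReal

variable {E : Type*} [NormedAddCommGroup E] [NormedSpace ℂ E] [NormedSpace ℝ E]

lemma wd_real_norm (e : E) {f : E → ℝ} {x : E} (hf : DifferentiableAt ℝ c% f x) :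
    ‖wd I e c% f x‖ = ‖wb e c% f x‖ := by
  have := wd_conj I e hf
  simp only [conj_ofReal, conj_I] at this
  rw [this, RCLike.norm_conj]

lemma norm3_sq (a b c : ℂ) : ‖a + b - c‖ ^ 2 ≤ 3 * (‖a‖ ^ 2 + ‖b‖ ^ 2 + ‖c‖ ^ 2) := by
  have h : ‖a + b - c‖ ≤ ‖a‖ + ‖b‖ + ‖c‖ := (norm_sub_le _ _).trans (by gcongr; exact norm_add_le _ _)
  have := pow_le_pow_left₀ (norm_nonneg _) h 2
  nlinarith [sq_nonneg (‖a‖ - ‖b‖), sq_nonneg (‖a‖ - ‖c‖), sq_nonneg (‖b‖ - ‖c‖)]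

lemma norm2_sq (a b : ℂ) : ‖a - b‖ ^ 2 ≤ 2 * (‖a‖ ^ 2 + ‖b‖ ^ 2) := by
  have := pow_le_pow_left₀ (norm_nonneg _) (norm_sub_le a b) 2
  nlinarith [sq_nonneg (‖a‖ - ‖b‖)]

lemma curl_sum {ι : Type*} [Fintype ι] (a b : ι → ℂ) :
    ∑ j, ∑ k, ‖b k * a j - b j * a k‖ ^ 2 ≤ 4 * (∑ j, ‖b j‖ ^ 2) * ∑ j, ‖a j‖ ^ 2 := by
  have h : ∑ j, ∑ k, ‖b k * a j - b j * a k‖ ^ 2 ≤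
      ∑ j, ∑ k, 2 * (‖b k‖ ^ 2 * ‖a j‖ ^ 2 + ‖b j‖ ^ 2 * ‖a k‖ ^ 2) :=
    Finset.sum_le_sum fun j _ => Finset.sum_le_sum fun k _ => by
      have := norm2_sq (b k * a j) (b j * a k)
      simpa only [norm_mul, mul_pow] using this
  refine h.trans (le_of_eq ?_)
  simp only [← Finset.mul_sum, Finset.sum_add_distrib]
  rw [Finset.sum_comm (f := fun j k => ‖b k‖ ^ 2 * ‖a j‖ ^ 2)]
  simp only [← Finset.mul_sum, ← Finset.sum_mul]
  ring

variable [FiniteDimensional ℝ E] [MeasurableSpace E] [BorelSpace E] (μ : Measure E)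
  [μ.IsAddHaarMeasure]

theorem apriori_step {ι : Type*} [Fintype ι] {D : Set E} (hD : IsOpen D) {φ η : E → ℝ}
    (hφ : ContDiffOn ℝ ∞ φ D) (hη : ContDiffOn ℝ ∞ η D) (e : ι → E)
    (hL : ∀ x ∈ D, ∀ X : ι → ℂ, (3 * ∑ j, ‖wb (e j) c% η x‖ ^ 2 + Real.exp (η x))
      * ∑ j, ‖X j‖ ^ 2 ≤ (∑ j, ∑ k, wd I (e k) (wb (e j) c% φ) x * X j * conj (X k)).re)
    {θ χ : E → ℝ} (hθ : DTest D c% θ) (hχ : DTest D c% χ)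
    (hθ0 : ∀ x, θ x ^ 2 ≤ 1)
    (hχθ : ∀ x ∈ tsupport c% θ, ∀ᶠ y in 𝓝 x, χ y = 1)
    {H : ι → E → ℂ} (hH : ∀ j, MemLp (H j) 2 μ) {t : E → ℂ} (ht : DTest D t)
    (hcl : ∀ w, DTest D w → ∀ j k, ∫ x, H j x * (cexp (((φ x - η x) / 2 : ℝ) : ℂ) * wd I (e k) w x) ∂μ
      = ∫ x, H k x * (cexp (((φ x - η x) / 2 : ℝ) : ℂ) * wd I (e j) w x) ∂μ)
    (hdv : ∀ w, DTest D w → ∑ j, ∫ x, H j x * (cexp ((-((φ x - η x) / 2) : ℝ) : ℂ) * wb (e j) w x) ∂μ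
      = - ∫ x, t x * w x ∂μ) :
    ∫ x, (∑ j, ‖H j x‖ ^ 2) * θ x ^ 2 ∂μ ≤ ∫ x, 3 * (‖t x‖ ^ 2 * Real.exp (φ x - 2 * η x)) ∂μ
      + ∫ x, 5 * ((∑ j, ‖H j x‖ ^ 2) *
        ((∑ j, ‖wb (e j) c% θ x‖ ^ 2) * Real.exp (-(η x)))) ∂μ := by
  have hofR : ∀ {u : E → ℝ}, ContDiffOn ℝ ∞ u D → ContDiffOn ℝ ∞ c% u D :=
    fun hu => ofRealCLM.contDiff.comp_contDiffOn hu
  set a : E → ℂ := fun x => cexp (((φ x - η x) / 2 : ℝ) : ℂ) with ha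
  set ai : E → ℂ := fun x => cexp ((-((φ x - η x) / 2) : ℝ) : ℂ) with hai
  have hcl' : ∀ w, DTest D w → ∀ j k, ∫ x, H j x * (a x * wd I (e k) w x) ∂μ
      = ∫ x, H k x * (a x * wd I (e j) w x) ∂μ := hcl
  have hdv' : ∀ w, DTest D w → ∑ j, ∫ x, H j x * (ai x * wb (e j) w x) ∂μ
      = - ∫ x, t x * w x ∂μ := hdv
  have hac : ContDiffOn ℝ ∞ a D := (hofR ((hφ.sub hη).div_const 2)).cexp
  have haic : ContDiffOn ℝ ∞ ai D := (hofR ((hφ.sub hη).div_const 2).neg).cexp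
  have haai : ∀ x, ai x * a x = 1 := fun x => by
    simp only [ha, hai]; rw [← Complex.exp_add, ← ofReal_add]; simp
  set w0 : E → ℂ := fun x => a x ^ 2 * (θ x : ℂ) with hw0
  have hw0T : DTest D w0 := DTest.mul hD (hac.pow 2) hθ
  have haθ : DTest D (fun x => a x * (θ x : ℂ)) := DTest.mul hD hac hθ
  have hdθ : ∀ c j, DTest D (fun x => a x * wd c (e j) c% θ x) := fun c j =>
    DTest.mul hD hac (hθ.wd c (e j))
  have hdw0 : ∀ j, DTest D (fun x => ai x * wb (e j) w0 x) := fun j => DTest.mul hD haic (hw0T.wd _ _)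
  set f : ι → E → ℂ := fun j x => (a x * (θ x : ℂ)) * H j x with hf
  set d : E → ℂ := fun x => w0 x * t x + ∑ j, (ai x * wb (e j) w0 x) * H j x with hd
  set c : ι → ι → E → ℂ := fun j k x => (a x * wd I (e k) c% θ x) * H j x
    - (a x * wd I (e j) c% θ x) * H k x with hc
  have hfL : ∀ j, MemLp (f j) 2 μ := fun j => haθ.mul_memLp μ (hH j)
  have hdL : MemLp d 2 μ := (hw0T.mul_memLp μ (ht.memLp μ 2)).add
    (memLp_finsetSum _ fun j _ => (hdw0 j).mul_memLp μ (hH j))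
  have hcL : ∀ j k, MemLp (c j k) 2 μ := fun j k => ((hdθ I k).mul_memLp μ (hH j)).sub
    ((hdθ I j).mul_memLp μ (hH k))
  set Φ : E → ℝ := fun x => φ x * χ x with hΦ
  have hΦT : DTest D c% Φ := by
    have := DTest.mul hD (hofR hφ) hχ
    simpa only [hΦ, ofReal_mul] using this
  have hΦs : ContDiff ℝ ∞ Φ := by
    have := reCLM.contDiff.comp hΦT.1 (n := ∞)
    exact this
  have hΦc : HasCompactSupport Φ := by
    have := hΦT.2.1.comp_left (g := Complex.re) s%
    exact this
  have hK : Bornology.IsBounded (tsupport c% θ) := hθ.2.1.isCompact.isBounded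
  have hdiff : ∀ {w : E → ℂ} (_ : ContDiff ℝ ∞ w) (x : E), DifferentiableAt ℝ w x := fun h x =>
    h.differentiable s% x
  have key := basic_ineq_weak μ hΦs hΦc e hfL hK (fun j x hx => by
      simp only [hf]
      rw [show (θ x : ℂ) = 0 from image_eq_zero_of_notMem_tsupport (f := c% θ) hx]; simp) hdL hcL
    (by
      intro w hw
      have hw1 : DTest D (fun x => w0 x * w x) := DTest.mulr hD hw.1.contDiffOn hw0T
      have h1 := hdv' _ hw1
      have hwL : ∀ e, MemLp (wb e w) 2 μ := fun e =>
        (wd_contDiff _ _ hw.1).continuous.memLp_of_hasCompactSupport (wd_hcs _ _ hw.2)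
      have hwL0 : MemLp w 2 μ := hw.1.continuous.memLp_of_hasCompactSupport hw.2
      have h2 : ∀ j x, H j x * (ai x * wb (e j) (fun x => w0 x * w x) x) =
          ((ai x * wb (e j) w0 x) * H j x) * w x + f j x * wb (e j) w x := by
        intro j x
        rw [wd_mul _ _ (hdiff hw0T.1 x) (hdiff hw.1 x)]
        simp only [hf, hw0]
        linear_combination (H j x * a x * θ x * wb (e j) w x) * haai x
      simp only [h2] at h1
      have i1 : ∀ j, Integrable (fun x => ((ai x * wb (e j) w0 x) * H j x) * w x) μ := fun j =>
        int_l2mul μ ((hdw0 j).mul_memLp μ (hH j)) hwL0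
      have i2 : ∀ j, Integrable (fun x => f j x * wb (e j) w x) μ := fun j => int_l2mul μ (hfL j) (hwL _)
      simp only [integral_add (i1 _) (i2 _), Finset.sum_add_distrib] at h1
      have h3 : ∫ x, d x * w x ∂μ = ∫ x, t x * (w0 x * w x) ∂μ
          + ∑ j, ∫ x, ((ai x * wb (e j) w0 x) * H j x) * w x ∂μ := by
        rw [← integral_finsetSum _ (fun j _ => i1 j), ← integral_add ((int_l2mul μ (ht.memLp μ 2) (hw1.memLp μ 2)))
          (integrable_finsetSum _ (fun j _ => i1 j))]
        congr 1; ext x; simp only [hd, add_mul, Finset.sum_mul]; ring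
      rw [h3]; linear_combination h1)
    (by
      intro j k w hw
      have hw1 : DTest D (fun x => (θ x : ℂ) * w x) := DTest.mulr hD hw.1.contDiffOn hθ
      have h1 := hcl' _ hw1 j k
      have hwL : ∀ e, MemLp (wd I e w) 2 μ := fun e =>
        (wd_contDiff _ _ hw.1).continuous.memLp_of_hasCompactSupport (wd_hcs _ _ hw.2)
      have hwL0 : MemLp w 2 μ := hw.1.continuous.memLp_of_hasCompactSupport hw.2
      have h2 : ∀ j k x, H j x * (a x * wd I (e k) (fun x => (θ x : ℂ) * w x) x) =
          ((a x * wd I (e k) c% θ x) * H j x) * w x + f j x * wd I (e k) w x := by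
        intro j k x
        rw [wd_mul _ _ (hdiff hθ.1 x) (hdiff hw.1 x)]
        simp only [hf]; ring
      have i1 : ∀ j k, Integrable (fun x => ((a x * wd I (e k) c% θ x) * H j x) * w x) μ :=
        fun j k => int_l2mul μ ((hdθ I k).mul_memLp μ (hH j)) hwL0
      have i2 : ∀ j k, Integrable (fun x => f j x * wd I (e k) w x) μ := fun j k =>
        int_l2mul μ (hfL j) (hwL _)
      simp only [h2] at h1
      rw [integral_add (i1 _ _) (i2 _ _), integral_add (i1 _ _) (i2 _ _)] at h1
      have h3 := integral_sub (i1 j k) (i1 k j)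
      have h4 : ∫ x, c j k x * w x ∂μ = _ := (by simp only [hc, sub_mul] : _ = _).trans h3
      rw [h4]; linear_combination h1)
 
  have hGc : Continuous (fun x => Real.exp (-(Φ x))) := Real.continuous_exp.comp hΦs.continuous.neg
  obtain ⟨CΦ, hCΦ⟩ := hcs_bdd hΦs.continuous hΦc
  have hGb : ∀ x, |Real.exp (-(Φ x))| ≤ Real.exp CΦ := fun x => by
    rw [abs_of_pos (Real.exp_pos _)]; exact Real.exp_le_exp.2 ((neg_le_abs _).trans (hCΦ x))
  have iP : Integrable (fun x => (∑ j, ∑ k, wd I (e k) (wb (e j) c% Φ) x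
      * f j x * conj (f k x)).re * Real.exp (-(Φ x))) μ := by
    refine Integrable.mul_bdd (c := Real.exp CΦ) (Integrable.re (𝕜 := ℂ) (integrable_finsetSum _ fun j _ =>
      integrable_finsetSum _ fun k _ => int_mul_conj (((hΦT.wd _ _).wd _ _).mul_memLp μ (hfL j)) (hfL k)))
      hGc.aestronglyMeasurable (ae_of_all _ hGb)
  have iQ : Integrable (fun x => ‖d x - ∑ j, wb (e j) c% Φ x * f j x‖ ^ 2
      * Real.exp (-(Φ x))) μ := int_sq_bdd μ (hdL.sub (memLp_finsetSum _ fun j _ =>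
        (hΦT.wd _ _).mul_memLp μ (hfL j))) hGc hGb
  have iR : Integrable (fun x => (1/2) * (∑ j, ∑ k, ‖c j k x‖ ^ 2) * Real.exp (-(Φ x))) μ := by
    have := (integrable_finsetSum Finset.univ fun j _ => integrable_finsetSum Finset.univ fun k _ =>
      int_sq_bdd μ (hcL j k) hGc hGb).const_mul (1/2)
    refine this.congr (ae_of_all _ fun x => ?_)
    simp only [Finset.sum_mul, mul_assoc]
  have i3 : Integrable (fun x => 3 * (‖t x‖ ^ 2 * Real.exp (φ x - 2 * η x))) μ := by
    have hu : ContDiffOn ℝ ∞ (fun x => cexp ((φ x - 2 * η x : ℝ) : ℂ)) D :=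
      (hofR (hφ.sub (contDiffOn_const.mul hη))).cexp
    have h1 := DTest.mul hD hu ht
    refine ((int_l2mul μ (h1.memLp μ 2) (ht.memLp μ 2)).norm.const_mul 3).congr (ae_of_all _ fun x => ?_)
    simp only [norm_mul, norm_exp, ofReal_re]; ring
  have i5 : Integrable (fun x => 5 * ((∑ j, ‖H j x‖ ^ 2) *
        ((∑ j, ‖wb (e j) c% θ x‖ ^ 2) * Real.exp (-(η x))))) μ := by
    have hu : ContDiffOn ℝ ∞ (fun x => cexp ((-(η x) / 2 : ℝ) : ℂ)) D :=
      (hofR (hη.neg.div_const 2)).cexp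
    have h1 := fun j => DTest.mul hD hu (hθ.wd (-I) (e j))
    have h2 := (integrable_finsetSum Finset.univ fun j _ => integrable_finsetSum Finset.univ fun k _ =>
      ((h1 k).mul_memLp μ (hH j)).integrable_norm_pow (p := 2) n%).const_mul 5
    refine h2.congr (ae_of_all _ fun x => ?_)
    simp only [norm_mul, norm_exp, ofReal_re, Finset.sum_mul, Finset.mul_sum, mul_pow]
    rw [Finset.sum_comm]
    refine Finset.sum_congr rfl fun j _ => Finset.sum_congr rfl fun k _ => ?_
    rw [← Real.exp_nat_mul]; push_cast
    rw [show 2 * (-(η x) / 2) = -(η x) by ring]; ring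
  have i4 : Integrable (fun x => (∑ j, ‖H j x‖ ^ 2) * θ x ^ 2) μ := by
    have h2 := (integrable_finsetSum Finset.univ fun j _ =>
      ((hθ.mul_memLp μ (hH j)).integrable_norm_pow (p := 2) n%))
    refine h2.congr (ae_of_all _ fun x => ?_)
    simp only [norm_mul, mul_pow, Finset.sum_mul, norm_real, Real.norm_eq_abs, sq_abs]
    exact Finset.sum_congr rfl fun j _ => by ring
 
  have hpt : ∀ x, (∑ j, ‖H j x‖ ^ 2) * θ x ^ 2 - 3 * (‖t x‖ ^ 2 * Real.exp (φ x - 2 * η x)) -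
      5 * ((∑ j, ‖H j x‖ ^ 2) * ((∑ j, ‖wb (e j) c% θ x‖ ^ 2) * Real.exp (-(η x)))) ≤
      (∑ j, ∑ k, wd I (e k) (wb (e j) c% Φ) x
      * f j x * conj (f k x)).re * Real.exp (-(Φ x)) -
      ‖d x - ∑ j, wb (e j) c% Φ x * f j x‖ ^ 2 * Real.exp (-(Φ x)) -
      (1/2) * (∑ j, ∑ k, ‖c j k x‖ ^ 2) * Real.exp (-(Φ x)) := by
    intro x
    by_cases hx : x ∈ tsupport c% θ
    · have hxD := hθ.2.2 hx
      have hD' := hD.mem_nhds hxD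
      have hev : c% Φ =ᶠ[𝓝 x] c% φ := by
        filter_upwards [hχθ x hx] with y hy; simp [hΦ, hy]
      have hev1 : ∀ j, wb (e j) c% Φ =ᶠ[𝓝 x] wb (e j) c% φ := fun j => by
        filter_upwards [hev.eventuallyEq_nhds] with y hy using wd_congr _ _ hy
      simp only [fun j => (hev1 j).eq_of_nhds, fun j k => wd_congr I (e k) (hev1 j)]
      have hΦx : Φ x = φ x := by have := hev.eq_of_nhds; exact_mod_cast this
      rw [hΦx]
      have dφ : DifferentiableAt ℝ c% φ x := ((hofR hφ).contDiffAt hD').differentiableAt s%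
      have dη : DifferentiableAt ℝ c% η x := ((hofR hη).contDiffAt hD').differentiableAt s%
      have da : DifferentiableAt ℝ a x := (hac.contDiffAt hD').differentiableAt s%
      have hwda : ∀ j, wb (e j) w0 x = a x ^ 2 * ((wb (e j) c% φ x -
          wb (e j) c% η x) * θ x + wb (e j) c% θ x) := by
        intro j
        have e1 : (fun x => a x ^ 2) = fun y => cexp ((φ y : ℂ) - (η y : ℂ)) := by
          ext y; simp only [ha]; rw [← Complex.exp_nat_mul]; congr 1; push_cast; ring
        have e2 : a x ^ 2 = cexp ((φ x : ℂ) - (η x : ℂ)) := congrFun e1 x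
        have := wd_mul (-I) (e j) (f := fun x => a x ^ 2) (g := c% θ) (da.pow 2) (hdiff hθ.1 x)
        simp only [hw0]
        rw [this, e1, wd_cexp _ _ (f := fun y => (φ y : ℂ) - (η y : ℂ)) (dφ.sub dη), wd_sub _ _ dφ dη, e2]; ring
      have hdd : d x - ∑ j, wb (e j) c% φ x * f j x = w0 x * t x +
          ∑ j, wb (e j) c% θ x * (a x * H j x) -
          ∑ j, wb (e j) c% η x * f j x := by
        simp only [hd, hwda, hf]
        rw [add_sub_assoc, add_sub_assoc, ← Finset.sum_sub_distrib, ← Finset.sum_sub_distrib]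
        congr 1
        refine Finset.sum_congr rfl fun j _ => ?_
        linear_combination (a x * H j x * ((wb (e j) c% φ x -
          wb (e j) c% η x) * θ x + wb (e j) c% θ x)) * haai x
      have hP := hL x hxD (fun j => f j x)
      set A : ℝ := Real.exp ((φ x - η x) / 2) with hA
      have hnA : ‖a x‖ = A := by simp only [ha, norm_exp, ofReal_re, hA]
      set G : ℝ := Real.exp (-(φ x)) with hG
      have hG0 : 0 < G := Real.exp_pos _
      have hA2 : A ^ 2 * G = Real.exp (-(η x)) := by
        rw [hA, hG, ← Real.exp_nat_mul, ← Real.exp_add]; congr 1; push_cast; ring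
      have hA4 : A ^ 4 * G = Real.exp (φ x - 2 * η x) := by
        rw [hA, hG, ← Real.exp_nat_mul, ← Real.exp_add]; congr 1; push_cast; ring
      have hηη : Real.exp (η x) * Real.exp (-(η x)) = 1 := by rw [← Real.exp_add]; simp
      set N2 := ∑ j, ‖H j x‖ ^ 2 with hN2
      set T2 := ∑ j, ‖wb (e j) c% θ x‖ ^ 2 with hT2
      set E2 := ∑ j, ‖wb (e j) c% η x‖ ^ 2 with hE2
      have haH : ∑ j, ‖a x * H j x‖ ^ 2 = A ^ 2 * N2 := by
        simp only [norm_mul, mul_pow, hnA, hN2, Finset.mul_sum]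
      have hfN : ∑ j, ‖f j x‖ ^ 2 = A ^ 2 * θ x ^ 2 * N2 := by
        simp only [hf, norm_mul, mul_pow, hnA, hN2, Finset.mul_sum, norm_real, Real.norm_eq_abs, sq_abs]
      rw [hfN] at hP
      have hQ : ‖d x - ∑ j, wb (e j) c% φ x * f j x‖ ^ 2 ≤
          3 * (A ^ 4 * ‖t x‖ ^ 2 + T2 * (A ^ 2 * N2) + E2 * (A ^ 2 * θ x ^ 2 * N2)) := by
        rw [hdd]
        refine (norm3_sq _ _ _).trans ?_
        have q1 : ‖w0 x * t x‖ ^ 2 ≤ A ^ 4 * ‖t x‖ ^ 2 := by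
          simp only [hw0, norm_mul, norm_pow, hnA, mul_pow, norm_real, Real.norm_eq_abs, sq_abs]
          have : (A ^ 2) ^ 2 = A ^ 4 := by ring
          rw [this]
          have := hθ0 x
          have h4 : 0 ≤ A ^ 4 := by positivity
          nlinarith [mul_nonneg h4 (sq_nonneg ‖t x‖)]
        have q2 := cs_sum (fun j => wb (e j) c% θ x) (fun j => a x * H j x)
        have q3 := cs_sum (fun j => wb (e j) c% η x) (fun j => f j x)
        rw [haH] at q2
        rw [hfN] at q3
        linarith
      have hR : ∑ j, ∑ k, ‖c j k x‖ ^ 2 ≤ 4 * T2 * (A ^ 2 * N2) := by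
        have := curl_sum (fun j => a x * H j x) (fun j => wd I (e j) c% θ x)
        rw [haH] at this
        simp only [wd_real_norm _ (hdiff hθ.1 x)] at this
        refine le_trans (le_of_eq ?_) this
        refine Finset.sum_congr rfl fun j _ => Finset.sum_congr rfl fun k _ => ?_
        simp only [hc]; congr 2; ring
      have p1 := mlr hP hG0.le
      have p2 := mlr hQ hG0.le
      have p3 := mlr hR hG0.le
      have r1 : (3 * E2 + Real.exp (η x)) * (A ^ 2 * θ x ^ 2 * N2) * G =
          3 * E2 * θ x ^ 2 * N2 * Real.exp (-(η x)) + θ x ^ 2 * N2 := by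
        linear_combination ((3 * E2 + Real.exp (η x)) * θ x ^ 2 * N2) * hA2 + (θ x ^ 2 * N2) * hηη
      have r2 : 3 * (A ^ 4 * ‖t x‖ ^ 2 + T2 * (A ^ 2 * N2) + E2 * (A ^ 2 * θ x ^ 2 * N2)) * G =
          3 * (Real.exp (φ x - 2 * η x) * ‖t x‖ ^ 2 + T2 * N2 * Real.exp (-(η x))
            + E2 * θ x ^ 2 * N2 * Real.exp (-(η x))) := by
        linear_combination (3 * ‖t x‖ ^ 2) * hA4 + (3 * T2 * N2 + 3 * E2 * θ x ^ 2 * N2) * hA2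
      have r3 : 4 * T2 * (A ^ 2 * N2) * G = 4 * T2 * N2 * Real.exp (-(η x)) := by
        linear_combination (4 * T2 * N2) * hA2
      rw [r1] at p1; rw [r2] at p2; rw [r3] at p3
      nlinarith
    · have hθx : (θ x : ℂ) = 0 := image_eq_zero_of_notMem_tsupport (f := c% θ) hx
      have hθx' : θ x = 0 := by exact_mod_cast hθx
      have hdθx : ∀ c j, wd c (e j) c% θ x = 0 := fun c j =>
        image_eq_zero_of_notMem_tsupport fun h => hx (wd_tsupport _ _ _ h)
      have hw0x : ∀ j, wb (e j) w0 x = 0 := fun j =>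
        image_eq_zero_of_notMem_tsupport fun h => hx (tsupport_mul_subset_right (wd_tsupport _ _ _ h))
      have hw0xx : w0 x = 0 := by simp only [hw0, hθx, mul_zero]
      simp only [hf, hd, hc, hdθx, hw0x, hw0xx, hθx']
      simp only [ofReal_zero, mul_zero, zero_mul, add_zero, Finset.sum_const_zero, sub_zero, norm_zero, ne_eq, OfNat.ofNat_ne_zero,
        not_false_eq_true, zero_pow, map_zero, Complex.zero_re, zero_sub, neg_nonpos]
      positivity
  have hm := integral_mono ((i4.sub i3).sub i5) ((iP.sub iQ).sub iR) hpt
  have e0 := integral_sub (i4.sub i3) i5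
  have e1 := integral_sub i4 i3
  simp only [Pi.sub_apply] at e0 e1 hm
  rw [e0, e1] at hm
  have e2 := integral_sub (iP.sub iQ) iR
  have e3 := integral_sub iP iQ
  simp only [Pi.sub_apply] at e2 e3
  rw [e2, e3] at hm
  linarith
end

section
open Complex ContDiff MeasureTheory Filter Topology
open scoped ComplexConjugate ENNReal

lemma riesz_factor {V X : Type*} [AddCommGroup V] [Module ℂ V] [NormedAddCommGroup X] [InnerProductSpace ℂ X]
    [CompleteSpace X] (S : V →ₗ[ℂ] X) (l : V →ₗ[ℂ] ℂ) (C : ℝ) (h : ∀ v, ‖l v‖ ≤ C * ‖S v‖) :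
    ∃ U : X, ∀ v, l v = inner ℂ U (S v) := by
  have hinj : ∀ v v', S v = S v' → l v = l v' := by
    intro v v' hv
    have := h (v - v')
    rw [map_sub, map_sub, hv, sub_self, norm_zero, mul_zero] at this
    exact sub_eq_zero.1 (norm_le_zero_iff.1 this)
  choose g hg using fun x : LinearMap.range S => x.2
  let f0 : LinearMap.range S →ₗ[ℂ] ℂ :=
    { toFun := fun x => l (g x)
      map_add' := fun x y => by
        rw [← map_add]; apply hinj; rw [map_add, hg, hg, hg]; rfl
      map_smul' := fun c x => by
        simp only [RingHom.id_apply]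
        rw [← map_smul]; apply hinj; rw [map_smul, hg, hg]; rfl }
  let f : LinearMap.range S →L[ℂ] ℂ := f0.mkContinuous C (fun x => by
    have := h (g x); rw [hg] at this; exact this)
  obtain ⟨F, hF, -⟩ := exists_extension_norm_eq (LinearMap.range S) f
  refine ⟨(InnerProductSpace.toDual ℂ X).symm F, fun v => ?_⟩
  rw [InnerProductSpace.toDual_symm_apply]
  have := hF ⟨S v, v, rfl⟩
  simp only at this
  rw [this]
  exact hinj _ _ (hg ⟨S v, v, rfl⟩).symm

section
variable {X : Type*} [MeasurableSpace X] {μ : Measure X}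
lemma inner_toLp {f g : X → ℂ} (hf : MemLp f 2 μ) (hg : MemLp g 2 μ) :
    inner ℂ (hg.toLp g) (hf.toLp f) = ∫ x, f x * conj (g x) ∂μ := by
  rw [L2.inner_def]
  refine integral_congr_ae ?_
  filter_upwards [hf.coeFn_toLp, hg.coeFn_toLp] with x h1 h2
  rw [h1, h2]; rfl

lemma norm_toLp_sq {f : X → ℂ} (hf : MemLp f 2 μ) : ‖hf.toLp f‖ ^ 2 = ∫ x, ‖f x‖ ^ 2 ∂μ := by
  have h1 := inner_self_eq_norm_sq_to_K (𝕜 := ℂ) (hf.toLp f)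
  rw [inner_toLp] at h1
  have h2 : ∀ x, f x * conj (f x) = ((‖f x‖ ^ 2 : ℝ) : ℂ) := fun x => by
    rw [mul_conj, normSq_eq_norm_sq]
  simp only [h2, integral_ofReal] at h1
  apply Complex.ofReal_injective
  refine Eq.trans ?_ (h1.symm.trans integral_ofReal)
  push_cast; rfl

noncomputable def vec {ι : Type*} {u : ι → X → ℂ} (h : ∀ j, MemLp (u j) 2 μ) : PiLp 2 (fun _ : ι => Lp ℂ 2 μ) :=
  WithLp.toLp 2 (fun j => (h j).toLp (u j))

lemma inner_vec {ι : Type*} [Fintype ι] {u v : ι → X → ℂ} (hu : ∀ j, MemLp (u j) 2 μ)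
    (hv : ∀ j, MemLp (v j) 2 μ) : inner ℂ (vec hu) (vec hv) = ∑ j, ∫ x, v j x * conj (u j x) ∂μ := by
  simp only [vec, PiLp.inner_apply]
  exact Finset.sum_congr rfl fun j _ => inner_toLp _ _

lemma norm_vec {ι : Type*} [Fintype ι] {u : ι → X → ℂ} (hu : ∀ j, MemLp (u j) 2 μ) :
    ‖vec hu‖ ^ 2 = ∫ x, ∑ j, ‖u j x‖ ^ 2 ∂μ := by
  rw [PiLp.norm_sq_eq_of_L2, integral_finsetSum _ fun j _ => (hu j).integrable_norm_pow n%]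
  exact Finset.sum_congr rfl fun j _ => norm_toLp_sq (hu j)

lemma vec_surj {ι : Type*} (v : PiLp 2 (fun _ : ι => Lp ℂ 2 μ)) :
    ∃ (u : ι → X → ℂ) (h : ∀ j, MemLp (u j) 2 μ), v = vec h := by
  refine ⟨fun j => v j, fun j => Lp.memLp _, ?_⟩
  ext1 j
  simp only [vec]
  rw [Lp.toLp_coeFn]
end

variable {E : Type*} [NormedAddCommGroup E] [NormedSpace ℂ E] [NormedSpace ℝ E]
variable [FiniteDimensional ℝ E] [MeasurableSpace E] [BorelSpace E] (μ : Measure E)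
  [μ.IsAddHaarMeasure]

structure HData (ι : Type*) [Fintype ι] (D : Set E) (φ η : E → ℝ) (e : ι → E) (θ : ℕ → E → ℝ) : Prop where
  hD : IsOpen D
  hφ : ContDiffOn ℝ ∞ φ D
  hη : ContDiffOn ℝ ∞ η D
  hL : ∀ x ∈ D, ∀ X : ι → ℂ, (3 * ∑ j, ‖wb (e j) c% η x‖ ^ 2 + Real.exp (η x))
      * ∑ j, ‖X j‖ ^ 2 ≤ (∑ j, ∑ k, wd I (e k) (wb (e j) c% φ) x * X j * conj (X k)).re
  hθ : ∀ i, DTest D (fun x => (θ i x : ℂ))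
  hθ1 : ∀ i x, θ i x ^ 2 ≤ 1
  hχ : ∀ i, ∃ χ : E → ℝ, DTest D c% χ ∧
    ∀ x ∈ tsupport (fun x => (θ i x : ℂ)), ∀ᶠ y in 𝓝 x, χ y = 1
  hdθ : ∀ i, ∀ x ∈ D, ∑ j, ‖wb (e j) (fun y => (θ i y : ℂ)) x‖ ^ 2 ≤ Real.exp (η x)
  hlim : ∀ x ∈ D, ∀ᶠ i in atTop, ∀ᶠ y in 𝓝 x, θ i y = 1

theorem apriori {ι : Type*} [Fintype ι] {D : Set E} {φ η : E → ℝ} {e : ι → E} {θ : ℕ → E → ℝ}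
    (h : HData ι D φ η e θ) {H : ι → E → ℂ} (hH : ∀ j, MemLp (H j) 2 μ) {t : E → ℂ} (ht : DTest D t)
    (hcl : ∀ w, DTest D w → ∀ j k, ∫ x, H j x * (cexp (((φ x - η x) / 2 : ℝ) : ℂ) * wd I (e k) w x) ∂μ
      = ∫ x, H k x * (cexp (((φ x - η x) / 2 : ℝ) : ℂ) * wd I (e j) w x) ∂μ)
    (hdv : ∀ w, DTest D w → ∑ j, ∫ x, H j x * (cexp ((-((φ x - η x) / 2) : ℝ) : ℂ) * wb (e j) w x) ∂μ
      = - ∫ x, t x * w x ∂μ) :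
    ∫ x, ∑ j, ‖D.indicator (H j) x‖ ^ 2 ∂μ ≤ ∫ x, 3 * (‖t x‖ ^ 2 * Real.exp (φ x - 2 * η x)) ∂μ := by
  have hstep := fun i => apriori_step μ h.hD h.hφ h.hη e h.hL (h.hθ i) (h.hχ i).choose_spec.1 (h.hθ1 i)
    (h.hχ i).choose_spec.2 hH ht hcl hdv
  have hS : Integrable (fun x => ∑ j, ‖H j x‖ ^ 2) μ :=
    integrable_finsetSum _ fun j _ => (hH j).integrable_norm_pow n%
  have hS0 : ∀ x, 0 ≤ ∑ j, ‖H j x‖ ^ 2 := fun x => by positivity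
  have hθr : ∀ i, Continuous (θ i) := fun i => by
    have := continuous_re.comp (h.hθ i).1.continuous
    exact this
  have t1 : Tendsto (fun i => ∫ x, (∑ j, ‖H j x‖ ^ 2) * θ i x ^ 2 ∂μ) atTop
      (𝓝 (∫ x, ∑ j, ‖D.indicator (H j) x‖ ^ 2 ∂μ)) := by
    refine tendsto_integral_of_dominated_convergence _
      (fun i => hS.1.mul ((hθr i).pow 2).aestronglyMeasurable) hS (fun i => ae_of_all _ fun x => ?_)
      (ae_of_all _ fun x => ?_)
    · rw [Real.norm_of_nonneg (mul_nonneg (hS0 x) (sq_nonneg _))]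
      exact mul_le_of_le_one_right (hS0 x) (h.hθ1 i x)
    · by_cases hx : x ∈ D
      · simp only [Set.indicator_of_mem hx]
        refine tendsto_const_nhds.congr' ?_
        filter_upwards [h.hlim x hx] with i hi
        rw [hi.self_of_nhds]; simp
      · simp only [Set.indicator_of_notMem hx]
        refine tendsto_const_nhds.congr fun i => ?_
        have := (h.hθ i).off hx
        rw [show θ i x = 0 by exact_mod_cast this]; simp
  have hG : ∀ i, AEStronglyMeasurable (fun x => (∑ j, ‖wb (e j) (fun y => (θ i y : ℂ)) x‖ ^ 2)
      * Real.exp (-(η x))) μ := fun i => by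
    have hu : ContDiffOn ℝ ∞ (fun x => cexp ((-(η x) / 2 : ℝ) : ℂ)) D :=
      (ofRealCLM.contDiff.comp_contDiffOn (h.hη.neg.div_const 2)).cexp
    have h1 := fun j => (DTest.mul h.hD hu ((h.hθ i).wd (-I) (e j))).1.continuous
    have h2 : Continuous (fun x => ∑ j, ‖cexp ((-(η x) / 2 : ℝ) : ℂ) * wb (e j) (fun y => (θ i y : ℂ)) x‖ ^ 2) :=
      continuous_finsetSum _ fun j _ => (h1 j).norm.pow 2
    convert h2.aestronglyMeasurable using 2 with x
    rw [Finset.sum_mul]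
    refine Finset.sum_congr rfl fun j _ => ?_
    simp only [norm_mul, norm_exp, ofReal_re, mul_pow]
    rw [← Real.exp_nat_mul]; push_cast
    rw [show 2 * (-(η x) / 2) = -(η x) by ring]; ring
  have t2 : Tendsto (fun i => ∫ x, 5 * ((∑ j, ‖H j x‖ ^ 2) *
        ((∑ j, ‖wb (e j) (fun y => (θ i y : ℂ)) x‖ ^ 2) * Real.exp (-(η x)))) ∂μ) atTop (𝓝 0) := by
    rw [show (0:ℝ) = ∫ _ : E, (0:ℝ) ∂μ by simp]
    refine tendsto_integral_of_dominated_convergence _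
      (fun i => (hS.1.mul (hG i)).const_mul 5) (hS.const_mul 5) (fun i => ae_of_all _ fun x => ?_)
      (ae_of_all _ fun x => ?_)
    · have h0 : 0 ≤ (∑ j, ‖wb (e j) (fun y => (θ i y : ℂ)) x‖ ^ 2) * Real.exp (-(η x)) := by positivity
      rw [Real.norm_of_nonneg (by have := hS0 x; positivity)]
      have h1 : (∑ j, ‖wb (e j) (fun y => (θ i y : ℂ)) x‖ ^ 2) * Real.exp (-(η x)) ≤ 1 := by
        by_cases hx : x ∈ D
        · calc _ ≤ Real.exp (η x) * Real.exp (-(η x)) := by gcongr; exact h.hdθ i x hx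
            _ = 1 := by rw [← Real.exp_add]; simp
        · simp [((h.hθ i).wd _ _).off hx]
      exact mll (mul_le_of_le_one_right (hS0 x) h1) n%
    · by_cases hx : x ∈ D
      · refine tendsto_const_nhds.congr' ?_
        filter_upwards [h.hlim x hx] with i hi
        have : ∀ j, wb (e j) (fun y => (θ i y : ℂ)) x = 0 := fun j => by
          rw [wd_congr (g := fun _ => 1) _ _ (by filter_upwards [hi] with y hy; simp [hy])]; simp [wd]
        simp [this]
      · refine tendsto_const_nhds.congr fun i => ?_
        simp [((h.hθ i).wd _ _).off hx]
  have := le_of_tendsto_of_tendsto' t1 (t2.const_add _) hstep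
  simpa using this
end

section
open Complex ContDiff MeasureTheory Filter Topology
open scoped ComplexConjugate ENNReal

variable {E : Type*} [NormedAddCommGroup E] [NormedSpace ℂ E] [NormedSpace ℝ E]
variable [FiniteDimensional ℝ E] [MeasurableSpace E] [BorelSpace E] (μ : Measure E)
  [μ.IsAddHaarMeasure]

theorem horm_bound {ι : Type*} [Fintype ι] [DecidableEq ι] {D : Set E} {φ η : E → ℝ} {e : ι → E} {θ : ℕ → E → ℝ}
    (h : HData ι D φ η e θ) {α : ι → E → ℂ} (hα0 : ∀ j, ∀ x ∉ D, α j x = 0)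
    (hα : ∀ j, MemLp (fun x => cexp ((-((φ x - η x) / 2) : ℝ) : ℂ) * α j x) 2 μ)
    (hcα : ∀ w, DTest D w → ∀ j k, ∫ x, α j x * wd I (e k) w x ∂μ = ∫ x, α k x * wd I (e j) w x ∂μ)
    {q : ι → E → ℂ} (hq : ∀ j, DTest D (q j)) :
    ‖∑ j, ∫ x, α j x * q j x ∂μ‖ ^ 2 ≤
      ‖vec hα‖ ^ 2 * ∫ x, 3 * (‖∑ j, wd I (e j) (q j) x‖ ^ 2 * Real.exp (φ x - 2 * η x)) ∂μ := by
  have hD := h.hD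
  have hofR : ∀ {u : E → ℝ}, ContDiffOn ℝ ∞ u D → ContDiffOn ℝ ∞ c% u D :=
    fun hu => ofRealCLM.contDiff.comp_contDiffOn hu
  obtain ⟨a, ha⟩ := ex_eq (fun x => cexp (((φ x - η x) / 2 : ℝ) : ℂ) : E → ℂ)
  obtain ⟨ai, hai⟩ := ex_eq (fun x => cexp ((-((φ x - η x) / 2) : ℝ) : ℂ) : E → ℂ)
  have hac : ContDiffOn ℝ ∞ a D := ha ▸ (hofR ((h.hφ.sub h.hη).div_const 2)).cexp
  have haic : ContDiffOn ℝ ∞ ai D := hai ▸ (hofR ((h.hφ.sub h.hη).div_const 2).neg).cexp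
  have haai : ∀ x, ai x * a x = 1 := fun x => by
    simp only [ha, hai]; rw [← Complex.exp_add, ← ofReal_add]; simp
  have hca : ∀ x, conj (a x) = a x := fun x => by simp only [ha, ← exp_conj, conj_ofReal]
  have hcai : ∀ x, conj (ai x) = ai x := fun x => by simp only [hai, ← exp_conj, conj_ofReal]
  have hα' : ∀ j, MemLp (fun x => ai x * α j x) 2 μ := by simpa only [hai] using hα
 
  have hv : ∀ {w : E → ℂ}, DTest D w → ∀ j, DTest D (fun x => conj (a x * wd I (e j) w x)) := fun hw j =>
    (DTest.mul hD hac (hw.wd _ _)).conj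
  let S : Set (PiLp 2 (fun _ : ι => Lp ℂ 2 μ)) := {V | ∃ (w : E → ℂ) (hw : DTest D w) (j k : ι),
    V = WithLp.toLp 2 (fun i => (if i = j then ((hv hw k).memLp μ 2).toLp _ else 0)
      - (if i = k then ((hv hw j).memLp μ 2).toLp _ else 0))}
  let N := (Submodule.span ℂ S)ᗮ
  have hN : ∀ {u : ι → E → ℂ} (hu : ∀ j, MemLp (u j) 2 μ), vec hu ∈ N ↔ ∀ w, DTest D w → ∀ j k,
      ∫ x, u j x * (a x * wd I (e k) w x) ∂μ = ∫ x, u k x * (a x * wd I (e j) w x) ∂μ := by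
    intro u hu
    have hin : ∀ (w : E → ℂ) (hw : DTest D w) (j k : ι), inner ℂ (WithLp.toLp 2 (fun i =>
        (if i = j then ((hv hw k).memLp μ 2).toLp _ else 0)
      - (if i = k then ((hv hw j).memLp μ 2).toLp _ else 0)) : PiLp 2 (fun _ : ι => Lp ℂ 2 μ)) (vec hu) =
        ∫ x, u j x * (a x * wd I (e k) w x) ∂μ - ∫ x, u k x * (a x * wd I (e j) w x) ∂μ := by
      intro w hw j k
      rw [PiLp.inner_apply]
      simp only [inner_sub_left, Finset.sum_sub_distrib]
      have key : ∀ j k, ∑ i, inner ℂ (if i = j then ((hv hw k).memLp μ 2).toLp _ else 0) ((vec hu) i) =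
          ∫ x, u j x * (a x * wd I (e k) w x) ∂μ := by
        intro j k
        rw [Finset.sum_eq_single j (fun i _ hi => by rw [if_neg hi, inner_zero_left]) s%, if_pos rfl]
        refine (inner_toLp (hu j) ((hv hw k).memLp μ 2)).trans ?_
        simp only [conj_conj]
      rw [key, key]
    constructor
    · intro hm w hw j k
      have := hm _ (Submodule.subset_span ⟨w, hw, j, k, rfl⟩)
      rw [hin w hw j k] at this
      exact sub_eq_zero.1 this
    · intro hm
      have hsp : Submodule.span ℂ S ⟂ Submodule.span ℂ {vec hu} := by
        rw [Submodule.isOrtho_span]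
        rintro _ ⟨w, hw, j, k, rfl⟩ v rfl
        rw [hin w hw j k, hm w hw j k, sub_self]
      intro s hs
      exact hsp.inner_eq hs (Submodule.subset_span rfl)
  have hQ : ∀ j, MemLp (fun x => a x * conj (q j x)) 2 μ := fun j =>
    (DTest.mul hD hac (hq j).conj).memLp μ 2
  haveI : CompleteSpace N := (Submodule.isClosed_orthogonal _).completeSpace_coe
  haveI : N.HasOrthogonalProjection := Submodule.HasOrthogonalProjection.ofCompleteSpace N
  obtain ⟨y, hy, z, hz, hyz⟩ := N.exists_add_mem_mem_orthogonal (vec hQ)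
  obtain ⟨H, hH, rfl⟩ := vec_surj y
  have hproj : ∀ g ∈ N, inner ℂ g (vec hQ) = inner ℂ g (vec hH) := by
    intro g hg
    rw [hyz, inner_add_right, hz g hg, add_zero]
  have hcl := (hN hH).1 hy
  have ht : DTest D (fun x => conj (∑ j, wd I (e j) (q j) x)) :=
    (DTest.sum Finset.univ fun j => (hq j).wd I (e j)).conj
  have hdiff : ∀ {w : E → ℂ} (_ : ContDiff ℝ ∞ w) (x : E), DifferentiableAt ℝ w x := fun h x =>
    h.differentiable s% x
  have hdv : ∀ w, DTest D w → ∑ j, ∫ x, H j x * (ai x * wb (e j) w x) ∂μ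
      = - ∫ x, conj (∑ j, wd I (e j) (q j) x) * w x ∂μ := by
    intro w hw
    have hw' := hw.conj
    have hG : ∀ j, MemLp (fun x => ai x * wd I (e j) (fun y => conj (w y)) x) 2 μ := fun j =>
      (DTest.mul hD haic (hw'.wd _ _)).memLp μ 2
    have hGN : vec hG ∈ N := by
      rw [hN]
      intro v hv j k
      have e1 : ∀ j k x, ai x * wd I (e j) (fun y => conj (w y)) x * (a x * wd I (e k) v x) =
          wd I (e j) (fun y => conj (w y)) x * wd I (e k) v x := fun j k x => by
        linear_combination (wd I (e j) (fun y => conj (w y)) x * wd I (e k) v x) * haai x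
      simp only [e1]
      rw [integral_wd_mul μ _ _ (hw'.wd _ _).1 hv.1 (hw'.wd _ _).2.1,
        integral_wd_mul μ _ _ (hw'.wd _ _).1 hv.1 (hw'.wd _ _).2.1]
      simp only [wd_comm I I (e k) (e j) hw'.1]
    have h1 := hproj _ hGN
    rw [inner_vec, inner_vec] at h1
    have e2 : ∀ j x, conj (wd I (e j) (fun y => conj (w y)) x) = wb (e j) w x := fun j x => by
      rw [wd_conj _ _ (hdiff hw.1 x), conj_conj, conj_I]
    simp only [map_mul, e2, hcai] at h1
    rw [← h1]
    have e3 : ∀ j, ∫ x, a x * conj (q j x) * (ai x * wb (e j) w x) ∂μ =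
        - ∫ x, conj (wd I (e j) (q j) x) * w x ∂μ := by
      intro j
      have : ∀ x, a x * conj (q j x) * (ai x * wb (e j) w x) = conj (q j x) * wb (e j) w x :=
        fun x => by linear_combination (conj (q j x) * wb (e j) w x) * haai x
      simp only [this]
      rw [integral_wd_mul μ _ _ (hq j).conj.1 hw.1 (hq j).conj.2.1]
      have : ∀ x, wb (e j) (fun y => conj (q j y)) x = conj (wd I (e j) (q j) x) := fun x => by
        rw [wd_conj _ _ (hdiff (hq j).1 x), map_neg, conj_I, neg_neg]
      simp only [this]
    simp only [e3, Finset.sum_neg_distrib, map_sum, Finset.sum_mul]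
    rw [integral_finsetSum]
    intro j _
    exact int_l2mul μ (((hq j).wd _ _).conj.memLp μ 2) (hw.memLp μ 2)
  have hap := apriori μ h hH ht (by simpa only [ha] using hcl) (by simpa only [hai] using hdv)
  simp only [RCLike.norm_conj] at hap
  have hαN : vec hα' ∈ N := by
    rw [hN]
    intro w hw j k
    have e1 : ∀ j k x, ai x * α j x * (a x * wd I (e k) w x) = α j x * wd I (e k) w x := fun j k x => by
      linear_combination (α j x * wd I (e k) w x) * haai x
    simp only [e1]; exact hcα w hw j k
  have hH' : ∀ j, MemLp (D.indicator (H j)) 2 μ := fun j => (hH j).indicator hD.measurableSet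
  have h2 : inner ℂ (vec hα') (vec hQ) = inner ℂ (vec hα') (vec hH') := by
    rw [hproj _ hαN, inner_vec, inner_vec]
    refine Finset.sum_congr rfl fun j _ => integral_congr_ae (ae_of_all _ fun x => ?_)
    by_cases hx : x ∈ D
    · simp [hx]
    · simp [hx, hα0]
  have h3 : inner ℂ (vec hα') (vec hQ) = conj (∑ j, ∫ x, α j x * q j x ∂μ) := by
    rw [inner_vec, map_sum]
    refine Finset.sum_congr rfl fun j _ => ?_
    rw [← integral_conj]
    refine integral_congr_ae (ae_of_all _ fun x => ?_)
    simp only [map_mul, hcai]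
    linear_combination (conj (q j x) * conj (α j x)) * haai x
  have h4 : vec hα = vec hα' := by subst hai; rfl
  have h5 := norm_inner_le_norm (𝕜 := ℂ) (vec hα') (vec hH')
  rw [← h2, h3, RCLike.norm_conj] at h5
  refine (pow_le_pow_left₀ (norm_nonneg _) h5 2).trans ?_
  rw [mul_pow, h4, norm_vec hH']
  gcongr

theorem horm_exists {ι : Type*} [Fintype ι] {D : Set E} {φ η : E → ℝ} {e : ι → E} {θ : ℕ → E → ℝ}
    (h : HData ι D φ η e θ) {α : ι → E → ℂ} (hα0 : ∀ j, ∀ x ∉ D, α j x = 0)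
    (hα : ∀ j, MemLp (fun x => cexp ((-((φ x - η x) / 2) : ℝ) : ℂ) * α j x) 2 μ)
    (hcα : ∀ w, DTest D w → ∀ j k, ∫ x, α j x * wd I (e k) w x ∂μ = ∫ x, α k x * wd I (e j) w x ∂μ) :
    ∃ u : E → ℂ, (∀ b, DTest D b → MemLp (fun x => b x * u x) 2 μ) ∧
      ∀ w, DTest D w → ∀ j, ∫ x, u x * wd I (e j) w x ∂μ = - ∫ x, α j x * w x ∂μ := by
  classical
  have hD := h.hD
  have hofR : ∀ {u : E → ℝ}, ContDiffOn ℝ ∞ u D → ContDiffOn ℝ ∞ c% u D :=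
    fun hu => ofRealCLM.contDiff.comp_contDiffOn hu
  obtain ⟨b, hb⟩ := ex_eq (fun x => cexp (((φ x - 2 * η x) / 2 : ℝ) : ℂ) : E → ℂ)
  have hbc : ContDiffOn ℝ ∞ b D := hb ▸ (hofR ((h.hφ.sub (contDiffOn_const.mul h.hη)).div_const 2)).cexp
  have hac : ContDiffOn ℝ ∞ (fun x => cexp (((φ x - η x) / 2 : ℝ) : ℂ)) D :=
    (hofR ((h.hφ.sub h.hη).div_const 2)).cexp
  have hint : ∀ j {w : E → ℂ}, DTest D w → Integrable (fun x => α j x * w x) μ := fun j w hw => by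
    refine (int_l2mul μ (hα j) ((DTest.mul hD hac hw).memLp μ 2)).congr (ae_of_all _ fun x => ?_)
    have : cexp ((-((φ x - η x) / 2) : ℝ) : ℂ) * cexp (((φ x - η x) / 2 : ℝ) : ℂ) = 1 := by
      rw [← Complex.exp_add, ← ofReal_add]; simp
    simp only
    linear_combination (α j x * w x) * this
  let T : Submodule ℂ (ι → E → ℂ) :=
    { carrier := {q | ∀ j, DTest D (q j)}
      add_mem' := fun ha hb j => (ha j).add (hb j)
      zero_mem' := fun j => DTest.zero
      smul_mem' := fun c q hq j => (hq j).smul hD c }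
  have hdiff : ∀ {w : E → ℂ} (_ : ContDiff ℝ ∞ w) (x : E), DifferentiableAt ℝ w x := fun h x =>
    h.differentiable s% x
  have hST : ∀ q : T, DTest D (fun x => b x * ∑ j, wd I (e j) (q.1 j) x) := fun q =>
    DTest.mul hD hbc (DTest.sum _ fun j => (q.2 j).wd _ _)
  have wd_smul : ∀ (c : ℂ) (j : ι) {w : E → ℂ} (_ : DTest D w) (x : E),
      wd I (e j) (fun y => c * w y) x = c * wd I (e j) w x := fun c j w hw x => by
    rw [wd_mul _ _ (differentiableAt_const c) (hdiff hw.1 x)]; simp [wd]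
  let l : T →ₗ[ℂ] ℂ :=
    { toFun := fun q => ∑ j, ∫ x, α j x * q.1 j x ∂μ
      map_add' := fun q q' => by
        rw [← Finset.sum_add_distrib]
        refine Finset.sum_congr rfl fun j _ => ?_
        rw [← integral_add (hint j (q.2 j)) (hint j (q'.2 j))]
        simp [mul_add]
      map_smul' := fun c q => by
        simp only [RingHom.id_apply, smul_eq_mul, Finset.mul_sum, ← integral_const_mul]
        refine Finset.sum_congr rfl fun j _ => integral_congr_ae (ae_of_all _ fun x => ?_)
        simp; ring }
  let S : T →ₗ[ℂ] Lp ℂ 2 μ :=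
    { toFun := fun q => ((hST q).memLp μ 2).toLp _
      map_add' := fun q q' => by
        rw [← MemLp.toLp_add]
        refine MemLp.toLp_congr _ _ (ae_of_all _ fun x => ?_)
        simp only [Pi.add_apply]
        rw [← mul_add, ← Finset.sum_add_distrib]
        congr 1
        refine Finset.sum_congr rfl fun j _ => ?_
        exact wd_add _ _ (hdiff (q.2 j).1 x) (hdiff (q'.2 j).1 x)
      map_smul' := fun c q => by
        simp only [RingHom.id_apply]
        rw [← MemLp.toLp_const_smul]
        refine MemLp.toLp_congr _ _ (ae_of_all _ fun x => ?_)
        simp only [Pi.smul_apply, smul_eq_mul]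
        rw [mul_left_comm]
        congr 1
        rw [Finset.mul_sum]
        refine Finset.sum_congr rfl fun j _ => ?_
        exact wd_smul c j (q.2 j) x }
  obtain ⟨U, hU⟩ := riesz_factor S l (‖vec hα‖ * Real.sqrt 3) (fun q => by
    have h1 := horm_bound μ h hα0 hα hcα q.2
    have h2 : ‖S q‖ ^ 2 = ∫ x, ‖b x * ∑ j, wd I (e j) (q.1 j) x‖ ^ 2 ∂μ := norm_toLp_sq ((hST q).memLp μ 2)
    refine (sq_le_sq₀ (norm_nonneg _) p%).1 (h1.trans (le_of_eq ?_))
    rw [mul_pow, mul_pow, Real.sq_sqrt n%, h2, integral_const_mul, mul_assoc]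
    congr 2
    refine integral_congr_ae (ae_of_all _ fun x => ?_)
    simp only [hb, norm_mul, norm_exp, ofReal_re, mul_pow]
    rw [← Real.exp_nat_mul, mul_comm]; push_cast; congr 2; ring)
  have hUm : MemLp (fun x => conj ((U : E → ℂ) x)) 2 μ := (Lp.memLp U).star
  refine ⟨fun x => - (conj ((U : E → ℂ) x) * b x), fun w hw => ?_, fun w hw j => ?_⟩
  · have := ((DTest.mul hD hbc hw).mul_memLp μ hUm).neg
    convert this using 1
    ext x; simp only [Pi.neg_apply]; ring
  · let q : T := ⟨fun i => if i = j then w else fun _ => 0, fun i => by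
      by_cases hi : i = j
      · simpa [hi] using hw
      · simpa [hi] using DTest.zero⟩
    have h1 := hU q
    have h2 : l q = ∫ x, α j x * w x ∂μ := by
      change ∑ i, ∫ x, α i x * (if i = j then w else fun _ => 0) x ∂μ = _
      rw [Finset.sum_eq_single j (fun i _ hi => by simp [hi]) s%]
      simp
    have h3 : ∀ x, ∑ i, wd I (e i) (q.1 i) x = wd I (e j) w x := fun x => by
      rw [Finset.sum_eq_single j (fun i _ hi => by simp [q, hi, wd]) s%]
      simp [q]
    have h4 : inner ℂ U (S q) = ∫ x, (b x * wd I (e j) w x) * conj ((U : E → ℂ) x) ∂μ := by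
      have h6 := inner_toLp ((hST q).memLp μ 2) (Lp.memLp U)
      rw [Lp.toLp_coeFn] at h6
      refine Eq.trans h6 ?_
      simp only [h3]
    rw [← h2, h1, h4, ← integral_neg]
    congr 1; ext x; ring
end

section
open Complex ContDiff MeasureTheory Filter Topology
open scoped ComplexConjugate ENNReal

variable {E : Type*} [NormedAddCommGroup E] [NormedSpace ℂ E] [NormedSpace ℝ E]

lemma wd_comp (c : ℂ) (e : E) {ψ : E → ℝ} {x : E} (hψ : DifferentiableAt ℝ ψ x) {g : ℝ → ℝ} {g' : ℝ}
    (hg : HasDerivAt g g' (ψ x)) :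
    wd c e (fun y => (g (ψ y) : ℂ)) x = g' * wd c e c% ψ x := by
  have h1 : HasFDerivAt c% ψ (ofRealCLM.comp (fderiv ℝ ψ x)) x :=
    ofRealCLM.hasFDerivAt.comp x hψ.hasFDerivAt
  have h2 : HasFDerivAt (fun y => (g (ψ y) : ℂ)) (ofRealCLM.comp (g' • fderiv ℝ ψ x)) x :=
    ofRealCLM.hasFDerivAt.comp x (hg.comp_hasFDerivAt x hψ.hasFDerivAt)
  simp only [wd, h1.fderiv, h2.fderiv]
  simp; ring

lemma st_bound : ∃ C : ℝ, 0 ≤ C ∧ ∀ t, |deriv Real.smoothTransition t| ≤ C ∧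
    (t < 0 ∨ 1 < t → deriv Real.smoothTransition t = 0) := by
  have h0 : ∀ t : ℝ, (t < 0 ∨ 1 < t) → deriv Real.smoothTransition t = 0 := by
    rintro t (ht | ht)
    · have : Real.smoothTransition =ᶠ[𝓝 t] fun _ => 0 := by
        filter_upwards [Iio_mem_nhds ht] with s hs using Real.smoothTransition.zero_of_nonpos (le_of_lt hs)
      rw [this.deriv_eq]; simp
    · have : Real.smoothTransition =ᶠ[𝓝 t] fun _ => 1 := by
        filter_upwards [Ioi_mem_nhds ht] with s hs using Real.smoothTransition.one_of_one_le (le_of_lt hs)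
      rw [this.deriv_eq]; simp
  have hc : Continuous (deriv Real.smoothTransition) :=
    (Real.smoothTransition.contDiff (n := ⊤)).continuous_deriv s%
  obtain ⟨C, hC⟩ := (isCompact_Icc (a := (0:ℝ)) (b := 1)).exists_bound_of_continuousOn hc.continuousOn
  refine ⟨max C 0, le_max_right _ _, fun t => ⟨?_, h0 t⟩⟩
  by_cases ht : t ∈ Set.Icc (0:ℝ) 1
  · exact (hC t ht).trans (le_max_left _ _)
  · rw [h0 t (by simpa only [Set.mem_Icc, not_and_or, not_le] using ht)]; simp

variable [FiniteDimensional ℝ E]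

theorem hdata_of_psi {ι : Type*} [Fintype ι] (e : ι → E) {ψ : E → ℝ} (hψ : ContDiff ℝ ∞ ψ) {m : ℝ} (hm : 0 < m)
    (hbd : Bornology.IsBounded {x | ψ x < 0})
    (hL : ∀ x, ψ x < 0 → ∀ X : ι → ℂ, m * ∑ j, ‖X j‖ ^ 2 ≤
      (∑ j, ∑ k, wd I (e k) (wb (e j) c% ψ) x * X j * conj (X k)).re) :
    ∃ A c : ℝ, 0 < A ∧ 0 < c ∧ ∃ θ, HData ι {x | ψ x < 0} (fun x => A * (-(ψ x)⁻¹))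
      (fun x => Real.log c - 2 * Real.log (ψ x)) e θ := by
  set D := {x | ψ x < 0} with hDdef
  have hD : IsOpen D := isOpen_lt hψ.continuous continuous_const
  have hψc : ContDiff ℝ ∞ c% ψ := ofRealCLM.contDiff.comp hψ
  have hψd : ∀ x, DifferentiableAt ℝ ψ x := fun x => hψ.differentiable s% x
  obtain ⟨Cs, hCs0, hCs⟩ := st_bound
  obtain ⟨P, hP0, hP⟩ : ∃ P : ℝ, 0 ≤ P ∧ ∀ x ∈ D, ∑ j, ‖wb (e j) c% ψ x‖ ^ 2 ≤ P := by
    have hcont : Continuous fun x => ∑ j, ‖wb (e j) c% ψ x‖ ^ 2 :=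
      continuous_finsetSum _ fun j _ => ((wd_contDiff _ _ hψc).continuous.norm.pow 2)
    obtain ⟨P, hP⟩ := (hbd.isCompact_closure).exists_bound_of_continuousOn hcont.continuousOn
    exact ⟨max P 0, le_max_right _ _, fun x hx => ((le_abs_self _).trans (hP x (subset_closure hx))).trans (le_max_left _ _)⟩
  obtain ⟨c, hc⟩ := ex_eq (4 * Cs ^ 2 * P + 1)
  have hc0 : 0 < c := by rw [hc]; positivity
  obtain ⟨A, hA⟩ := ex_eq ((12 * P + c) / m)
  have hA0 : 0 < A := by rw [hA]; positivity
  have hexp : ∀ x ∈ D, Real.exp (Real.log c - 2 * Real.log (ψ x)) = c / ψ x ^ 2 := fun x hx => by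
    have hx : ψ x < 0 := hx
    rw [Real.exp_sub, Real.exp_log hc0, two_mul, Real.exp_add, Real.exp_log_eq_abs hx.ne, ← abs_mul,
      abs_of_pos (mul_pos_of_neg_of_neg hx hx), sq]
  have hsub : ∀ (a : ℝ), 0 < a → IsCompact {x | ψ x ≤ -a} := fun a ha =>
    Metric.isCompact_of_isClosed_isBounded (isClosed_le hψ.continuous continuous_const)
      (hbd.subset fun x (hx : ψ x ≤ -a) => show ψ x < 0 by linarith)
  let θ : ℕ → E → ℝ := fun i x => Real.smoothTransition (((i:ℝ) + 1) * (-ψ x) - 1)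
  have hts : ∀ i, tsupport (fun x => (θ i x : ℂ)) ⊆ {x | ψ x ≤ -(1 / ((i:ℝ) + 1))} := fun i => by
    refine closure_minimal (fun x hx => ?_) (isClosed_le hψ.continuous continuous_const)
    by_contra hcon
    apply hx
    simp only [Set.mem_setOf_eq, not_le] at hcon
    have : ((i:ℝ) + 1) * (-ψ x) < 1 := by
      have := mul_lt_mul_of_pos_left hcon (by positivity : (0:ℝ) < i + 1)
      rw [mul_neg, mul_one_div_cancel p%] at this; linarith
    simp only [θ, Real.smoothTransition.zero_of_nonpos (by linarith : ((i:ℝ) + 1) * (-ψ x) - 1 ≤ 0), ofReal_zero]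
  have hθ : ∀ i, DTest D (fun x => (θ i x : ℂ)) := fun i => by
    refine ⟨ofRealCLM.contDiff.comp (Real.smoothTransition.contDiff.comp
      ((contDiff_const.mul hψ.neg).sub contDiff_const)), ?_, (hts i).trans fun x hx => ?_⟩
    · exact (hsub _ p%).of_isClosed_subset (isClosed_tsupport _) (hts i)
    · have : 0 < 1 / ((i:ℝ) + 1) := by positivity
      simp only [Set.mem_setOf_eq, D] at hx ⊢; linarith
  have hone : ∀ (i : ℕ) x, 2 < ((i:ℝ) + 1) * (-ψ x) → ∀ᶠ y in 𝓝 x, θ i y = 1 := fun i x hx => by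
    have : Continuous fun y => ((i:ℝ) + 1) * (-ψ y) := continuous_const.mul hψ.continuous.neg
    filter_upwards [this.continuousAt.eventually (lt_mem_nhds hx)] with y hy
    exact Real.smoothTransition.one_of_one_le l%
  refine ⟨A, c, hA0, hc0, θ, hD, ?_, ?_, ?_, hθ, ?_, ?_, ?_, ?_⟩
  · exact contDiffOn_const.mul (hψ.contDiffOn.inv fun x hx => (show ψ x < 0 from hx).ne).neg
  · exact contDiffOn_const.sub (contDiffOn_const.mul (hψ.contDiffOn.log fun x hx => (show ψ x < 0 from hx).ne))
  · intro x hx X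
    have hx0 : ψ x < 0 := hx
    have hη : ∀ j, wb (e j) (fun y => ((Real.log c - 2 * Real.log (ψ y) : ℝ) : ℂ)) x =
        ((-(2 * (ψ x)⁻¹) : ℝ) : ℂ) * wb (e j) c% ψ x := fun j =>
      wd_comp (g := fun t => Real.log c - 2 * Real.log t) _ _ (hψd x)
        (by simpa using ((Real.hasDerivAt_log hx0.ne).const_mul 2).const_sub (Real.log c))
    have hφ1 : ∀ j, ∀ y ∈ D, wb (e j) (fun y => ((A * (-(ψ y)⁻¹) : ℝ) : ℂ)) y =
        ((A * ((ψ y) ^ 2)⁻¹ : ℝ) : ℂ) * wb (e j) c% ψ y := fun j y hy =>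
      wd_comp (g := fun t => A * (-t⁻¹)) _ _ (hψd y)
        (by simpa using ((hasDerivAt_inv (show ψ y < 0 from hy).ne).neg).const_mul A)
    have hφ2 : ∀ j k, wd I (e k) (wb (e j) (fun y => ((A * (-(ψ y)⁻¹) : ℝ) : ℂ))) x =
        ((A * (-(2 * ψ x) / ((ψ x) ^ 2) ^ 2) : ℝ) : ℂ) * conj (wb (e k) c% ψ x) *
          wb (e j) c% ψ x + ((A * ((ψ x) ^ 2)⁻¹ : ℝ) : ℂ) *
            wd I (e k) (wb (e j) c% ψ) x := fun j k => by
      have h2 : HasDerivAt (fun t : ℝ => A * (t ^ 2)⁻¹) (A * (-(2 * ψ x) / ((ψ x) ^ 2) ^ 2)) (ψ x) := by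
        have := ((hasDerivAt_pow 2 (ψ x)).inv (pow_ne_zero 2 hx0.ne)).const_mul A
        simpa using this
      have hdd : DifferentiableAt ℝ (fun y => ((A * ((ψ y) ^ 2)⁻¹ : ℝ) : ℂ)) x :=
        ofRealCLM.differentiableAt.comp x (h2.differentiableAt.comp x (hψd x))
      rw [wd_congr _ _ (Filter.eventually_of_mem (hD.mem_nhds hx) (hφ1 j)),
        wd_mul _ _ hdd ((wd_contDiff _ _ hψc).differentiable s% x),
        wd_comp (g := fun t => A * (t ^ 2)⁻¹) _ _ (hψd x) h2]
      have h3 := wd_conj I (e k) (hψc.differentiable s% x)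
      simp only [conj_ofReal, conj_I] at h3
      rw [h3]
    simp only [hη, hφ2, norm_mul, mul_pow, norm_real, Real.norm_eq_abs, sq_abs, ← Finset.mul_sum]
    rw [hexp x hx]
    obtain ⟨ψj, hψj⟩ := ex_eq (fun j => wb (e j) c% ψ x : ι → ℂ)
    have hPx := hP x hx
    have hLx := hL x hx X
    simp only [← congrFun hψj] at hPx ⊢
    have hs : ∑ j, ∑ k, (((A * (-(2 * ψ x) / ((ψ x) ^ 2) ^ 2) : ℝ) : ℂ) * conj (ψj k) * ψj j +
        ((A * ((ψ x) ^ 2)⁻¹ : ℝ) : ℂ) * wd I (e k) (wb (e j) c% ψ) x) * X j * conj (X k) =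
        ((A * (-(2 * ψ x) / ((ψ x) ^ 2) ^ 2) : ℝ) : ℂ) * ((∑ j, ψj j * X j) * conj (∑ k, ψj k * X k)) +
        ((A * ((ψ x) ^ 2)⁻¹ : ℝ) : ℂ) * ∑ j, ∑ k, wd I (e k) (wb (e j) c% ψ) x * X j * conj (X k) := by
      rw [map_sum, Finset.sum_mul_sum]
      simp only [Finset.mul_sum, ← Finset.sum_add_distrib, map_mul]
      refine Finset.sum_congr rfl fun j _ => Finset.sum_congr rfl fun k _ => by ring
    rw [hs, mul_conj, add_re, ← ofReal_mul, ofReal_re, re_ofReal_mul]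
    have h1 : 0 ≤ A * (-(2 * ψ x) / ((ψ x) ^ 2) ^ 2) * normSq (∑ j, ψj j * X j) :=
      mul_nonneg (mul_nonneg hA0.le (div_nonneg l% p%)) (normSq_nonneg _)
    have hψ2 : 0 < ψ x ^ 2 := sq_pos_of_neg hx0
    have h3 : A * (ψ x ^ 2)⁻¹ * (m * ∑ j, ‖X j‖ ^ 2) ≤ A * (ψ x ^ 2)⁻¹ * (∑ j, ∑ k, wd I (e k) (wb (e j) c% ψ) x * X j * conj (X k)).re :=
      mll hLx p%
    have h4 : 3 * ((-(2 * (ψ x)⁻¹)) ^ 2 * ∑ i, ‖ψj i‖ ^ 2) + c / ψ x ^ 2 ≤ A * (ψ x ^ 2)⁻¹ * m := by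
      have e1 : A * (ψ x ^ 2)⁻¹ * m = (12 * P + c) / ψ x ^ 2 := by rw [hA]; field_simp
      have e2 : 3 * ((-(2 * (ψ x)⁻¹)) ^ 2 * ∑ i, ‖ψj i‖ ^ 2) + c / ψ x ^ 2 = (12 * ∑ i, ‖ψj i‖ ^ 2 + c) / ψ x ^ 2 := by
        field_simp; ring
      rw [e1, e2]; gcongr
    have h5 := mlr h4 (by positivity : 0 ≤ ∑ j, ‖X j‖ ^ 2)
    linarith
  · intro i x
    exact pow_le_one₀ (Real.smoothTransition.nonneg _) (Real.smoothTransition.le_one _)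
  · intro i
    refine ⟨θ (4 * i + 3), hθ _, fun x hx => hone _ x ?_⟩
    have h1 : ψ x ≤ -(1 / ((i:ℝ) + 1)) := hts i hx
    push_cast
    have h2 := mll h1 (by positivity : (0:ℝ) ≤ i + 1)
    rw [mul_neg, mul_one_div_cancel p%] at h2
    linarith
  · intro i x hx
    have hx0 : ψ x < 0 := hx
    rw [hexp x hx]
    have h1 : ∀ j, wb (e j) (fun y => (θ i y : ℂ)) x =
        ((deriv Real.smoothTransition (((i:ℝ) + 1) * (-ψ x) - 1) * ((i + 1) * (-1)) : ℝ) : ℂ) * wb (e j) c% ψ x := fun j => by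
      refine wd_comp (g := fun t => Real.smoothTransition (((i:ℝ) + 1) * (-t) - 1)) _ _ (hψd x) ?_
      have := ((Real.smoothTransition.contDiff (n := ⊤)).differentiable s% (((i:ℝ) + 1) * (-ψ x) - 1)).hasDerivAt
      exact this.comp (ψ x) (((hasDerivAt_neg (ψ x)).const_mul _).sub_const _)
    simp only [h1, norm_mul, mul_pow, norm_real, Real.norm_eq_abs, sq_abs, ← Finset.mul_sum]
    have hψ2 : 0 < ψ x ^ 2 := sq_pos_of_neg hx0
    by_cases ht : ((i:ℝ) + 1) * (-ψ x) - 1 < 0 ∨ 1 < ((i:ℝ) + 1) * (-ψ x) - 1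
    · rw [(hCs _).2 ht]; simp; positivity
    · push Not at ht
      have h2 : (((i:ℝ) + 1) * (-ψ x)) ^ 2 ≤ 4 := by nlinarith
      have h3 : (deriv Real.smoothTransition (((i:ℝ) + 1) * (-ψ x) - 1)) ^ 2 ≤ Cs ^ 2 := by
        rw [← sq_abs]; exact pow_le_pow_left₀ (abs_nonneg _) (hCs _).1 2
      rw [le_div_iff₀ hψ2]
      have h4 := mul_le_mul h3 h2 (sq_nonneg _) (sq_nonneg _)
      have h5 := mul_le_mul h4 (hP x hx) p% p%
      rw [hc]
      linarith
  · intro x hx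
    have hx0 : 0 < -ψ x := by have : ψ x < 0 := hx; linarith
    obtain ⟨N, hN⟩ := exists_nat_gt (2 / (-ψ x))
    filter_upwards [eventually_ge_atTop N] with i hi
    refine hone i x ?_
    rw [div_lt_iff₀ hx0] at hN
    have : (N:ℝ) ≤ i := by exact_mod_cast hi
    nlinarith

variable [MeasurableSpace E] [BorelSpace E] (μ : Measure E) [μ.IsAddHaarMeasure]

theorem horm_D {ι : Type*} [Fintype ι] (e : ι → E) {ψ : E → ℝ} (hψ : ContDiff ℝ ∞ ψ) {m : ℝ} (hm : 0 < m)
    (hbd : Bornology.IsBounded {x | ψ x < 0})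
    (hL : ∀ x, ψ x < 0 → ∀ X : ι → ℂ, m * ∑ j, ‖X j‖ ^ 2 ≤
      (∑ j, ∑ k, wd I (e k) (wb (e j) c% ψ) x * X j * conj (X k)).re)
    {α : ι → E → ℂ} (hα0 : ∀ j, ∀ x ∉ {x | ψ x < 0}, α j x = 0) (hαc : ∀ j, ContinuousOn (α j) {x | ψ x < 0})
    {M : ℝ} (hαM : ∀ j x, ‖α j x‖ ≤ M)
    (hcα : ∀ w, DTest {x | ψ x < 0} w → ∀ j k, ∫ x, α j x * wd I (e k) w x ∂μ = ∫ x, α k x * wd I (e j) w x ∂μ) :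
    ∃ u : E → ℂ, (∀ b, DTest {x | ψ x < 0} b → MemLp (fun x => b x * u x) 2 μ) ∧
      ∀ w, DTest {x | ψ x < 0} w → ∀ j, ∫ x, u x * wd I (e j) w x ∂μ = - ∫ x, α j x * w x ∂μ := by
  obtain ⟨A, c, hA, hc, θ, h⟩ := hdata_of_psi e hψ hm hbd hL
  have hD := h.hD
  refine horm_exists μ h hα0 (fun j => ?_) hcα
  have hind : (fun x => cexp ((-((A * (-(ψ x)⁻¹) - (Real.log c - 2 * Real.log (ψ x))) / 2) : ℝ) : ℂ) * α j x) =
      {x | ψ x < 0}.indicator (fun x => cexp ((-((A * (-(ψ x)⁻¹) - (Real.log c - 2 * Real.log (ψ x))) / 2) : ℝ) : ℂ) * α j x) := by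
    ext x
    by_cases hx : x ∈ {x | ψ x < 0}
    · rw [Set.indicator_of_mem hx]
    · rw [Set.indicator_of_notMem hx, hα0 j x hx, mul_zero]
  rw [hind, memLp_indicator_iff_restrict hD.measurableSet]
  haveI : IsFiniteMeasure (μ.restrict {x | ψ x < 0}) := ⟨by
    rw [Measure.restrict_apply_univ]; exact hbd.measure_lt_top⟩
  refine MemLp.of_bound (C := Real.exp (Real.log c / 2) * (2 / A) * M) ?_ ?_
  · refine ContinuousOn.aestronglyMeasurable (ContinuousOn.mul ?_ (hαc j)) hD.measurableSet
    refine (continuous_ofReal.comp_continuousOn ?_).cexp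
    exact (((h.hφ.sub h.hη).div_const 2).neg).continuousOn
  · refine (ae_restrict_iff' hD.measurableSet).2 (ae_of_all _ fun x hx => ?_)
    have hx0 : ψ x < 0 := hx
    rw [norm_mul]
    have hM := hαM j x
    refine mul_le_mul ?_ hM (norm_nonneg _) p%
    rw [norm_exp, ofReal_re]
    have e1 : -((A * (-(ψ x)⁻¹) - (Real.log c - 2 * Real.log (ψ x))) / 2) =
      Real.log c / 2 + (- Real.log (ψ x) + - (A / 2 * (-(ψ x)⁻¹))) := by ring
    rw [e1, Real.exp_add, Real.exp_add, Real.exp_neg, Real.exp_log_eq_abs hx0.ne, abs_of_neg hx0]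
    have hy : 0 < -(ψ x)⁻¹ := by have := inv_lt_zero.2 hx0; linarith
    have h2 := Real.add_one_le_exp (A / 2 * (-(ψ x)⁻¹))
    rw [Real.exp_neg (A / 2 * _)]
    gcongr
    rw [inv_neg, ← div_eq_mul_inv, div_le_div_iff₀ (Real.exp_pos _) hA]
    linarith
end

section
open Complex ContDiff MeasureTheory Filter Topology
open scoped ComplexConjugate ENNReal

theorem taylor2 {𝕜 : Type*} [RCLike 𝕜] {E F : Type*} [NormedAddCommGroup E] [NormedSpace 𝕜 E] [NormedSpace ℝ E] [NormedAddCommGroup F] [NormedSpace 𝕜 F]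
    {f : E → F} {f' : E → E →L[𝕜] F} {f'' : E → E →L[𝕜] E →L[𝕜] F} {z0 h : E} {η : ℝ}
    (h1 : ∀ z ∈ Metric.closedBall z0 ‖h‖, HasFDerivAt f (f' z) z)
    (h2 : ∀ z ∈ Metric.closedBall z0 ‖h‖, HasFDerivAt f' (f'' z) z)
    (hs : ∀ u v, f'' z0 u v = f'' z0 v u) (hη : ∀ z ∈ Metric.closedBall z0 ‖h‖, ‖f'' z - f'' z0‖ ≤ η) :
    ‖f (z0 + h) - f z0 - f' z0 h - (1 / 2 : 𝕜) • f'' z0 h h‖ ≤ η * ‖h‖ ^ 2 := by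
  have hc := convex_closedBall z0 ‖h‖
  have hz : z0 ∈ Metric.closedBall z0 ‖h‖ := Metric.mem_closedBall_self (norm_nonneg _)
  have hη0 : 0 ≤ η := (ContinuousLinearMap.opNorm_nonneg _).trans (hη z0 hz)
  have hzh : z0 + h ∈ Metric.closedBall z0 ‖h‖ := by simp
  have hg : ∀ z ∈ Metric.closedBall z0 ‖h‖, ‖f' z - f' z0 - f'' z0 (z - z0)‖ ≤ η * ‖h‖ := by
    intro z hzz
    have := hc.norm_image_sub_le_of_norm_hasFDerivWithin_le (f := fun z => f' z - f'' z0 (z - z0))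
      (f' := fun z => f'' z - f'' z0) (fun x hx => ((h2 x hx).sub
        ((f'' z0).hasFDerivAt.comp x ((hasFDerivAt_id x).sub_const z0))).hasFDerivWithinAt) hη hz hzz
    simp only [sub_self, map_zero, sub_zero] at this
    have e : f' z - f' z0 - f'' z0 (z - z0) = f' z - f'' z0 (z - z0) - f' z0 := by abel
    rw [e]
    refine this.trans (mll ?_ hη0)
    simpa [dist_eq_norm] using hzz
  have hG : ∀ x ∈ Metric.closedBall z0 ‖h‖, HasFDerivAt
      (fun z => f z - f' z0 (z - z0) - (1 / 2 : 𝕜) • f'' z0 (z - z0) (z - z0))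
      (f' x - f' z0 - f'' z0 (x - z0)) x := by
    intro x hx
    have hi : HasFDerivAt (fun z => z - z0) (ContinuousLinearMap.id 𝕜 E) x := (hasFDerivAt_id x).sub_const z0
    have hb := ((f'' z0).hasFDerivAt.comp x hi).clm_apply hi
    refine (((h1 x hx).sub ((f' z0).hasFDerivAt.comp x hi)).sub (hb.const_smul (1 / 2 : 𝕜))).congr_fderiv ?_
    ext v
    simp only [ContinuousLinearMap.sub_apply, ContinuousLinearMap.smul_apply,
      ContinuousLinearMap.add_apply, ContinuousLinearMap.comp_apply, ContinuousLinearMap.flip_apply,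
      ContinuousLinearMap.id_apply, ContinuousLinearMap.comp_id, Function.comp_apply]
    rw [hs v (x - z0), ← two_smul 𝕜, smul_smul]
    norm_num
  have := hc.norm_image_sub_le_of_norm_hasFDerivWithin_le (fun x hx => (hG x hx).hasFDerivWithinAt) hg hz hzh
  simp only [sub_self, map_zero, smul_zero, sub_zero, add_sub_cancel_left] at this
  have e : f (z0 + h) - f z0 - f' z0 h - (1 / 2 : 𝕜) • f'' z0 h h = f (z0 + h) - f' z0 h - (1 / 2 : 𝕜) • f'' z0 h h - f z0 := by abel
  rw [e]; refine this.trans (le_of_eq (by ring))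

variable {E : Type*} [NormedAddCommGroup E] [NormedSpace ℂ E] [NormedSpace ℝ E] [IsScalarTower ℝ ℂ E]

lemma smul_split (a : ℂ) (e : E) : a • e = a.re • e + a.im • (I • e) := by
  have h : (a.re • (1:ℂ) + a.im • I) • e = a.re • e + a.im • (I • e) := by
    rw [add_smul, smul_assoc, smul_assoc, one_smul]
  rw [← h]
  congr 1
  apply Complex.ext <;> simp

lemma wd_vec (a : ℂ) (e : E) (f : E → ℂ) (x : E) :
    wb (a • e) f x = a * wb e f x ∧ wd I (a • e) f x = conj a * wd I e f x := by
  have h2 : I • a • e = a.re • (I • e) + (-a.im) • e := by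
    rw [smul_split a e, smul_add, smul_comm I, smul_comm I, ← mul_smul I I, I_mul_I]; simp
  have hc : conj a = a.re - a.im * I := by apply Complex.ext <;> simp
  have ha : a = a.re + a.im * I := (re_add_im a).symm
  simp only [wd, h2]
  rw [hc]
  have h3 := congrArg (fderiv ℝ f x) (smul_split a e)
  rw [h3]
  constructor
  · simp only [map_add, map_smul, real_smul]
    push_cast
    linear_combination (-(1 / 2 * ((fderiv ℝ f x) e + -I * (fderiv ℝ f x) (I • e)))) * ha + ((a.im:ℂ) * fderiv ℝ f x (I • e) / 2) * I_sq
  · simp only [map_add, map_smul, real_smul]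
    push_cast
    linear_combination ((a.im:ℂ) * fderiv ℝ f x (I • e) / 2) * I_sq

lemma wd_vec_add (c : ℂ) (e e' : E) (f : E → ℂ) (x : E) :
    wd c (e + e') f x = wd c e f x + wd c e' f x := by
  simp only [wd, smul_add, map_add]; ring

lemma wd_vec_sum {ι : Type*} (s : Finset ι) (c : ℂ) (e : ι → E) (f : E → ℂ) (x : E) :
    wd c (∑ j ∈ s, e j) f x = ∑ j ∈ s, wd c (e j) f x := by
  classical
  induction s using Finset.induction_on with
  | empty => simp [wd]
  | insert a s ha ih => rw [Finset.sum_insert ha, Finset.sum_insert ha, wd_vec_add, ih]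

lemma levi_wd {ι : Type*} [Fintype ι] (e : ι → E) {ψ : E → ℝ} (hψ : ContDiff ℝ ∞ ψ) (x : E) (X : ι → ℂ) :
    (∑ j, ∑ k, wd I (e k) (wb (e j) c% ψ) x * X j * conj (X k)).re =
      1 / 4 * (fderiv ℝ (fderiv ℝ ψ) x (∑ j, X j • e j) (∑ j, X j • e j)
        + fderiv ℝ (fderiv ℝ ψ) x (I • ∑ j, X j • e j) (I • ∑ j, X j • e j)) := by
  have hψc : ContDiff ℝ ∞ c% ψ := ofRealCLM.contDiff.comp hψ
  obtain ⟨Y, hY⟩ := ex_eq (∑ j, X j • e j)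
  have hw : ∀ j, DifferentiableAt ℝ (wb (e j) c% ψ) x := fun j =>
    (wd_contDiff _ _ hψc).differentiable s% x
  have h1 : ∑ j, ∑ k, wd I (e k) (wb (e j) c% ψ) x * X j * conj (X k) =
      wd I Y (wb Y c% ψ) x := by
    have e1 : wb Y c% ψ = fun x => ∑ j, X j * wb (e j) c% ψ x := by
      ext x; rw [hY, wd_vec_sum]; simp only [(wd_vec _ _ _ x).1]
    have e2 : ∀ k, wd I (e k) (fun x => ∑ j, X j * wb (e j) c% ψ x) x =
        ∑ j, X j * wd I (e k) (wb (e j) c% ψ) x := fun k => by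
      simp only [wd.eq_1 I]
      rw [fderiv_fun_sum (fun j _ => (hw j).const_mul _)]
      simp only [fderiv_const_mul (hw _), ContinuousLinearMap.sum_apply, ContinuousLinearMap.smul_apply, smul_eq_mul,
        Finset.mul_sum, ← Finset.sum_add_distrib]
      exact Finset.sum_congr rfl fun j _ => by ring
    rw [e1, hY, wd_vec_sum]
    simp only [(wd_vec _ _ _ x).2, e2, Finset.mul_sum]
    rw [Finset.sum_comm]
    exact Finset.sum_congr rfl fun j _ => Finset.sum_congr rfl fun k _ => by ring
  rw [h1, ← hY]
  have hd : ∀ y, fderiv ℝ c% ψ y = ofRealCLM.comp (fderiv ℝ ψ y) := fun y =>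
    (ofRealCLM.hasFDerivAt.comp y (hψ.differentiable s% y).hasFDerivAt).fderiv
  have hdd : DifferentiableAt ℝ (fderiv ℝ ψ) x := (hψ.fderiv_right (m := ∞) s%).differentiable s% x
  have hv : ∀ v, HasFDerivAt (fun y => ((fderiv ℝ ψ y v : ℝ) : ℂ)) (ofRealCLM.comp ((fderiv ℝ (fderiv ℝ ψ) x).flip v)) x := fun v =>
    ofRealCLM.hasFDerivAt.comp x ((hdd.hasFDerivAt.clm_apply (hasFDerivAt_const v x)).congr_fderiv s%)
  have h3 : fderiv ℝ (wb Y c% ψ) x = (1 / 2 : ℂ) • (ofRealCLM.comp ((fderiv ℝ (fderiv ℝ ψ) x).flip Y) +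
      (-I) • ofRealCLM.comp ((fderiv ℝ (fderiv ℝ ψ) x).flip (I • Y))) := by
    refine HasFDerivAt.fderiv ?_
    have := ((hv Y).add ((hv (I • Y)).const_mul (-I))).const_mul (1 / 2 : ℂ)
    refine this.congr_of_eventuallyEq (Eventually.of_forall fun y => ?_)
    simp [wd, hd]
  rw [wd, h3]
  simp
  ring
end

section
open Complex ContDiff MeasureTheory Filter Topology
open scoped ComplexConjugate ENNReal Convolution

variable {E : Type*} [NormedAddCommGroup E] [NormedSpace ℂ E] [NormedSpace ℝ E] [IsScalarTower ℝ ℂ E]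

theorem cont_norm_sub {X F : Type*} [PseudoMetricSpace X] [NormedAddCommGroup F] {g : X → F} (hg : Continuous g) (x : X) {η : ℝ}
    (hη : 0 < η) : ∃ δ > 0, ∀ z, dist z x < δ → ‖g z - g x‖ ≤ η := by
  obtain ⟨δ, hδ, h⟩ := Metric.continuous_iff.1 hg x η hη
  exact ⟨δ, hδ, fun z hz => by rw [← dist_eq_norm]; exact (h z hz).le⟩

theorem levi_nonneg {f : E → ℝ} (hf : ContDiff ℝ ∞ f) (x w : E)
    (hsub : ∃ s0 > 0, ∀ s : ℝ, 0 < s → s < s0 → f x ≤ (1 / (2 * Real.pi)) *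
      ∫ θ in (0:ℝ)..(2 * Real.pi), f (x + ((s:ℂ) * cexp (θ * I)) • w)) :
    0 ≤ fderiv ℝ (fderiv ℝ f) x w w + fderiv ℝ (fderiv ℝ f) x (I • w) (I • w) := by
  obtain ⟨s0, hs0, hsub⟩ := hsub
  have hf1 : ContDiff ℝ ∞ (fderiv ℝ f) := hf.fderiv_right s%
  have hf2 : Continuous (fderiv ℝ (fderiv ℝ f)) := (hf1.fderiv_right (m := ∞) s%).continuous
  have hsym : ∀ u v, fderiv ℝ (fderiv ℝ f) x u v = fderiv ℝ (fderiv ℝ f) x v u := fun u v =>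
    (hf.contDiffAt (x := x)).isSymmSndFDerivAt
      (by simp only [minSmoothness_of_isRCLikeNormedField]; exact WithTop.coe_le_coe.2 (le_top : (2:ℕ∞) ≤ ⊤)) u v
  obtain ⟨A, hA⟩ := ex_eq (fderiv ℝ (fderiv ℝ f) x w w)
  obtain ⟨B, hB⟩ := ex_eq (fderiv ℝ (fderiv ℝ f) x w (I • w))
  obtain ⟨C, hC⟩ := ex_eq (fderiv ℝ (fderiv ℝ f) x (I • w) (I • w))
  obtain ⟨a, ha⟩ := ex_eq (fderiv ℝ f x w)
  obtain ⟨b, hb⟩ := ex_eq (fderiv ℝ f x (I • w))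
  rw [← hA, ← hC]
  have key : ∀ η > 0, 0 ≤ (A + C) / 4 + η * ‖w‖ ^ 2 := by
    intro η hη
    obtain ⟨δ, hδ, hδ'⟩ : ∃ δ > 0, ∀ z, dist z x < δ → ‖fderiv ℝ (fderiv ℝ f) z - fderiv ℝ (fderiv ℝ f) x‖ ≤ η :=
      cont_norm_sub (F := E →L[ℝ] E →L[ℝ] ℝ) hf2 x hη
    obtain ⟨s, hs, hss0, hsw⟩ : ∃ s : ℝ, 0 < s ∧ s < s0 ∧ s * ‖w‖ < δ := by
      refine ⟨min (s0 / 2) (δ / (2 * (‖w‖ + 1))), by positivity, (min_le_left _ _).trans_lt l%, ?_⟩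
      refine (mlr (min_le_right _ _) (norm_nonneg w)).trans_lt ?_
      rw [div_mul_eq_mul_div, div_lt_iff₀ p%]
      nlinarith [norm_nonneg w]
    obtain ⟨G, hG⟩ : ∃ G : ℝ → ℝ, G = fun θ => (f x + η * (s ^ 2 * ‖w‖ ^ 2)) + s * (Real.cos θ * a + Real.sin θ * b) +
        s ^ 2 / 2 * (Real.cos θ ^ 2 * A + 2 * (Real.sin θ * Real.cos θ) * B + Real.sin θ ^ 2 * C) := ⟨_, rfl⟩
    have hpt : ∀ θ : ℝ, f (x + ((s:ℂ) * cexp (θ * I)) • w) ≤ G θ := by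
      intro θ
      obtain ⟨h, hh⟩ := ex_eq (((s:ℂ) * cexp (θ * I)) • w)
      have hn : ‖h‖ = s * ‖w‖ := by
        rw [hh, norm_smul, norm_mul, norm_exp_ofReal_mul_I, mul_one, norm_real, Real.norm_of_nonneg hs.le]
      have hsp : h = (s * Real.cos θ) • w + (s * Real.sin θ) • (I • w) := by
        rw [hh, smul_split]
        congr 2 <;> simp [exp_ofReal_mul_I_re, exp_ofReal_mul_I_im]
      have ht := taylor2 (f := f) (f' := fderiv ℝ f) (f'' := fderiv ℝ (fderiv ℝ f)) (z0 := x) (h := h) (η := η)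
        (fun z _ => (hf.differentiable s% z).hasFDerivAt) (fun z _ => (hf1.differentiable s% z).hasFDerivAt)
        hsym (fun z hz => by
          exact hδ' z ((Metric.mem_closedBall.1 hz).trans_lt (hn ▸ hsw)))
      rw [hn, Real.norm_eq_abs] at ht
      have h1 := (abs_le.1 ht).2
      have h2 : fderiv ℝ f x h = s * (Real.cos θ * a + Real.sin θ * b) := by
        rw [hsp, map_add, map_smul, map_smul, ← ha, ← hb]; simp only [smul_eq_mul]; ring
      have h3 : fderiv ℝ (fderiv ℝ f) x h h = s ^ 2 * (Real.cos θ ^ 2 * A + 2 * (Real.sin θ * Real.cos θ) * B + Real.sin θ ^ 2 * C) := by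
        rw [hsp]
        simp only [map_add, map_smul, ContinuousLinearMap.add_apply, ContinuousLinearMap.smul_apply, smul_eq_mul]
        rw [hsym (I • w) w, ← hA, ← hB, ← hC]; ring
      rw [h2, h3, smul_eq_mul] at h1
      rw [← hh, hG]
      simp only
      linarith
    have hGi : ∫ θ in (0:ℝ)..(2 * Real.pi), G θ = 2 * Real.pi * (f x + η * (s ^ 2 * ‖w‖ ^ 2)) + s ^ 2 / 2 * Real.pi * (A + C) := by
      have hd : ∀ θ ∈ Set.uIcc 0 (2 * Real.pi), HasDerivAt (fun θ => (f x + η * (s ^ 2 * ‖w‖ ^ 2)) * θ + s * (Real.sin θ * a + (-Real.cos θ) * b) +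
          s ^ 2 / 2 * ((θ + Real.sin θ * Real.cos θ) / 2 * A + Real.sin θ ^ 2 * B + (θ - Real.sin θ * Real.cos θ) / 2 * C)) (G θ) θ := by
        intro θ _
        have hs1 := Real.hasDerivAt_sin θ
        have hc1 := Real.hasDerivAt_cos θ
        have hi := hasDerivAt_id θ
        have h := ((hi.const_mul (f x + η * (s ^ 2 * ‖w‖ ^ 2))).add (((hs1.mul_const a).add (hc1.neg.mul_const b)).const_mul s)).add
          ((((((hi.add (hs1.mul hc1)).div_const 2).mul_const A).add ((hs1.pow 2).mul_const B)).add
            (((hi.sub (hs1.mul hc1)).div_const 2).mul_const C)).const_mul (s ^ 2 / 2))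
        refine h.congr_deriv ?_
        rw [hG]
        have := Real.sin_sq_add_cos_sq θ
        simp only [Nat.cast_ofNat]
        linear_combination (s ^ 2 / 4 * A + s ^ 2 / 4 * C) * (-this)
      rw [intervalIntegral.integral_eq_sub_of_hasDerivAt hd (by
        rw [hG]; exact Continuous.intervalIntegrable (by fun_prop) _ _)]
      simp
      ring
    have hm := hsub s hs hss0
    have hmono : ∫ θ in (0:ℝ)..(2 * Real.pi), f (x + ((s:ℂ) * cexp (θ * I)) • w) ≤ ∫ θ in (0:ℝ)..(2 * Real.pi), G θ := by
      refine intervalIntegral.integral_mono_on p% ?_ ?_ fun θ _ => hpt θ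
      · have := hf.continuous
        exact Continuous.intervalIntegrable (by fun_prop) _ _
      · rw [hG]; exact Continuous.intervalIntegrable (by fun_prop) _ _
    have hπ := Real.pi_pos
    have h5 := hm.trans (mll hmono p%)
    rw [hGi] at h5
    have h6 : 1 / (2 * Real.pi) * (2 * Real.pi * (f x + η * (s ^ 2 * ‖w‖ ^ 2)) + s ^ 2 / 2 * Real.pi * (A + C)) =
      f x + s ^ 2 * (η * ‖w‖ ^ 2 + (A + C) / 4) := by field_simp; ring
    rw [h6] at h5
    have := nonneg_of_mul_nonneg_right (by linarith : 0 ≤ s ^ 2 * (η * ‖w‖ ^ 2 + (A + C) / 4)) p%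
    linarith
  by_contra hcon
  push Not at hcon
  have := key (-(A + C) / (8 * (‖w‖ ^ 2 + 1))) (div_pos l% p%)
  have h2 : -(A + C) / (8 * (‖w‖ ^ 2 + 1)) * ‖w‖ ^ 2 ≤ -(A + C) / 8 := by
    rw [div_mul_eq_mul_div, div_le_div_iff₀ p% n%]
    nlinarith [sq_nonneg ‖w‖]
  linarith

variable [FiniteDimensional ℝ E] [MeasurableSpace E] [BorelSpace E]

theorem psh_smooth (μ : Measure E) [μ.IsAddHaarMeasure] {U K : Set E} (hU : IsOpen U) (hUb : Bornology.IsBounded U) (hUne : Uᶜ.Nonempty)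
    (hsub : ∀ a ∈ U, ∀ w : E, ∀ r : ℝ, 0 < r → (∀ l : ℂ, ‖l‖ ≤ r → a + l • w ∈ U) →
      -Real.log (Metric.infDist a Uᶜ) ≤ (1 / (2 * Real.pi)) * ∫ θ in (0:ℝ)..(2 * Real.pi),
        -Real.log (Metric.infDist (a + ((r : ℂ) * Complex.exp (θ * Complex.I)) • w) Uᶜ))
    (hK : IsCompact K) (hKU : K ⊆ U) {Q : E → ℝ} (hQ : ContDiff ℝ ∞ Q) (hQ0 : ∀ x, 0 ≤ Q x)
    (hQL : ∀ x w, 4 * ‖w‖ ^ 2 ≤ fderiv ℝ (fderiv ℝ Q) x w w + fderiv ℝ (fderiv ℝ Q) x (I • w) (I • w)) :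
    ∃ (ψ : E → ℝ) (m : ℝ), 0 < m ∧ ContDiff ℝ ∞ ψ ∧ {x | ψ x < 0} ⊆ U ∧ K ⊆ {x | ψ x < 0} ∧
      ∀ x, ψ x < 0 → ∀ w, 4 * m * ‖w‖ ^ 2 ≤ fderiv ℝ (fderiv ℝ ψ) x w w + fderiv ℝ (fderiv ℝ ψ) x (I • w) (I • w) := by
  obtain ⟨δ, hδ⟩ := ex_eq (fun x => Metric.infDist x Uᶜ : E → ℝ)
  have hδc : Continuous δ := hδ ▸ Metric.continuous_infDist_pt _
  have hδ0 : ∀ x, 0 ≤ δ x := fun x => hδ ▸ Metric.infDist_nonneg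
  have hδL : ∀ x y, δ x ≤ δ y + dist x y := fun x y => by rw [hδ]; exact Metric.infDist_le_infDist_add_dist
  have hδU : ∀ x, 0 < δ x ↔ x ∈ U := fun x => by
    rw [hδ]
    simp only
    rw [← hU.isClosed_compl.notMem_iff_infDist_pos hUne, Set.notMem_compl_iff]
  obtain ⟨d, hd, hdK⟩ : ∃ d > 0, ∀ x ∈ K, d ≤ δ x := by
    rcases K.eq_empty_or_nonempty with rfl | hne
    · exact ⟨1, one_pos, by simp⟩
    · obtain ⟨x, hx, hm⟩ := hK.exists_isMinOn hne hδc.continuousOn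
      exact ⟨δ x, (hδU x).2 (hKU hx), fun y hy => hm hy⟩
  obtain ⟨u, hu⟩ := ex_eq (fun x => -Real.log (max (δ x) (d / 4)) : E → ℝ)
  have hmp : ∀ x, 0 < max (δ x) (d / 4) := fun x => lt_max_of_lt_right p%
  have huc : Continuous u := hu ▸ ((hδc.max continuous_const).log fun x => (hmp x).ne').neg
  have huL : ∀ x y, u x - u y ≤ dist x y * (4 / d) := by
    intro x y
    have h1 : max (δ y) (d / 4) ≤ max (δ x) (d / 4) + dist x y := by
      have := hδL y x
      rw [dist_comm] at this
      exact max_le (by linarith [le_max_left (δ x) (d / 4)]) (by linarith [le_max_right (δ x) (d / 4), dist_nonneg (x := x) (y := y)])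
    have h2 := Real.log_le_sub_one_of_pos (div_pos (hmp y) (hmp x))
    rw [Real.log_div (hmp y).ne' (hmp x).ne'] at h2
    rw [hu]
    simp only
    have h3 : max (δ y) (d / 4) / max (δ x) (d / 4) - 1 ≤ dist x y * (4 / d) := by
      rw [div_sub_one (hmp x).ne', div_le_iff₀ (hmp x)]
      have h4 : dist x y * (4 / d) * (d / 4) ≤ dist x y * (4 / d) * max (δ x) (d / 4) :=
        mll (le_max_right _ _) p%
      have h5 : dist x y * (4 / d) * (d / 4) = dist x y := by field_simp
      linarith
    linarith
  obtain ⟨M, hM⟩ : ∃ M, ∀ x, ‖u x‖ ≤ M := by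
    obtain ⟨M, hM⟩ := hUb.isCompact_closure.exists_bound_of_continuousOn huc.continuousOn
    refine ⟨max M |Real.log (d / 4)|, fun x => ?_⟩
    by_cases hx : x ∈ U
    · exact (hM x (subset_closure hx)).trans (le_max_left _ _)
    · have : δ x = 0 := le_antisymm (not_lt.1 fun h => hx ((hδU x).1 h)) (hδ0 x)
      rw [hu]; simp [this, max_eq_right (by positivity : (0:ℝ) ≤ d / 4)]
  let φ : ContDiffBump (0:E) := ⟨d / 80, d / 40, by positivity, by linarith⟩
  obtain ⟨f, hf⟩ := ex_eq (φ.normed μ ⋆[ContinuousLinearMap.lsmul ℝ ℝ, μ] u : E → ℝ)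
  have hfs : ContDiff ℝ ∞ f := by
    rw [hf]
    exact φ.hasCompactSupport_normed.contDiff_convolution_left _ φ.contDiff_normed huc.locallyIntegrable
  have hfe : ∀ x, |f x - u x| ≤ 1 / 10 := fun x => by
    rw [hf, ← Real.dist_eq]
    refine φ.dist_normed_convolution_le huc.aestronglyMeasurable fun y hy => ?_
    have hy' : dist y x < d / 40 := hy
    have h1 : dist y x * (4 / d) ≤ 1 / 10 := by
      have := mlr hy'.le (by positivity : 0 ≤ 4 / d)
      have e : d / 40 * (4 / d) = 1 / 10 := by rw [div_mul_div_comm, mul_comm d 4, mul_div_mul_right _ _ hd.ne']; norm_num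
      linarith
    rw [Real.dist_eq, abs_le]
    have := huL x y
    rw [dist_comm] at this
    exact ⟨by linarith, by linarith [huL y x]⟩
  obtain ⟨κ, hκ, hκK⟩ : ∃ κ > 0, ∀ x ∈ K, κ * Q x ≤ 1 / 10 := by
    obtain ⟨C, hC⟩ := hK.exists_bound_of_continuousOn hQ.continuous.continuousOn
    refine ⟨1 / (10 * (|C| + 1)), by positivity, fun x hx => ?_⟩
    have := (le_abs_self _).trans (hC x hx)
    rw [div_mul_eq_mul_div, div_le_div_iff₀ p% n%]
    linarith [le_abs_self C]
  have hneg : ∀ x, f x + κ * Q x + (Real.log d - 3 / 10) < 0 → d / 2 < δ x := by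
    intro x hx
    by_contra hcon
    push Not at hcon
    have h1 : Real.log 2 - Real.log d ≤ u x := by
      rw [hu]
      have : Real.log (max (δ x) (d / 4)) ≤ Real.log (d / 2) := Real.log_le_log (hmp x) (max_le hcon l%)
      rw [Real.log_div hd.ne' two_ne_zero] at this
      simp only; linarith
    have h2 := (abs_le.1 (hfe x)).1
    have := Real.log_two_gt_d9
    have := mul_nonneg hκ.le (hQ0 x)
    linarith
  have hlev : ∀ x, d / 2 < δ x → ∀ w, 0 ≤ fderiv ℝ (fderiv ℝ f) x w w + fderiv ℝ (fderiv ℝ f) x (I • w) (I • w) := by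
    intro x hx w
    refine levi_nonneg hfs x w ⟨d / (8 * (‖w‖ + 1)), by positivity, fun s hs hs' => ?_⟩
    have hsw : s * ‖w‖ ≤ d / 8 := by
      rw [lt_div_iff₀ p%] at hs'
      nlinarith [norm_nonneg w]
    have hfx : ∀ x, f x = ∫ t, φ.normed μ t * u (x - t) ∂μ := fun x => by rw [hf]; rfl
    simp only [hfx]
    have hpt : ∀ t, φ.normed μ t * u (x - t) ≤ φ.normed μ t * ((1 / (2 * Real.pi)) *
        ∫ θ in (0:ℝ)..(2 * Real.pi), u (x - t + ((s:ℂ) * cexp (θ * I)) • w)) := by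
      intro t
      by_cases ht : t ∈ Metric.ball (0:E) (d / 40)
      · refine mll ?_ (φ.nonneg_normed t)
        have hn : ∀ l : ℂ, ‖l‖ ≤ s → d / 4 < δ (x - t + l • w) := by
          intro l hl
          have h1 := hδL x (x - t + l • w)
          have h2 : dist x (x - t + l • w) ≤ ‖t‖ + ‖l‖ * ‖w‖ := by
            rw [dist_eq_norm, ← norm_smul]
            have : x - (x - t + l • w) = t - l • w := by abel
            rw [this]; exact norm_sub_le _ _
          have h3 : ‖l‖ * ‖w‖ ≤ s * ‖w‖ := mlr hl (norm_nonneg _)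
          rw [mem_ball_zero_iff] at ht
          linarith
        have hue : ∀ y, d / 4 < δ y → u y = -Real.log (Metric.infDist y Uᶜ) := fun y hy => by
          rw [hu]; simp only; rw [max_eq_left hy.le, hδ]
        have h0 : d / 4 < δ (x - t) := by simpa using hn 0 (by simpa using hs.le)
        have := hsub (x - t) ((hδU _).1 (lt_trans p% h0)) w s hs
          (fun l hl => (hδU _).1 (lt_trans p% (hn l hl)))
        rw [hue _ h0]
        refine this.trans (le_of_eq ?_)
        congr 1
        refine intervalIntegral.integral_congr fun θ _ => ?_
        rw [hue]
        refine hn _ ?_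
        rw [norm_mul, norm_exp_ofReal_mul_I, mul_one, norm_real, Real.norm_of_nonneg hs.le]
      · have : φ.normed μ t = 0 := by
          rw [← Function.notMem_support, φ.support_normed_eq]; exact ht
        simp [this]
    have hint : Integrable (Function.uncurry fun (θ : ℝ) (t : E) => φ.normed μ t * u (x + ((s:ℂ) * cexp (θ * I)) • w - t))
        ((volume.restrict (Set.uIoc 0 (2 * Real.pi))).prod μ) := by
      haveI : IsFiniteMeasure (volume.restrict (Set.uIoc 0 (2 * Real.pi))) :=
        ⟨by rw [Measure.restrict_apply_univ, Set.uIoc]; exact measure_Ioc_lt_top⟩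
      have hg := (integrable_const (μ := volume.restrict (Set.uIoc 0 (2 * Real.pi))) M).mul_prod (φ.integrable_normed (μ := μ))
      have hcn := φ.continuous_normed (μ := μ)
      refine hg.mono' (Continuous.aestronglyMeasurable (by fun_prop)) (ae_of_all _ fun p => ?_)
      simp only [Function.uncurry, norm_mul]
      rw [Real.norm_of_nonneg (φ.nonneg_normed _), mul_comm]
      exact mlr (hM _) (φ.nonneg_normed _)
    have hsw := intervalIntegral_integral_swap (μ := μ) hint
    rw [hsw, ← integral_const_mul]
    have e : ∀ t, 1 / (2 * Real.pi) * ∫ θ in (0:ℝ)..(2 * Real.pi), φ.normed μ t * u (x + ((s:ℂ) * cexp (θ * I)) • w - t) =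
        φ.normed μ t * ((1 / (2 * Real.pi)) * ∫ θ in (0:ℝ)..(2 * Real.pi), u (x - t + ((s:ℂ) * cexp (θ * I)) • w)) := fun t => by
      rw [intervalIntegral.integral_const_mul, mul_left_comm]
      simp only [add_sub_right_comm]
    simp only [e]
    refine integral_mono ?_ ?_ hpt
    · exact (φ.integrable_normed (μ := μ)).mul_bdd (c := M) (huc.comp (continuous_const.sub continuous_id)).aestronglyMeasurable
        (ae_of_all _ fun t => hM _)
    · have h1 := (hint.integral_prod_right).const_mul (1 / (2 * Real.pi))
      refine h1.congr (ae_of_all _ fun t => ?_)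
      simp only
      rw [← e t, intervalIntegral.intervalIntegral_eq_integral_uIoc, if_pos p%]
      simp [Function.uncurry]
  refine ⟨fun x => f x + κ * Q x + (Real.log d - 3 / 10), κ, hκ,
    (hfs.add (contDiff_const.mul hQ)).add contDiff_const, fun x hx => (hδU x).1 (lt_trans p% (hneg x hx)), ?_, ?_⟩
  · intro x hx
    have h1 : u x ≤ - Real.log d := by
      rw [hu]
      have := Real.log_le_log hd ((hdK x hx).trans (le_max_left (δ x) (d / 4)))
      simp only; linarith
    have h2 := (abs_le.1 (hfe x)).2
    have := hκK x hx
    simp only [Set.mem_setOf_eq]; linarith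
  · intro x hx w
    have hd1 : ∀ x, fderiv ℝ (fun x => f x + κ * Q x + (Real.log d - 3 / 10)) x = fderiv ℝ f x + κ • fderiv ℝ Q x := fun x =>
      (((hfs.differentiable s% x).hasFDerivAt.add ((hQ.differentiable s% x).hasFDerivAt.const_mul κ)).add_const _).fderiv
    have hd2 : fderiv ℝ (fderiv ℝ (fun x => f x + κ * Q x + (Real.log d - 3 / 10))) x = fderiv ℝ (fderiv ℝ f) x + κ • fderiv ℝ (fderiv ℝ Q) x := by
      rw [funext hd1]
      exact ((((hfs.fderiv_right (m := ∞) s%).differentiable s% x).hasFDerivAt).add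
        ((((hQ.fderiv_right (m := ∞) s%).differentiable s% x).hasFDerivAt).const_smul κ)).fderiv
    rw [hd2]
    simp only [ContinuousLinearMap.add_apply, ContinuousLinearMap.smul_apply, smul_eq_mul]
    have h1 := hlev x (hneg x hx) w
    have h2 := mll (hQL x w) hκ.le
    linarith
end

section
open Complex ContDiff MeasureTheory Filter Topology
open scoped ComplexConjugate ENNReal

variable {E : Type*} [NormedAddCommGroup E] [NormedSpace ℂ E] [NormedSpace ℝ E] [IsScalarTower ℝ ℂ E]

theorem wd_holo {f : E → ℂ} {x : E} (hf : DifferentiableAt ℂ f x) (y : E) : wd I y f x = 0 := by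
  have h : fderiv ℝ f x = (fderiv ℂ f x).restrictScalars ℝ := (hf.hasFDerivAt.restrictScalars ℝ).fderiv
  rw [wd, h]
  simp only [ContinuousLinearMap.coe_restrictScalars', map_smul, smul_eq_mul]
  rw [← mul_assoc, I_mul_I]; ring

theorem holo_of_wd {f : E → ℂ} {x : E} (hf : DifferentiableAt ℝ f x) (h : ∀ y, wd I y f x = 0) :
    DifferentiableAt ℂ f x := by
  rw [differentiableAt_iff_restrictScalars ℝ hf]
  have hI : ∀ y, fderiv ℝ f x (I • y) = I * fderiv ℝ f x y := fun y => by
    have := h y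
    rw [wd] at this
    linear_combination (-2 * I) * this + (fderiv ℝ f x (I • y)) * I_mul_I
  refine ⟨{ toFun := fun y => fderiv ℝ f x y, map_add' := map_add _, map_smul' := fun c y => ?_, cont := (fderiv ℝ f x).cont }, ?_⟩
  · rw [smul_split, map_add, map_smul, map_smul, hI]
    simp only [real_smul, RingHom.id_apply, smul_eq_mul]
    conv_rhs => rw [← re_add_im c]
    ring
  · ext y; rfl

variable [FiniteDimensional ℝ E] [MeasurableSpace E] [BorelSpace E] (μ : Measure E) [μ.IsAddHaarMeasure]

theorem integral_rot (c : ℂ) (hc : ‖c‖ = 1) {F : E → ℂ} (hF : Continuous F) : ∫ t, F (c • t) ∂μ = ∫ t, F t ∂μ := by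
  let L : E →ₗ[ℝ] E := { toFun := fun t => c • t, map_add' := smul_add c, map_smul' := fun r t => smul_comm c r t }
  have hc0 : c ≠ 0 := fun h => by simp [h] at hc
  have him : L '' Metric.ball 0 1 = Metric.ball 0 1 := by
    ext t
    constructor
    · rintro ⟨s, hs, rfl⟩
      rw [mem_ball_zero_iff] at hs ⊢
      change ‖c • s‖ < 1
      rwa [norm_smul, hc, one_mul]
    · intro ht
      rw [mem_ball_zero_iff] at ht
      refine ⟨c⁻¹ • t, ?_, smul_inv_smul₀ hc0 t⟩
      rw [mem_ball_zero_iff, norm_smul, norm_inv, hc, inv_one, one_mul]; exact ht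
  have hdet := μ.addHaar_image_linearMap L (Metric.ball 0 1)
  rw [him] at hdet
  have h1 : ENNReal.ofReal |LinearMap.det L| = 1 := by
    have hp := (Metric.measure_ball_pos μ (0:E) one_pos).ne'
    have hf := (measure_ball_lt_top (μ := μ) (x := (0:E)) (r := 1)).ne
    exact ((ENNReal.mul_eq_right hp hf).1 hdet.symm)
  have h2 : |LinearMap.det L| = 1 := by simpa using h1
  have hmap := Measure.map_linearMap_addHaar_eq_smul_addHaar μ (f := L) (fun h => by simp [h] at h2)
  rw [abs_inv, h2, inv_one, ENNReal.ofReal_one, one_smul] at hmap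
  have hLc : Continuous L := continuous_const_smul c
  calc ∫ t, F (c • t) ∂μ = ∫ t, F t ∂(Measure.map L μ) := (integral_map hLc.aemeasurable hF.aestronglyMeasurable).symm
    _ = _ := by rw [hmap]

theorem radial_bump (hN : ContDiff ℝ ∞ fun x : E => ‖x‖ ^ 2) {s : ℝ} (hs : 0 < s) : ∃ ρ : E → ℝ, ContDiff ℝ ∞ ρ ∧
    HasCompactSupport ρ ∧ (∀ x, s ≤ ‖x‖ → ρ x = 0) ∧ ∫ x, ρ x ∂μ = 1 ∧ ∀ (c : ℂ) x, ‖c‖ = 1 → ρ (c • x) = ρ x := by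
  obtain ⟨f, hf⟩ := ex_eq (fun x => Real.smoothTransition (s ^ 2 - ‖x‖ ^ 2) : E → ℝ)
  have hfs : ContDiff ℝ ∞ f := by
    rw [hf]; exact (Real.smoothTransition.contDiff (n := ⊤)).comp (contDiff_const.sub hN)
  have hz : ∀ x, s ≤ ‖x‖ → f x = 0 := fun x hx => by
    rw [hf]; exact Real.smoothTransition.zero_of_nonpos (by nlinarith)
  have hfc : HasCompactSupport f := HasCompactSupport.intro (isCompact_closedBall (0:E) s) fun x hx =>
    hz x (by rw [mem_closedBall_zero_iff, not_le] at hx; exact hx.le)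
  have hpos : 0 < ∫ x, f x ∂μ := hfs.continuous.integral_pos_of_hasCompactSupport_nonneg_nonzero hfc
    (fun x => by rw [hf]; exact Real.smoothTransition.nonneg _) (x := 0) (by
      rw [hf]; exact (Real.smoothTransition.pos_of_pos (by simpa using pow_pos hs 2)).ne')
  refine ⟨fun x => (∫ x, f x ∂μ)⁻¹ * f x, contDiff_const.mul hfs, hfc.mul_left, fun x hx => by simp [hz x hx], ?_, ?_⟩
  · rw [integral_const_mul, inv_mul_cancel₀ hpos.ne']
  · intro c x hc
    simp only [hf, norm_smul, hc, one_mul]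

theorem mean_val {ρ : E → ℝ} {s s' : ℝ} (hρ : Continuous ρ) (hρc : HasCompactSupport ρ) (hρs : ∀ x, s ≤ ‖x‖ → ρ x = 0)
    (h1 : ∫ x, ρ x ∂μ = 1) (hrot : ∀ (c : ℂ) x, ‖c‖ = 1 → ρ (c • x) = ρ x) {q : E → ℂ} (hq : Continuous q)
    (hqc : HasCompactSupport q) {x : E} (hss : s < s') (hd : ∀ y ∈ Metric.ball x s', DifferentiableAt ℂ q y) :
    moll μ ρ q x = q x := by
  obtain ⟨M, hM⟩ := hcs_bdd hq hqc
  rw [moll_swap]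
  have hπ := Real.pi_pos
  have hrotI : ∀ θ : ℝ, ∫ t, q (x - circleMap 0 1 θ • t) * (ρ t : ℂ) ∂μ = ∫ t, q (x - t) * (ρ t : ℂ) ∂μ := fun θ => by
    have hn : ‖circleMap 0 1 θ‖ = 1 := by simp [circleMap]
    rw [← integral_rot μ _ hn (F := fun t => q (x - t) * (ρ t : ℂ)) (by fun_prop)]
    simp only [hrot _ _ hn]
  have hint : Integrable (Function.uncurry fun (θ : ℝ) (t : E) => q (x - circleMap 0 1 θ • t) * (ρ t : ℂ))
      ((volume.restrict (Set.uIoc 0 (2 * Real.pi))).prod μ) := by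
    haveI : IsFiniteMeasure (volume.restrict (Set.uIoc 0 (2 * Real.pi))) :=
      ⟨by rw [Measure.restrict_apply_univ, Set.uIoc]; exact measure_Ioc_lt_top⟩
    have hg := (integrable_const (μ := volume.restrict (Set.uIoc 0 (2 * Real.pi))) M).mul_prod
      (hρ.integrable_of_hasCompactSupport hρc (μ := μ)).norm
    have hcm : Continuous fun θ => circleMap 0 1 θ := by fun_prop
    refine hg.mono' (Continuous.aestronglyMeasurable (by fun_prop)) (ae_of_all _ fun p => ?_)
    simp only [Function.uncurry, norm_mul, norm_real]
    exact mlr (hM _) (norm_nonneg _)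
  have hsw := intervalIntegral_integral_swap (μ := μ) hint
  simp only [hrotI] at hsw
  rw [intervalIntegral.integral_const] at hsw
  have hin : ∀ t, ∫ θ in (0:ℝ)..(2 * Real.pi), q (x - circleMap 0 1 θ • t) * (ρ t : ℂ) = (2 * Real.pi) • (q x * ρ t) := by
    intro t
    by_cases ht : s ≤ ‖t‖
    · simp [hρs t ht]
    · have hdf : DiffContOnCl ℂ (fun l : ℂ => q (x - l • t)) (Metric.ball 0 |1|) := by
        refine DifferentiableOn.diffContOnCl fun l hl => ?_
        rw [abs_one, closure_ball _ one_ne_zero, mem_closedBall_zero_iff] at hl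
        refine (DifferentiableAt.comp l (hd _ ?_) (by fun_prop)).differentiableWithinAt
        rw [mem_ball_iff_norm, sub_sub_cancel_left, norm_neg, norm_smul]
        push Not at ht
        nlinarith [norm_nonneg t]
      have := hdf.circleAverage
      rw [Real.circleAverage_def] at this
      simp only [zero_smul, sub_zero] at this
      rw [intervalIntegral.integral_mul_const, ← this]
      simp only [real_smul]
      push_cast
      field_simp
  simp only [hin] at hsw
  rw [integral_smul, sub_zero] at hsw
  have := smul_right_injective ℂ (by positivity : (2 * Real.pi) ≠ 0) hsw
  rw [this, integral_const_mul, integral_complex_ofReal, h1]; simp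
end

section
open Complex ContDiff MeasureTheory Filter Topology
open scoped ComplexConjugate ENNReal

variable {E : Type*} [NormedAddCommGroup E] [NormedSpace ℂ E] [NormedSpace ℝ E] [IsScalarTower ℝ ℂ E]
variable [FiniteDimensional ℝ E] [MeasurableSpace E] [BorelSpace E] [Nontrivial E]

theorem cut_psi {ψ : E → ℝ} (hψ : ContDiff ℝ ∞ ψ) (hbd : Bornology.IsBounded {x | ψ x < 0}) {c : ℝ} (hc : 0 < c) :
    ∃ κ : E → ℂ, DTest {x | ψ x < 0} κ ∧ (∀ x, ψ x ≤ -c → κ x = 1) ∧ ∀ x, 0 ≤ ψ x → κ =ᶠ[𝓝 x] 0 := by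
  have hz : ∀ x, -(c / 2) ≤ ψ x → ((Real.smoothTransition ((-ψ x - c / 2) / (c / 2)) : ℝ) : ℂ) = 0 := fun x hx => by
    rw [Real.smoothTransition.zero_of_nonpos (div_nonpos_of_nonpos_of_nonneg l% p%), ofReal_zero]
  have hcl : IsClosed {x | ψ x ≤ -(c / 2)} := isClosed_le hψ.continuous continuous_const
  have hs : tsupport (fun x => ((Real.smoothTransition ((-ψ x - c / 2) / (c / 2)) : ℝ) : ℂ)) ⊆ {x | ψ x ≤ -(c / 2)} :=
    closure_minimal (fun x hx => by by_contra h; exact hx (hz x (not_le.1 h).le)) hcl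
  have hs' : {x | ψ x ≤ -(c / 2)} ⊆ {x | ψ x < 0} := fun x hx => by
    have : ψ x ≤ -(c / 2) := hx
    change ψ x < 0; linarith
  refine ⟨fun x => ((Real.smoothTransition ((-ψ x - c / 2) / (c / 2)) : ℝ) : ℂ), ⟨?_, ?_, hs.trans hs'⟩, ?_, ?_⟩
  · exact ofReal_contDiff ((Real.smoothTransition.contDiff (n := ⊤)).comp ((hψ.neg.sub contDiff_const).div_const _))
  · exact (Metric.isCompact_of_isClosed_isBounded hcl (hbd.subset hs')).of_isClosed_subset (isClosed_tsupport _) hs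
  · intro x hx
    simp only
    rw [Real.smoothTransition.one_of_one_le, ofReal_one]
    rw [le_div_iff₀ p%]; linarith
  · intro x hx
    filter_upwards [hψ.continuous.continuousAt.eventually (lt_mem_nhds (show -(c / 2) < ψ x by linarith))] with y hy
    exact hz y hy.le

theorem cousin (μ : Measure E) [μ.IsAddHaarMeasure] {ι : Type*} [Fintype ι] (e : ι → E) (he : ∀ X : ι → ℂ, ‖∑ j, X j • e j‖ ^ 2 = ∑ j, ‖X j‖ ^ 2)
    (hsp : ∀ y : E, ∃ X : ι → ℂ, y = ∑ j, X j • e j) (hN : ContDiff ℝ ∞ fun x : E => ‖x‖ ^ 2)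
    (hQL : ∀ x w : E, 4 * ‖w‖ ^ 2 ≤ fderiv ℝ (fderiv ℝ (fun x : E => ‖x‖ ^ 2)) x w w
      + fderiv ℝ (fderiv ℝ (fun x : E => ‖x‖ ^ 2)) x (I • w) (I • w)) {K : Set E} (hK : IsCompact K)
    (hSt : ∀ W : Set E, IsOpen W → K ⊆ W → ∃ U, IsOpen U ∧ K ⊆ U ∧ U ⊆ W ∧
      ∀ a ∈ U, ∀ w : E, ∀ r : ℝ, 0 < r → (∀ l : ℂ, ‖l‖ ≤ r → a + l • w ∈ U) →
      -Real.log (Metric.infDist a Uᶜ) ≤ (1 / (2 * Real.pi)) * ∫ θ in (0:ℝ)..(2 * Real.pi),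
        -Real.log (Metric.infDist (a + ((r : ℂ) * Complex.exp (θ * Complex.I)) • w) Uᶜ))
    {p : E} (hp : p ∈ K) {om : E → ℂ} (hom : ContDiff ℂ ∞ om) {r : ℝ} (hr : 0 < r) (hz : ∀ y ∈ K, ‖y - p‖ ≤ r → om y = 0 → y = p) :
    ∃ (g v : E → ℂ) (r1 : ℝ), 0 < r1 ∧ ContDiff ℝ ∞ v ∧ (∀ y ∈ Metric.ball p r1, DifferentiableAt ℂ v y) ∧
      (∀ y ∈ K, y ≠ p → DifferentiableAt ℂ g y ∧ ContDiffAt ℝ 1 g y) ∧ ∀ y ∈ Metric.ball p r1, g y = 1 / om y - v y := by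
  have homd : Differentiable ℂ om := hom.differentiable s%
  have homs : ContDiff ℝ ∞ om := hom.restrict_scalars ℝ
  have hinv : ∀ t, om t ≠ 0 → DifferentiableAt ℂ (fun y => 1 / om y) t := fun t ht => by
    simp only [one_div]; exact (homd t).inv ht
  have hnc : Continuous fun x : E => ‖x - p‖ := by fun_prop
  obtain ⟨R, hR⟩ := hK.isBounded.subset_ball p
  obtain ⟨ψ, c, hψ, hc, hDb, hDz, hKc, m, hm, hL⟩ : ∃ (ψ : E → ℝ) (c : ℝ), ContDiff ℝ ∞ ψ ∧ 0 < c ∧ Bornology.IsBounded {x | ψ x < 0} ∧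
      (∀ x, ψ x < 0 → r / 8 ≤ ‖x - p‖ → ‖x - p‖ ≤ r → om x ≠ 0) ∧ (∀ x ∈ K, ψ x < -(2 * c)) ∧ ∃ m : ℝ, 0 < m ∧
      ∀ x, ψ x < 0 → ∀ w, 4 * m * ‖w‖ ^ 2 ≤ fderiv ℝ (fderiv ℝ ψ) x w w + fderiv ℝ (fderiv ℝ ψ) x (I • w) (I • w) := by
    have hcl : IsClosed {x | (r / 8 ≤ ‖x - p‖ ∧ ‖x - p‖ ≤ r) ∧ om x = 0} :=
      ((isClosed_le continuous_const hnc).inter (isClosed_le hnc continuous_const)).inter (isClosed_eq homs.continuous continuous_const)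
    obtain ⟨U, hU, hKU, hUW, hsub⟩ := hSt (Metric.ball p R ∩ {x | (r / 8 ≤ ‖x - p‖ ∧ ‖x - p‖ ≤ r) ∧ om x = 0}ᶜ)
      (Metric.isOpen_ball.inter hcl.isOpen_compl) (fun x hx => ⟨hR hx, fun h => by
        have := hz x hx h.1.2 h.2
        have h1 := h.1.1
        rw [this, sub_self, norm_zero] at h1; linarith⟩)
    have hUb : Bornology.IsBounded U := Metric.isBounded_ball.subset (hUW.trans Set.inter_subset_left)
    obtain ⟨ψ, m, hm, hψ, hψU, hKψ, hL⟩ := psh_smooth μ hU hUb (by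
      rw [Set.nonempty_compl]; rintro rfl; exact NormedSpace.unbounded_univ ℝ E hUb) hsub hK hKU hN (fun x => by positivity) hQL
    obtain ⟨x0, hx0, hmax⟩ := hK.exists_isMaxOn ⟨p, hp⟩ hψ.continuous.continuousOn
    have hx0' : ψ x0 < 0 := hKψ hx0
    refine ⟨ψ, -ψ x0 / 4, hψ, by linarith, hUb.subset hψU, fun x hx h1 h2 h3 => (hUW (hψU hx)).2 ⟨⟨h1, h2⟩, h3⟩,
      fun x hx => ?_, m, hm, hL⟩
    have : ψ x ≤ ψ x0 := hmax hx
    linarith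
  obtain ⟨κ, hκ, hκ1, hκ0⟩ := cut_psi hψ hDb hc
  have hψ' : ContDiff ℝ ∞ fun x => ψ x + c := hψ.add contDiff_const
  have hDb' : Bornology.IsBounded {x | ψ x + c < 0} := hDb.subset fun x hx => by
    have : ψ x + c < 0 := hx
    change ψ x < 0; linarith
  obtain ⟨κ', hκ', hκ1', -⟩ := cut_psi hψ' hDb' hc
  let χ : ContDiffBump p := ⟨r / 2, r, by positivity, by linarith⟩
  let χ2 : ContDiffBump p := ⟨r / 8, r / 4, by positivity, by linarith⟩
  let χ3 : ContDiffBump p := ⟨5 * r / 16, 7 * r / 16, by positivity, by linarith⟩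
  obtain ⟨q, hq⟩ := ex_eq (fun x => κ x * ((χ x * (1 - χ2 x) : ℝ) : ℂ) / om x : E → ℂ)
  have hqs : ContDiff ℝ ∞ q := by
    rw [contDiff_iff_contDiffAt]
    intro x
    by_cases hx : om x = 0
    · have : q =ᶠ[𝓝 x] fun _ => 0 := by
        by_cases h0 : 0 ≤ ψ x
        · filter_upwards [hκ0 x h0] with y hy
          simp [hq, hy]
        · by_cases h1 : ‖x - p‖ < r / 8
          · filter_upwards [hnc.continuousAt.eventually (gt_mem_nhds h1)] with y hy
            have : χ2 y = 1 := χ2.one_of_mem_closedBall (mem_closedBall_iff_norm.2 (le_of_lt hy))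
            simp [hq, this]
          · have h2 : r < ‖x - p‖ := by
              by_contra h; exact hDz x (not_le.1 h0) (not_lt.1 h1) (not_lt.1 h) hx
            filter_upwards [hnc.continuousAt.eventually (lt_mem_nhds h2)] with y hy
            have : χ y = 0 := χ.zero_of_le_dist (by rw [dist_eq_norm]; exact le_of_lt hy)
            simp [hq, this]
      exact contDiffAt_const.congr_of_eventuallyEq this
    · rw [hq]
      simp only [div_eq_mul_inv]
      exact (hκ.1.mul (ofReal_contDiff (χ.contDiff.mul (contDiff_const.sub χ2.contDiff)))).contDiffAt.mul (homs.contDiffAt.inv hx)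
  have hqc : HasCompactSupport q := by
    have : q = fun x => κ x * (((χ x * (1 - χ2 x) : ℝ) : ℂ) / om x) := by rw [hq]; ext x; rw [mul_div_assoc]
    rw [this]; exact hκ.2.1.mul_right
  have hqA : ∀ t, ψ t < -c → r / 4 < ‖t - p‖ → ‖t - p‖ < r / 2 → om t ≠ 0 ∧ q =ᶠ[𝓝 t] fun y => 1 / om y := by
    intro t h1 h2 h3
    refine ⟨hDz t l% l% l%, ?_⟩
    filter_upwards [hψ.continuous.continuousAt.eventually (gt_mem_nhds h1), hnc.continuousAt.eventually (gt_mem_nhds h3),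
      hnc.continuousAt.eventually (lt_mem_nhds h2)] with y y1 y2 y3
    have a1 : χ y = 1 := χ.one_of_mem_closedBall (mem_closedBall_iff_norm.2 (le_of_lt y2))
    have a2 : χ2 y = 0 := χ2.zero_of_le_dist (by rw [dist_eq_norm]; exact le_of_lt y3)
    simp [hq, a1, a2, hκ1 y (le_of_lt y1)]
  have hqd : ∀ t, ψ t < -c → r / 4 < ‖t - p‖ → ‖t - p‖ < r / 2 → DifferentiableAt ℂ q t := fun t h1 h2 h3 => by
    obtain ⟨h, h'⟩ := hqA t h1 h2 h3
    exact (hinv t h).congr_of_eventuallyEq h'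
  obtain ⟨A, hA⟩ := ex_eq (fun j x => ((1 - χ3 x : ℝ) : ℂ) * wd I (e j) q x : ι → E → ℂ)
  have h3s : ContDiff ℝ ∞ fun x => ((1 - χ3 x : ℝ) : ℂ) := ofReal_contDiff (contDiff_const.sub χ3.contDiff)
  have hAs : ∀ j, ContDiff ℝ ∞ (A j) := fun j => by
    rw [hA]; exact h3s.mul (wd_contDiff _ _ hqs)
  have hAc : ∀ j, HasCompactSupport (A j) := fun j => by rw [hA]; exact (wd_hcs I (e j) hqc).mul_left
  have hA0 : ∀ j t, ψ t < -c → ‖t - p‖ < r / 2 → A j t = 0 := fun j t h1 h2 => by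
    by_cases h3 : r / 4 < ‖t - p‖
    · simp [hA, wd_holo (hqd t h1 h3 h2)]
    · have : χ3 t = 1 := χ3.one_of_mem_closedBall (mem_closedBall_iff_norm.2 (by change _ ≤ 5 * r / 16; linarith))
      simp [hA, this]
  have hAq : ∀ j t, ψ t < -c → r / 4 < ‖t - p‖ → A j t = wd I (e j) q t := fun j t h1 h2 => by
    by_cases h3 : ‖t - p‖ < r / 2
    · rw [hA0 j t h1 h3, wd_holo (hqd t h1 h2 h3)]
    · have : χ3 t = 0 := χ3.zero_of_le_dist (by rw [dist_eq_norm]; change 7 * r / 16 ≤ _; linarith)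
      simp [hA, this]
  have hAw : ∀ j k t, ψ t < -c → wd I (e k) (A j) t = ((1 - χ3 t : ℝ) : ℂ) * wd I (e k) (wd I (e j) q) t := by
    intro j k t h1
    by_cases h3 : r / 4 < ‖t - p‖ ∧ ‖t - p‖ < r / 2
    · have ev : ∀ i, wd I (e i) q =ᶠ[𝓝 t] fun _ => 0 := fun i => by
        filter_upwards [hψ.continuous.continuousAt.eventually (gt_mem_nhds h1), hnc.continuousAt.eventually (gt_mem_nhds h3.2),
          hnc.continuousAt.eventually (lt_mem_nhds h3.1)] with y y1 y2 y3
        exact wd_holo (hqd y y1 y3 y2) _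
      have ev' : A j =ᶠ[𝓝 t] fun _ => 0 := by
        filter_upwards [ev j] with y hy
        simp [hA, hy]
      rw [wd_congr _ _ ev', wd_congr _ _ (ev j)]
      simp [wd]
    · rw [hA]
      simp only
      rw [wd_mul _ _ (h3s.differentiable s% t) ((wd_contDiff _ _ hqs).differentiable s% t)]
      have : wd I (e k) (fun x => ((1 - χ3 x : ℝ) : ℂ)) t = 0 := by
        have hcst : ∃ b : ℂ, (fun x => ((1 - χ3 x : ℝ) : ℂ)) =ᶠ[𝓝 t] fun _ => b := by
          by_cases h4 : r / 4 < ‖t - p‖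
          · have h5 : 7 * r / 16 < ‖t - p‖ := by by_contra h; exact h3 ⟨h4, by linarith⟩
            refine ⟨1, ?_⟩
            filter_upwards [hnc.continuousAt.eventually (lt_mem_nhds h5)] with y hy
            have : χ3 y = 0 := χ3.zero_of_le_dist (by rw [dist_eq_norm]; exact le_of_lt hy)
            simp [this]
          · have h5 : ‖t - p‖ < 5 * r / 16 := by linarith
            refine ⟨0, ?_⟩
            filter_upwards [hnc.continuousAt.eventually (gt_mem_nhds h5)] with y hy
            have : χ3 y = 1 := χ3.one_of_mem_closedBall (mem_closedBall_iff_norm.2 (le_of_lt hy))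
            simp [this]
        obtain ⟨b, hb⟩ := hcst
        rw [wd_congr _ _ hb]; simp [wd]
      rw [this, zero_mul, zero_add]
  obtain ⟨D, hD⟩ := ex_eq ({x | ψ x + c < 0} : Set E)
  have hDm : ∀ x, x ∈ D ↔ ψ x < -c := fun x => by
    rw [hD]; exact ⟨fun h => by have : ψ x + c < 0 := h; linarith, fun h => by change ψ x + c < 0; linarith⟩
  have hDw : ∀ (f : E → ℂ) (w : E → ℂ), DTest D w → ∫ x, D.indicator f x * w x ∂μ = ∫ x, f x * w x ∂μ := fun f w hw => by
    congr 1; ext x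
    by_cases hx : x ∈ D
    · rw [Set.indicator_of_mem hx]
    · rw [hw.off hx, mul_zero, mul_zero]
  obtain ⟨M, hM⟩ : ∃ M, ∀ j x, ‖A j x‖ ≤ M := by
    choose C hC using fun j => hcs_bdd (hAs j).continuous (hAc j)
    exact ⟨∑ j, |C j|, fun j x => (hC j x).trans ((le_abs_self _).trans (Finset.single_le_sum (f := fun j => |C j|) (fun i _ => abs_nonneg _) (Finset.mem_univ j)))⟩
  obtain ⟨u, hu2, hu⟩ := horm_D μ e (ψ := fun x => ψ x + c) hψ' hm hDb' (fun x hx X => by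
      rw [levi_wd e hψ' x X, ← he]
      have : fderiv ℝ (fun x => ψ x + c) = fderiv ℝ ψ := by ext1 y; exact fderiv_add_const c
      rw [this]
      have := hL x l% (∑ j, X j • e j)
      linarith) (α := fun j => D.indicator (A j)) (fun j x hx => Set.indicator_of_notMem (hD ▸ hx) _)
    (fun j => by rw [← hD]; exact (hAs j).continuous.continuousOn.congr fun x hx => Set.indicator_of_mem hx _)
    (M := M) (fun j x => (norm_indicator_le_norm_self _ _).trans (hM j x)) (fun w hw j k => by
      rw [← hD] at hw
      rw [hDw _ _ (hw.wd I (e k)), hDw _ _ (hw.wd I (e j)), integral_wd_mul μ _ _ (hAs j) hw.1 (hAc j),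
        integral_wd_mul μ _ _ (hAs k) hw.1 (hAc k)]
      congr 2; ext x
      by_cases hx : x ∈ D
      · rw [hAw j k x ((hDm x).1 hx), hAw k j x ((hDm x).1 hx), wd_comm _ _ _ _ hqs]
      · rw [hw.off hx, mul_zero, mul_zero])
  rw [← hD] at hu2 hu hκ'
  obtain ⟨f1, hf1⟩ := ex_eq (fun x => κ' x * u x : E → ℂ)
  have hf1L : LocallyIntegrable f1 μ := by rw [hf1]; exact (hu2 _ hκ').locallyIntegrable n%
  have hqL : LocallyIntegrable q μ := hqs.continuous.locallyIntegrable
  obtain ⟨δ, hδ, hδK⟩ := hK.exists_cthickening_subset_open (isOpen_lt hψ.continuous continuous_const) (fun x hx => hKc x hx : K ⊆ {x | ψ x < -(2 * c)})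
  obtain ⟨s, hs, hsδ, hsr⟩ : ∃ s : ℝ, 0 < s ∧ 3 * s ≤ δ ∧ 32 * s ≤ r :=
    ⟨min (δ / 3) (r / 32), by positivity, by linarith [min_le_left (δ / 3) (r / 32)], by linarith [min_le_right (δ / 3) (r / 32)]⟩
  obtain ⟨ρ, hρ, hρc, hρ0, hρ1, hρr⟩ := radial_bump μ hN hs
  obtain ⟨T, hT⟩ := ex_eq (Metric.thickening s K)
  have hTo : IsOpen T := hT ▸ Metric.isOpen_thickening
  have hTs : ∀ x ∈ T, ∀ t, ‖t - x‖ < 2 * s → ψ t < -(2 * c) := fun x hx t ht => by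
    refine hδK ?_
    rw [hT, Metric.mem_thickening_iff] at hx
    obtain ⟨k, hk, hxk⟩ := hx
    refine Metric.mem_cthickening_of_dist_le t k δ K hk ?_
    have := dist_triangle t x k
    rw [dist_eq_norm t x] at this; linarith
  have hw : ∀ x ∈ T, DTest D (fun y => (ρ (x - y) : ℂ)) ∧ tsupport (fun y => (ρ (x - y) : ℂ)) ⊆ Metric.closedBall x s := by
    intro x hx
    have h1 : tsupport (fun y => (ρ (x - y) : ℂ)) ⊆ Metric.closedBall x s :=
      closure_minimal (fun y hy => by
        by_contra h
        rw [mem_closedBall_iff_norm', not_le] at h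
        exact hy (by simp [hρ0 _ h.le])) Metric.isClosed_closedBall
    refine ⟨⟨ofReal_contDiff (hρ.comp (contDiff_const.sub contDiff_id)), (isCompact_closedBall x s).of_isClosed_subset (isClosed_tsupport _) h1, ?_⟩, h1⟩
    intro y hy
    have := hTs x hx y ((mem_closedBall_iff_norm.1 (h1 hy)).trans_lt l%)
    exact (hDm y).2 l%
  have hwd : ∀ x ∈ T, ∀ j, wd I (e j) (moll μ ρ f1) x = ∫ t, A j t * (ρ (x - t) : ℂ) ∂μ := by
    intro x hx j
    obtain ⟨h1, h2⟩ := hw x hx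
    rw [moll_wd μ hρ hρc hf1L]
    have h3 := hu _ h1 j
    rw [hDw _ _ h1] at h3
    rw [← neg_neg (∫ t, A j t * (ρ (x - t) : ℂ) ∂μ), ← h3]
    congr 2; ext t
    by_cases ht : t ∈ Metric.closedBall x s
    · rw [hf1]
      simp only
      rw [hκ1' t (by have := hTs x hx t ((mem_closedBall_iff_norm.1 ht).trans_lt l%); linarith), one_mul]
    · rw [image_eq_zero_of_notMem_tsupport (f := wd I (e j) (fun y => (ρ (x - y) : ℂ))) (fun h => ht (h2 (wd_tsupport _ _ _ h))), mul_zero, mul_zero]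
  have hhol : ∀ (f : E → ℂ) x, ContDiff ℝ ∞ f → (∀ j, wd I (e j) f x = 0) → DifferentiableAt ℂ f x := fun f x hf h => by
    refine holo_of_wd (hf.differentiable s% x) fun y => ?_
    obtain ⟨X, rfl⟩ := hsp y
    rw [wd_vec_sum]
    exact Finset.sum_eq_zero fun j _ => by rw [(wd_vec _ _ _ _).2, h, mul_zero]
  have hms := moll_contDiff μ hρ hρc hf1L
  have hmq := moll_contDiff μ hρ hρc hqL
  have hv : ∀ x ∈ T, ‖x - p‖ < 7 * r / 16 → DifferentiableAt ℂ (moll μ ρ f1) x := by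
    intro x hx hxp
    refine hhol _ x hms fun j => ?_
    rw [hwd x hx j]
    refine integral_eq_zero_of_ae (ae_of_all _ fun t => ?_)
    by_cases ht : ‖x - t‖ < s
    · simp only; rw [hA0 j t, zero_mul]; rfl
      · have := hTs x hx t (by rw [norm_sub_rev]; linarith); linarith
      · have := norm_sub_le_norm_sub_add_norm_sub t x p
        rw [norm_sub_rev t x] at this; linarith
    · simp [hρ0 _ (not_lt.1 ht)]
  have hg : ∀ x ∈ T, 5 * r / 16 < ‖x - p‖ → DifferentiableAt ℂ (fun x => moll μ ρ q x - moll μ ρ f1 x) x := by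
    intro x hx hxp
    refine hhol _ x (hmq.sub hms) fun j => ?_
    rw [wd_sub _ _ (hmq.differentiable s% x) (hms.differentiable s% x), hwd x hx j, moll_wd μ hρ hρc hqL,
      integral_wd_mul μ _ _ hqs (hw x hx).1.1 hqc, neg_neg, sub_eq_zero]
    congr 1; ext t
    by_cases ht : ‖x - t‖ < s
    · rw [hAq j t]
      · have := hTs x hx t (by rw [norm_sub_rev]; linarith); linarith
      · have := norm_sub_le_norm_sub_add_norm_sub x t p
        linarith
    · simp [hρ0 _ (not_lt.1 ht)]
  have hov : ∀ x ∈ T, 5 * r / 16 < ‖x - p‖ → ‖x - p‖ < 7 * r / 16 → moll μ ρ q x = 1 / om x := by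
    intro x hx h1 h2
    rw [mean_val μ hρ.continuous hρc hρ0 hρ1 hρr hqs.continuous hqc (by linarith : s < 2 * s) fun y hy => ?_]
    · exact (hqA x (by have := hTs x hx x (by simpa using hs); linarith) l% l%).2.self_of_nhds
    · rw [mem_ball_iff_norm] at hy
      have a1 := norm_sub_le_norm_sub_add_norm_sub y x p
      have a2 := norm_sub_le_norm_sub_add_norm_sub x y p
      rw [norm_sub_rev x y] at a2
      exact hqd y (by have := hTs x hx y hy; linarith) l% l%
  have hKT : K ⊆ T := hT ▸ Metric.self_subset_thickening hs K
  refine ⟨fun x => if ‖x - p‖ < 3 * r / 8 then 1 / om x - moll μ ρ f1 x else moll μ ρ q x - moll μ ρ f1 x, moll μ ρ f1, s, hs, hms, ?_, ?_, ?_⟩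
  · intro y hy
    refine hv y (hT ▸ Metric.mem_thickening_iff.2 ⟨p, hp, hy⟩) ?_
    rw [mem_ball_iff_norm] at hy; linarith
  · intro y hy hyp
    by_cases h : ‖y - p‖ < 7 * r / 16
    · have h0 : om y ≠ 0 := fun h' => hyp (hz y hy l% h')
      have hs1 : ContDiffAt ℝ 1 (fun y => 1 / om y) y := by
        simp only [one_div]; exact (homs.of_le s%).contDiffAt.inv h0
      suffices hee : _ =ᶠ[𝓝 y] fun x => 1 / om x - moll μ ρ f1 x from
        ⟨((hinv y h0).sub (hv y (hKT hy) h)).congr_of_eventuallyEq hee, (hs1.sub (hms.of_le s%).contDiffAt).congr_of_eventuallyEq hee⟩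
      filter_upwards [hTo.mem_nhds (hKT hy), hnc.continuousAt.eventually (gt_mem_nhds h)] with z z1 z2
      by_cases hz3 : ‖z - p‖ < 3 * r / 8
      · simp only [hz3, if_true]
      · simp only [hz3, if_false]; rw [hov z z1 l% z2]
    · suffices hee : _ =ᶠ[𝓝 y] fun x => moll μ ρ q x - moll μ ρ f1 x from
        ⟨(hg y (hKT hy) l%).congr_of_eventuallyEq hee, ((hmq.sub hms).of_le s%).contDiffAt.congr_of_eventuallyEq hee⟩
      filter_upwards [hnc.continuousAt.eventually (lt_mem_nhds (show 3 * r / 8 < ‖y - p‖ by linarith))] with z z2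
      rw [if_neg (not_lt.2 (le_of_lt z2))]
  · intro y hy
    rw [mem_ball_iff_norm] at hy
    simp only; rw [if_pos l%]
end

section
open Filter Topology

theorem ev_small {A c ε : ℝ} (hc : 0 < c) (hε : 0 < ε) : ∀ᶠ s : ℝ in 𝓝[>] 0, A * s ^ ε ≤ c := by
  have : Tendsto (fun s : ℝ => A * s ^ ε) (𝓝[>] 0) (𝓝 (A * 0 ^ ε)) :=
    ((Real.continuousAt_rpow_const 0 ε (Or.inr hε.le)).tendsto.const_mul A).mono_left nhdsWithin_le_nhds
  rw [Real.zero_rpow hε.ne', mul_zero] at this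
  exact (this.eventually (gt_mem_nhds hc)).mono fun s h => h.le

theorem pow_le_sig {H C σ ε : ℝ} (hH : 0 ≤ H) (hσ : 0 ≤ σ) (hC : 1 ≤ C) (hε : 0 < ε) (hε1 : ε ≤ 1) (h : H ^ 2 ≤ C * σ) :
    H ^ ε ≤ C * σ ^ (ε / 2) := by
  have h1 : H ^ ε = (H ^ 2) ^ (ε / 2) := by rw [← Real.rpow_natCast_mul hH]; congr 1; push_cast; ring
  rw [h1]
  calc (H ^ 2) ^ (ε / 2) ≤ (C * σ) ^ (ε / 2) := Real.rpow_le_rpow p% h p%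
    _ = C ^ (ε / 2) * σ ^ (ε / 2) := Real.mul_rpow l% hσ
    _ ≤ C * σ ^ (ε / 2) := by
      refine mlr ?_ p%
      calc C ^ (ε / 2) ≤ C ^ (1:ℝ) := Real.rpow_le_rpow_of_exponent_le hC l%
        _ = C := Real.rpow_one C

theorem le_rpow_self {H ε : ℝ} (hH : 0 ≤ H) (hH1 : H ≤ 1) (hε : 0 < ε) (hε1 : ε ≤ 1) : H ≤ H ^ ε := by
  rcases hH.eq_or_lt with rfl | h
  · positivity
  · calc H = H ^ (1:ℝ) := (Real.rpow_one H).symm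
      _ ≤ H ^ ε := Real.rpow_le_rpow_of_exponent_ge h hH1 hε1

theorem near_real {A ε : ℝ} (hA : 1 ≤ A) (hε : 0 < ε) (hε1 : ε ≤ 1) : ∃ B > 0, ∀ s0 > 0, ∃ s2 : ℝ, 0 < s2 ∧ s2 ≤ s0 ∧ ∀ κ H l σ x : ℝ, 0 < κ → κ ≤ σ → 0 ≤ H → H ≤ s2 →
    κ ≤ s2 → 0 ≤ l → l ≤ A * (σ + H ^ 2) → H ^ 2 ≤ A * (σ + l * H + H ^ 2 * H ^ ε) → σ ≤ A * (κ + H) →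
    -(A * (l * H + H ^ 2 * H ^ ε)) ≤ x → -(B * (σ * σ ^ (ε / 2))) ≤ x ∧ B * σ ^ (ε / 2) ≤ 1 / 8 := by
  refine ⟨36 * A ^ 8, by positivity, fun s0 hs0 => ?_⟩
  have e1 := ev_small (A := A ^ 2) (c := 1 / 4) n% one_pos
  have e2 := ev_small (A := A) (c := 1 / 4) n% hε
  have e3 := ev_small (A := 36 * A ^ 8 * (2 * A) ^ (ε / 2)) (c := 1 / 8) n% (half_pos hε)
  have e4 := ev_small (A := 1) (c := min 1 s0) p% one_pos
  obtain ⟨s2, h1, h2, h3, h4, h5⟩ := (e1.and (e2.and (e3.and (e4.and self_mem_nhdsWithin)))).exists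
  have h5 : 0 < s2 := h5
  rw [Real.rpow_one] at h1 h4
  rw [one_mul] at h4
  have h6 := h4.trans (min_le_left _ _)
  refine ⟨s2, h5, h4.trans (min_le_right _ _), fun κ H l σ x hκ hκσ hH hHs hκs hl hl2 hH2 hσ hx => ?_⟩
  have hσ0 : 0 < σ := hκ.trans_le hκσ
  have hHε : H ^ ε ≤ s2 ^ ε := Real.rpow_le_rpow hH hHs hε.le
  have hHε0 : 0 ≤ H ^ ε := by positivity
  have hA2 : A ≤ A ^ 2 := by nlinarith
  have k1 : l * H ≤ A * (σ + H ^ 2) * s2 := mul_le_mul hl2 hHs hH p%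
  have k2 : H ^ 2 * H ^ ε ≤ H ^ 2 * s2 ^ ε := by gcongr
  have k3 : H ^ 2 ≤ 4 * A * σ := by
    have a1 : A * (A * (σ + H ^ 2) * s2) ≤ (σ + H ^ 2) * (1 / 4) := by
      have := mll h1 (by positivity : 0 ≤ σ + H ^ 2)
      nlinarith
    have a2 : A * (H ^ 2 * s2 ^ ε) ≤ H ^ 2 * (1 / 4) := by
      have := mll h2 (by positivity : 0 ≤ H ^ 2)
      nlinarith
    have a3 := mll k1 (by linarith : 0 ≤ A)
    have a4 := mll k2 (by linarith : 0 ≤ A)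
    nlinarith
  have k4 : l ≤ 5 * A ^ 2 * σ := by nlinarith [mll k3 (by linarith : 0 ≤ A)]
  have k5 : H ^ ε ≤ 4 * A * σ ^ (ε / 2) := pow_le_sig hH hσ0.le l% hε hε1 k3
  have k6 : H ≤ H ^ ε := le_rpow_self hH (hHs.trans h6) hε hε1
  have k7 : l * H + H ^ 2 * H ^ ε ≤ (9 * A ^ 2 * σ) * (4 * A * σ ^ (ε / 2)) := by
    calc l * H + H ^ 2 * H ^ ε ≤ l * H ^ ε + H ^ 2 * H ^ ε := by gcongr
      _ = (l + H ^ 2) * H ^ ε := by ring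
      _ ≤ _ := mul_le_mul (by nlinarith) k5 hHε0 p%
  have k8 : A * (l * H + H ^ 2 * H ^ ε) ≤ 36 * A ^ 8 * (σ * σ ^ (ε / 2)) := by
    have p0 : 0 ≤ σ * σ ^ (ε / 2) := by positivity
    calc A * (l * H + H ^ 2 * H ^ ε) ≤ A * ((9 * A ^ 2 * σ) * (4 * A * σ ^ (ε / 2))) := by gcongr
      _ = 36 * A ^ 4 * (σ * σ ^ (ε / 2)) := by ring
      _ ≤ 36 * A ^ 8 * (σ * σ ^ (ε / 2)) := by gcongr; norm_num
  refine ⟨by linarith, ?_⟩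
  have k9 : σ ^ (ε / 2) ≤ (2 * A) ^ (ε / 2) * s2 ^ (ε / 2) := by
    rw [← Real.mul_rpow p% h5.le]
    exact Real.rpow_le_rpow hσ0.le (by nlinarith) p%
  calc 36 * A ^ 8 * σ ^ (ε / 2) ≤ 36 * A ^ 8 * ((2 * A) ^ (ε / 2) * s2 ^ (ε / 2)) := by gcongr
    _ ≤ 1 / 8 := by rw [← mul_assoc]; exact h3

theorem onto_real {A ε : ℝ} (hA : 1 ≤ A) (hε : 0 < ε) (hε1 : ε ≤ 1) : ∃ B > 0, ∀ s0 > 0, ∃ s3 > 0, ∀ X l H σ : ℝ, 0 ≤ X →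
    0 ≤ l → 0 ≤ H → 0 < σ → σ ≤ s3 → X ^ 2 ≤ A * σ → l ≤ A * (σ + X ^ 2) → H ≤ X + A * l →
    H < s0 ∧ A * (l * (H + X) + H ^ 2 * H ^ ε) ≤ B * (σ * σ ^ (ε / 2)) := by
  refine ⟨300 * A ^ 20, by positivity, fun s0 hs0 => ?_⟩
  obtain ⟨m, hm, hm0, hm1⟩ : ∃ m : ℝ, 0 < m ∧ m ≤ 1 ∧ m ≤ s0 / 2 := ⟨min 1 (s0 / 2), by positivity, min_le_left _ _, min_le_right _ _⟩
  refine ⟨m ^ 2 / (16 * A ^ 6), by positivity, fun X l H σ hX hl hH hσ hσs hX2 hl2 hH2 => ?_⟩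
  rw [le_div_iff₀ p%] at hσs
  have hA6 : 1 ≤ A ^ 6 := one_le_pow₀ hA
  have hAA : ∀ i j : ℕ, i ≤ j → A ^ i ≤ A ^ j := fun i j h => pow_le_pow_right₀ hA h
  have hσ1 : σ ≤ 1 := by nlinarith
  have k1 : l ≤ 2 * A ^ 2 * σ := by nlinarith [hAA 1 2 n%, mll hX2 (by linarith : 0 ≤ A)]
  have k2 : H ≤ X + 2 * A ^ 3 * σ := by nlinarith
  have k3 : H ^ 2 ≤ 10 * A ^ 6 * σ := by
    have a1 : H ^ 2 ≤ (X + 2 * A ^ 3 * σ) ^ 2 := by gcongr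
    have a2 : (2 * A ^ 3 * σ) ^ 2 ≤ 4 * A ^ 6 * σ := by
      have : σ ^ 2 ≤ σ := by nlinarith
      calc (2 * A ^ 3 * σ) ^ 2 = 4 * A ^ 6 * σ ^ 2 := by ring
        _ ≤ _ := by gcongr
    have a3 : X ^ 2 ≤ A ^ 6 * σ := hX2.trans (by have := hAA 1 6 n%; gcongr; simpa using this)
    nlinarith [sq_nonneg (X - 2 * A ^ 3 * σ)]
  have k4 : H ^ 2 ≤ m ^ 2 := by nlinarith
  have k5 : H ≤ m := (pow_le_pow_iff_left₀ hH hm.le n%).1 k4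
  have k6 : X ≤ m := by
    refine (pow_le_pow_iff_left₀ hX hm.le (by norm_num : 2 ≠ 0)).1 (hX2.trans ?_)
    have : A * σ ≤ A ^ 6 * σ := by have := hAA 1 6 n%; gcongr; simpa using this
    nlinarith
  refine ⟨by linarith, ?_⟩
  have p1 : H ^ ε ≤ 10 * A ^ 6 * σ ^ (ε / 2) := pow_le_sig hH hσ.le l% hε hε1 k3
  have p2 : X ^ ε ≤ 10 * A ^ 6 * σ ^ (ε / 2) := pow_le_sig hX hσ.le l% hε hε1
    (hX2.trans (by have := hAA 1 6 n%; nlinarith))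
  have p3 := le_rpow_self hH (k5.trans hm0) hε hε1
  have p4 := le_rpow_self hX (k6.trans hm0) hε hε1
  have hs : 0 ≤ σ ^ (ε / 2) := by positivity
  calc A * (l * (H + X) + H ^ 2 * H ^ ε)
      ≤ A * ((2 * A ^ 2 * σ) * (10 * A ^ 6 * σ ^ (ε / 2) + 10 * A ^ 6 * σ ^ (ε / 2)) + (10 * A ^ 6 * σ) * (10 * A ^ 6 * σ ^ (ε / 2))) := by
        gcongr <;> linarith
    _ = (40 * A ^ 9 + 100 * A ^ 13) * (σ * σ ^ (ε / 2)) := by ring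
    _ ≤ _ := by
      have := hAA 9 20 n%
      have := hAA 13 20 n%
      have : 40 * A ^ 9 + 100 * A ^ 13 ≤ 300 * A ^ 20 := by nlinarith [pow_pos (by linarith : 0 < A) 20]
      gcongr
end

section
open Filter Topology

variable {E : Type*} [NormedAddCommGroup E] [InnerProductSpace ℂ E]

theorem core_est {a0 : E →L[ℂ] ℂ} {b0 : E →L[ℂ] E →L[ℂ] ℂ} {T0 : E →L[ℂ] E} {ν : E} {A ε : ℝ} (hA : 1 ≤ A)
    (hT1 : ∀ X, ‖T0 X‖ ≤ A * ‖X‖) (hT2 : ∀ X, ‖X‖ ≤ A * ‖T0 X‖) (hν : ‖ν‖ ≤ A) (ha0 : ∀ X, ‖a0 X‖ ≤ A * ‖X‖)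
    (hb : ∀ X Y, ‖b0 X Y‖ ≤ A * ‖X‖ * ‖Y‖) (hν2 : 1 / 2 ≤ ‖a0 ν‖) {κ r : ℝ} {lam W : ℂ} {h X : E} (hκ : 0 < κ)
    (hh : h = X + lam • ν) (ha : a0 X = 0) (hW : W = κ - 2 * a0 h - b0 X X)
    (hr : |r + κ - (2 * (a0 h).re + (b0 h h).re) - ‖T0 h‖ ^ 2| ≤ A * (‖h‖ ^ 2 * ‖h‖ ^ ε)) :
    ‖lam‖ ≤ κ + ‖W‖ + A * ‖X‖ ^ 2 ∧ |r + W.re - ‖T0 X‖ ^ 2| ≤ 2 * A ^ 3 * (‖lam‖ * (‖h‖ + ‖X‖)) + A * (‖h‖ ^ 2 * ‖h‖ ^ ε) ∧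
    ‖h‖ ≤ ‖X‖ + A * ‖lam‖ ∧ ‖X‖ ≤ 3 * A ^ 2 * ‖h‖ ∧
    (r < 0 → ‖h‖ ^ 2 ≤ A ^ 2 * (‖W‖ + A ^ 2 * (‖lam‖ * (‖h‖ + ‖X‖)) + A * (‖h‖ ^ 2 * ‖h‖ ^ ε))) ∧
    ‖W‖ ≤ κ + 2 * A * ‖h‖ + A * ‖X‖ ^ 2 := by
  have hah : a0 h = lam * a0 ν := by rw [hh]; simp [ha]
  have hln : ‖lam • ν‖ ≤ A * ‖lam‖ := by rw [norm_smul, mul_comm]; gcongr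
  have hbX : ‖b0 X X‖ ≤ A * ‖X‖ ^ 2 := (hb X X).trans (by rw [pow_two, mul_assoc])
  have hl2 : ‖lam‖ ≤ 2 * ‖a0 h‖ := by
    rw [hah, norm_mul]; nlinarith [norm_nonneg lam]
  have h1 : ‖lam‖ ≤ κ + ‖W‖ + A * ‖X‖ ^ 2 := by
    have e : 2 * a0 h = κ - W - b0 X X := by rw [hW]; ring
    have e2 : 2 * ‖a0 h‖ = ‖2 * a0 h‖ := by simp
    rw [e] at e2
    have := norm_sub_le (κ - W) (b0 X X)
    have h3 := norm_sub_le (κ : ℂ) W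
    rw [Complex.norm_real, Real.norm_of_nonneg hκ.le] at h3
    linarith
  have hX : X = h - lam • ν := by rw [hh]; simp
  have h3 : ‖h‖ ≤ ‖X‖ + A * ‖lam‖ := by
    have := norm_add_le X (lam • ν); rw [← hh] at this; linarith
  have h4 : ‖X‖ ≤ 3 * A ^ 2 * ‖h‖ := by
    have q := norm_sub_le h (lam • ν); rw [← hX] at q
    have q2 : A * ‖lam‖ ≤ A * (2 * (A * ‖h‖)) := by gcongr; exact hl2.trans (by gcongr; exact ha0 h)
    have : 1 * ‖h‖ ≤ A ^ 2 * ‖h‖ := by gcongr; nlinarith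
    nlinarith
  have hbd : ‖b0 h h - b0 X X‖ ≤ A ^ 2 * (‖lam‖ * (‖h‖ + ‖X‖)) := by
    have e : b0 h h - b0 X X = b0 (lam • ν) h + b0 X (lam • ν) := by
      conv_lhs => rw [show b0 h = b0 X + b0 (lam • ν) by rw [hh, map_add]]
      conv_lhs => rw [ContinuousLinearMap.add_apply]
      rw [show b0 X h = b0 X X + b0 X (lam • ν) by rw [← map_add, ← hh]]
      ring
    rw [e]
    have q1 := hb (lam • ν) h
    have q2 := hb X (lam • ν)
    have q3 : A * ‖lam • ν‖ * ‖h‖ ≤ A * (A * ‖lam‖) * ‖h‖ := by gcongr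
    have q4 : A * ‖X‖ * ‖lam • ν‖ ≤ A * ‖X‖ * (A * ‖lam‖) := by gcongr
    have := norm_add_le (b0 (lam • ν) h) (b0 X (lam • ν))
    nlinarith
  have hTd : |‖T0 h‖ ^ 2 - ‖T0 X‖ ^ 2| ≤ A ^ 3 * (‖lam‖ * (‖h‖ + ‖X‖)) := by
    have e : ‖T0 h‖ ^ 2 - ‖T0 X‖ ^ 2 = (‖T0 h‖ - ‖T0 X‖) * (‖T0 h‖ + ‖T0 X‖) := by ring
    rw [e, abs_mul, abs_of_nonneg (a := ‖T0 h‖ + ‖T0 X‖) p%]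
    have q1 : |‖T0 h‖ - ‖T0 X‖| ≤ A * (A * ‖lam‖) := by
      refine (abs_norm_sub_norm_le _ _).trans ?_
      rw [← map_sub, show h - X = lam • ν by rw [hh]; simp]
      exact (hT1 _).trans (by gcongr)
    have q2 : ‖T0 h‖ + ‖T0 X‖ ≤ A * (‖h‖ + ‖X‖) := by linarith [hT1 h, hT1 X]
    calc _ ≤ A * (A * ‖lam‖) * (A * (‖h‖ + ‖X‖)) := by gcongr
      _ = _ := by ring
  have hWre : W.re = κ - 2 * (a0 h).re - (b0 X X).re := by rw [hW]; simp
  have hbr := (Complex.abs_re_le_norm _).trans hbd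
  rw [Complex.sub_re] at hbr
  have hP : 0 ≤ ‖lam‖ * (‖h‖ + ‖X‖) := by positivity
  have hA23 : A ^ 2 * (‖lam‖ * (‖h‖ + ‖X‖)) ≤ A ^ 3 * (‖lam‖ * (‖h‖ + ‖X‖)) := by gcongr; norm_num
  rw [abs_le] at hbr hTd hr
  refine ⟨h1, ?_, h3, h4, ?_, ?_⟩
  · rw [hWre, abs_le]; constructor <;> linarith [hbr.1, hbr.2, hTd.1, hTd.2, hr.1, hr.2]
  · intro hr0
    have q : ‖h‖ ^ 2 ≤ A ^ 2 * ‖T0 h‖ ^ 2 := by rw [← mul_pow]; gcongr; exact hT2 h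
    refine q.trans ?_
    gcongr
    have := (Complex.re_le_norm W)
    rw [hWre] at this
    linarith [hbr.1, hbr.2, hr.1, hr.2]
  · rw [hW]
    have q1 := norm_sub_le ((κ : ℂ) - 2 * a0 h) (b0 X X)
    have q2 := norm_sub_le (κ : ℂ) (2 * a0 h)
    rw [Complex.norm_real, Real.norm_of_nonneg hκ.le, norm_mul, Complex.norm_ofNat] at q2
    linarith [ha0 h]

theorem near_fin {κ ε B x : ℝ} {W : ℂ} (hκ : 0 < κ) (hB : 0 < B) (hε : 0 < ε) (hε1 : ε ≤ 1) (hx : x ≤ W.re)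
    (d1 : -(B * ((κ + ‖W‖) * (κ + ‖W‖) ^ (ε / 2))) ≤ x) (d2 : B * (κ + ‖W‖) ^ (ε / 2) ≤ 1 / 8) :
    (κ:ℂ) + W ≠ 0 ∧ -(16 * B * κ ^ (ε / 2)) ≤ 4 * κ * x / ‖(κ:ℂ) + W‖ ^ 2 := by
  obtain ⟨σ, hσd⟩ := ex_eq (κ + ‖W‖)
  have hσ : 0 < σ := by rw [hσd]; positivity
  rw [← hσd] at d1 d2
  have hσκ : κ ≤ σ := by linarith [norm_nonneg W]
  have hn : ‖(κ:ℂ) + W‖ ^ 2 = κ ^ 2 + 2 * κ * W.re + ‖W‖ ^ 2 := by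
    rw [Complex.sq_norm, Complex.sq_norm, Complex.normSq_apply, Complex.normSq_apply]; simp; ring
  have hn2 : σ ^ 2 / 4 ≤ ‖(κ:ℂ) + W‖ ^ 2 := by
    have e0 : B * (σ * σ ^ (ε / 2)) ≤ 1 / 8 * σ := by nlinarith
    have e1 : -(1 / 8 * σ) ≤ W.re := by linarith
    have : 2 * κ * (-(1 / 8 * σ)) ≤ 2 * κ * W.re := by gcongr
    have hW2 : ‖W‖ = σ - κ := by linarith
    rw [hn, hW2]
    nlinarith [sq_nonneg (σ - 2 * κ)]
  have hpos : 0 < ‖(κ:ℂ) + W‖ ^ 2 := by nlinarith [sq_nonneg σ]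
  refine ⟨fun h0 => by rw [h0] at hpos; simp at hpos, ?_⟩
  rw [le_div_iff₀ hpos]
  have e1 : κ * σ ^ (ε / 2) ≤ κ ^ (ε / 2) * σ := by
    have q1 : κ = κ ^ (ε / 2) * κ ^ (1 - ε / 2) := by rw [← Real.rpow_add hκ]; simp
    have q2 : σ = σ ^ (1 - ε / 2) * σ ^ (ε / 2) := by rw [← Real.rpow_add hσ]; simp
    calc κ * σ ^ (ε / 2) = κ ^ (ε / 2) * κ ^ (1 - ε / 2) * σ ^ (ε / 2) := by rw [← q1]
      _ ≤ κ ^ (ε / 2) * σ ^ (1 - ε / 2) * σ ^ (ε / 2) := by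
        have := Real.rpow_le_rpow hκ.le hσκ (by linarith : 0 ≤ 1 - ε / 2)
        gcongr
      _ = κ ^ (ε / 2) * σ := by rw [mul_assoc, ← q2]
  have e2 : 16 * B * κ ^ (ε / 2) * (σ ^ 2 / 4) ≤ 16 * B * κ ^ (ε / 2) * ‖(κ:ℂ) + W‖ ^ 2 := by gcongr
  have e3 : 4 * B * σ * (κ * σ ^ (ε / 2)) ≤ 4 * B * σ * (κ ^ (ε / 2) * σ) := by gcongr
  have e4 := mll d1 (by positivity : 0 ≤ 4 * κ)
  nlinarith

theorem near_est {A ε : ℝ} (hA : 1 ≤ A) (hε : 0 < ε) (hε1 : ε ≤ 1) : ∃ B > 0, ∀ s0 > 0, ∃ s2 : ℝ, 0 < s2 ∧ s2 ≤ s0 ∧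
    ∀ {a0 : E →L[ℂ] ℂ} {b0 : E →L[ℂ] E →L[ℂ] ℂ} {T0 : E →L[ℂ] E} {ν : E}
    (_ : ∀ X, ‖T0 X‖ ≤ A * ‖X‖) (_ : ∀ X, ‖X‖ ≤ A * ‖T0 X‖) (_ : ‖ν‖ ≤ A) (_ : ∀ X, ‖a0 X‖ ≤ A * ‖X‖)
    (_ : ∀ X Y, ‖b0 X Y‖ ≤ A * ‖X‖ * ‖Y‖) (_ : 1 / 2 ≤ ‖a0 ν‖) {κ r : ℝ} {lam W : ℂ} {h X : E} (_ : 0 < κ)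
    (_ : h = X + lam • ν) (_ : a0 X = 0) (_ : W = κ - 2 * a0 h - b0 X X)
    (_ : |r + κ - (2 * (a0 h).re + (b0 h h).re) - ‖T0 h‖ ^ 2| ≤ A * (‖h‖ ^ 2 * ‖h‖ ^ ε)), κ ≤ s2 → ‖h‖ ≤ s2 → r < 0 →
      (κ:ℂ) + W ≠ 0 ∧ -(16 * B * κ ^ (ε / 2)) ≤ 4 * κ * (W.re - ‖T0 X‖ ^ 2) / ‖(κ:ℂ) + W‖ ^ 2 := by
  obtain ⟨B, hB, hB2⟩ := near_real (A := 11 * A ^ 8) (by nlinarith [one_le_pow₀ (n := 8) hA]) hε hε1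
  refine ⟨B, hB, fun s0 hs0 => ?_⟩
  obtain ⟨s2, h2, h20, h3⟩ := hB2 (min s0 1) p%
  refine ⟨s2, h2, h20.trans (min_le_left _ _), ?_⟩
  intro a0 b0 T0 ν hT1 hT2 hν ha0 hb hν2 κ r lam W h X hκ hh ha hW hr hκs hhs hr0
  obtain ⟨c1, c2, c3, c4, c5, c6⟩ := core_est hA hT1 hT2 hν ha0 hb hν2 hκ hh ha hW hr
  have c5 := c5 hr0
  have hH1 : ‖h‖ ≤ 1 := hhs.trans (h20.trans (min_le_right _ _))
  have hAA : ∀ i j : ℕ, i ≤ j → A ^ i ≤ A ^ j := fun i j h => pow_le_pow_right₀ hA h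
  have hX2 : A * ‖X‖ ^ 2 ≤ 9 * A ^ 5 * ‖h‖ ^ 2 := by
    calc A * ‖X‖ ^ 2 ≤ A * (3 * A ^ 2 * ‖h‖) ^ 2 := by gcongr
      _ = _ := by ring
  have hlX : ‖lam‖ * (‖h‖ + ‖X‖) ≤ 4 * A ^ 2 * (‖lam‖ * ‖h‖) := by
    have : 1 * ‖h‖ ≤ A ^ 2 * ‖h‖ := by gcongr; nlinarith
    calc ‖lam‖ * (‖h‖ + ‖X‖) ≤ ‖lam‖ * (4 * A ^ 2 * ‖h‖) := by gcongr; linarith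
      _ = _ := by ring
  have p0 : 0 ≤ ‖lam‖ * ‖h‖ := by positivity
  have p1 : 0 ≤ ‖h‖ ^ 2 * ‖h‖ ^ ε := by positivity
  have A0 := hAA 0 8 n%
  have A1 := hAA 1 8 n%
  have A2 := hAA 2 8 n%
  have A3 := hAA 3 8 n%
  have A5 := hAA 5 8 n%
  have A6 := hAA 6 8 n%
  have A00 : 0 < A ^ 8 := by positivity
  have hσ : 0 < κ + ‖W‖ := by positivity
  rw [pow_zero] at A0; rw [pow_one] at A1
  obtain ⟨d1, d2⟩ := h3 κ ‖h‖ ‖lam‖ (κ + ‖W‖) (W.re - ‖T0 X‖ ^ 2) hκ (by linarith [norm_nonneg W]) (norm_nonneg _) hhs hκs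
    (norm_nonneg _) (by
      have e1 : 9 * A ^ 5 * ‖h‖ ^ 2 ≤ 11 * A ^ 8 * ‖h‖ ^ 2 := by gcongr; norm_num
      have e2 : 1 * (κ + ‖W‖) ≤ 11 * A ^ 8 * (κ + ‖W‖) := by gcongr; linarith
      linarith) (by
      refine c5.trans ?_
      have e1 : A ^ 2 * ‖W‖ ≤ 11 * A ^ 8 * (κ + ‖W‖) := by gcongr <;> linarith
      have e2 : A ^ 4 * (‖lam‖ * (‖h‖ + ‖X‖)) ≤ A ^ 4 * (4 * A ^ 2 * (‖lam‖ * ‖h‖)) := by gcongr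
      have e3 : 4 * A ^ 6 * (‖lam‖ * ‖h‖) ≤ 11 * A ^ 8 * (‖lam‖ * ‖h‖) := by gcongr; norm_num
      have e4 : A ^ 3 * (‖h‖ ^ 2 * ‖h‖ ^ ε) ≤ 11 * A ^ 8 * (‖h‖ ^ 2 * ‖h‖ ^ ε) := by gcongr; linarith
      linarith) (by
      have e0 : ‖h‖ ^ 2 ≤ ‖h‖ := by nlinarith [norm_nonneg h]
      have e1 : 9 * A ^ 5 * ‖h‖ ^ 2 ≤ 9 * A ^ 8 * ‖h‖ := by gcongr
      have e2 : 2 * A * ‖h‖ ≤ 2 * A ^ 8 * ‖h‖ := by gcongr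
      have e3 : 2 * κ ≤ 11 * A ^ 8 * κ := by gcongr; linarith
      linarith) (by
      have e2 : 2 * A ^ 3 * (‖lam‖ * (‖h‖ + ‖X‖)) ≤ 2 * A ^ 3 * (4 * A ^ 2 * (‖lam‖ * ‖h‖)) := by gcongr
      have e3 : 8 * A ^ 5 * (‖lam‖ * ‖h‖) ≤ 11 * A ^ 8 * (‖lam‖ * ‖h‖) := by gcongr; norm_num
      have e4 : A * (‖h‖ ^ 2 * ‖h‖ ^ ε) ≤ 11 * A ^ 8 * (‖h‖ ^ 2 * ‖h‖ ^ ε) := by gcongr; linarith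
      rw [abs_le] at c2
      linarith [c2.1])
  exact near_fin hκ hB hε hε1 (by linarith [sq_nonneg ‖T0 X‖]) d1 d2
end

section
open Filter Topology
open scoped InnerProductSpace

variable {E : Type*} [NormedAddCommGroup E] [InnerProductSpace ℂ E]

theorem ksig {κ σ ε : ℝ} (hκ : 0 < κ) (hσκ : κ ≤ σ) (hε1 : ε ≤ 1) : κ * σ ^ (ε / 2) ≤ κ ^ (ε / 2) * σ := by
  have hσ := hκ.trans_le hσκ
  have q1 : κ = κ ^ (ε / 2) * κ ^ (1 - ε / 2) := by rw [← Real.rpow_add hκ]; simp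
  have q2 : σ = σ ^ (1 - ε / 2) * σ ^ (ε / 2) := by rw [← Real.rpow_add hσ]; simp
  calc κ * σ ^ (ε / 2) = κ ^ (ε / 2) * κ ^ (1 - ε / 2) * σ ^ (ε / 2) := by rw [← q1]
    _ ≤ κ ^ (ε / 2) * σ ^ (1 - ε / 2) * σ ^ (ε / 2) := by
      have := Real.rpow_le_rpow hκ.le hσκ (by linarith : 0 ≤ 1 - ε / 2)
      gcongr
    _ = κ ^ (ε / 2) * σ := by rw [mul_assoc, ← q2]

theorem cayley_norm {N Z : E} {κ : ℝ} {W : ℂ} (hN : ‖N‖ = 1) (hNZ : ⟪N, Z⟫_ℂ = 0) (hκ : 0 < κ) (hW : (κ:ℂ) + W ≠ 0) :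
    ‖((κ:ℂ) + W)⁻¹ • ((2 * (√κ : ℂ)) • Z + ((κ:ℂ) - W) • N)‖ ^ 2 = 1 - 4 * κ * (W.re - ‖Z‖ ^ 2) / ‖(κ:ℂ) + W‖ ^ 2 := by
  have h0 : 0 < ‖(κ:ℂ) + W‖ := norm_pos_iff.2 hW
  have hZN : ⟪Z, N⟫_ℂ = 0 := by rw [← inner_conj_symm, hNZ, map_zero]
  have e : ‖(2 * (√κ : ℂ)) • Z + ((κ:ℂ) - W) • N‖ ^ 2 = 4 * κ * ‖Z‖ ^ 2 + ‖(κ:ℂ) - W‖ ^ 2 := by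
    have := norm_add_sq_eq_norm_sq_add_norm_sq_of_inner_eq_zero (𝕜 := ℂ) ((2 * (√κ : ℂ)) • Z) (((κ:ℂ) - W) • N)
      (by rw [inner_smul_left, inner_smul_right, hZN]; simp)
    rw [pow_two, this, norm_smul, norm_smul, hN, norm_mul, Complex.norm_real, Real.norm_of_nonneg (Real.sqrt_nonneg _),
      Complex.norm_ofNat]
    linear_combination 4 * ‖Z‖ ^ 2 * Real.mul_self_sqrt hκ.le
  have e2 : ‖(κ:ℂ) - W‖ ^ 2 = ‖(κ:ℂ) + W‖ ^ 2 - 4 * κ * W.re := by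
    rw [Complex.sq_norm, Complex.sq_norm, Complex.normSq_apply, Complex.normSq_apply]; simp; ring
  rw [norm_smul, mul_pow, e, e2, norm_inv]
  field_simp
  ring

set_option maxHeartbeats 1000000 in
theorem onto_est {A ε : ℝ} (hA : 1 ≤ A) (hε : 0 < ε) (hε1 : ε ≤ 1) : ∃ C2 > 0, ∀ s0 > 0, ∃ s3 > 0,
    ∀ {κ C : ℝ} {W : ℂ} {z X l : ℝ}, 0 < κ → κ ≤ s3 → (κ:ℂ) + W ≠ 0 → C2 ≤ C →
    C * κ ^ (ε / 2) ≤ 4 * κ * (W.re - z ^ 2) / ‖(κ:ℂ) + W‖ ^ 2 → 0 ≤ z → 0 ≤ X → X ≤ A * z → 0 ≤ l → l ≤ κ + ‖W‖ + A * X ^ 2 →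
    ∀ H, 0 ≤ H → H ≤ X + A * l → H < s0 ∧ ∀ r, (|r + W.re - z ^ 2| ≤ 2 * A ^ 3 * (l * (H + X)) + A * (H ^ 2 * H ^ ε)) → r < 0 := by
  have hAA : ∀ i j : ℕ, i ≤ j → A ^ i ≤ A ^ j := fun i j h => pow_le_pow_right₀ hA h
  have A3 := hAA 0 3 n%
  have A13 := hAA 1 3 n%
  have A23 := hAA 2 3 n%
  rw [pow_zero] at A3; rw [pow_one] at A13
  obtain ⟨B, hB, hB2⟩ := onto_real (A := 2 * A ^ 3) l% hε hε1
  refine ⟨8 * B + 8, by positivity, fun s0 hs0 => ?_⟩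
  obtain ⟨s3, hs3, h3⟩ := hB2 s0 hs0
  refine ⟨min 1 (s3 ^ 2), by positivity, ?_⟩
  intro κ C W z X l hκ hκs hW hC h hz hX hXz hl hl2 H hH hH2
  have hκ1 := hκs.trans (min_le_left _ _)
  have hκ2 := hκs.trans (min_le_right _ _)
  have hp : 0 < ‖(κ:ℂ) + W‖ ^ 2 := by have := norm_pos_iff.2 hW; positivity
  have hk : 0 < κ ^ (ε / 2) := by positivity
  rw [le_div_iff₀ hp] at h
  have hC0 : 0 < C := by linarith
  have hx : 0 ≤ W.re - z ^ 2 := by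
    by_contra hc; push Not at hc
    have : 0 < C * κ ^ (ε / 2) * ‖(κ:ℂ) + W‖ ^ 2 := by positivity
    nlinarith
  have hre : 0 ≤ W.re := by nlinarith
  have hn : ‖(κ:ℂ) + W‖ ^ 2 = κ ^ 2 + 2 * κ * W.re + ‖W‖ ^ 2 := by
    rw [Complex.sq_norm, Complex.sq_norm, Complex.normSq_apply, Complex.normSq_apply]; simp; ring
  obtain ⟨σ, hσ⟩ := ex_eq (κ + ‖W‖)
  have hσκ : κ ≤ σ := by linarith [norm_nonneg W]
  have hσ0 : 0 < σ := by linarith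
  have hn2 : σ ^ 2 / 2 ≤ ‖(κ:ℂ) + W‖ ^ 2 := by
    rw [hn, hσ]; nlinarith [sq_nonneg (κ - ‖W‖), mul_nonneg hκ.le hre]
  have h4 : C * κ ^ (ε / 2) * σ ^ 2 ≤ 8 * κ * (W.re - z ^ 2) := by
    have : C * κ ^ (ε / 2) * (σ ^ 2 / 2) ≤ C * κ ^ (ε / 2) * ‖(κ:ℂ) + W‖ ^ 2 := by gcongr
    linarith
  have hWσ : W.re ≤ σ := by linarith [Complex.re_le_norm W]
  have h5 : σ ≤ s3 := by
    have q1 : C * κ ^ (ε / 2) * σ ≤ 8 * κ := by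
      have : C * κ ^ (ε / 2) * σ ^ 2 ≤ 8 * κ * σ := h4.trans (by gcongr; nlinarith)
      nlinarith
    have q2 : κ ^ (ε / 2) * σ ≤ κ := by
      have : 8 * (κ ^ (ε / 2) * σ) ≤ C * (κ ^ (ε / 2) * σ) := by gcongr; linarith
      linarith
    have q3 : κ ^ (1/2 : ℝ) ≤ κ ^ (ε / 2) := Real.rpow_le_rpow_of_exponent_ge hκ hκ1 l%
    rw [← Real.sqrt_eq_rpow] at q3
    have q4 : √κ ≤ s3 := Real.sqrt_le_iff.2 ⟨hs3.le, hκ2⟩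
    have q5 : √κ * σ ≤ √κ * √κ := by rw [Real.mul_self_sqrt hκ.le]; exact (by gcongr : √κ * σ ≤ κ ^ (ε / 2) * σ).trans q2
    exact (le_of_mul_le_mul_left q5 (Real.sqrt_pos.2 hκ)).trans q4
  have hX2 : X ^ 2 ≤ 2 * A ^ 3 * σ := by
    calc X ^ 2 ≤ (A * z) ^ 2 := by gcongr
      _ = A ^ 2 * z ^ 2 := by ring
      _ ≤ (2 * A ^ 3) * σ := by gcongr <;> linarith
  obtain ⟨k1, k2⟩ := h3 X l H σ hX hl hH hσ0 h5 hX2 (by rw [← hσ] at hl2; nlinarith [mul_nonneg (by linarith : 0 ≤ A ^ 3 - A) (sq_nonneg X), sq_nonneg X]) (by nlinarith)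
  refine ⟨k1, fun r hr => ?_⟩
  have h6 := ksig hκ hσκ hε1
  have h7 : C / 8 * (σ * σ ^ (ε / 2)) ≤ W.re - z ^ 2 := by
    have : C * σ * (κ * σ ^ (ε / 2)) ≤ C * σ * (κ ^ (ε / 2) * σ) := by gcongr
    have : κ * (C / 8 * (σ * σ ^ (ε / 2))) ≤ κ * (W.re - z ^ 2) := by linarith
    exact le_of_mul_le_mul_left this hκ
  have h8 : 0 < σ * σ ^ (ε / 2) := by positivity
  have h9 : B * (σ * σ ^ (ε / 2)) < C / 8 * (σ * σ ^ (ε / 2)) := by gcongr; linarith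
  have hHε : 0 ≤ H ^ 2 * H ^ ε := by positivity
  have h10 : A * (H ^ 2 * H ^ ε) ≤ 2 * A ^ 3 * (H ^ 2 * H ^ ε) := by gcongr; linarith
  rw [abs_le] at hr
  linarith [hr.2]

theorem unit_normal [FiniteDimensional ℂ E] {a0 : E →L[ℂ] ℂ} {T0 : E →L[ℂ] E} {A : ℝ} (hT2 : ∀ X, ‖X‖ ≤ A * ‖T0 X‖) {ν : E} (hν : a0 ν ≠ 0) :
    Function.Bijective T0 ∧ ∃ N : E, ‖N‖ = 1 ∧ ∀ X, ⟪N, T0 X⟫_ℂ = 0 ↔ a0 X = 0 := by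
  have hinj : Function.Injective (T0 : E →ₗ[ℂ] E) := (injective_iff_map_eq_zero _).2 fun X hX => by
    have hX : T0 X = 0 := hX
    have := hT2 X; rw [hX] at this; simpa using this
  have hsurj := LinearMap.injective_iff_surjective.1 hinj
  refine ⟨⟨hinj, hsurj⟩, ?_⟩
  haveI := FiniteDimensional.complete ℂ E
  let e := LinearEquiv.ofBijective (T0 : E →ₗ[ℂ] E) ⟨hinj, hsurj⟩
  let φ : E →L[ℂ] ℂ := LinearMap.toContinuousLinearMap ((a0 : E →ₗ[ℂ] ℂ) ∘ₗ (e.symm : E →ₗ[ℂ] E))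
  obtain ⟨N0, hN0⟩ := (InnerProductSpace.toDual ℂ E).surjective φ
  have hi : ∀ X, ⟪N0, T0 X⟫_ℂ = a0 X := fun X => by
    rw [← InnerProductSpace.toDual_apply_apply, hN0]
    change a0 (e.symm (e X)) = a0 X
    rw [e.symm_apply_apply]
  have h0 : N0 ≠ 0 := fun h => hν (by rw [← hi, h, inner_zero_left])
  have hn : ‖N0‖ ≠ 0 := norm_ne_zero_iff.2 h0
  refine ⟨((‖N0‖⁻¹ : ℝ) : ℂ) • N0, ?_, fun X => ?_⟩
  · rw [norm_smul, Complex.norm_real, norm_inv, norm_norm, inv_mul_cancel₀ hn]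
  · rw [inner_smul_left, hi]
    simp [hn]
end

section
open Filter Topology
open scoped InnerProductSpace

variable {E : Type*} [NormedAddCommGroup E] [InnerProductSpace ℂ E] [FiniteDimensional ℂ E]

theorem ev_norm_lt {X F : Type*} [TopologicalSpace X] [NormedAddCommGroup F] {g : X → F} {x : X} {A : ℝ} (hg : ContinuousAt g x) (h : ‖g x‖ < A) :
    ∀ᶠ y in 𝓝 x, ‖g y‖ < A := hg.norm.eventually (gt_mem_nhds h)

theorem exposed_pt {a0 : E →L[ℂ] ℂ} {b0 : E →L[ℂ] E →L[ℂ] ℂ} {T0 : E →L[ℂ] E} {ν : E} {A : ℝ} (hT2 : ∀ X, ‖X‖ ≤ A * ‖T0 X‖)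
    (hν : a0 ν ≠ 0) {S : Set E} {y0 : E} (hy0 : y0 ∈ S) {κ k C1 C2 : ℝ} (hκ : 0 < κ) (hk : 0 < k) (hC1 : 0 < C1) (hC2 : 0 < C2)
    (hup : ∀ y ∈ S, ∀ (lam W : ℂ) (X : E), y - y0 = X + lam • ν → a0 X = 0 → W = κ - 2 * a0 (y - y0) - b0 X X →
      (κ:ℂ) + W ≠ 0 ∧ -(C1 * k) ≤ 4 * κ * (W.re - ‖T0 X‖ ^ 2) / ‖(κ:ℂ) + W‖ ^ 2)
    (hon : ∀ (h X : E) (lam W : ℂ), h = X + lam • ν → a0 X = 0 → W = κ - 2 * a0 h - b0 X X → (κ:ℂ) + W ≠ 0 →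
      C2 * k ≤ 4 * κ * (W.re - ‖T0 X‖ ^ 2) / ‖(κ:ℂ) + W‖ ^ 2 → y0 + h ∈ S) :
    ∃ f : E → E, DifferentiableOn ℂ f S ∧ Set.InjOn f S ∧ Set.MapsTo f S (Metric.ball 0 1) ∧ f y0 = 0 ∧
      Metric.ball 0 (1 - (C1 + C2) * k) ⊆ f '' S := by
  obtain ⟨⟨hTi, hTs⟩, N, hN, hNT⟩ := unit_normal hT2 hν
  obtain ⟨L, hL⟩ := ex_eq (fun y => a0 (y - y0) / a0 ν : E → ℂ)
  obtain ⟨X, hX⟩ := ex_eq (fun y => (y - y0) - L y • ν : E → E)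
  obtain ⟨W, hW⟩ := ex_eq (fun y => κ - 2 * a0 (y - y0) - b0 (X y) (X y) : E → ℂ)
  obtain ⟨V, hV⟩ := ex_eq (fun y => ((κ:ℂ) + W y)⁻¹ • ((2 * (√κ : ℂ)) • T0 (X y) + ((κ:ℂ) - W y) • N) : E → E)
  have hh : ∀ y, y - y0 = X y + L y • ν := fun y => by rw [hX]; simp
  have haX : ∀ y, a0 (X y) = 0 := fun y => by rw [hX, hL]; simp [hν]
  have hWe : ∀ y, W y = κ - 2 * a0 (y - y0) - b0 (X y) (X y) := fun y => by rw [hW]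
  have dL : Differentiable ℂ L := by rw [hL]; fun_prop
  have dX : Differentiable ℂ X := by rw [hX]; fun_prop
  have dW : Differentiable ℂ W := by
    rw [hW]
    have : Differentiable ℂ fun y => b0 (X y) (X y) := fun y => (b0.differentiableAt.comp y dX.differentiableAt).clm_apply dX.differentiableAt
    fun_prop
  have hs : 0 < √κ := Real.sqrt_pos.2 hκ
  have hsc : (√κ : ℂ) ≠ 0 := by exact_mod_cast hs.ne'
  have hκc : (κ : ℂ) ≠ 0 := by exact_mod_cast hκ.ne'
  have hNX : ∀ y, ⟪N, T0 (X y)⟫_ℂ = 0 := fun y => (hNT _).2 (haX y)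
  have hNN : ⟪N, N⟫_ℂ = 1 := by rw [inner_self_eq_norm_sq_to_K, hN]; simp
  have hu := fun y hy => hup y hy (L y) (W y) (X y) (hh y) (haX y) (hWe y)
  have hc1 : 0 < 1 + C1 * k := by positivity
  have hc1c : ((1 + C1 * k : ℝ) : ℂ) ≠ 0 := by exact_mod_cast hc1.ne'
  have hVn : ∀ y ∈ S, ‖V y‖ < 1 + C1 * k := fun y hy => by
    have := cayley_norm hN (hNX y) hκ (hu y hy).1
    have e : ‖V y‖ ^ 2 ≤ 1 + C1 * k := by rw [hV]; simp only; rw [this]; linarith [(hu y hy).2]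
    have : 0 < C1 * k := by positivity
    nlinarith [norm_nonneg (V y)]
  refine ⟨fun y => ((1 + C1 * k : ℝ) : ℂ)⁻¹ • V y, ?_, ?_, ?_, ?_, ?_⟩
  · intro y hy
    refine DifferentiableAt.differentiableWithinAt ?_
    refine DifferentiableAt.const_smul ?_ _
    rw [hV]
    refine DifferentiableAt.smul (DifferentiableAt.inv ((differentiableAt_const _).add dW.differentiableAt) (hu y hy).1) ?_
    exact ((T0.differentiableAt.comp y dX.differentiableAt).const_smul _).add (((differentiableAt_const _).sub dW.differentiableAt).smul_const N)
  · intro y hy y' hy' he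
    have he : V y = V y' := smul_right_injective E (inv_ne_zero hc1c) he
    have hi : ∀ y ∈ S, ⟪N, V y⟫_ℂ * (κ + W y) = κ - W y := fun y hy => by
      have := (hu y hy).1
      rw [hV]; simp only
      rw [inner_smul_right, inner_add_right, inner_smul_right, inner_smul_right, hNX, hNN]
      field_simp; ring
    have hWW : W y = W y' := by
      have e1 := hi y hy; have e2 := hi y' hy'
      rw [he] at e1
      have : (κ:ℂ) * (W y - W y') = 0 := by
        linear_combination ((κ + W y' : ℂ) / 2) * e1 - ((κ + W y : ℂ) / 2) * e2
      simpa [hκc, sub_eq_zero] using this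
    have hXX : X y = X y' := by
      rw [hV] at he; simp only at he
      have n := (hu y' hy').1
      rw [hWW, smul_right_inj (inv_ne_zero n), add_left_inj, smul_right_inj (mul_ne_zero two_ne_zero hsc)] at he
      exact hTi he
    have haa : a0 (y - y0) = a0 (y' - y0) := by
      have e1 := hWe y; have e2 := hWe y'
      rw [hWW, hXX] at e1
      linear_combination (1/2) * (e1 - e2)
    have : y - y0 = y' - y0 := by
      rw [hh y, hh y', hXX, hL]; simp only; rw [haa]
    simpa using this
  · intro y hy
    rw [mem_ball_zero_iff, norm_smul, norm_inv, Complex.norm_real, Real.norm_of_nonneg hc1.le, inv_mul_lt_iff₀ hc1, mul_one]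
    exact hVn y hy
  · have hX0 : X y0 = 0 := by rw [hX, hL]; simp
    have hW0 : W y0 = κ := by rw [hWe, hX0]; simp
    simp only; rw [hV]; simp [hX0, hW0]
  · intro v hv
    rw [mem_ball_zero_iff] at hv
    obtain ⟨U, hU⟩ := ex_eq (((1 + C1 * k : ℝ) : ℂ) • v)
    have hUn : ‖U‖ ≤ 1 - C2 * k := by
      rw [hU, norm_smul, Complex.norm_real, Real.norm_of_nonneg hc1.le]
      have := mll hv.le hc1.le
      have p1 : 0 < C1 * k := by positivity
      have p2 : 0 < C2 * k := by positivity
      nlinarith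
    have p2 : 0 < C2 * k := by positivity
    obtain ⟨t, ht⟩ := ex_eq (⟪N, U⟫_ℂ)
    have htn : ‖t‖ < 1 := by
      have := norm_inner_le_norm (𝕜 := ℂ) N U
      rw [hN, ← ht] at this; linarith
    have ht1 : 1 + t ≠ 0 := fun h0 => by
      rw [show t = -1 by linear_combination h0] at htn; simp at htn
    obtain ⟨w, hw⟩ := ex_eq (κ * (1 - t) / (1 + t) : ℂ)
    have hw1 : κ + w = 2 * κ / (1 + t) := by rw [hw]; field_simp; ring
    have hw0 : κ + w ≠ 0 := by rw [hw1]; exact div_ne_zero (mul_ne_zero two_ne_zero hκc) ht1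
    have hw2 : κ - w = t * (κ + w) := by rw [hw1, hw]; field_simp; ring
    obtain ⟨Z, hZ⟩ := ex_eq (((κ + w) / (2 * (√κ : ℂ))) • (U - t • N))
    obtain ⟨x, hx⟩ := hTs Z
    have hx : T0 x = Z := hx
    have hNZ : ⟪N, Z⟫_ℂ = 0 := by
      rw [hZ, inner_smul_right, inner_sub_right, inner_smul_right, hNN, ← ht]; simp
    have hax : a0 x = 0 := (hNT x).1 (by rw [hx, hNZ])
    have hUe : U = ((κ:ℂ) + w)⁻¹ • ((2 * (√κ : ℂ)) • Z + ((κ:ℂ) - w) • N) := by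
      rw [hw2, hZ, smul_smul, mul_div_cancel₀ _ (mul_ne_zero two_ne_zero hsc), mul_comm t, mul_smul, ← smul_add, smul_smul,
        inv_mul_cancel₀ hw0, one_smul, sub_add_cancel]
    have hUn2 := cayley_norm hN hNZ hκ hw0
    rw [← hUe] at hUn2
    obtain ⟨l, hl⟩ := ex_eq ((κ - w - b0 x x) / 2 / a0 ν : ℂ)
    have hah : a0 (x + l • ν) = (κ - w - b0 x x) / 2 := by
      rw [map_add, hax, zero_add, map_smul, smul_eq_mul, hl]; field_simp
    have hwe : w = κ - 2 * a0 (x + l • ν) - b0 x x := by rw [hah]; ring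
    have hm : y0 + (x + l • ν) ∈ S := by
      refine hon _ x l w rfl hax hwe hw0 ?_
      rw [hx]
      nlinarith [norm_nonneg U]
    refine ⟨_, hm, ?_⟩
    have hLe : L (y0 + (x + l • ν)) = l := by rw [hL]; simp [hax, hν]
    have hXe : X (y0 + (x + l • ν)) = x := by rw [hX]; simp only; rw [hLe]; simp
    have hWe2 : W (y0 + (x + l • ν)) = w := by rw [hWe, hXe, add_sub_cancel_left, ← hwe]
    simp only
    rw [hV]; simp only
    rw [hXe, hWe2, hx, ← hUe, hU, smul_smul, inv_mul_cancel₀ hc1c, one_smul]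

theorem exposed {S : Set E} (hS : Bornology.IsBounded S) {ys : E} {rh : E → ℝ} {a : E → E →L[ℂ] ℂ} {b : E → E →L[ℂ] E →L[ℂ] ℂ} {T : E → E →L[ℂ] E}
    {s1 A ε : ℝ} (hs1 : 0 < s1) (hε : 0 < ε) (hε1 : ε ≤ 1)
    (hT : ∀ y0 ∈ Metric.ball ys s1, ∀ h, ‖h‖ < s1 → |rh (y0 + h) - rh y0 - (2 * (a y0 h).re + (b y0 h h).re) - ‖T y0 h‖ ^ 2| ≤ A * (‖h‖ ^ 2 * ‖h‖ ^ ε))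
    (hT1 : ∀ y0 ∈ Metric.ball ys s1, ∀ X, ‖T y0 X‖ ≤ A * ‖X‖) (hT2 : ∀ y0 ∈ Metric.ball ys s1, ∀ X, ‖X‖ ≤ A * ‖T y0 X‖)
    (ca : ContinuousAt a ys) (cb : ContinuousAt b ys) (cr : ContinuousAt rh ys) (hr0 : rh ys = 0) (ha0 : a ys ≠ 0)
    (hb0 : ∀ X, a ys X = 0 → b ys X X = 0) (hSr : ∀ y ∈ Metric.ball ys s1, y ∈ S ↔ rh y < 0)
    (he : ∀ t > 0, ∃ c > 0, ∀ y ∈ S, t ≤ ‖y - ys‖ → c ≤ ‖a ys (y - ys)‖) :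
    ∃ C > 0, ∃ t > 0, ∀ y0 ∈ S, ‖y0 - ys‖ < t → ∃ f : E → E, DifferentiableOn ℂ f S ∧ Set.InjOn f S ∧ Set.MapsTo f S (Metric.ball 0 1) ∧
      f y0 = 0 ∧ Metric.ball 0 (1 - C * (-rh y0) ^ (ε / 2)) ⊆ f '' S := by
  haveI := FiniteDimensional.proper ℂ E
  obtain ⟨ν, hν⟩ : ∃ ν, a ys ν = 1 := by
    obtain ⟨x, hx⟩ : ∃ x, a ys x ≠ 0 := by
      by_contra hc; push Not at hc; exact ha0 (ContinuousLinearMap.ext hc)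
    exact ⟨(a ys x)⁻¹ • x, by simp [hx]⟩
  obtain ⟨M, hM0, hM⟩ := hS.exists_pos_norm_le
  obtain ⟨A1, hA1, hA2, hA3, hA4, hA5⟩ : ∃ A1, 1 ≤ A1 ∧ A ≤ A1 ∧ ‖ν‖ ≤ A1 ∧ ‖a ys‖ < A1 ∧ ‖b ys‖ < A1 := by
    refine ⟨1 + |A| + ‖ν‖ + ‖a ys‖ + ‖b ys‖, ?_, ?_, ?_, ?_, ?_⟩ <;>
    linarith [abs_nonneg A, le_abs_self A, norm_nonneg ν, ContinuousLinearMap.opNorm_nonneg (a ys), ContinuousLinearMap.opNorm_nonneg (b ys)]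
  obtain ⟨B, hB, hnear⟩ := near_est (E := E) hA1 hε hε1
  obtain ⟨s2, hs2, hs21, hnear⟩ := hnear (s1 / 2) p%
  obtain ⟨C2, hC2, honto⟩ := onto_est hA1 hε hε1
  obtain ⟨s3, hs3, honto⟩ := honto (s1 / 2) p%
  obtain ⟨c, hc, hec⟩ := he (s2 / 2) p%
  let K := closure (S ∩ {y | s2 / 2 ≤ ‖y - ys‖})
  have hK : IsCompact K := Metric.isCompact_of_isClosed_isBounded isClosed_closure (hS.subset Set.inter_subset_left).closure
  have hKc : ∀ y ∈ K, c ≤ ‖a ys (y - ys)‖ := fun y hy => by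
    have hcl : IsClosed {y | c ≤ ‖a ys (y - ys)‖} := isClosed_le continuous_const (by fun_prop)
    exact closure_minimal (fun y hy => hec y hy.1 hy.2) hcl hy
  have ev1 : ∀ᶠ y0 in 𝓝 ys, ∀ y ∈ K, c < ‖2 * ((-rh y0 : ℝ) : ℂ) - 2 * a y0 (y - y0) - b y0 ((y - y0) - (a y0 (y - y0) / a y0 ν) • ν) ((y - y0) - (a y0 (y - y0) / a y0 ν) • ν)‖ := by
    refine hK.eventually_forall_of_forall_eventually fun y hy => ?_
    have c1 : ContinuousAt (fun z : E × E => a z.1) (ys, y) := ContinuousAt.comp (f := Prod.fst) (x := (ys, y)) ca continuousAt_fst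
    have c2 : ContinuousAt (fun z : E × E => b z.1) (ys, y) := ContinuousAt.comp (f := Prod.fst) (x := (ys, y)) cb continuousAt_fst
    have c3 : ContinuousAt (fun z : E × E => rh z.1) (ys, y) := ContinuousAt.comp (f := Prod.fst) (x := (ys, y)) cr continuousAt_fst
    have c4 : ContinuousAt (fun z : E × E => z.2 - z.1) (ys, y) := (continuous_snd.sub continuous_fst).continuousAt
    have c5 : ContinuousAt (fun z : E × E => a z.1 (z.2 - z.1)) (ys, y) := c1.clm_apply c4
    have c6 : ContinuousAt (fun z : E × E => a z.1 ν) (ys, y) := c1.clm_apply continuousAt_const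
    have c7 : ContinuousAt (fun z : E × E => (z.2 - z.1) - (a z.1 (z.2 - z.1) / a z.1 ν) • ν) (ys, y) :=
      c4.sub ((c5.div c6 (by simp [hν])).smul continuousAt_const)
    have c8 : ContinuousAt (fun z : E × E => ‖2 * ((-rh z.1 : ℝ) : ℂ) - 2 * a z.1 (z.2 - z.1) - b z.1 ((z.2 - z.1) - (a z.1 (z.2 - z.1) / a z.1 ν) • ν) ((z.2 - z.1) - (a z.1 (z.2 - z.1) / a z.1 ν) • ν)‖) (ys, y) :=
      ((((Complex.continuous_ofReal.continuousAt.comp c3.neg).const_mul 2).sub (c5.const_mul 2)).sub ((c2.clm_apply c7).clm_apply c7)).norm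
    refine c8.eventually (lt_mem_nhds ?_)
    simp only
    rw [hb0 _ (by simp [hν]), hr0]
    have := hKc y hy
    simp only [neg_zero, Complex.ofReal_zero, mul_zero, zero_sub, sub_zero, norm_neg, norm_mul, Complex.norm_ofNat]
    linarith
  have ev2 : ∀ᶠ y0 in 𝓝 ys, 1 / 2 < ‖a y0 ν‖ :=
    (ca.clm_apply continuousAt_const).norm.eventually (lt_mem_nhds (by simp only; rw [hν]; norm_num))
  have ev3 : ∀ᶠ y0 in 𝓝 ys, ‖a y0‖ < A1 := ca.norm.eventually (gt_mem_nhds hA4)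
  have ev4 : ∀ᶠ y0 in 𝓝 ys, ‖b y0‖ < A1 := by
    have := ev_norm_lt (F := E →L[ℂ] E →L[ℂ] ℂ) cb hA5
    exact this
  have ev5 : ∀ᶠ y0 in 𝓝 ys, -rh y0 < min 1 (min s2 s3) := cr.neg.eventually (gt_mem_nhds (by simp only [Pi.neg_apply]; rw [hr0, neg_zero]; positivity))
  have ev6 : ∀ᶠ y0 in 𝓝 ys, y0 ∈ Metric.ball ys (s2 / 2) := Metric.ball_mem_nhds _ p%
  obtain ⟨t, ht, htt⟩ := Metric.eventually_nhds_iff.1 (ev1.and (ev2.and (ev3.and (ev4.and (ev5.and ev6)))))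
  obtain ⟨D, hD⟩ := ex_eq ((A1 * (3 * A1 ^ 2 * (2 * M))) ^ 2 + (1 + 2 * A1 * (2 * M) + A1 * (3 * A1 ^ 2 * (2 * M)) ^ 2))
  have hD0 : 0 < D := by rw [hD]; positivity
  refine ⟨(16 * B + 4 * D / c ^ 2) + C2, by positivity, t, ht, fun y0 hy0 hy0t => ?_⟩
  obtain ⟨h1, h2, h3, h4, h5, h6⟩ := htt (by rwa [dist_eq_norm])
  rw [mem_ball_iff_norm] at h6
  have hball : y0 ∈ Metric.ball ys s1 := by rw [mem_ball_iff_norm]; linarith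
  have hκ : 0 < -rh y0 := by linarith [(hSr y0 hball).1 hy0]
  obtain ⟨κ, hκd⟩ := ex_eq (-rh y0)
  rw [← hκd] at hκ h5 ⊢
  have hκ1 : κ ≤ 1 := h5.le.trans (min_le_left _ _)
  have hκ2 : κ ≤ s2 := h5.le.trans ((min_le_right _ _).trans (min_le_left _ _))
  have hκ3 : κ ≤ s3 := h5.le.trans ((min_le_right _ _).trans (min_le_right _ _))
  have T1 : ∀ X, ‖T y0 X‖ ≤ A1 * ‖X‖ := fun X => (hT1 y0 hball X).trans (by gcongr)
  have T2 : ∀ X, ‖X‖ ≤ A1 * ‖T y0 X‖ := fun X => (hT2 y0 hball X).trans (by gcongr)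
  have a1 : ∀ X, ‖a y0 X‖ ≤ A1 * ‖X‖ := fun X => ((a y0).le_opNorm X).trans (by gcongr)
  have b1 : ∀ X Y, ‖b y0 X Y‖ ≤ A1 * ‖X‖ * ‖Y‖ := fun X Y => ((b y0).le_opNorm₂ X Y).trans (by gcongr)
  have R1 : ∀ h, ‖h‖ < s1 → |rh (y0 + h) + κ - (2 * (a y0 h).re + (b y0 h h).re) - ‖T y0 h‖ ^ 2| ≤ A1 * (‖h‖ ^ 2 * ‖h‖ ^ ε) := fun h hh => by
    have := (hT y0 hball h hh).trans (mlr hA2 (by positivity : 0 ≤ ‖h‖ ^ 2 * ‖h‖ ^ ε))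
    rw [hκd, ← sub_eq_add_neg]; exact this
  have hν0 : a y0 ν ≠ 0 := fun h0 => by rw [h0] at h2; norm_num at h2
  refine exposed_pt (κ := κ) (k := κ ^ (ε / 2)) (C1 := 16 * B + 4 * D / c ^ 2) (C2 := C2) (a0 := a y0) (b0 := b y0) (T0 := T y0) (ν := ν) T2 hν0 hy0 hκ p% p% hC2 ?_ ?_
  · intro y hy lam W X hh haX hW
    rcases le_or_gt ‖y - y0‖ s2 with hn | hf
    · have hyb : y ∈ Metric.ball ys s1 := by
        rw [mem_ball_iff_norm]
        have := norm_add_le (y - y0) (y0 - ys); rw [sub_add_sub_cancel] at this; linarith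
      have := R1 (y - y0) l%
      rw [add_sub_cancel] at this
      obtain ⟨q1, q2⟩ := hnear T1 T2 hA3 a1 b1 h2.le hκ hh haX hW this hκ2 hn ((hSr y hyb).1 hy)
      refine ⟨q1, le_trans ?_ q2⟩
      have : 0 ≤ 4 * D / c ^ 2 * κ ^ (ε / 2) := by positivity
      linarith
    · have hyK : y ∈ K := subset_closure ⟨hy, by
        change s2 / 2 ≤ ‖y - ys‖
        have := norm_sub_le (y - ys) (y0 - ys); rw [sub_sub_sub_cancel_right] at this; linarith⟩
      have hlam : a y0 (y - y0) / a y0 ν = lam := by rw [hh]; simp [haX, hν0]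
      have hXe : X = (y - y0) - lam • ν := by rw [hh]; simp
      have h7 := h1 y hyK
      rw [hlam, ← hXe, ← hκd] at h7
      have e : 2 * (κ:ℂ) - 2 * a y0 (y - y0) - b y0 X X = κ + W := by rw [hW]; ring
      rw [e] at h7
      refine ⟨fun h0 => by rw [h0, norm_zero] at h7; linarith, ?_⟩
      obtain ⟨d1, d2, d3, d4, d5, d6⟩ := core_est (r := -κ + (2 * (a y0 (y - y0)).re + (b y0 (y - y0) (y - y0)).re) + ‖T y0 (y - y0)‖ ^ 2) (ε := ε) hA1 T1 T2 hA3 a1 b1 h2.le hκ hh haX hW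
        (by
          ring_nf; rw [abs_zero]; positivity)
      have hyy : ‖y - y0‖ ≤ 2 * M := (norm_sub_le _ _).trans (by linarith [hM y hy, hM y0 hy0])
      have hXn : ‖X‖ ≤ 3 * A1 ^ 2 * (2 * M) := d4.trans (by gcongr)
      have hDn : ‖T y0 X‖ ^ 2 - W.re ≤ D := by
        have q1 : ‖T y0 X‖ ^ 2 ≤ (A1 * (3 * A1 ^ 2 * (2 * M))) ^ 2 := by
          have := (T1 X).trans (mll hXn (by linarith : 0 ≤ A1))
          gcongr
        have q2 : ‖W‖ ≤ 1 + 2 * A1 * (2 * M) + A1 * (3 * A1 ^ 2 * (2 * M)) ^ 2 := d6.trans (by gcongr)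
        have q3 := (abs_le.1 (Complex.abs_re_le_norm W)).1
        rw [hD]; linarith
      have hpp : 0 < ‖(κ:ℂ) + W‖ := hc.trans h7
      have hκe : κ ≤ κ ^ (ε / 2) := le_rpow_self hκ.le hκ1 p% l%
      rw [le_div_iff₀ p%]
      have q1 : 4 * κ * (‖T y0 X‖ ^ 2 - W.re) ≤ 4 * κ ^ (ε / 2) * D := by
        calc 4 * κ * (‖T y0 X‖ ^ 2 - W.re) ≤ 4 * κ * D := by gcongr
          _ ≤ _ := by gcongr
      have q2 : 4 * κ ^ (ε / 2) * D ≤ 4 * D / c ^ 2 * κ ^ (ε / 2) * ‖(κ:ℂ) + W‖ ^ 2 := by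
        calc 4 * κ ^ (ε / 2) * D = 4 * D / c ^ 2 * κ ^ (ε / 2) * c ^ 2 := by field_simp
          _ ≤ _ := by gcongr
      have q3 : 0 ≤ 16 * B * κ ^ (ε / 2) * ‖(κ:ℂ) + W‖ ^ 2 := by positivity
      linarith
  · intro h X lam W hh haX hW hW0 hge
    obtain ⟨d1, -, d3, -, -, -⟩ := core_est (r := -κ + (2 * (a y0 h).re + (b y0 h h).re) + ‖T y0 h‖ ^ 2) (ε := ε) hA1 T1 T2 hA3 a1 b1 h2.le hκ hh haX hW
        (by ring_nf; rw [abs_zero]; positivity)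
    obtain ⟨g1, g2⟩ := honto hκ hκ3 hW0 le_rfl hge (norm_nonneg _) (norm_nonneg X) (T2 X) (norm_nonneg lam) d1 ‖h‖ (norm_nonneg _) d3
    have hR := R1 h l%
    obtain ⟨-, d2, -, -, -, -⟩ := core_est hA1 T1 T2 hA3 a1 b1 h2.le hκ hh haX hW hR
    refine (hSr _ ?_).2 (g2 _ d2)
    rw [mem_ball_iff_norm]
    have := norm_add_le h (y0 - ys)
    rw [show y0 + h - ys = h + (y0 - ys) by abel]; linarith
end

section
open Complex ContDiff Filter Topology

variable {E : Type*} [NormedAddCommGroup E] [NormedSpace ℂ E] [NormedSpace ℝ E] [IsScalarTower ℝ ℂ E]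

theorem holo_dir {f : E → ℂ} (hf : ContDiff ℝ ∞ f) {U : Set E} (hU : IsOpen U) (h : ∀ y ∈ U, DifferentiableAt ℂ f y) (w : E) :
    ContDiff ℝ ∞ (fun x => fderiv ℝ f x w) ∧ ∀ y ∈ U, DifferentiableAt ℂ (fun x => fderiv ℝ f x w) y := by
  have h1 : ContDiff ℝ ∞ (fderiv ℝ f) := hf.fderiv_right s%
  have h2 : ∀ w, ContDiff ℝ ∞ (fun x => fderiv ℝ f x w) := fun w => h1.clm_apply contDiff_const
  have h3 : ∀ y, DifferentiableAt ℝ (fderiv ℝ f) y := fun y => (h1.differentiable s%) y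
  have h4 : ∀ y w X, fderiv ℝ (fun x => fderiv ℝ f x w) y X = fderiv ℝ (fderiv ℝ f) y X w := fun y w X => by
    rw [fderiv_clm_apply (h3 y) (by fun_prop)]; simp
  refine ⟨h2 w, fun y hy => holo_of_wd ((h2 w).differentiable s% y) fun X => ?_⟩
  have hs : ∀ X, fderiv ℝ (fderiv ℝ f) y X w = fderiv ℝ (fderiv ℝ f) y w X := fun X =>
    (hf.contDiffAt.isSymmSndFDerivAt (by simp; exact WithTop.coe_le_coe.2 (le_top : (2:ℕ∞) ≤ ⊤))).eq X w
  have e0 : (fun x => fderiv ℝ f x X + I * fderiv ℝ f x (I • X)) =ᶠ[𝓝 y] fun _ => 0 := by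
    filter_upwards [hU.mem_nhds hy] with x hx
    have := wd_holo (h x hx) X
    rw [wd] at this; simpa using this
  have e1 : HasFDerivAt (fun x => fderiv ℝ f x X + I * fderiv ℝ f x (I • X))
      (fderiv ℝ (fun x => fderiv ℝ f x X) y + I • fderiv ℝ (fun x => fderiv ℝ f x (I • X)) y) y :=
    (((h2 X).differentiable s% y).hasFDerivAt).add ((((h2 (I • X)).differentiable s% y).hasFDerivAt).const_mul I)
  have e2 := congrArg (fun T => T w) (e1.unique ((hasFDerivAt_const (0 : ℂ) y).congr_of_eventuallyEq e0))
  simp only [ContinuousLinearMap.add_apply, ContinuousLinearMap.smul_apply, ContinuousLinearMap.zero_apply, h4, smul_eq_mul] at e2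
  rw [wd, h4, h4, hs, hs, e2, mul_zero]

theorem holo_contDiff [FiniteDimensional ℂ E] {U : Set E} (hU : IsOpen U) (m : ℕ) : ∀ {f : E → ℂ}, ContDiff ℝ ∞ f →
    (∀ y ∈ U, DifferentiableAt ℂ f y) → ContDiffOn ℂ m f U := by
  induction m with
  | zero => intro f hf _; exact contDiffOn_zero.2 hf.continuous.continuousOn
  | succ m ih =>
    intro f hf h
    push_cast
    refine (contDiffOn_succ_iff_fderiv_of_isOpen hU).2 ⟨fun y hy => (h y hy).differentiableWithinAt, by simp, ?_⟩
    refine contDiffOn_clm_apply.2 fun w => ?_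
    have := holo_dir hf hU h w
    refine (ih this.1 this.2).congr fun y hy => ?_
    rw [((h y hy).hasFDerivAt.restrictScalars ℝ).fderiv]; rfl
end

section
open Complex Filter Topology Set

theorem log_mono {w w' : ℂ} (hw : 0 < w.re) (hw' : 0 < w'.re) : 0 ≤ ((log w - log w') * (starRingEnd ℂ) (w - w')).re := by
  have hre : ∀ t ∈ Icc (0:ℝ) 1, 0 < (w' + t * (w - w')).re := fun t ht => by
    simp; nlinarith [ht.1, ht.2, mul_nonneg ht.1 hw.le, mul_nonneg (sub_nonneg.2 ht.2) hw'.le]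
  have hd : ∀ t ∈ Icc (0:ℝ) 1, HasDerivAt (fun t : ℝ => (log (w' + t * (w - w')) * (starRingEnd ℂ) (w - w')).re)
      (((w - w') / (w' + t * (w - w')) * (starRingEnd ℂ) (w - w')).re) t := fun t ht => by
    have h1 : HasDerivAt (fun t : ℝ => w' + t * (w - w')) (w - w') t := by
      simpa using ((Complex.ofRealCLM.hasDerivAt (x := t)).mul_const (w - w')).const_add w'
    have h2 := ((h1.clog_real (Or.inl (hre t ht))).mul_const ((starRingEnd ℂ) (w - w')))
    exact Complex.reCLM.hasFDerivAt.comp_hasDerivAt t h2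
  obtain ⟨c, hc, he⟩ := exists_hasDerivAt_eq_slope _ _ (zero_lt_one' ℝ) (fun t ht => (hd t ht).continuousAt.continuousWithinAt) (fun t ht => hd t ⟨ht.1.le, ht.2.le⟩)
  have h3 : (0:ℝ) ≤ ((w - w') / (w' + c * (w - w')) * (starRingEnd ℂ) (w - w')).re := by
    have h4 := hre c ⟨hc.1.le, hc.2.le⟩
    rw [div_mul_eq_mul_div, mul_conj, div_eq_mul_inv, re_ofReal_mul, inv_re]
    exact mul_nonneg (normSq_nonneg _) (div_nonneg h4.le (normSq_nonneg _))
  rw [he] at h3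
  simpa [sub_mul] using h3

theorem log_low {w w' : ℂ} (hw : w ≠ 0) (hw' : w' ≠ 0) : ‖w - w'‖ ≤ max ‖w‖ ‖w'‖ * ‖log w - log w'‖ := by
  have h := Convex.norm_image_sub_le_of_norm_deriv_le (𝕜 := ℂ) (f := exp) (C := max ‖w‖ ‖w'‖) (s := {z | z.re ≤ Real.log (max ‖w‖ ‖w'‖)}) (x := log w') (y := log w)
    (fun x _ => differentiableAt_exp) (fun x hx => by
      rw [Complex.deriv_exp, norm_exp]
      exact (Real.exp_le_exp.2 hx).trans_eq (Real.exp_log (lt_max_of_lt_left (norm_pos_iff.2 hw)))) (convex_halfSpace_re_le _)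
      (by simp only [mem_setOf_eq, log_re]; exact Real.log_le_log (norm_pos_iff.2 hw') (le_max_right _ _))
      (by simp only [mem_setOf_eq, log_re]; exact Real.log_le_log (norm_pos_iff.2 hw) (le_max_left _ _))
  rwa [exp_log hw, exp_log hw'] at h

theorem finger_pair {N : ℝ} (hN : 0 < N) {w w' x x' z : ℂ} (hw : 0 < w.re) (hw' : 0 < w'.re) (hx : log w - log w' = -N * (x - x'))
    (hz : w - w' = -((x - x') * z)) (hne : w ≠ w') : 0 ≤ z.re ∧ ‖z‖ ≤ N * max ‖w‖ ‖w'‖ := by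
  have hd : x - x' ≠ 0 := fun h => hne (by rw [h] at hz; simpa [sub_eq_zero] using hz)
  have hd0 : 0 < normSq (x - x') := normSq_pos.2 hd
  have h1 := log_mono hw hw'
  have h2 := log_low (w := w) (w' := w') (fun h => by simp [h] at hw) (fun h => by simp [h] at hw')
  rw [hx, hz] at h1 h2
  constructor
  · have : (-(N:ℂ) * (x - x') * (starRingEnd ℂ) (-((x - x') * z))) = ((N * normSq (x - x') : ℝ) : ℂ) * (starRingEnd ℂ) z := by
      push_cast; rw [← mul_conj, map_neg, map_mul]; ring
    rw [this, re_ofReal_mul, conj_re] at h1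
    exact nonneg_of_mul_nonneg_right h1 p%
  · rw [norm_neg, norm_mul, norm_mul, norm_neg, norm_real, Real.norm_of_nonneg hN.le] at h2
    have := norm_pos_iff.2 hd
    nlinarith

theorem ult_lim {X : Type*} [TopologicalSpace X] {f : Ultrafilter ℕ} {K : Set X} (hK : IsCompact K) {y : ℕ → X} (h : ∀ᶠ N in (f : Filter ℕ), y N ∈ K) :
    ∃ a ∈ K, Tendsto y f (𝓝 a) := by
  obtain ⟨a, ha, hl⟩ := hK.ultrafilter_le_nhds (f.map y) (le_principal_iff.2 h)
  exact ⟨a, ha, hl⟩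

noncomputable def fx (N : ℕ) (u : ℂ) : ℂ := -(1 / (N : ℂ)) * log (u + Real.exp (-N))

theorem xlim {f : Ultrafilter ℕ} (hf : (f : Filter ℕ) ≤ atTop) {U : ℕ → ℂ} {M : ℝ} (h0 : ∀ᶠ N in (f : Filter ℕ), 0 ≤ (U N).re) (hM : ∀ᶠ N in (f : Filter ℕ), ‖U N‖ ≤ M) :
    ∃ s ∈ Icc (0:ℝ) 1, Tendsto (fun N => fx N (U N)) f (𝓝 (s : ℂ)) ∧ (∀ c : ℂ, 0 < c.re → Tendsto U f (𝓝 c) → s = 0) ∧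
      (0 < s → Tendsto (fun N : ℕ => N * ‖U N + Real.exp (-N)‖) f (𝓝 0)) := by
  have hN1 : ∀ᶠ N : ℕ in (f : Filter ℕ), 1 ≤ N := hf (eventually_ge_atTop 1)
  have hinv : Tendsto (fun N : ℕ => 1 / (N : ℝ)) f (𝓝 0) := tendsto_one_div_atTop_nhds_zero_nat.mono_left hf
  have hM0 : 0 ≤ M := by obtain ⟨N, hN⟩ := hM.exists; exact (norm_nonneg _).trans hN
  have hre : ∀ N : ℕ, (fx N (U N)).re = -(1 / (N:ℝ)) * Real.log ‖U N + Real.exp (-N)‖ := fun N => by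
    have : -(1 / (N : ℂ)) = ((-(1 / (N:ℝ)) : ℝ) : ℂ) := by push_cast; rfl
    rw [fx, this, re_ofReal_mul, log_re]
  have him : ∀ N : ℕ, (fx N (U N)).im = -(1 / (N:ℝ)) * arg (U N + Real.exp (-N)) := fun N => by
    have : -(1 / (N : ℂ)) = ((-(1 / (N:ℝ)) : ℝ) : ℂ) := by push_cast; rfl
    rw [fx, this, im_ofReal_mul, log_im]
  have hlow : ∀ᶠ N : ℕ in (f : Filter ℕ), Real.exp (-N) ≤ ‖U N + Real.exp (-N)‖ := by
    filter_upwards [h0] with N h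
    refine le_trans ?_ (re_le_norm _)
    simp only [add_re, ofReal_re]; linarith
  have hup : ∀ᶠ N : ℕ in (f : Filter ℕ), (fx N (U N)).re ≤ 1 := by
    filter_upwards [hlow, hN1] with N h h1
    have h1' : (0:ℝ) < N := by exact_mod_cast h1
    rw [hre]
    have := Real.log_le_log (Real.exp_pos _) h
    rw [Real.log_exp] at this
    rw [neg_mul, ← mul_neg, one_div, inv_mul_le_iff₀ h1']; linarith
  have hlo : ∀ᶠ N : ℕ in (f : Filter ℕ), -(1 / (N:ℝ)) * Real.log (M + 1) ≤ (fx N (U N)).re := by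
    filter_upwards [hlow, hN1, hM] with N h h1 h2
    rw [hre]
    have h3 : Real.log ‖U N + Real.exp (-N)‖ ≤ Real.log (M + 1) := by
      refine Real.log_le_log ((Real.exp_pos _).trans_le h) ((norm_add_le _ _).trans (add_le_add h2 ?_))
      rw [norm_real, Real.norm_of_nonneg (Real.exp_pos _).le]
      exact Real.exp_le_one_iff.2 s%
    have h4 : (0:ℝ) ≤ 1 / N := by positivity
    nlinarith
  have himt : Tendsto (fun N => (fx N (U N)).im) f (𝓝 0) := by
    refine squeeze_zero_norm (fun N => ?_) (by simpa using hinv.mul_const Real.pi)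
    rw [him, norm_mul, norm_neg, Real.norm_of_nonneg (by positivity : (0:ℝ) ≤ 1 / N), Real.norm_eq_abs]
    rw [one_div]; exact mll (abs_arg_le_pi _) p%
  obtain ⟨s, -, hs⟩ := ult_lim (f := f) (isCompact_Icc (a := -Real.log (M + 1)) (b := 1)) (y := fun N => (fx N (U N)).re) (by
    filter_upwards [hup, hlo, hN1] with N h1 h2 h3
    refine ⟨le_trans ?_ h2, h1⟩
    have h4 : (1:ℝ) / N ≤ 1 := by rw [div_le_one (by exact_mod_cast h3)]; exact_mod_cast h3
    nlinarith [Real.log_nonneg (by linarith : 1 ≤ M + 1)])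
  have hx : Tendsto (fun N => fx N (U N)) f (𝓝 (s : ℂ)) := by
    have := (Complex.continuous_ofReal.tendsto s |>.comp hs).add ((Complex.continuous_ofReal.tendsto 0 |>.comp himt).mul_const I)
    simpa [Function.comp_def, re_add_im] using this
  have he : Tendsto (fun N : ℕ => Real.exp (-N)) f (𝓝 0) := (Real.tendsto_exp_atBot.comp (tendsto_neg_atTop_atBot.comp tendsto_natCast_atTop_atTop)).mono_left hf
  have h00 : Tendsto (fun N : ℕ => -(1 / (N:ℝ)) * Real.log (M + 1)) f (𝓝 0) := by simpa using hinv.neg.mul_const (Real.log (M + 1))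
  refine ⟨s, ⟨le_of_tendsto_of_tendsto h00 hs hlo, le_of_tendsto hs hup⟩, hx, fun c hc hU => ?_, fun hs0 => ?_⟩
  · have h1 : Tendsto (fun N : ℕ => log (U N + Real.exp (-N))) f (𝓝 (log (c + (0:ℝ)))) :=
      (continuousAt_clog (by simp [mem_slitPlane_iff, hc])).tendsto.comp (hU.add ((Complex.continuous_ofReal.tendsto 0).comp he))
    have h2 := ((Complex.continuous_ofReal.tendsto 0).comp hinv).neg.mul h1
    have h3 := tendsto_nhds_unique hx (h2.congr fun N => by simp [fx])
    simpa using h3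
  · refine squeeze_zero' (Eventually.of_forall fun N => by positivity) (g := fun N : ℕ => N * Real.exp (-((s / 2) * N))) ?_ ?_
    · filter_upwards [hs.eventually (lt_mem_nhds (half_lt_self hs0)), hlow, hN1] with N h1 h2 h3
      have h3' : (0:ℝ) < N := by exact_mod_cast h3
      refine mll ?_ h3'.le
      rw [← Real.log_le_iff_le_exp ((Real.exp_pos _).trans_le h2)]
      rw [hre, neg_mul, ← mul_neg, one_div, lt_inv_mul_iff₀ h3'] at h1
      linarith
    · have := (Real.tendsto_pow_mul_exp_neg_atTop_nhds_zero 1).comp (tendsto_natCast_atTop_atTop (R := ℝ).const_mul_atTop (half_pos hs0))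
      have h2 := (this.const_mul (2 / s)).mono_left hf
      rw [mul_zero] at h2
      refine h2.congr fun N => ?_
      simp only [Function.comp, pow_one]; field_simp
end

section
open Complex Filter Topology Set Asymptotics
open scoped NNReal

theorem pair_lim {f : Ultrafilter ℕ} (hf : (f : Filter ℕ) ≤ atTop) {U U' z : ℕ → ℂ} {M : ℝ} (h0 : ∀ᶠ N in (f : Filter ℕ), 0 ≤ (U N).re ∧ 0 ≤ (U' N).re)
    (hM : ∀ᶠ N in (f : Filter ℕ), ‖U N‖ ≤ M ∧ ‖U' N‖ ≤ M) {s : ℝ} (hs : Tendsto (fun N => fx N (U N)) f (𝓝 (s : ℂ)))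
    (hs' : Tendsto (fun N => fx N (U' N)) f (𝓝 (s : ℂ))) {z0 : ℂ} (hz : Tendsto z f (𝓝 z0)) (hz0 : z0 ≠ 0) (hsz : s = 0 → z0.re < 0)
    (he : ∀ᶠ N in (f : Filter ℕ), U N ≠ U' N ∧ U N - U' N = -((fx N (U N) - fx N (U' N)) * z N)) : False := by
  have hN1 : ∀ᶠ N : ℕ in (f : Filter ℕ), 1 ≤ N := hf (eventually_ge_atTop 1)
  have hp : ∀ᶠ N : ℕ in (f : Filter ℕ), 0 ≤ (z N).re ∧ ‖z N‖ ≤ N * ‖U N + Real.exp (-N)‖ + N * ‖U' N + Real.exp (-N)‖ := by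
    filter_upwards [h0, he, hN1] with N ⟨h1, h2⟩ ⟨h3, h4⟩ h5
    have h5' : (0:ℝ) < N := by exact_mod_cast h5
    have h6 : (N:ℂ) ≠ 0 := by exact_mod_cast h5'.ne'
    have h7 := Real.exp_pos (-(N:ℝ))
    have := finger_pair h5' (w := U N + Real.exp (-N)) (w' := U' N + Real.exp (-N)) (x := fx N (U N)) (x' := fx N (U' N)) (z := z N)
      (by simp only [add_re, ofReal_re]; linarith) (by simp only [add_re, ofReal_re]; linarith)
      (by simp only [fx]; push_cast; field_simp; ring) (by rw [← h4]; ring) (by simpa using h3)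
    refine ⟨this.1, this.2.trans ?_⟩
    rw [← mul_add]
    exact mll (max_le_add_of_nonneg (norm_nonneg _) (norm_nonneg _)) h5'.le
  obtain ⟨t, ht, ht1, -, ht2⟩ := xlim hf (h0.mono fun _ h => h.1) (hM.mono fun _ h => h.1)
  obtain ⟨t', -, ht1', -, ht2'⟩ := xlim hf (h0.mono fun _ h => h.2) (hM.mono fun _ h => h.2)
  have e1 : t = s := by exact_mod_cast tendsto_nhds_unique ht1 hs
  have e2 : t' = s := by exact_mod_cast tendsto_nhds_unique ht1' hs'
  subst e1; subst e2
  rcases ht.1.eq_or_lt with h | h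
  · exact absurd (ge_of_tendsto ((Complex.continuous_re.tendsto _).comp hz) (hp.mono fun _ h => h.1)) (not_le.2 (hsz h.symm))
  · have := le_of_tendsto_of_tendsto hz.norm ((ht2 h).add (ht2' h)) (hp.mono fun _ h => h.2)
    rw [add_zero] at this
    exact hz0 (norm_le_zero_iff.1 this)

variable {E : Type*} [NormedAddCommGroup E] [NormedSpace ℂ E]

theorem tendsto_slope {f : Filter ℕ} {Γ : ℂ → E} {G' : E} {s : ℂ} {x x' : ℕ → ℂ} (h : HasStrictDerivAt Γ G' s) (hx : Tendsto x f (𝓝 s)) (hx' : Tendsto x' f (𝓝 s)) :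
    (fun N => Γ (x N) - Γ (x' N) - (x N - x' N) • G') =o[f] fun N => x N - x' N :=
  (hasStrictFDerivAt_iff_isLittleO.1 h.hasStrictFDerivAt).comp_tendsto (hx.prodMk_nhds hx')

theorem finger_seq {K : Set E} (hK : IsCompact K) {u : E → ℂ} (hud : ∀ y ∈ K, DifferentiableAt ℂ u y)
    (hu0 : u 0 = 0) (hur : ∀ y ∈ K, y ≠ 0 → 0 < (u y).re) 
    {f : Ultrafilter ℕ} (hf : (f : Filter ℕ) ≤ atTop) {y : ℕ → E} (hy : ∀ᶠ N in (f : Filter ℕ), y N ∈ K) :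
    (∀ᶠ N in (f : Filter ℕ), 0 ≤ (u (y N)).re) ∧ (∃ M, ∀ᶠ N in (f : Filter ℕ), ‖u (y N)‖ ≤ M) ∧ ∃ a ∈ K, Tendsto y f (𝓝 a) ∧ Tendsto (fun N => u (y N)) f (𝓝 (u a)) ∧
      ∃ s ∈ Icc (0:ℝ) 1, Tendsto (fun N => fx N (u (y N))) f (𝓝 (s : ℂ)) ∧ (a ≠ 0 → s = 0) := by
  have h0 : ∀ᶠ N in (f : Filter ℕ), 0 ≤ (u (y N)).re := hy.mono fun N h => by
    by_cases h' : y N = 0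
    · simp [h', hu0]
    · exact (hur _ h h').le
  obtain ⟨a, ha, hya⟩ := ult_lim hK hy
  have hua : Tendsto (fun N => u (y N)) f (𝓝 (u a)) := (hud a ha).continuousAt.tendsto.comp hya
  have hM : ∀ᶠ N in (f : Filter ℕ), ‖u (y N)‖ ≤ ‖u a‖ + 1 := (hua.norm.eventually (gt_mem_nhds (lt_add_one _))).mono fun _ h => le_of_lt h
  obtain ⟨s, hs, h1, h2, -⟩ := xlim hf h0 hM
  exact ⟨h0, ⟨_, hM⟩, a, ha, hya, hua, s, hs, h1, fun h => h2 _ (hur a ha h) hua⟩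

theorem ev_of_ult {P : ℕ → Prop} (h : ∀ f : Ultrafilter ℕ, (f : Filter ℕ) ≤ atTop → (∀ᶠ N in (f : Filter ℕ), ¬ P N) → False) : ∀ᶠ N in atTop, P N := by
  by_contra hc
  have hc' := not_eventually.1 hc
  haveI : NeBot (atTop ⊓ 𝓟 {N | ¬ P N}) := frequently_mem_iff_neBot.1 hc'
  exact h (Ultrafilter.of (atTop ⊓ 𝓟 {N | ¬ P N})) ((Ultrafilter.of_le _).trans inf_le_left) (le_principal_iff.1 ((Ultrafilter.of_le _).trans inf_le_right))

theorem finger_inj {K : Set E} (hK : IsCompact K) {u : E → ℂ} (hud : ∀ y ∈ K, DifferentiableAt ℂ u y)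
    (hu0 : u 0 = 0) (hur : ∀ y ∈ K, y ≠ 0 → 0 < (u y).re) {om : E →L[ℂ] ℂ} {Γ : ℂ → E} (hΓ : ContDiff ℂ 3 Γ) (Γ0 : Γ 0 = 0)
    (huL : ∀ y ∈ K, ∃ C : ℝ≥0, ∃ t ∈ 𝓝 y, LipschitzOnWith C u t) (hus : HasStrictFDerivAt u om 0)
    (hinj : ∀ s ∈ Icc (0:ℝ) 1, ∀ s' ∈ Icc (0:ℝ) 1, Γ s = Γ s' → s = s') (hd : ∀ s ∈ Icc (0:ℝ) 1, om (deriv Γ s) ≠ 0) (hd0 : (om (deriv Γ 0)).re < 0)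
    (hΓK : ∀ s ∈ Icc (0:ℝ) 1, Γ s ∈ K → s = 0) : ∀ᶠ N in atTop, InjOn (fun y => y + Γ (fx N (u y))) K := by
  have hst : ∀ s : ℂ, HasStrictDerivAt Γ (deriv Γ s) s := fun s => (hΓ.contDiffAt.hasStrictDerivAt n%)
  refine ev_of_ult fun f hf hbad => ?_
  have hb : ∀ N, ∃ y y', ¬ InjOn (fun y => y + Γ (fx N (u y))) K → y ∈ K ∧ y' ∈ K ∧ y + Γ (fx N (u y)) = y' + Γ (fx N (u y')) ∧ y ≠ y' := fun N => by
    by_cases h : InjOn (fun y => y + Γ (fx N (u y))) K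
    · exact ⟨0, 0, fun h' => absurd h h'⟩
    · have h' := h
      simp only [InjOn] at h'; push Not at h'
      obtain ⟨y, hy, y', hy', h1, h2⟩ := h'
      exact ⟨y, y', fun _ => ⟨hy, hy', h1, h2⟩⟩
  choose y y' hyy using hb
  have hev := hbad.mono fun N h => hyy N h
  have hyK := hev.mono fun N h => h.1
  have hyK' := hev.mono fun N h => h.2.1
  obtain ⟨h0, ⟨M, hM⟩, a, ha, hya, hua, s, hs, hx, hsa⟩ := finger_seq hK hud hu0 hur hf hyK
  obtain ⟨h0', ⟨M', hM'⟩, a', ha', hya', hua', s', hs', hx', hsa'⟩ := finger_seq hK hud hu0 hur hf hyK'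
  have hlim : a + Γ s = a' + Γ s' := tendsto_nhds_unique (hya.add ((hΓ.continuous.tendsto _).comp hx))
    ((hya'.add ((hΓ.continuous.tendsto _).comp hx')).congr' (hev.mono fun N h => h.2.2.1.symm))
  have hG0 : Γ ((0:ℝ):ℂ) = 0 := by simpa using Γ0
  have hss : a = a' ∧ s = s' := by
    by_cases h : a = 0 <;> by_cases h' : a' = 0
    · rw [h, h', zero_add, zero_add] at hlim
      exact ⟨by rw [h, h'], hinj s hs s' hs' hlim⟩
    · rw [h, hsa' h', hG0, zero_add, add_zero] at hlim
      have := hΓK s hs (hlim ▸ ha')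
      exact absurd (by rw [← hlim, this, hG0]) h'
    · rw [h', hsa h, hG0, zero_add, add_zero] at hlim
      have := hΓK s' hs' (hlim ▸ ha)
      exact absurd (by rw [hlim, this, hG0]) h
    · rw [hsa h, hsa' h'] at hlim ⊢
      exact ⟨by simpa using hlim, rfl⟩
  obtain ⟨rfl, rfl⟩ := hss
  have hsl := tendsto_slope (hst s) hx hx'
  have hyx : ∀ᶠ N in (f : Filter ℕ), y N - y' N = -(Γ (fx N (u (y N))) - Γ (fx N (u (y' N)))) := hev.mono fun N h => by
    have := h.2.2.1; rw [neg_sub, sub_eq_sub_iff_add_eq_add, this, add_comm]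
  have hxne : ∀ᶠ N in (f : Filter ℕ), fx N (u (y N)) - fx N (u (y' N)) ≠ 0 := by
    filter_upwards [hyx, hev] with N h1 h2 h3
    rw [sub_eq_zero.1 h3, sub_self, neg_zero, sub_eq_zero] at h1
    exact h2.2.2.2 h1
  have hO : (fun N => y N - y' N) =O[f] fun N => fx N (u (y N)) - fx N (u (y' N)) := by
    have h1 : (fun N => (fx N (u (y N)) - fx N (u (y' N))) • deriv Γ (s:ℂ)) =O[f] fun N => fx N (u (y N)) - fx N (u (y' N)) :=
      IsBigO.of_bound ‖deriv Γ (s:ℂ)‖ (Eventually.of_forall fun N => by rw [norm_smul, mul_comm])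
    refine ((hsl.isBigO.add h1).neg_left).congr' (hyx.mono fun N h => ?_) EventuallyEq.rfl
    simp only [h, sub_add_cancel]
  by_cases h : a = 0
  · subst h
    have h1 : (fun N => u (y N) - u (y' N) - om (y N - y' N)) =o[f] fun N => fx N (u (y N)) - fx N (u (y' N)) :=
      ((hasStrictFDerivAt_iff_isLittleO.1 hus).comp_tendsto (hya.prodMk_nhds hya')).trans_isBigO hO
    have h2 : (fun N => om (Γ (fx N (u (y N))) - Γ (fx N (u (y' N))) - (fx N (u (y N)) - fx N (u (y' N))) • deriv Γ (s:ℂ))) =o[f] fun N => fx N (u (y N)) - fx N (u (y' N)) :=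
      (om.isBigO_comp _ _).trans_isLittleO hsl
    have h3 := (h2.sub h1).tendsto_div_nhds_zero
    have h4 := h3.add_const (om (deriv Γ (s:ℂ)))
    rw [zero_add] at h4
    have hne : ∀ᶠ N in (f : Filter ℕ), u (y N) ≠ u (y' N) := hxne.mono fun N h h' => h (by rw [h', sub_self])
    refine pair_lim hf (h0.and h0') (M := max M M') ((hM.and hM').mono fun N h => ⟨h.1.trans (le_max_left _ _), h.2.trans (le_max_right _ _)⟩) hx hx' h4 (hd s hs)
      (fun h => by rw [h]; simpa using hd0) ?_
    filter_upwards [hne, hxne, hyx] with N h5 h6 h7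
    refine ⟨h5, ?_⟩
    rw [h7, map_neg, map_sub, map_smul, smul_eq_mul]
    field_simp
    ring
  · obtain ⟨C, t, ht, hL⟩ := huL a ha
    have hs0 := hsa h
    subst hs0
    have hau := hur a ha h
    have hlog : HasStrictDerivAt log (u a)⁻¹ (u a) := Complex.hasStrictDerivAt_log (Or.inl hau)
    have he : Tendsto (fun N : ℕ => ((Real.exp (-N) : ℝ) : ℂ)) f (𝓝 ((0:ℝ):ℂ)) :=
      (Complex.continuous_ofReal.tendsto 0).comp ((Real.tendsto_exp_atBot.comp (tendsto_neg_atTop_atBot.comp tendsto_natCast_atTop_atTop)).mono_left hf)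
    have ho := tendsto_slope hlog (x := fun N => u (y N) + (Real.exp (-N) : ℝ)) (x' := fun N => u (y' N) + (Real.exp (-N) : ℝ)) (by simpa only [ofReal_zero, add_zero] using hua.add he) (by simpa only [ofReal_zero, add_zero] using hua'.add he)
    have h1 : (fun N => log (u (y N) + Real.exp (-N)) - log (u (y' N) + Real.exp (-N))) =O[f] fun N => y N - y' N := by
      have h2 : (fun N : ℕ => (u (y N) + Real.exp (-N)) - (u (y' N) + Real.exp (-N))) =O[f] fun N => y N - y' N := by
        refine IsBigO.of_bound C ?_
        filter_upwards [hya ht, hya' ht] with N h3 h4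
        rw [add_sub_add_right_eq_sub]; exact hL.norm_sub_le h3 h4
      have h3 : (fun N : ℕ => ((u (y N) + Real.exp (-N)) - (u (y' N) + Real.exp (-N))) • (u a)⁻¹) =O[f] fun N => y N - y' N :=
        (IsBigO.of_bound ‖(u a)⁻¹‖ (Eventually.of_forall fun N => by rw [norm_smul, mul_comm])).trans h2
      exact ((ho.isBigO.trans h2).add h3).congr_left fun N => by simp
    have h2 : (fun N => fx N (u (y N)) - fx N (u (y' N))) =o[f] fun N => y N - y' N := by
      have h3 : (fun N : ℕ => -(1 / (N : ℂ))) =o[f] fun _ => (1:ℝ) := by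
        rw [isLittleO_one_iff]
        have := (tendsto_one_div_atTop_nhds_zero_nat (𝕜 := ℝ)).mono_left hf
        have h4 := ((Complex.continuous_ofReal.tendsto 0).comp this).neg
        simpa [Function.comp_def] using h4
      have h4 := h3.mul_isBigO h1.norm_right
      refine (h4.congr (fun N => ?_) (fun N => ?_)).of_norm_right (g' := fun N => y N - y' N)
      · simp only [fx]; ring
      · simp
    exact isLittleO_irrefl (hev.mono fun N h => sub_ne_zero.2 h.2.2.2).frequently (hO.trans_isLittleO h2)

theorem finger_exp {K : Set E} (hK : IsCompact K) {u : E → ℂ} (hud : ∀ y ∈ K, DifferentiableAt ℂ u y)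
    (hu0 : u 0 = 0) (hur : ∀ y ∈ K, y ≠ 0 → 0 < (u y).re) {om : E →L[ℂ] ℂ} {Γ : ℂ → E} (hΓ : ContDiff ℂ 3 Γ) (Γ0 : Γ 0 = 0)
    {ψ : E → ℂ} (huψ : ∀ᶠ y in 𝓝 0, u y = om y * ψ y) (hψ : ContinuousAt ψ 0) (hψ0 : ψ 0 = 1)
    (hd : om (deriv Γ 1) ≠ 0) (he : ∀ s ∈ Icc (0:ℝ) 1, om (Γ s) = om (Γ 1) → s = 1) (heK : ∀ y ∈ K, om y ≠ om (Γ 1)) :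
    ∀ᶠ N in atTop, ∀ y ∈ K, y ≠ 0 → om (y + Γ (fx N (u y))) ≠ om (Γ 1) := by
  have hst : HasStrictDerivAt Γ (deriv Γ 1) 1 := (hΓ.contDiffAt.hasStrictDerivAt n%)
  refine ev_of_ult fun f hf hbad => ?_
  have hb : ∀ N, ∃ y, ¬ (∀ y ∈ K, y ≠ 0 → om (y + Γ (fx N (u y))) ≠ om (Γ 1)) → y ∈ K ∧ y ≠ 0 ∧ om (y + Γ (fx N (u y))) = om (Γ 1) := fun N => by
    by_cases h : ∀ y ∈ K, y ≠ 0 → om (y + Γ (fx N (u y))) ≠ om (Γ 1)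
    · exact ⟨0, fun h' => absurd h h'⟩
    · have h' := h
      push Not at h'
      obtain ⟨y, h1⟩ := h'
      exact ⟨y, fun _ => h1⟩
  choose y hyy using hb
  have hev := hbad.mono fun N h => hyy N h
  obtain ⟨h0, ⟨M, hM⟩, a, ha, hya, hua, s, hs, hx, hsa⟩ := finger_seq hK hud hu0 hur hf (hev.mono fun N h => h.1)
  have hlim : om (a + Γ s) = om (Γ 1) := tendsto_nhds_unique ((om.continuous.tendsto _).comp (hya.add ((hΓ.continuous.tendsto _).comp hx)))
    (tendsto_const_nhds.congr' (hev.mono fun N h => h.2.2.symm))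
  have hG0 : Γ ((0:ℝ):ℂ) = 0 := by simpa using Γ0
  have ha0 : a = 0 := by
    by_contra h
    rw [hsa h, hG0, add_zero] at hlim
    exact heK a ha hlim
  subst ha0
  rw [zero_add] at hlim
  obtain rfl := he s hs hlim
  rw [ofReal_one] at hx
  have hf1 : ∀ᶠ N in (f : Filter ℕ), fx N 0 = 1 := ((eventually_ge_atTop 1).filter_mono hf).mono fun N (h : 1 ≤ N) => by
    have : (N:ℂ) ≠ 0 := by exact_mod_cast (by omega : N ≠ 0)
    rw [fx, zero_add, ← ofReal_log (Real.exp_pos _).le, Real.log_exp]; push_cast; field_simp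
  have hx1 : Tendsto (fun N => fx N 0) f (𝓝 1) := tendsto_const_nhds.congr' (hf1.mono fun N h => h.symm)
  have h3 := ((om.isBigO_comp _ _).trans_isLittleO (tendsto_slope hst hx hx1)).tendsto_div_nhds_zero
  have h4 := (h3.add_const (om (deriv Γ 1))).mul (hψ.tendsto.comp hya)
  rw [zero_add, hψ0, mul_one] at h4
  refine pair_lim (U := fun N => u (y N)) (U' := fun _ => 0) hf (h0.mono fun N h => ⟨h, le_rfl⟩) (M := M) (hM.mono fun N h => ⟨h, by simpa using (norm_nonneg _).trans h⟩)
    (by simpa using hx) (by simpa using hx1) h4 hd (fun h => absurd h one_ne_zero) ?_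
  filter_upwards [hev, hya huψ, hf1] with N h1 h2 h5
  have h6 : u (y N) ≠ 0 := fun h => by simpa [h] using hur _ h1.1 h1.2.1
  refine ⟨h6, ?_⟩
  have h2' : u (y N) = om (y N) * ψ (y N) := h2
  have h7 := h1.2.2
  rw [map_add] at h7
  have h8 : fx N (u (y N)) - 1 ≠ 0 := fun h => by
    rw [sub_eq_zero.1 h, add_eq_right] at h7
    exact h6 (by rw [h2', h7, zero_mul])
  simp only [h5, Function.comp, sub_zero, map_sub, map_smul, smul_eq_mul]
  rw [sub_div, mul_div_cancel_left₀ _ h8, sub_add_cancel, ← mul_assoc, mul_div_cancel₀ _ h8]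
  rw [← h7]; conv_lhs => rw [h2']
  ring

theorem finger_diff {u : E → ℂ} {Γ : ℂ → E} (hΓ : ContDiff ℂ 3 Γ) {N : ℕ} {y : E} (hu : ContDiffAt ℂ 3 u y) (hr : 0 ≤ (u y).re) :
    ContDiffAt ℂ 3 (fun y => y + Γ (fx N (u y))) y := by
  have h0 : u y + Real.exp (-N) ∈ slitPlane := Or.inl (by simp only [add_re, ofReal_re]; linarith [Real.exp_pos (-(N:ℝ))])
  have h1 : ContDiffAt ℂ 3 (fun y => fx N (u y)) y :=
    contDiffAt_const.mul (ContDiffAt.comp (g := log) (f := fun y => u y + Real.exp (-N)) y (Complex.contDiffAt_log h0) (hu.add contDiffAt_const))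
  exact contDiffAt_id.add (hΓ.contDiffAt.comp y h1)

theorem finger {K : Set E} (hK : IsCompact K) (h0K : 0 ∈ K) {u : E → ℂ} (hud : ∀ y ∈ K, DifferentiableAt ℂ u y)
    (hu0 : u 0 = 0) (hur : ∀ y ∈ K, y ≠ 0 → 0 < (u y).re) {om : E →L[ℂ] ℂ} {Γ : ℂ → E} (hΓ : ContDiff ℂ 3 Γ) (Γ0 : Γ 0 = 0)
    (huL : ∀ y ∈ K, ∃ C : ℝ≥0, ∃ t ∈ 𝓝 y, LipschitzOnWith C u t) (hus : HasStrictFDerivAt u om 0) (hu3 : ContDiffAt ℂ 3 u 0)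
    (hinj : ∀ s ∈ Icc (0:ℝ) 1, ∀ s' ∈ Icc (0:ℝ) 1, Γ s = Γ s' → s = s') (hd : ∀ s ∈ Icc (0:ℝ) 1, om (deriv Γ s) ≠ 0) (hd0 : (om (deriv Γ 0)).re < 0)
    (hΓK : ∀ s ∈ Icc (0:ℝ) 1, Γ s ∈ K → s = 0)
    {ψ : E → ℂ} (huψ : ∀ᶠ y in 𝓝 0, u y = om y * ψ y) (hψ : ContinuousAt ψ 0) (hψ0 : ψ 0 = 1)
    (he : ∀ s ∈ Icc (0:ℝ) 1, om (Γ s) = om (Γ 1) → s = 1) (heK : ∀ y ∈ K, om y ≠ om (Γ 1)) :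
    ∃ F : E → E, (∀ y ∈ K, DifferentiableAt ℂ F y) ∧ ContDiffAt ℂ 3 F 0 ∧ InjOn F K ∧ (∀ᶠ X in 𝓝 0, om X = 0 → F X = X + F 0) ∧
      (∀ X, fderiv ℂ F 0 X = 0 → X = 0) ∧ ∀ y ∈ K, y ≠ 0 → om (F y) ≠ om (F 0) := by
  have hd1 : om (deriv Γ 1) ≠ 0 := by simpa using hd 1 s%
  have e3 : ∀ᶠ N : ℕ in atTop, N * Real.exp (-N) < ‖om (deriv Γ 1)‖ := by
    have := (Real.tendsto_pow_mul_exp_neg_atTop_nhds_zero 1).comp (tendsto_natCast_atTop_atTop (R := ℝ))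
    simpa using this.eventually (gt_mem_nhds (norm_pos_iff.2 hd1))
  obtain ⟨N, h1, h2, h3, h4⟩ := ((finger_inj hK hud hu0 hur hΓ Γ0 huL hus hinj hd hd0 hΓK).and ((finger_exp hK hud hu0 hur hΓ Γ0 huψ hψ hψ0 hd1 he heK).and
    (e3.and (eventually_ge_atTop 1)))).exists
  have hf1 : fx N 0 = 1 := by
    have : (N:ℂ) ≠ 0 := by exact_mod_cast (by omega : N ≠ 0)
    rw [fx, zero_add, ← ofReal_log (Real.exp_pos _).le, Real.log_exp]; push_cast; field_simp
  refine ⟨fun y => y + Γ (fx N (u y)), fun y hy => ?_, finger_diff hΓ hu3 (by simp [hu0]), h1, ?_, ?_, by simpa [hu0, hf1] using h2⟩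
  · have hr : 0 ≤ (u y).re := by
      by_cases h : y = 0
      · simp [h, hu0]
      · exact (hur y hy h).le
    have h5 : DifferentiableAt ℂ (fun y => fx N (u y)) y := by
      refine (((hud y hy).add_const _).clog (Or.inl ?_)).const_mul _
      simp only [add_re, ofReal_re]; linarith [Real.exp_pos (-(N:ℝ))]
    exact differentiableAt_id.add ((hΓ.differentiable n% _).comp y h5)
  · filter_upwards [huψ] with X hX h
    rw [hX, h, zero_mul, hu0, zero_add]
  · intro X hX
    have hN : (N:ℂ) ≠ 0 := by exact_mod_cast (by omega : N ≠ 0)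
    have hq := Real.exp_pos (-(N:ℝ))
    have h5 : HasFDerivAt (fun y => fx N (u y)) (-(1 / (N:ℂ)) • ((u 0 + Real.exp (-N))⁻¹ • om)) 0 :=
      ((hus.hasFDerivAt.add_const _).clog (Or.inl (by simp only [add_re, ofReal_re, hu0, zero_re]; linarith))).const_mul _
    have h6 := (hΓ.differentiable n% (fx N (u 0))).hasFDerivAt.comp (0:E) h5
    have h66 : HasFDerivAt (fun y => y + Γ (fx N (u y))) _ 0 := (hasFDerivAt_id (0:E)).add h6
    rw [h66.fderiv] at hX
    rw [hu0, hf1] at hX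
    simp only [ContinuousLinearMap.add_apply, ContinuousLinearMap.comp_apply, ContinuousLinearMap.smul_apply, ContinuousLinearMap.id_apply, smul_eq_mul, zero_add] at hX
    rw [← mul_one (_ * _ : ℂ), ← smul_eq_mul, map_smul, fderiv_apply_one_eq_deriv] at hX
    by_cases h : om X = 0
    · simpa [h] using hX
    · exfalso
      have h7 := congrArg om hX
      rw [map_add, map_smul, map_zero, smul_eq_mul] at h7
      have hqc : ((Real.exp (-N) : ℝ) : ℂ) ≠ 0 := by exact_mod_cast hq.ne'
      have h8 : om (deriv Γ 1) = N * (Real.exp (-N) : ℝ) := by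
        field_simp at h7
        rw [mul_zero] at h7
        linear_combination -(mul_eq_zero.1 h7).resolve_left h
      rw [h8, norm_mul, norm_real, Complex.norm_natCast, Real.norm_of_nonneg hq.le] at h3
      exact lt_irrefl _ h3
end

section
open Filter Topology Set Metric Module
variable {E : Type*} [NormedAddCommGroup E] [InnerProductSpace ℂ E] [FiniteDimensional ℂ E]

def PC (U : Set E) : Prop := ∀ a ∈ U, ∀ w : E, ∀ r : ℝ, 0 < r → (∀ l : ℂ, ‖l‖ ≤ r → a + l • w ∈ U) →
  -Real.log (Metric.infDist a Uᶜ) ≤ (1 / (2 * Real.pi)) * ∫ θ in (0:ℝ)..(2 * Real.pi),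
        -Real.log (Metric.infDist (a + ((r : ℂ) * Complex.exp (θ * Complex.I)) • w) Uᶜ)

theorem ortho_exists (h2 : 2 ≤ finrank ℂ E) (x : E) : ∃ w : E, ‖w‖ = 1 ∧ inner ℂ x w = 0 := by
  have : ((ℂ ∙ x)ᗮ : Submodule ℂ E) ≠ ⊥ := by
    intro h
    have h1 := Submodule.finrank_add_finrank_orthogonal (ℂ ∙ x)
    rw [h, finrank_bot] at h1
    have : finrank ℂ (ℂ ∙ x) ≤ 1 := (finrank_span_le_card ({x} : Set E)).trans s%
    omega
  obtain ⟨w, hw, h0⟩ := Submodule.exists_mem_ne_zero_of_ne_bot this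
  refine ⟨((‖w‖⁻¹ : ℝ) : ℂ) • w, ?_, ?_⟩
  · rw [norm_smul, Complex.norm_real, norm_inv, norm_norm, inv_mul_cancel₀ (norm_ne_zero_iff.2 h0)]
  · rw [inner_smul_right, (Submodule.mem_orthogonal_singleton_iff_inner_right).1 hw, mul_zero]

theorem pyth {x w : E} (h : inner ℂ x w = 0) : ‖x + w‖ ^ 2 = ‖x‖ ^ 2 + ‖w‖ ^ 2 := by
  rw [sq, sq, sq]; exact norm_add_sq_eq_norm_sq_add_norm_sq_of_inner_eq_zero x w h

theorem no_hole (h2 : 2 ≤ finrank ℂ E) {U O : Set E} (hU : IsOpen U) (hPC : PC U) (hO : IsOpen O) {x0 : E} (hx : x0 ∈ O) (hxU : x0 ∉ U)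
    (hm : ∀ y ∈ O, y ∉ U → ‖y‖ ≤ ‖x0‖) : False := by
  obtain ⟨d, hd, hdO⟩ := Metric.isOpen_iff.1 hO x0 hx
  obtain ⟨v, hv1, hv⟩ : ∃ v : E, ‖v‖ = 1 ∧ x0 = (‖x0‖ : ℂ) • v := by
    by_cases h : x0 = 0
    · obtain ⟨w, hw, -⟩ := ortho_exists h2 (0:E)
      exact ⟨w, hw, by simp [h]⟩
    · have h0 := norm_ne_zero_iff.2 h
      refine ⟨((‖x0‖⁻¹ : ℝ) : ℂ) • x0, by rw [norm_smul, Complex.norm_real, norm_inv, norm_norm, inv_mul_cancel₀ h0], ?_⟩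
      rw [smul_smul, ← Complex.ofReal_mul, mul_inv_cancel₀ h0, Complex.ofReal_one, one_smul]
  obtain ⟨w, hw1, hw⟩ := ortho_exists h2 v
  obtain ⟨q, hq⟩ := ex_eq (‖x0‖)
  have hq0 : 0 ≤ q := hq ▸ norm_nonneg _
  have hsq : q < Real.sqrt (q ^ 2 + (d / 2) ^ 2) := Real.lt_sqrt_of_sq_lt (by nlinarith)
  obtain ⟨c, hc⟩ := ex_eq (min (Real.sqrt (q ^ 2 + (d / 2) ^ 2) - q) (d / 4))
  have hc0 : 0 < c := by rw [hc]; exact lt_min l% l%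
  have hc1 : c ≤ _ := hc.le.trans (min_le_left _ _)
  have hc2 : c ≤ _ := hc.le.trans (min_le_right _ _)
  obtain ⟨t, ht⟩ := ex_eq (c / 2)
  have hn : ∀ l : ℂ, ‖x0 + (t:ℂ) • v + l • w‖ ^ 2 = (q + t) ^ 2 + ‖l‖ ^ 2 := by
    intro l
    have : x0 + (t:ℂ) • v = ((q + t : ℝ) : ℂ) • v := by rw [hv, ← hq]; push_cast; rw [add_smul]
    rw [this, pyth (by rw [inner_smul_left, inner_smul_right, hw]; simp), norm_smul, norm_smul, hv1, hw1, Complex.norm_real, mul_one, mul_one, Real.norm_eq_abs, sq_abs]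
  have hdist : ∀ l : ℂ, ‖x0 + (t:ℂ) • v + l • w - x0‖ ≤ t + ‖l‖ := by
    intro l
    have : x0 + (t:ℂ) • v + l • w - x0 = (t:ℂ) • v + l • w := by abel
    rw [this]
    refine (norm_add_le _ _).trans ?_
    rw [norm_smul, norm_smul, hv1, hw1, Complex.norm_real, Real.norm_of_nonneg l%, mul_one, mul_one]
  have hin : ∀ l : ℂ, ‖l‖ ≤ d / 2 → x0 + (t:ℂ) • v + l • w ∈ U := by
    intro l hl
    by_contra h
    have h1 := hm _ (hdO (by rw [mem_ball, dist_eq_norm]; linarith [hdist l])) h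
    have h3 := hn l
    rw [← hq] at h1
    nlinarith [norm_nonneg (x0 + (t:ℂ) • v + l • w), sq_nonneg ‖l‖]
  have hb : ∀ l : ℂ, ‖l‖ = d / 2 → c ≤ infDist (x0 + (t:ℂ) • v + l • w) Uᶜ := by
    intro l hl
    refine (le_infDist ⟨x0, hxU⟩).2 fun y hy => ?_
    by_contra! h
    have h1 := hdist l
    rw [dist_eq_norm] at h
    have h3 : ‖y - x0‖ < d := by
      have : y - x0 = (x0 + (t:ℂ) • v + l • w - x0) - (x0 + (t:ℂ) • v + l • w - y) := by abel
      rw [this]; exact (norm_sub_le _ _).trans_lt l%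
    have h4 := hm y (hdO (by rwa [mem_ball, dist_eq_norm])) hy
    have h5 : Real.sqrt (q ^ 2 + (d / 2) ^ 2) ≤ ‖x0 + (t:ℂ) • v + l • w‖ := Real.sqrt_le_iff.2 ⟨norm_nonneg _, by rw [hn, hl]; nlinarith⟩
    have h6 := norm_sub_norm_le (x0 + (t:ℂ) • v + l • w) y
    linarith
  have ha : x0 + (t:ℂ) • v ∈ U := by simpa using hin 0 (by rw [norm_zero]; linarith)
  have hl : ∀ θ : ℝ, ‖((d / 2 : ℝ) : ℂ) * Complex.exp (θ * Complex.I)‖ = d / 2 := fun θ => by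
    rw [norm_mul, Complex.norm_exp_ofReal_mul_I, mul_one, Complex.norm_real, Real.norm_of_nonneg l%]
  have h1 := hPC _ ha w (d / 2) l% hin
  have hpos : 0 < infDist (x0 + (t:ℂ) • v) Uᶜ := ((hU.isClosed_compl).notMem_iff_infDist_pos ⟨x0, hxU⟩).1 (by simpa using ha)
  have h3 : infDist (x0 + (t:ℂ) • v) Uᶜ ≤ t := (infDist_le_dist_of_mem hxU).trans (by rw [dist_eq_norm]; simpa using hdist 0)
  have h4 : ∫ θ in (0:ℝ)..(2 * Real.pi), -Real.log (Metric.infDist (x0 + (t:ℂ) • v + (((d / 2 : ℝ) : ℂ) * Complex.exp (θ * Complex.I)) • w) Uᶜ) ≤ ∫ θ in (0:ℝ)..(2 * Real.pi), -Real.log c := by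
    refine intervalIntegral.integral_mono_on p% ?_ s% fun θ _ => neg_le_neg (Real.log_le_log hc0 (hb _ (hl θ)))
    refine Continuous.intervalIntegrable (Continuous.neg (Continuous.log ?_ fun θ => (hc0.trans_le (hb _ (hl θ))).ne')) _ _
    exact (continuous_infDist_pt _).comp (by fun_prop)
  rw [intervalIntegral.integral_const, sub_zero, smul_eq_mul] at h4
  have h5 := mll h4 (show 0 ≤ 1 / (2 * Real.pi) by positivity)
  have h6 : 1 / (2 * Real.pi) * (2 * Real.pi * -Real.log c) = -Real.log c := by field_simp
  rw [h6] at h5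
  have h7 := Real.log_le_log hpos h3
  have h8 := Real.log_lt_log (show 0 < t by linarith) (show t < c by linarith)
  linarith

theorem pc_compl (h2 : 2 ≤ finrank ℂ E) {K : Set E} (hK : IsCompact K)
    (hSt : ∀ W, IsOpen W → K ⊆ W → ∃ U, IsOpen U ∧ K ⊆ U ∧ U ⊆ W ∧ PC U) : IsPathConnected Kᶜ := by
  letI : InnerProductSpace ℝ E := InnerProductSpace.complexToReal
  obtain ⟨R, hR0, hR⟩ := hK.isBounded.subset_closedBall_lt 0 0
  have hX : IsPathConnected {x : E | R < ‖x‖} := by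
    have h1 : IsPathConnected ({0}ᶜ : Set E) := by
      refine isPathConnected_compl_singleton_of_one_lt_rank ?_ 0
      rw [← finrank_eq_rank]
      have := finrank_real_of_complex E
      exact_mod_cast (by omega : 1 < finrank ℝ E)
    have h3 := h1.image' (f := fun x => x + (R / ‖x‖) • x) (by
      refine continuousOn_id.add ((continuousOn_const.div continuousOn_id.norm fun x hx => ?_).smul continuousOn_id)
      simpa using hx)
    convert h3 using 1
    ext y
    simp only [mem_setOf_eq, mem_image, mem_compl_iff, mem_singleton_iff]
    constructor
    · intro hy
      have hy0 : 0 < ‖y‖ := hR0.trans hy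
      have e : ‖(1 - R / ‖y‖) • y‖ = ‖y‖ - R := by
        rw [norm_smul, Real.norm_of_nonneg (by rw [sub_nonneg, div_le_one hy0]; exact hy.le)]; field_simp
      refine ⟨(1 - R / ‖y‖) • y, fun h => ?_, ?_⟩
      · rw [h, norm_zero] at e; linarith
      · rw [e, smul_smul, ← add_smul]
        have : ‖y‖ - R ≠ 0 := by linarith
        have e2 : 1 - R / ‖y‖ + R / (‖y‖ - R) * (1 - R / ‖y‖) = 1 := by field_simp; ring
        rw [e2, one_smul]
    · rintro ⟨x, hx, rfl⟩
      have hx0 : 0 < ‖x‖ := norm_pos_iff.2 hx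
      have : x + (R / ‖x‖) • x = (1 + R / ‖x‖) • x := by rw [add_smul, one_smul]
      rw [this, norm_smul, Real.norm_of_nonneg p%]; field_simp; linarith
  have hXK : {x : E | R < ‖x‖} ⊆ Kᶜ := fun x hx h => by
    have := hR h; simp only [mem_closedBall, dist_zero_right] at this; exact absurd hx (not_lt.2 this)
  obtain ⟨x1, hx1⟩ := hX.nonempty
  refine ⟨x1, hXK hx1, fun {xs} hxs => ?_⟩
  by_contra hn
  have hKo : IsOpen Kᶜ := hK.isClosed.isOpen_compl
  have hO : IsOpen (pathComponentIn Kᶜ xs) := hKo.pathComponentIn xs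
  have hOR : ∀ y ∈ pathComponentIn Kᶜ xs, ‖y‖ ≤ R := by
    intro y hy
    by_contra! h
    exact hn (((hX.joinedIn x1 hx1 y h).mono hXK).trans (JoinedIn.symm hy))
  obtain ⟨U, hU, hKU, hUx, hP⟩ := hSt {xs}ᶜ isOpen_compl_singleton (fun y hy h => hxs (by rw [mem_singleton_iff] at h; exact h ▸ hy))
  have hcl : ∀ y ∈ closure (pathComponentIn Kᶜ xs), y ∉ K → y ∈ pathComponentIn Kᶜ xs := by
    intro y hy hyK
    obtain ⟨z, hz1, hz2⟩ := mem_closure_iff.1 hy _ (hKo.pathComponentIn y) (mem_pathComponentIn_self hyK)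
    exact JoinedIn.trans hz2 (JoinedIn.symm hz1)
  have hc : IsCompact (closure (pathComponentIn Kᶜ xs) \ U) := by
    haveI := FiniteDimensional.proper ℂ E
    refine (Metric.isCompact_of_isClosed_isBounded isClosed_closure ?_).diff hU
    exact (isBounded_iff_subset_closedBall 0 |>.2 ⟨R, fun y hy => by simpa using hOR y hy⟩).closure
  obtain ⟨x0, h0, h0m⟩ := hc.exists_isMaxOn ⟨xs, subset_closure (mem_pathComponentIn_self hxs), fun h => hUx h rfl⟩ continuous_norm.continuousOn
  exact no_hole h2 hU hP hO (hcl x0 h0.1 fun h => h0.2 (hKU h)) h0.2 fun y hy hyU => h0m ⟨subset_closure hy, hyU⟩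
end

section
open Filter Topology Set Metric Module Polynomial unitInterval
variable {E : Type*} [NormedAddCommGroup E] [NormedSpace ℂ E] [FiniteDimensional ℂ E]

theorem pdiff (p : ℂ[X]) : ∃ q : ℝ × ℝ → ℂ, ContDiff ℝ 1 q ∧ (∀ s s' : ℝ, p.eval (s:ℂ) - p.eval (s':ℂ) = (s - s') * q (s, s')) ∧
    ∀ s : ℝ, p.derivative.eval (s:ℂ) = q (s, s) := by
  induction p using Polynomial.induction_on' with
  | add p q hp hq =>
    obtain ⟨f, f1, f2, f3⟩ := hp
    obtain ⟨g, g1, g2, g3⟩ := hq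
    refine ⟨fun x => f x + g x, f1.add g1, fun s s' => ?_, fun s => ?_⟩
    · rw [eval_add, eval_add, mul_add, ← f2, ← g2]; ring
    · rw [derivative_add, eval_add, f3, g3]
  | monomial m a =>
    refine ⟨fun x => a * ∑ i ∈ Finset.range m, (x.1:ℂ) ^ i * (x.2:ℂ) ^ (m - 1 - i), ?_, fun s s' => ?_, fun s => ?_⟩
    · have h1 : ContDiff ℝ 1 fun x : ℝ × ℝ => (x.1 : ℂ) := Complex.ofRealCLM.contDiff.comp contDiff_fst
      have h2 : ContDiff ℝ 1 fun x : ℝ × ℝ => (x.2 : ℂ) := Complex.ofRealCLM.contDiff.comp contDiff_snd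
      exact contDiff_const.mul (ContDiff.sum fun i _ => (h1.pow _).mul (h2.pow _))
    · simp only [eval_monomial]
      rw [← mul_sub, ← (Commute.all (s:ℂ) (s':ℂ)).geom_sum₂_mul]; ring
    · simp only [derivative_monomial, eval_monomial]
      rw [geom_sum₂_self]; ring

theorem poly_approx (φ : C(I, E)) {η : ℝ} (hη : 0 < η) : ∃ (N : ℕ) (P : Fin N → ℂ[X]) (v : Fin N → E),
    ∀ s : I, ‖∑ k, (P k).eval ((s:ℝ):ℂ) • v k - φ s‖ < η := by
  obtain ⟨N, hN⟩ := ((Metric.tendsto_atTop.1 (bernsteinApproximation_uniform φ)) η hη)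
  refine ⟨N + 1, fun k => C ((N.choose k : ℂ)) * X ^ (k:ℕ) * (1 - X) ^ (N - k), fun k => φ (bernstein.z k), fun s => ?_⟩
  have h1 := (ContinuousMap.dist_apply_le_dist s).trans_lt (hN N le_rfl)
  rw [dist_eq_norm, bernsteinApproximation.apply] at h1
  refine lt_of_eq_of_lt (congrArg (fun y => ‖y - φ s‖) (Finset.sum_congr rfl fun k _ => ?_)) h1
  rw [bernstein_apply, ← Complex.coe_smul]
  congr 1
  simp

theorem gamma_exists (h2 : 2 ≤ finrank ℂ E) {K : Set E} (hK : IsCompact K) (hpc : IsPathConnected Kᶜ) {om : E →L[ℂ] ℂ} {e : E} (he : (om e).re < 0)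
    {r η0 : ℝ} (hr : 0 < r) (hη0 : 0 < η0) (hcone : ∀ s : ℝ, 0 < s → s ≤ r → ∀ X : E, ‖X‖ ≤ η0 → (s:ℂ) • (e + X) ∉ K) :
    ∃ Γ : ℂ → E, ContDiff ℂ 3 Γ ∧ Γ 0 = 0 ∧ (∀ s ∈ Icc (0:ℝ) 1, ∀ s' ∈ Icc (0:ℝ) 1, Γ s = Γ s' → s = s') ∧
      (∀ s ∈ Icc (0:ℝ) 1, om (deriv Γ s) ≠ 0) ∧ (om (deriv Γ 0)).re < 0 ∧ (∀ s ∈ Icc (0:ℝ) 1, Γ s ∈ K → s = 0) ∧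
      (∀ s ∈ Icc (0:ℝ) 1, om (Γ s) = om (Γ 1) → s = 1) ∧ ∀ y ∈ K, om y ≠ om (Γ 1) := by
  have hoe : om e ≠ 0 := by intro h; simp [h] at he
  have hoe' : 0 < ‖om e‖ := norm_pos_iff.2 hoe
  obtain ⟨B, hB⟩ := (hK.image om.continuous).isBounded.exists_norm_le
  have hB' : ∀ y ∈ K, ‖om y‖ ≤ max B 0 := fun y hy => (hB _ (mem_image_of_mem _ hy)).trans (le_max_left _ _)
  obtain ⟨B0, hB0⟩ := ex_eq (max B 0)
  rw [← hB0] at hB'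
  have hB00 : 0 ≤ B0 := hB0 ▸ le_max_right _ _
  obtain ⟨x1, hx1⟩ : ∃ x1 : E, ‖om x1‖ = B0 + 1 := ⟨(((B0 + 1) / ‖om e‖ : ℝ) : ℂ) • e, by
    rw [map_smul, norm_smul, Complex.norm_real, Real.norm_of_nonneg p%]; field_simp⟩
  have hx1K : x1 ∈ Kᶜ := fun h => by linarith [hB' _ h]
  obtain ⟨s0, hs0⟩ := ex_eq (min r (1/2) : ℝ)
  have s0p : 0 < s0 := hs0 ▸ lt_min hr n%
  have s0r : s0 ≤ r := hs0 ▸ min_le_left _ _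
  have s01 : s0 ≤ 1/2 := hs0 ▸ min_le_right _ _
  have hx0 : (s0:ℂ) • e ∈ Kᶜ := by simpa using hcone s0 s0p s0r 0 (by simpa using hη0.le)
  obtain ⟨γ, hγ⟩ := hpc.joinedIn _ hx0 _ hx1K
  obtain ⟨d1, hd1, hd⟩ := (isCompact_range γ.continuous).exists_thickening_subset_open hK.isClosed.isOpen_compl (by rintro _ ⟨t, rfl⟩; exact hγ t)
  obtain ⟨c, hc⟩ := ex_eq (fun s => ((min s s0 : ℝ) : ℂ) • e + (γ.extend ((s - s0) / (1 - s0)) - (s0:ℂ) • e) : ℝ → E)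
  have hcc : Continuous c := by
    rw [hc]
    have : Continuous fun s : ℝ => ((min s s0 : ℝ) : ℂ) := Complex.continuous_ofReal.comp (continuous_id.min continuous_const)
    have h3 : Continuous fun s : ℝ => γ.extend ((s - s0) / (1 - s0)) := γ.continuous_extend.comp (by fun_prop)
    exact (this.smul continuous_const).add (h3.sub continuous_const)
  have c1 : ∀ s ≤ s0, c s = (s:ℂ) • e := fun s hs => by
    rw [hc]; simp only []
    rw [min_eq_left hs, γ.extend_of_le_zero (div_nonpos_of_nonpos_of_nonneg l% l%)]; abel
  have c2 : ∀ s, s0 ≤ s → c s = γ.extend ((s - s0) / (1 - s0)) := fun s hs => by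
    rw [hc]; simp only []
    rw [min_eq_right hs]; abel
  have c2' : ∀ s, s0 ≤ s → c s ∈ range γ := fun s hs => by
    rw [c2 s hs, Path.extend, ]; exact ⟨_, rfl⟩
  have c3 : c 1 = x1 := by rw [c2 1 l%, div_self l%, γ.extend_one]
  obtain ⟨φ, hφ⟩ := ex_eq (fun s => (((max s s0 : ℝ) : ℂ) ^ 2)⁻¹ • (c s - (s:ℂ) • e) : ℝ → E)
  have hφc : Continuous φ := by
    rw [hφ]
    have : Continuous fun s : ℝ => ((max s s0 : ℝ) : ℂ) := Complex.continuous_ofReal.comp (continuous_id.max continuous_const)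
    refine ((this.pow 2).inv₀ fun s => ?_).smul (hcc.sub (Complex.continuous_ofReal.smul continuous_const))
    have : 0 < max s s0 := lt_max_of_lt_right s0p
    exact pow_ne_zero _ (Complex.ofReal_ne_zero.2 this.ne')
  obtain ⟨η, hη, h1η, h2η, h3η, h4η⟩ : ∃ η : ℝ, 0 < η ∧ 2 * η ≤ η0 ∧ 2 * η < d1 ∧ ‖om‖ * (2 * η) < 1 ∧ ‖om‖ * η < -(om e).re := by
    obtain ⟨η, h⟩ := ex_eq (min (min (η0 / 2) (d1 / 4)) (min (1 / (4 * (‖om‖ + 1))) (-(om e).re / (2 * (‖om‖ + 1)))) : ℝ)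
    have hop : 0 ≤ ‖om‖ := norm_nonneg _
    have a1 : η ≤ η0 / 2 := h.le.trans ((min_le_left _ _).trans (min_le_left _ _))
    have a2 : η ≤ d1 / 4 := h.le.trans ((min_le_left _ _).trans (min_le_right _ _))
    have a3 : η ≤ 1 / (4 * (‖om‖ + 1)) := h.le.trans ((min_le_right _ _).trans (min_le_left _ _))
    have a4 : η ≤ -(om e).re / (2 * (‖om‖ + 1)) := h.le.trans ((min_le_right _ _).trans (min_le_right _ _))
    have a0 : 0 < η := by
      rw [h]
      exact lt_min (lt_min l% l%) (lt_min p% (div_pos l% p%))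
    rw [le_div_iff₀ p%] at a3 a4
    exact ⟨η, a0, by linarith, by linarith, by nlinarith, by nlinarith⟩
  obtain ⟨N, P, v, hP⟩ := poly_approx ⟨fun s : I => φ s, hφc.comp continuous_subtype_val⟩ hη
  have hP' : ∀ s ∈ Icc (0:ℝ) 1, ‖∑ k, (P k).eval (s:ℂ) • v k - φ s‖ < η := fun s hs => hP ⟨s, hs⟩
  choose q q1 q2 q3 using fun k => pdiff (X ^ 2 * P k)
  obtain ⟨Q, hQ⟩ := ex_eq (fun x => e + ∑ k, q k x • v k : ℝ × ℝ → E)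
  have hQ1 : ContDiff ℝ 1 Q := by
    rw [hQ]; exact contDiff_const.add (ContDiff.sum fun k _ => (q1 k).smul contDiff_const)
  have hfr := finrank_real_of_complex E
  haveI : FiniteDimensional ℝ E := FiniteDimensional.complexToReal E
  have d1' : Dense ((fun x => -Q x) '' (Icc (0:ℝ) 1 ×ˢ Icc (0:ℝ) 1))ᶜ :=
    (hQ1.neg.dense_compl_range_of_finrank_lt_finrank (by simp; omega)).mono (compl_subset_compl.2 (image_subset_range _ _))
  have hop : IsOpenMap om := om.isOpenMap (fun c => ⟨(c / om e) • e, by rw [map_smul, smul_eq_mul]; field_simp⟩)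
  have hω : ∀ {j : ℝ → ℝ × ℝ}, ContDiff ℝ 1 j → Dense (om ⁻¹' ((fun s => -om (Q (j s))) '' Icc (0:ℝ) 1)ᶜ) ∧ IsOpen (om ⁻¹' ((fun s => -om (Q (j s))) '' Icc (0:ℝ) 1)ᶜ) := by
    intro j hj
    have h3 : ContDiff ℝ 1 fun s => -om (Q (j s)) := (((om.restrictScalars ℝ).contDiff.comp hQ1).comp hj).neg
    exact ⟨((h3.dense_compl_range_of_finrank_lt_finrank (by simp [Complex.finrank_real_complex])).mono (compl_subset_compl.2 (image_subset_range _ _))).preimage hop,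
      (isCompact_Icc.image h3.continuous).isClosed.isOpen_compl.preimage om.continuous⟩
  have w1 := hω (j := fun s => (s, s)) (by fun_prop)
  have w2 := hω (j := fun s => (s, 1)) (by fun_prop)
  obtain ⟨κ, ⟨⟨k1, k2⟩, k3⟩, hκ⟩ := ((d1'.inter_of_isOpen_right w1.1 w1.2).inter_of_isOpen_right w2.1 w2.2).exists_mem_open isOpen_ball (⟨0, mem_ball_self hη⟩ : (ball (0:E) η).Nonempty)
  rw [mem_ball, dist_zero_right] at hκ
  have hD1 : ∀ s ∈ Icc (0:ℝ) 1, ∀ s' ∈ Icc (0:ℝ) 1, Q (s, s') + κ ≠ 0 := fun s hs s' hs' h => k1 ⟨(s, s'), ⟨hs, hs'⟩, (eq_neg_of_add_eq_zero_right h).symm⟩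
  have hD2 : ∀ s ∈ Icc (0:ℝ) 1, om (Q (s, s) + κ) ≠ 0 := fun s hs h => k2 ⟨s, hs, by rw [map_add] at h; exact (eq_neg_of_add_eq_zero_right h).symm⟩
  have hD3 : ∀ s ∈ Icc (0:ℝ) 1, om (Q (s, 1) + κ) ≠ 0 := fun s hs h => k3 ⟨s, hs, by rw [map_add] at h; exact (eq_neg_of_add_eq_zero_right h).symm⟩
  obtain ⟨Γ, hΓ⟩ := ex_eq (fun x => x • (e + κ) + ∑ k, (X ^ 2 * P k).eval x • v k : ℂ → E)
  have hG0 : Γ 0 = 0 := by rw [hΓ]; simp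
  have hGd : ∀ s : ℝ, deriv Γ s = Q (s, s) + κ := by
    intro s
    have : HasDerivAt Γ ((1:ℂ) • (e + κ) + ∑ k, (derivative (X ^ 2 * P k)).eval (s:ℂ) • v k) s := by
      rw [hΓ]
      exact ((hasDerivAt_id _).smul_const _).add (HasDerivAt.fun_sum fun k _ => ((X ^ 2 * P k).hasDerivAt _).smul_const _)
    rw [this.deriv, hQ, one_smul]; simp only [q3]; abel
  have hGs : ∀ s s' : ℝ, Γ s - Γ s' = ((s - s' : ℝ) : ℂ) • (Q (s, s') + κ) := by
    intro s s'
    have h5 : ∀ k, (((s - s' : ℝ) : ℂ) * q k (s, s')) • v k = (X ^ 2 * P k).eval (s:ℂ) • v k - (X ^ 2 * P k).eval (s':ℂ) • v k := fun k => by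
      rw [← sub_smul, q2]; push_cast; rfl
    rw [hΓ, hQ]; simp only [smul_add, Finset.smul_sum, smul_smul, h5, Finset.sum_sub_distrib]
    push_cast; simp only [sub_smul]; abel
  have hG3 : ∀ s : ℝ, Γ s = (s:ℂ) • (e + κ) + (s:ℂ) ^ 2 • ∑ k, (P k).eval (s:ℂ) • v k := fun s => by
    rw [hΓ]; simp only [Finset.smul_sum, smul_smul, eval_mul, eval_pow, eval_X]
  have hnear : ∀ s ∈ Icc (0:ℝ) 1, s0 ≤ s → ‖Γ s - c s‖ < 2 * η := by
    intro s hs h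
    have hs' : (s:ℂ) ≠ 0 := Complex.ofReal_ne_zero.2 l%
    have h5 : c s = (s:ℂ) • e + (s:ℂ) ^ 2 • φ s := by
      rw [hφ]; simp only [max_eq_left h]; rw [smul_smul, mul_inv_cancel₀ (pow_ne_zero _ hs'), one_smul]; abel
    have h6 : Γ s - c s = (s:ℂ) • κ + (s:ℂ) ^ 2 • (∑ k, (P k).eval (s:ℂ) • v k - φ s) := by
      rw [hG3, h5, smul_add, smul_sub]; abel
    rw [h6]
    refine (norm_add_le _ _).trans_lt ?_
    rw [norm_smul, norm_smul, norm_pow, Complex.norm_real, Real.norm_of_nonneg hs.1]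
    have := hP' s hs
    have h7 : s ^ 2 ≤ 1 := pow_le_one₀ hs.1 hs.2
    nlinarith [mlr hs.2 (norm_nonneg κ), mlr h7 (norm_nonneg (∑ k, (P k).eval (s:ℂ) • v k - φ s))]
  have h11 := hnear 1 s% l%
  rw [c3, Complex.ofReal_one] at h11
  refine ⟨Γ, ?_, hG0, fun s hs s' hs' h => ?_, fun s hs => by rw [hGd]; exact hD2 s hs, ?_, fun s hs h => ?_, fun s hs h => ?_, fun y hy h => ?_⟩
  · rw [hΓ]
    exact (contDiff_id.smul contDiff_const).add (ContDiff.sum fun k _ => ContDiff.smul (Polynomial.contDiff_aeval (X ^ 2 * P k) 3) contDiff_const)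
  · have h5 := hGs s s'
    rw [h, sub_self, eq_comm, smul_eq_zero, or_iff_left (hD1 s hs s' hs'), Complex.ofReal_eq_zero] at h5
    linarith
  · have h5 := hGd 0
    have h6 : Q (0, 0) = e := by
      rw [hQ]; simp only [← q3]; simp
    rw [Complex.ofReal_zero, h6] at h5
    rw [h5, map_add, Complex.add_re]
    have := (Complex.re_le_norm (om κ)).trans (om.le_opNorm κ)
    nlinarith [mll hκ.le (norm_nonneg om)]
  · by_contra hs0'
    have hsp : 0 < s := lt_of_le_of_ne hs.1 (Ne.symm hs0')
    rcases le_total s s0 with h5 | h5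
    · refine hcone s hsp (h5.trans s0r) (κ + (s:ℂ) • ∑ k, (P k).eval (s:ℂ) • v k) ?_ ?_
      · have h6 := hP' s hs
        have h7 : φ s = 0 := by rw [hφ]; simp only [c1 s h5, sub_self, smul_zero]
        rw [h7, sub_zero] at h6
        refine (norm_add_le _ _).trans ?_
        rw [norm_smul, Complex.norm_real, Real.norm_of_nonneg hs.1]
        nlinarith [mlr hs.2 (norm_nonneg (∑ k, (P k).eval (s:ℂ) • v k))]
      · rw [hG3] at h
        convert h using 1
        simp only [smul_add, smul_smul, sq, add_assoc]
    · exact hd (mem_thickening_iff.2 ⟨c s, c2' s h5, by rw [dist_eq_norm]; exact (hnear s hs h5).trans h2η⟩) h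
  · have h5 := hGs s 1
    rw [Complex.ofReal_one] at h5
    have h6 := congrArg om h5
    rw [map_sub, h, sub_self, map_smul, eq_comm, smul_eq_zero, or_iff_left (hD3 s hs), Complex.ofReal_eq_zero] at h6
    linarith
  · have h5 := hB' y hy
    rw [h] at h5
    have h6 := om.le_opNorm (Γ 1 - x1)
    rw [map_sub] at h6
    have h7 := norm_sub_norm_le (om x1) (om (Γ 1))
    rw [norm_sub_rev] at h7
    nlinarith [mll h11.le (norm_nonneg om)]
end

section
open Filter Topology Set Metric Module
open scoped NNReal
variable {E : Type*} [NormedAddCommGroup E] [NormedSpace ℂ E] [NormedSpace ℝ E] [IsScalarTower ℝ ℂ E]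

theorem re_inv_ge {w : ℂ} {C : ℝ} (h : -(C * ‖w‖ ^ 2) < w.re) : w ≠ 0 ∧ -C ≤ (1 / w).re := by
  have h0 : w ≠ 0 := by rintro rfl; simp at h
  refine ⟨h0, ?_⟩
  rw [one_div, Complex.inv_re, Complex.normSq_eq_norm_sq, le_div_iff₀ (by have := norm_pos_iff.2 h0; positivity)]
  linarith

theorem mk_u {K : Set E} (hK : IsCompact K) (om0 : E →L[ℂ] ℂ) {g v : E → ℂ} {r1 C1 : ℝ} (hr1 : 0 < r1)
    (hloc : ∀ y ∈ K, ‖y‖ < r1 → y ≠ 0 → -(C1 * ‖om0 y‖ ^ 2) < (om0 y).re) (hg : ∀ y ∈ K, y ≠ 0 → DifferentiableAt ℂ g y ∧ ContDiffAt ℝ 1 g y)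
    (hv : ContDiffAt ℂ 3 v 0) (hgv : ∀ y, ‖y‖ < r1 → g y = 1 / om0 y - v y) :
    ∃ (u ψ : E → ℂ) (τ : ℝ), 0 < τ ∧ (∀ y ∈ K, DifferentiableAt ℂ u y) ∧ u 0 = 0 ∧ (∀ y ∈ K, y ≠ 0 → 0 < (u y).re) ∧
      (∀ y ∈ K, ∃ C : ℝ≥0, ∃ t ∈ 𝓝 y, LipschitzOnWith C u t) ∧ HasStrictFDerivAt u ((τ:ℂ) • om0) 0 ∧ ContDiffAt ℂ 3 u 0 ∧
      (∀ᶠ y in 𝓝 0, u y = ((τ:ℂ) • om0) y * ψ y) ∧ ContinuousAt ψ 0 ∧ ψ 0 = 1 := by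
  obtain ⟨V, hV0, r2, hr2, hr21, hV⟩ : ∃ V, 0 ≤ V ∧ ∃ r2 > 0, r2 ≤ r1 ∧ ∀ y, ‖y‖ < r2 → ‖v y‖ ≤ V := by
    have := hv.continuousAt.norm.eventually (gt_mem_nhds (lt_add_one ‖v 0‖))
    obtain ⟨r, hr, h⟩ := Metric.eventually_nhds_iff.1 this
    exact ⟨‖v 0‖ + 1, by positivity, min r r1, lt_min hr hr1, min_le_right _ _, fun y hy => (h (by simpa using hy.trans_le (min_le_left _ _))).le⟩
  obtain ⟨M, hM⟩ : ∃ M, ∀ y ∈ K \ ball 0 r2, ‖g y‖ ≤ M := (hK.diff isOpen_ball).exists_bound_of_continuousOn fun y hy =>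
    (hg y hy.1 (by rintro rfl; exact hy.2 (mem_ball_self hr2))).1.continuousAt.continuousWithinAt
  obtain ⟨t, ht, htp⟩ : ∃ t : ℝ, 0 < t ∧ t * (|C1| + V + |M|) < 1 := by
    refine ⟨1 / (|C1| + V + |M| + 1), by positivity, ?_⟩
    rw [div_mul_eq_mul_div, one_mul, div_lt_one p%]; linarith
  have hgr : ∀ y ∈ K, y ≠ 0 → 0 < (1 + t * g y).re := by
    intro y hy h0
    have h1 : -(|C1| + V + |M|) ≤ (g y).re := by
      by_cases h : ‖y‖ < r2
      · rw [hgv y (h.trans_le hr21), Complex.sub_re]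
        have h2 := (re_inv_ge (hloc y hy (h.trans_le hr21) h0)).2
        have h3 := (Complex.re_le_norm (v y)).trans (hV y h)
        linarith [le_abs_self C1, abs_nonneg M]
      · have h2 := hM y ⟨hy, by simpa using h⟩
        linarith [(abs_le.1 (Complex.abs_re_le_norm (g y))).1, le_abs_self M, abs_nonneg C1]
    simp only [Complex.add_re, Complex.one_re, Complex.mul_re, Complex.ofReal_re, Complex.ofReal_im, zero_mul, sub_zero]
    nlinarith
  obtain ⟨D, hD⟩ := ex_eq (fun y => om0 y + t * (1 - om0 y * v y) : E → ℂ)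
  have hD3 : ContDiffAt ℂ 3 D 0 := by
    rw [hD]; exact om0.contDiff.contDiffAt.add (contDiffAt_const.mul (contDiffAt_const.sub (om0.contDiff.contDiffAt.mul hv)))
  have htc : (t:ℂ) ≠ 0 := Complex.ofReal_ne_zero.2 ht.ne'
  have hD0 : D 0 = t := by rw [hD]; simp
  obtain ⟨r3, hr3, hr31, hDr⟩ : ∃ r3 > 0, r3 < r1 ∧ ∀ y, ‖y‖ < r3 → D y ≠ 0 := by
    obtain ⟨r, hr, h⟩ := Metric.eventually_nhds_iff.1 (hD3.continuousAt.eventually_ne (by rw [hD0]; exact htc))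
    exact ⟨min r (r1 / 2), lt_min hr l%, (min_le_right _ _).trans_lt l%, fun y hy => h (by simpa using hy.trans_le (min_le_left _ _))⟩
  obtain ⟨ψ, hψ⟩ := ex_eq (fun y => t * (D y)⁻¹ : E → ℂ)
  have hψ3 : ContDiffAt ℂ 3 ψ 0 := by rw [hψ]; exact contDiffAt_const.mul (hD3.inv (by rw [hD0]; exact htc))
  have hψ0 : ψ 0 = 1 := by rw [hψ]; simp only [hD0]; exact mul_inv_cancel₀ htc
  classical
  obtain ⟨u, hu⟩ := ex_eq (fun y => if ‖y‖ < r3 then om0 y * (D y)⁻¹ else (1 + t * g y)⁻¹ : E → ℂ)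
  have hun : ∀ᶠ y in 𝓝 0, u y = (((t⁻¹ : ℝ) : ℂ) • om0) y * ψ y := by
    filter_upwards [ball_mem_nhds 0 hr3] with y hy
    rw [hu, hψ]; simp only [if_pos (mem_ball_zero_iff.1 hy), ContinuousLinearMap.smul_apply, smul_eq_mul]; push_cast; field_simp
  have hu3 : ContDiffAt ℂ 3 u 0 := (((((t⁻¹ : ℝ) : ℂ) • om0).contDiff.contDiffAt).mul hψ3).congr_of_eventuallyEq hun
  have huK : ∀ y ∈ K, y ≠ 0 → u =ᶠ[𝓝 y] fun y => (1 + t * g y)⁻¹ := by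
    intro y hy h0
    by_cases h : ‖y‖ < r1
    · have h1 := (re_inv_ge (hloc y hy h h0)).1
      filter_upwards [om0.continuous.continuousAt.eventually_ne h1, continuous_norm.continuousAt.eventually (gt_mem_nhds h)] with z hz hz1
      rw [hu]; simp only
      split_ifs with h2
      · have h3 := hDr z h2
        have e : D z = om0 z * (1 + t * g z) := by
          rw [hD, hgv z hz1]; simp only; field_simp
        rw [e, mul_inv, ← mul_assoc, mul_inv_cancel₀ hz, one_mul]
      · rfl
    · filter_upwards [continuous_norm.continuousAt.eventually (lt_mem_nhds (hr31.trans_le (not_lt.1 h)))] with z hz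
      rw [hu]; simp only [if_neg (not_lt.2 hz.le)]
  have hne : ∀ y ∈ K, y ≠ 0 → 1 + t * g y ≠ 0 := fun y hy h0 h => by have := hgr y hy h0; rw [h] at this; simp at this
  refine ⟨u, ψ, t⁻¹, by positivity, fun y hy => ?_, ?_, fun y hy h0 => ?_, fun y hy => ?_, ?_, hu3, hun, hψ3.continuousAt, hψ0⟩
  · by_cases h0 : y = 0
    · rw [h0]; exact hu3.differentiableAt n%
    · exact (((hg y hy h0).1.const_mul _).const_add 1 |>.inv (hne y hy h0)).congr_of_eventuallyEq (huK y hy h0)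
  · rw [hu]; simp [hr3]
  · rw [(huK y hy h0).eq_of_nhds, Complex.inv_re]
    exact div_pos (hgr y hy h0) (Complex.normSq_pos.2 (hne y hy h0))
  · by_cases h0 : y = 0
    · rw [h0]; exact (hu3.of_le n%).exists_lipschitzOnWith
    · have : ContDiffAt ℝ 1 u y := ((contDiffAt_const.add (contDiffAt_const.mul (hg y hy h0).2)).inv (hne y hy h0)).congr_of_eventuallyEq (huK y hy h0)
      exact this.exists_lipschitzOnWith
  · have h1 : HasStrictFDerivAt u (fderiv ℂ u 0) 0 := hu3.hasStrictFDerivAt n%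
    have h2 : HasFDerivAt (fun y => (((t⁻¹ : ℝ) : ℂ) • om0) y * ψ y) _ 0 := ((((t⁻¹ : ℝ) : ℂ) • om0).hasFDerivAt).mul (hψ3.differentiableAt n%).hasFDerivAt
    have h3 := (h2.congr_of_eventuallyEq hun).fderiv
    rw [h3] at h1
    convert h1 using 1; ext X; simp [hψ0]

theorem mk_F [FiniteDimensional ℂ E] {K : Set E} (hK : IsCompact K) (h0K : 0 ∈ K) (om0 : E →L[ℂ] ℂ) {ν : E} (hν : om0 ν = -1) {g v : E → ℂ} {r1 C1 : ℝ} (hr1 : 0 < r1)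
    (hloc : ∀ y ∈ K, ‖y‖ < r1 → y ≠ 0 → -(C1 * ‖om0 y‖ ^ 2) < (om0 y).re) (hg : ∀ y ∈ K, y ≠ 0 → DifferentiableAt ℂ g y ∧ ContDiffAt ℝ 1 g y)
    (hv : ContDiffAt ℂ 3 v 0) (hgv : ∀ y, ‖y‖ < r1 → g y = 1 / om0 y - v y) (hpc : 2 ≤ finrank ℂ E → IsPathConnected Kᶜ) :
    ∃ F : E → E, (∀ y ∈ K, DifferentiableAt ℂ F y) ∧ ContDiffAt ℂ 3 F 0 ∧ InjOn F K ∧ (∀ᶠ X in 𝓝 0, om0 X = 0 → F X = X + F 0) ∧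
      (∀ X, fderiv ℂ F 0 X = 0 → X = 0) ∧ ∀ y ∈ K, y ≠ 0 → om0 (F y) ≠ om0 (F 0) := by
  by_cases h2 : 2 ≤ finrank ℂ E
  · obtain ⟨u, ψ, τ, hτ, u1, u2, u3, u4, u5, u6, u7, u8, u9⟩ := mk_u hK om0 hr1 hloc hg hv hgv
    have hτc : (τ:ℂ) ≠ 0 := Complex.ofReal_ne_zero.2 hτ.ne'
    have hop := norm_nonneg om0
    have hcone : ∃ r > 0, ∃ η0 > 0, ∀ s : ℝ, 0 < s → s ≤ r → ∀ X : E, ‖X‖ ≤ η0 → (s:ℂ) • (ν + X) ∉ K := by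
      obtain ⟨η0, h⟩ := ex_eq (1 / (2 * (‖om0‖ + 1)) : ℝ)
      have hη : 0 < η0 := by rw [h]; positivity
      have hη1 : ‖om0‖ * η0 ≤ 1 / 2 := by rw [h]; field_simp; linarith
      obtain ⟨r, hr⟩ := ex_eq (min (1 / (8 * (|C1| + 1))) (r1 / (2 * (‖ν‖ + η0))) : ℝ)
      refine ⟨r, by rw [hr]; positivity, η0, hη, fun s hs hsr X hX hKs => ?_⟩
      have ho : om0 ((s:ℂ) • (ν + X)) = s * (-1 + om0 X) := by rw [map_smul, map_add, hν, smul_eq_mul]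
      have hX1 : ‖om0 X‖ ≤ 1 / 2 := (om0.le_opNorm X).trans ((mll hX hop).trans hη1)
      have hre : (om0 ((s:ℂ) • (ν + X))).re ≤ -(s / 2) := by
        rw [ho]; simp only [Complex.mul_re, Complex.ofReal_re, Complex.ofReal_im, zero_mul, sub_zero, Complex.add_re, Complex.neg_re, Complex.one_re]
        nlinarith [Complex.re_le_norm (om0 X)]
      have hno : ‖om0 ((s:ℂ) • (ν + X))‖ ≤ s * 2 := by
        rw [ho, norm_mul, Complex.norm_real, Real.norm_of_nonneg hs.le]
        refine mll ((norm_add_le _ _).trans ?_) hs.le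
        rw [norm_neg, norm_one]; linarith
      have s1 : s ≤ 1 / (8 * (|C1| + 1)) := hsr.trans (hr ▸ min_le_left _ _)
      have s2 : s ≤ r1 / (2 * (‖ν‖ + η0)) := hsr.trans (hr ▸ min_le_right _ _)
      have hnr : ‖(s:ℂ) • (ν + X)‖ < r1 := by
        rw [norm_smul, Complex.norm_real, Real.norm_of_nonneg hs.le]
        rw [le_div_iff₀ p%] at s2
        have := norm_add_le ν X
        nlinarith [mll (this.trans (add_le_add_right hX _)) hs.le]
      have h3 := hloc _ hKs hnr (by intro h; rw [h, map_zero, Complex.zero_re] at hre; linarith)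
      rw [le_div_iff₀ p%] at s1
      have h4 : ‖om0 ((s:ℂ) • (ν + X))‖ ^ 2 ≤ (s * 2) ^ 2 := pow_le_pow_left₀ (norm_nonneg _) hno 2
      have h5 := mul_le_mul (le_abs_self C1) h4 (sq_nonneg _) (abs_nonneg _)
      nlinarith [abs_nonneg C1]
    obtain ⟨r, hr, η0, hη0, hcone⟩ := hcone
    obtain ⟨Γ, G1, G2, G3, G4, G5, G6, G7, G8⟩ := gamma_exists h2 hK (hpc h2) (om := (τ:ℂ) • om0) (e := ν) (by
      simp [hν, hτ]) hr hη0 hcone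
    obtain ⟨F, F1, F2, F3, F4, F5, F6⟩ := finger hK h0K u1 u2 u3 G1 G2 u4 u5 u6 G3 G4 G5 G6 u7 u8 u9 G7 G8
    refine ⟨F, F1, F2, F3, F4.mono fun X h h0 => h (by simp [h0]), F5, fun y hy h0 h => F6 y hy h0 ?_⟩
    simp [h]
  · refine ⟨id, fun y _ => differentiableAt_id, contDiffAt_id, injOn_id _, by simp, by simp [fderiv_id], fun y _ h0 h => h0 ?_⟩
    simp only [id, map_zero] at h
    by_contra
    have hli : LinearIndependent ℂ ![ν, y] := by
      rw [LinearIndependent.pair_iff]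
      intro s t hst
      have h3 := congrArg om0 hst
      simp [hν, h] at h3
      subst h3
      simpa [h0] using hst
    exact h2 (by simpa using hli.fintype_card_le_finrank)
end

section
open Filter Topology Set Metric Module
open scoped NNReal
variable {E : Type*} [NormedAddCommGroup E] [NormedSpace ℂ E]

noncomputable def qa (a : E → E →L[ℂ] ℂ) (G : E → E) (y : E) : E →L[ℂ] ℂ := (a (G y)).comp (fderiv ℂ G y)
noncomputable def qb (a : E → E →L[ℂ] ℂ) (b : E → E →L[ℂ] E →L[ℂ] ℂ) (G : E → E) (y : E) : E →L[ℂ] E →L[ℂ] ℂ :=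
  (ContinuousLinearMap.compL ℂ E E ℂ (a (G y))).comp (fderiv ℂ (fderiv ℂ G) y) + (((b (G y)).comp (fderiv ℂ G y)).flip.comp (fderiv ℂ G y))

theorem qb_apply (a : E → E →L[ℂ] ℂ) (b : E → E →L[ℂ] E →L[ℂ] ℂ) (G : E → E) (y X : E) :
    qb a b G y X X = a (G y) (fderiv ℂ (fderiv ℂ G) y X X) + b (G y) (fderiv ℂ G y X) (fderiv ℂ G y X) := rfl

set_option synthInstance.maxHeartbeats 100000 in
theorem q_cont {a : E → E →L[ℂ] ℂ} {b : E → E →L[ℂ] E →L[ℂ] ℂ} {G : E → E} {ys : E} (hG : ContDiffAt ℂ 3 G ys) (ca : ContinuousAt a (G ys)) (cb : ContinuousAt b (G ys)) :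
    ContinuousAt (qa a G) ys ∧ ContinuousAt (qb a b G) ys := by
  have g1 : ContDiffAt ℂ 2 (fderiv ℂ G) ys := hG.fderiv_right n%
  have g2 : ContDiffAt ℂ 1 (fderiv ℂ (fderiv ℂ G)) ys := g1.fderiv_right n%
  have ca' : ContinuousAt (fun y => a (G y)) ys := ContinuousAt.comp ca hG.continuousAt
  have cb' : ContinuousAt (fun y => b (G y)) ys := ContinuousAt.comp cb hG.continuousAt
  have hfl : ContinuousAt (fun y => ((b (G y)).comp (fderiv ℂ G y)).flip) ys :=
    (ContinuousLinearMap.flipₗᵢ ℂ E E ℂ).continuous.continuousAt.comp (cb'.clm_comp g1.continuousAt)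
  have h1 : ContinuousAt (fun y => (ContinuousLinearMap.compL ℂ E E ℂ (a (G y))).comp (fderiv ℂ (fderiv ℂ G) y)) ys :=
    ContinuousAt.clm_comp ((ContinuousLinearMap.compL ℂ E E ℂ).continuous.continuousAt.comp ca') g2.continuousAt
  have h2 : ContinuousAt (fun y => ((b (G y)).comp (fderiv ℂ G y)).flip.comp (fderiv ℂ G y)) ys := hfl.clm_comp g1.continuousAt
  exact ⟨ca'.clm_comp g1.continuousAt, h1.add h2⟩

theorem tr_arith {A N B z x3 K r a1 a2 a3 b1 b2 t1 t2 : ℝ} (hA : 0 ≤ A) (hN : 1 ≤ N) (hB : 0 ≤ B) (hz : 0 ≤ z) (hx : x3 ≤ z) (hm : |r - (2 * a1 + b1) - t1 ^ 2| ≤ K)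
    (X1 : K ≤ A * N ^ 3 * z) (X2 : |2 * a1 - 2 * a2 - a3| ≤ 2 * N ^ 2 * x3) (X3 : |b1 - b2| ≤ 4 * N ^ 3 * x3) (X4 : |t1 ^ 2 - t2 ^ 2| ≤ 4 * A ^ 2 * N ^ 2 * x3) :
    |r - (2 * a2 + (a3 + b2)) - t2 ^ 2| ≤ (32 * (A + 1) ^ 2 * N ^ 3 + 2 * B * A) * z := by
  have Y1 := hm.trans X1
  have Y2 := X2.trans (mll hx p%)
  have Y3 := X3.trans (mll hx p%)
  have Y4 := X4.trans (mll hx p%)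
  have hAz : (A * N ^ 3 + 2 * N ^ 2 + 4 * N ^ 3 + 4 * A ^ 2 * N ^ 2) * z ≤ (32 * (A + 1) ^ 2 * N ^ 3 + 2 * B * A) * z := by
    refine mlr ?_ hz
    have q1 : N ^ 2 ≤ N ^ 3 := pow_le_pow_right₀ hN n%
    have q3 : 0 ≤ N ^ 3 := by positivity
    have q2 : A ^ 2 * N ^ 2 ≤ A ^ 2 * N ^ 3 := mll q1 (sq_nonneg A)
    linarith [mul_nonneg hA q3, mul_nonneg (sq_nonneg A) q3, mul_nonneg hB hA]
  rw [abs_le] at Y1 Y2 Y3 Y4 ⊢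
  constructor <;> linarith [Y1.1, Y1.2, Y2.1, Y2.2, Y3.1, Y3.2, Y4.1, Y4.2]

set_option maxHeartbeats 1000000 in
theorem transfer {rh : E → ℝ} {a : E → E →L[ℂ] ℂ} {b : E → E →L[ℂ] E →L[ℂ] ℂ} {T : E → E →L[ℂ] E} {s1 A ε : ℝ} {p : E}
    (hs1 : 0 < s1) (hε : 0 < ε) (hε1 : ε ≤ 1) (hA : 0 ≤ A)
    (hT : ∀ y0 ∈ ball p s1, ∀ h, ‖h‖ < s1 → |rh (y0 + h) - rh y0 - (2 * (a y0 h).re + (b y0 h h).re) - ‖T y0 h‖ ^ 2| ≤ A * (‖h‖ ^ 2 * ‖h‖ ^ ε))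
    (hT1 : ∀ y0 ∈ ball p s1, ∀ X, ‖T y0 X‖ ≤ A * ‖X‖) (hT2 : ∀ y0 ∈ ball p s1, ∀ X, ‖X‖ ≤ A * ‖T y0 X‖)
    (ca : ContinuousAt a p) (cb : ContinuousAt b p) {G : E → E} {ys : E} (hG : ContDiffAt ℂ 3 G ys) (hG0 : G ys = p) {B : ℝ} (hB : 0 < B)
    (hGi : ∀ X, ‖X‖ ≤ B * ‖fderiv ℂ G ys X‖) : ∃ s2 > 0, ∃ A', 
    (∀ y0 ∈ ball ys s2, ∀ h, ‖h‖ < s2 → |rh (G (y0 + h)) - rh (G y0) - (2 * (qa a G y0 h).re + (qb a b G y0 h h).re) - ‖((T (G y0)).comp (fderiv ℂ G y0)) h‖ ^ 2| ≤ A' * (‖h‖ ^ 2 * ‖h‖ ^ ε)) ∧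
    (∀ y0 ∈ ball ys s2, ∀ X, ‖((T (G y0)).comp (fderiv ℂ G y0)) X‖ ≤ A' * ‖X‖) ∧ (∀ y0 ∈ ball ys s2, ∀ X, ‖X‖ ≤ A' * ‖((T (G y0)).comp (fderiv ℂ G y0)) X‖) := by
  have g1 : ContDiffAt ℂ 2 (fderiv ℂ G) ys := hG.fderiv_right n%
  have g2 : ContDiffAt ℂ 1 (fderiv ℂ (fderiv ℂ G)) ys := g1.fderiv_right n%
  subst hG0
  have ca' : ContinuousAt (fun y => ‖a (G y)‖) ys := (ContinuousAt.comp ca hG.continuousAt).norm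
  have cb' : ContinuousAt (fun y => ‖b (G y)‖) ys := ContinuousAt.norm (E := E →L[ℂ] E →L[ℂ] ℂ) (ContinuousAt.comp cb hG.continuousAt)
  obtain ⟨K1, t1, ht1, hK1⟩ := (hG.of_le n% : ContDiffAt ℂ 1 G ys).exists_lipschitzOnWith
  obtain ⟨K2, t2, ht2, hK2⟩ := g2.exists_lipschitzOnWith
  have c1 : ContinuousAt (fun y => ‖fderiv ℂ G y‖) ys := g1.continuousAt.norm
  have c2 : ContinuousAt (fun y => ‖fderiv ℂ (fderiv ℂ G) y‖) ys := g2.continuousAt.norm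
  obtain ⟨M, hM⟩ := ex_eq (1 + K1 + K2 + ‖a (G ys)‖ + ‖b (G ys)‖ + ‖fderiv ℂ G ys‖ + ‖fderiv ℂ (fderiv ℂ G) ys‖ : ℝ)
  have n1 := norm_nonneg (a (G ys))
  have n2 := norm_nonneg (b (G ys))
  have n3 := norm_nonneg (fderiv ℂ G ys)
  have n4 := norm_nonneg (fderiv ℂ (fderiv ℂ G) ys)
  have n5 := K1.2
  have n6 := K2.2
  have hM1 : 1 ≤ M := by rw [hM]; linarith
  have hM0 : 0 ≤ M := by linarith
  have hev := (((((((((hG.eventually n%).and (g1.eventually n%)).and ht1).and ht2).and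
    (ca'.eventually (gt_mem_nhds (lt_add_one _)))).and (cb'.eventually (gt_mem_nhds (lt_add_one _)))).and (c1.eventually (gt_mem_nhds (lt_add_one _)))).and
    (c2.eventually (gt_mem_nhds (lt_add_one _)))).and (hG.continuousAt.eventually (ball_mem_nhds _ hs1))).and
    ((g1.continuousAt.sub continuousAt_const).norm.eventually (gt_mem_nhds (show ‖fderiv ℂ G ys - fderiv ℂ G ys‖ < 1 / (2 * B) by simp; positivity)))
  obtain ⟨r, hr, hev⟩ := Metric.eventually_nhds_iff.1 hev
  obtain ⟨s2, hs2⟩ := ex_eq (min (r / 2) (min 1 (s1 / (2 * M))) : ℝ)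
  have s2p : 0 < s2 := by rw [hs2]; positivity
  have s2r : s2 ≤ r / 2 := hs2 ▸ min_le_left _ _
  have s21 : s2 ≤ 1 := hs2 ▸ (min_le_right _ _).trans (min_le_left _ _)
  have s2s : s2 ≤ s1 / (2 * M) := hs2 ▸ (min_le_right _ _).trans (min_le_right _ _)
  rw [le_div_iff₀ p%] at s2s
  have hinB : ∀ y0 ∈ ball ys s2, dist y0 ys < r := fun y0 hy => (mem_ball.1 hy).trans l%
  obtain ⟨A', hA'⟩ := ex_eq (32 * (A + 1) ^ 2 * (M + 1) ^ 3 + 2 * B * A)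
  have hM3 : (M + 1) ≤ (M + 1) ^ 3 := le_self_pow₀ l% n%
  have hA2 : (A + 1) ≤ (A + 1) ^ 2 := le_self_pow₀ l% n%
  refine ⟨s2, s2p, A', fun y0 hy h hh => ?_, fun y0 hy X => ?_, fun y0 hy X => ?_⟩
  · obtain ⟨⟨⟨⟨⟨⟨⟨⟨⟨-, -⟩, e3⟩, e4⟩, e5⟩, e6⟩, e7⟩, e8⟩, e9⟩, -⟩ := hev (hinB y0 hy)
    have hcb : ∀ z ∈ closedBall y0 ‖h‖, dist z ys < r := fun z hz => by
      linarith [dist_triangle z y0 ys, mem_closedBall.1 hz, mem_ball.1 hy]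
    have hcl := hev (hcb (y0 + h) s%)
    have htay := taylor2 (𝕜 := ℂ) (f := G) (f' := fderiv ℂ G) (f'' := fderiv ℂ (fderiv ℂ G)) (z0 := y0) (h := h) (η := (M + 1) * ‖h‖)
      (fun z hz => ((hev (hcb z hz)).1.1.1.1.1.1.1.1.1.differentiableAt n%).hasFDerivAt)
      (fun z hz => ((hev (hcb z hz)).1.1.1.1.1.1.1.1.2.differentiableAt n%).hasFDerivAt)
      (fun v w => (hev (hinB y0 hy)).1.1.1.1.1.1.1.1.1.isSymmSndFDerivAt (by rw [minSmoothness_of_isRCLikeNormedField]; norm_num) v w) (fun z hz => by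
        have h1 := hK2.dist_le_mul z (hev (hcb z hz)).1.1.1.1.1.1.2 y0 e4
        rw [dist_eq_norm] at h1
        refine h1.trans (mul_le_mul ?_ (mem_closedBall.1 hz) dist_nonneg l%)
        rw [hM]; push_cast; linarith)
    have hk1 := hK1.dist_le_mul _ hcl.1.1.1.1.1.1.1.2 _ e3
    rw [dist_eq_norm, dist_eq_norm, add_sub_cancel_left] at hk1
    obtain ⟨k, hk⟩ := ex_eq (G (y0 + h) - G y0)
    obtain ⟨d, hd⟩ := ex_eq (fderiv ℂ G y0 h)
    obtain ⟨d2, hd2⟩ := ex_eq (fderiv ℂ (fderiv ℂ G) y0 h h)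
    rw [← hk, ← hd, ← hd2] at htay
    rw [← hk] at hk1
    have hn := norm_nonneg h
    have hh1 : ‖h‖ ≤ 1 := hh.le.trans s21
    have hkM : ‖k‖ ≤ (M + 1) * ‖h‖ := hk1.trans (mlr (by rw [hM]; push_cast; linarith) hn)
    have hdM : ‖d‖ ≤ (M + 1) * ‖h‖ := by
      rw [hd]; exact (ContinuousLinearMap.le_opNorm _ _).trans (mlr (by rw [hM]; linarith) hn)
    have hd2M : ‖d2‖ ≤ (M + 1) * ‖h‖ ^ 2 := by
      rw [hd2, sq, ← mul_assoc]; exact (ContinuousLinearMap.le_opNorm₂ _ _ _).trans (mlr (mlr (by rw [hM]; linarith) hn) hn)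
    have hq : ‖k - d‖ ≤ 2 * (M + 1) * ‖h‖ ^ 2 := by
      have e : k - d = (k - d - (1 / 2 : ℂ) • d2) + (1 / 2 : ℂ) • d2 := by abel
      rw [e]
      refine (norm_add_le _ _).trans ?_
      rw [norm_smul]
      have : ‖(1 / 2 : ℂ)‖ = 1 / 2 := by norm_num
      rw [this]
      nlinarith [mlr hh1 (sq_nonneg ‖h‖)]
    have hks : ‖k‖ < s1 := by
      have : (M + 1) * ‖h‖ ≤ 2 * M * ‖h‖ := mlr l% hn
      nlinarith
    have hmain := hT (G y0) e9 k hks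
    have e : G y0 + k = G (y0 + h) := by rw [hk]; abel
    rw [e] at hmain
    obtain ⟨N, hN⟩ := ex_eq (M + 1)
    rw [← hN] at htay hkM hdM hd2M hq
    have hN1 : 1 ≤ N := by linarith
    have hN0 : 0 ≤ N := by linarith
    have ha : ‖a (G y0)‖ ≤ N := by rw [hN, hM]; linarith
    have hb : ‖b (G y0)‖ ≤ N := by rw [hN, hM]; linarith
    obtain ⟨x, hx⟩ := ex_eq (‖h‖)
    rw [← hx] at htay hkM hdM hd2M hq hn hh1 ⊢
    have hxε := Real.rpow_nonneg hn ε
    have hx3 : x ^ 3 ≤ x ^ 2 * x ^ ε := by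
      have : x ≤ x ^ ε := by
        rcases hn.eq_or_lt with h0 | h0
        · rw [← h0, Real.zero_rpow hε.ne']
        · simpa using Real.rpow_le_rpow_of_exponent_ge h0 hh1 hε1
      rw [pow_succ]; exact mll this (sq_nonneg _)
    have X1 : A * (‖k‖ ^ 2 * ‖k‖ ^ ε) ≤ A * N ^ 3 * (x ^ 2 * x ^ ε) := by
      have q1 : ‖k‖ ^ ε ≤ N * x ^ ε := by
        refine (Real.rpow_le_rpow (norm_nonneg _) hkM hε.le).trans ?_
        rw [Real.mul_rpow hN0 hn]
        exact mlr (by simpa using Real.rpow_le_rpow_of_exponent_le hN1 hε1) hxε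
      have q2 : ‖k‖ ^ 2 ≤ (N * x) ^ 2 := pow_le_pow_left₀ (norm_nonneg _) hkM 2
      refine (mll (mul_le_mul q2 q1 p% p%) hA).trans (le_of_eq (by ring))
    have X2 : |2 * (a (G y0) k).re - 2 * (a (G y0) d).re - (a (G y0) d2).re| ≤ 2 * N ^ 2 * x ^ 3 := by
      have q1 : 2 * (a (G y0) k).re - 2 * (a (G y0) d).re - (a (G y0) d2).re = 2 * (a (G y0) (k - d - (1 / 2 : ℂ) • d2)).re := by
        rw [map_sub, map_sub, map_smul]; simp; ring
      have q2 := (Complex.abs_re_le_norm _).trans ((a (G y0)).le_of_opNorm_le ha (k - d - (1 / 2 : ℂ) • d2))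
      rw [q1, abs_mul, abs_two]
      linarith [mll htay hN0]
    have X3 : |(b (G y0) k k).re - (b (G y0) d d).re| ≤ 4 * N ^ 3 * x ^ 3 := by
      have q1 : b (G y0) k k - b (G y0) d d = b (G y0) (k - d) k + b (G y0) d (k - d) := by simp only [map_sub, ContinuousLinearMap.sub_apply]; ring
      rw [← Complex.sub_re, q1]
      refine (Complex.abs_re_le_norm _).trans ((norm_add_le _ _).trans ?_)
      have q2 : ∀ u w : E, ‖b (G y0) u w‖ ≤ N * ‖u‖ * ‖w‖ := fun u w => ((b (G y0)).le_opNorm₂ u w).trans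
        (mlr (mlr hb (norm_nonneg _)) (norm_nonneg _))
      have q3 := (q2 (k - d) k).trans (mul_le_mul (mll hq hN0) hkM (norm_nonneg _) p%)
      have q4 := (q2 d (k - d)).trans (mul_le_mul (mll hdM hN0) hq (norm_nonneg _) p%)
      refine (add_le_add q3 q4).trans (le_of_eq (by ring))
    have X4 : |‖T (G y0) k‖ ^ 2 - ‖T (G y0) d‖ ^ 2| ≤ 4 * A ^ 2 * N ^ 2 * x ^ 3 := by
      have t1 := (hT1 _ e9 k).trans (mll hkM hA)
      have t2 := (hT1 _ e9 d).trans (mll hdM hA)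
      have t3 := (hT1 _ e9 (k - d)).trans (mll hq hA)
      have t4 := abs_norm_sub_norm_le (T (G y0) k) (T (G y0) d)
      rw [← map_sub] at t4
      have q1 : ‖T (G y0) k‖ ^ 2 - ‖T (G y0) d‖ ^ 2 = (‖T (G y0) k‖ - ‖T (G y0) d‖) * (‖T (G y0) k‖ + ‖T (G y0) d‖) := by ring
      rw [q1, abs_mul, abs_of_nonneg (show 0 ≤ ‖T (G y0) k‖ + ‖T (G y0) d‖ by positivity)]
      refine (mul_le_mul (t4.trans t3) (add_le_add t1 t2) p% p%).trans (le_of_eq (by ring))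
    rw [qb_apply, qa, ContinuousLinearMap.comp_apply, ContinuousLinearMap.comp_apply, ← hd, ← hd2, Complex.add_re]
    obtain ⟨z, hz⟩ := ex_eq (x ^ 2 * x ^ ε)
    rw [← hz] at X1 hx3 ⊢
    have hz0 : 0 ≤ z := by rw [hz]; positivity
    rw [hA', ← hN]
    exact tr_arith hA hN1 hB.le hz0 hx3 hmain X1 X2 X3 X4
  · obtain ⟨⟨⟨⟨⟨⟨⟨⟨⟨-, -⟩, e3⟩, e4⟩, e5⟩, e6⟩, e7⟩, e8⟩, e9⟩, -⟩ := hev (hinB y0 hy)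
    rw [ContinuousLinearMap.comp_apply]
    have h1 : ‖fderiv ℂ G y0 X‖ ≤ (M + 1) * ‖X‖ := (ContinuousLinearMap.le_opNorm _ _).trans (mlr (by rw [hM]; linarith) (norm_nonneg _))
    refine (hT1 _ e9 _).trans ((mll h1 hA).trans ?_)
    rw [← mul_assoc]
    refine mlr ?_ (norm_nonneg _)
    rw [hA']
    nlinarith [mul_le_mul hA2 hM3 l% p%, mul_nonneg hB.le hA]
  · obtain ⟨⟨⟨⟨⟨⟨⟨⟨⟨-, -⟩, e3⟩, e4⟩, e5⟩, e6⟩, e7⟩, e8⟩, e9⟩, e10⟩ := hev (hinB y0 hy)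
    rw [ContinuousLinearMap.comp_apply]
    have h1 := (fderiv ℂ G y0 - fderiv ℂ G ys).le_of_opNorm_le e10.le X
    have h2 := hGi X
    have h3 := norm_sub_norm_le (fderiv ℂ G ys X) (fderiv ℂ G y0 X)
    rw [norm_sub_rev, ← ContinuousLinearMap.sub_apply] at h3
    have h4 : B * (1 / (2 * B) * ‖X‖) = ‖X‖ / 2 := by field_simp
    have h5 : ‖X‖ ≤ 2 * B * ‖fderiv ℂ G y0 X‖ := by linarith [mll (h3.trans h1) hB.le]
    refine h5.trans ((mll (hT2 _ e9 _) p%).trans ?_)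
    rw [← mul_assoc]
    refine mlr ?_ (norm_nonneg _)
    rw [hA']
    have : 0 ≤ 32 * (A + 1) ^ 2 * (M + 1) ^ 3 := by positivity
    linarith
end

section
open Filter Topology Set Metric Module
open scoped NNReal ContDiff
variable {E : Type*} [NormedAddCommGroup E] [InnerProductSpace ℂ E] [FiniteDimensional ℂ E]

theorem hess_normSq (x w : E) : fderiv ℝ (fderiv ℝ (fun x : E => ‖x‖ ^ 2)) x w w = 2 * ‖w‖ ^ 2 := by
  letI : InnerProductSpace ℝ E := InnerProductSpace.complexToReal
  have h1 : DifferentiableAt ℝ (fderiv ℝ (fun x : E => ‖x‖ ^ 2)) x :=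
    ((contDiff_norm_sq ℂ (n := 2)).fderiv_right (m := 1) n%).differentiable n% x
  have h2 := h1.hasFDerivAt.clm_apply (hasFDerivAt_const w x)
  have h3 : HasFDerivAt (fun y => fderiv ℝ (fun x : E => ‖x‖ ^ 2) y w) (((2 : ℝ) • innerSL ℝ w : E →L[ℝ] ℝ)) x := by
    have : (fun y => fderiv ℝ (fun x : E => ‖x‖ ^ 2) y w) = ⇑((2 : ℝ) • innerSL ℝ w : E →L[ℝ] ℝ) := by
      rw [fderiv_norm_sq]; ext y; simp [real_inner_comm]
    rw [this]; exact ContinuousLinearMap.hasFDerivAt _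
  have h4 := congrArg (fun L : E →L[ℝ] ℝ => L w) (h2.unique h3)
  simpa using h4

theorem cousinH [Nontrivial E] {K : Set E} (hK : IsCompact K) (hSt : ∀ W, IsOpen W → K ⊆ W → ∃ U, IsOpen U ∧ K ⊆ U ∧ U ⊆ W ∧ PC U)
    {p : E} (hp : p ∈ K) {om : E → ℂ} (hom : ContDiff ℂ ∞ om) {r : ℝ} (hr : 0 < r) (hz : ∀ y ∈ K, ‖y - p‖ ≤ r → om y = 0 → y = p) :
    ∃ (g v : E → ℂ) (r1 : ℝ), 0 < r1 ∧ ContDiffAt ℂ 3 v p ∧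
      (∀ y ∈ K, y ≠ p → DifferentiableAt ℂ g y ∧ ContDiffAt ℝ 1 g y) ∧ ∀ y ∈ Metric.ball p r1, g y = 1 / om y - v y := by
  letI : MeasurableSpace E := borel E
  haveI : BorelSpace E := ⟨rfl⟩
  haveI : FiniteDimensional ℝ E := FiniteDimensional.complexToReal E
  obtain ⟨g, v, r1, h1, h2, h3, h4, h5⟩ := cousin (E := E) MeasureTheory.Measure.addHaar (stdOrthonormalBasis ℂ E) (fun X => by
      have := (stdOrthonormalBasis ℂ E).repr.symm.norm_map (WithLp.toLp 2 X)
      rw [← OrthonormalBasis.sum_repr_symm] at this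
      rw [show (∑ j, X j • (stdOrthonormalBasis ℂ E) j) = ∑ j, (WithLp.toLp 2 X).ofLp j • (stdOrthonormalBasis ℂ E) j from rfl, this, EuclideanSpace.norm_sq_eq])
    (fun y => ⟨fun j => (stdOrthonormalBasis ℂ E).repr y j, ((stdOrthonormalBasis ℂ E).sum_repr y).symm⟩) (contDiff_norm_sq ℂ)
    (fun x w => by rw [hess_normSq, hess_normSq, norm_smul]; simp; linarith) hK hSt hp hom hr hz
  exact ⟨g, v, r1, h1, ((holo_contDiff isOpen_ball 3 h2 h3).contDiffAt (ball_mem_nhds p h1)), h4, h5⟩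

theorem mk_Phi {K : Set E} (hK : IsCompact K) (hSt : ∀ W, IsOpen W → K ⊆ W → ∃ U, IsOpen U ∧ K ⊆ U ∧ U ⊆ W ∧ PC U)
    {p : E} (hp : p ∈ K) (a : E →L[ℂ] ℂ) (b : E →L[ℂ] E →L[ℂ] ℂ) {ν : E} (hν : a ν = 1) {r C1 : ℝ} (hr : 0 < r)
    (hloc : ∀ z ∈ K, ‖z - p‖ < r → z ≠ p → -(C1 * ‖a (z - p) + (1 / 2 : ℂ) * b (z - p - a (z - p) • ν) (z - p - a (z - p) • ν)‖ ^ 2) <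
      -(a (z - p) + (1 / 2 : ℂ) * b (z - p - a (z - p) • ν) (z - p - a (z - p) • ν)).re) :
    ∃ Φ : E → E, (∀ z ∈ K, DifferentiableAt ℂ Φ z) ∧ ContDiffAt ℂ 3 Φ p ∧ InjOn Φ K ∧ (∀ z ∈ K, z ≠ p → a (Φ z) ≠ a (Φ p)) ∧
      (∀ X, fderiv ℂ Φ p X = 0 → X = 0) ∧ (∀ᶠ X in 𝓝 0, a X = 0 → Φ (p + X - ((1 / 2 : ℂ) * b X X) • ν) = X + Φ p) := by
  haveI : Nontrivial E := ⟨⟨ν, 0, fun h => by rw [h, map_zero] at hν; exact zero_ne_one hν⟩⟩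
  obtain ⟨om, hom⟩ := ex_eq (fun z => -(a (z - p) + (1 / 2 : ℂ) * b (z - p - a (z - p) • ν) (z - p - a (z - p) • ν)) : E → ℂ)
  obtain ⟨Ψ, hΨ⟩ := ex_eq (fun z => z - p + ((1 / 2 : ℂ) * b (z - p - a (z - p) • ν) (z - p - a (z - p) • ν)) • ν : E → E)
  obtain ⟨Θ, hΘ⟩ := ex_eq (fun y => p + y - ((1 / 2 : ℂ) * b (y - a y • ν) (y - a y • ν)) • ν : E → E)
  have cΨ : ContDiff ℂ ∞ Ψ := by rw [hΨ]; fun_prop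
  have cΘ : ContDiff ℂ ∞ Θ := by rw [hΘ]; fun_prop
  have com : ContDiff ℂ ∞ om := by rw [hom]; fun_prop
  have aΨ : ∀ z, a (Ψ z) = - om z := fun z => by simp only [hΨ, hom, map_add, map_smul, hν, smul_eq_mul]; ring
  have ΘΨ : ∀ z, Θ (Ψ z) = z := fun z => by
    have e : Ψ z - a (Ψ z) • ν = z - p - a (z - p) • ν := by
      rw [aΨ, hom, hΨ]; module
    simp only [hΘ]; rw [e]; simp only [hΨ]; abel
  have ΨΘ : ∀ y, Ψ (Θ y) = y := fun y => by
    have e0 : Θ y - p = y - ((1 / 2 : ℂ) * b (y - a y • ν) (y - a y • ν)) • ν := by simp only [hΘ]; abel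
    have e : Θ y - p - a (Θ y - p) • ν = y - a y • ν := by
      have : a (Θ y - p) = a y - (1 / 2 : ℂ) * b (y - a y • ν) (y - a y • ν) := by rw [e0, map_sub a, map_smul a, hν]; simp
      rw [this, e0]; module
    simp only [hΨ]; rw [e, e0]; abel
  have Ψp : Ψ p = 0 := by simp [hΨ]
  have Θ0 : Θ 0 = p := by rw [← Ψp, ΘΨ]
  obtain ⟨g, v, r1, hr1, hv, hg, hgv⟩ := cousinH hK hSt hp com (half_pos hr) (fun y hy hyr h0 => by
    by_contra hne
    have := hloc y hy l% hne
    have h1 : a (y - p) + (1 / 2 : ℂ) * b (y - p - a (y - p) • ν) (y - p - a (y - p) • ν) = 0 := by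
      rw [hom] at h0; exact neg_eq_zero.1 h0
    rw [h1] at this; simp at this)
  have hΘc : ContinuousAt Θ 0 := cΘ.continuous.continuousAt
  obtain ⟨r2, hr2, h2⟩ := Metric.eventually_nhds_iff.1 (hΘc.eventually (Θ0.symm ▸ ball_mem_nhds p (lt_min hr1 hr)))
  have h2' : ∀ y, ‖y‖ < r2 → ‖Θ y - p‖ < min r1 r := fun y hy => by
    have := h2 (y := y) (by simpa using hy); rw [Θ0, dist_eq_norm] at this; exact this
  have memI : ∀ y, y ∈ Ψ '' K → Θ y ∈ K := by rintro _ ⟨z, hz, rfl⟩; rwa [ΘΨ]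
  have ne0 : ∀ y, y ≠ 0 → Θ y ≠ p := fun y hy h => hy (by rw [← ΨΘ y, h, Ψp])
  have omΘ : ∀ y, om (Θ y) = (-a) y := fun y => by
    have := aΨ (Θ y); rw [ΨΘ] at this; simp [this]
  obtain ⟨F, f1, f2, f3, f4, f5, f6⟩ := mk_F (K := Ψ '' K) (hK.image cΨ.continuous) ⟨p, hp, Ψp⟩ (-a) (ν := ν) (by simp [hν]) (g := g ∘ Θ) (v := v ∘ Θ) (r1 := r2) (C1 := C1) hr2
    (fun y hy hyr hy0 => by
      have := hloc (Θ y) (memI y hy) ((h2' y hyr).trans_le (min_le_right _ _)) (ne0 y hy0)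
      have h1 := omΘ y
      rw [hom] at h1
      rw [← h1, norm_neg]
      exact this)
    (fun y hy hy0 => ⟨((hg _ (memI y hy) (ne0 y hy0)).1.comp y (cΘ.differentiable s% y)),
      ((hg _ (memI y hy) (ne0 y hy0)).2.comp y ((cΘ.restrict_scalars ℝ).of_le s%).contDiffAt)⟩)
    (ContDiffAt.comp 0 (by rw [Θ0]; exact hv) (cΘ.of_le (WithTop.coe_le_coe.2 (le_top : (3 : ℕ∞) ≤ ⊤))).contDiffAt)
    (fun y hy => by
      have := hgv (Θ y) (by simpa [dist_eq_norm] using (h2' y hy).trans_le (min_le_left _ _))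
      rw [omΘ] at this; exact this)
    (fun hd => by
      have e : (Ψ '' K)ᶜ = Ψ '' Kᶜ := (image_compl_eq ⟨fun x y h => by rw [← ΘΨ x, h, ΘΨ], fun y => ⟨Θ y, ΨΘ y⟩⟩).symm
      rw [e]; exact (pc_compl hd hK hSt).image cΨ.continuous)
  have dΨ : ∀ z, DifferentiableAt ℂ Ψ z := cΨ.differentiable s%
  have dΘ : HasFDerivAt Θ (fderiv ℂ Θ 0) 0 := (cΘ.differentiable s% 0).hasFDerivAt
  have hF0 : DifferentiableAt ℂ F (Ψ p) := f1 _ ⟨p, hp, rfl⟩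
  refine ⟨F ∘ Ψ, fun z hz => (f1 _ ⟨z, hz, rfl⟩).comp z (dΨ z), ContDiffAt.comp p (by rw [Ψp]; exact f2) (cΨ.of_le (WithTop.coe_le_coe.2 (le_top : (3 : ℕ∞) ≤ ⊤))).contDiffAt, ?_, ?_, ?_, ?_⟩
  · intro x hx y hy h
    have := f3 ⟨x, hx, rfl⟩ ⟨y, hy, rfl⟩ h
    rw [← ΘΨ x, this, ΘΨ]
  · intro z hz hzp h
    refine f6 _ ⟨z, hz, rfl⟩ (fun h => hzp (by rw [← ΘΨ z, h, Θ0])) ?_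
    simp only [Function.comp, Ψp] at h
    simp [h]
  · intro X hX
    rw [fderiv_comp p hF0 (dΨ p), ContinuousLinearMap.comp_apply, Ψp] at hX
    have h1 := f5 _ hX
    have h2 : HasFDerivAt (Θ ∘ Ψ) ((fderiv ℂ Θ 0).comp (fderiv ℂ Ψ p)) p := HasFDerivAt.comp p (by rw [Ψp]; exact dΘ) (dΨ p).hasFDerivAt
    have h3 : Θ ∘ Ψ = id := funext ΘΨ
    rw [h3] at h2
    have h4 := h2.unique (hasFDerivAt_id p)
    have := congrArg (fun L : E →L[ℂ] E => L X) h4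
    simpa [h1] using this.symm
  · filter_upwards [f4] with X hX haX
    have e : Θ X = p + X - ((1 / 2 : ℂ) * b X X) • ν := by simp [hΘ, haX]
    rw [← e, Function.comp, Function.comp, ΨΘ, Ψp]
    exact hX (by simp [haX])
end

section
open Filter Topology Set Metric Module
open scoped NNReal ContDiff
variable {E : Type*} [NormedAddCommGroup E] [InnerProductSpace ℂ E] [FiniteDimensional ℂ E]

theorem hloc_arith {m M x w A P t R1 al : ℝ} (hm : 0 < m) (hM : 0 ≤ M) (hx : 0 < x) (ht : m * x ^ 2 ≤ t) (hw : 0 ≤ w)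
    (h1 : 2 * R1 + t ≤ A * (x ^ 2 * P) + al * (M * x)) (hal : al ≤ w + M * x ^ 2) (hs : A * P + M ^ 2 * x < m / 4) :
    -(M ^ 2 / (2 * m) * w ^ 2) < -R1 := by
  have h2 : al * (M * x) ≤ (w + M * x ^ 2) * (M * x) := mlr hal p%
  have h3 : w * M * x ≤ m / 4 * x ^ 2 + M ^ 2 / m * w ^ 2 := by
    have := sq_nonneg (m * x / 2 - M * w)
    have e : m / 4 * x ^ 2 + M ^ 2 / m * w ^ 2 - w * M * x = (m * x / 2 - M * w) ^ 2 / m := by field_simp; ring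
    have := div_nonneg this hm.le
    linarith
  have h4 : (A * P + M ^ 2 * x) * x ^ 2 < m / 4 * x ^ 2 := mul_lt_mul_of_pos_right hs p%
  have h5 : M ^ 2 / (2 * m) * w ^ 2 = M ^ 2 / m * w ^ 2 / 2 := by field_simp
  have h6 : 0 < m * x ^ 2 := by positivity
  rw [h5]; nlinarith

theorem mk_hloc {Ω : Set E} {p : E} {rh : E → ℝ} {a : E →L[ℂ] ℂ} {b : E →L[ℂ] E →L[ℂ] ℂ} {T : E →L[ℂ] E} {s1 A ε : ℝ} (hs1 : 0 < s1) (hε : 0 < ε) (hA : 0 ≤ A)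
    (hT : ∀ h, ‖h‖ < s1 → |rh (p + h) - rh p - (2 * (a h).re + (b h h).re) - ‖T h‖ ^ 2| ≤ A * (‖h‖ ^ 2 * ‖h‖ ^ ε))
    (hT2 : ∀ X, ‖X‖ ≤ A * ‖T X‖) (hr0 : rh p = 0) (hΩ : ∀ z ∈ ball p s1, z ∈ Ω ↔ rh z < 0) {ν : E} :
    ∃ r > 0, ∃ C1, ∀ z ∈ closure Ω, ‖z - p‖ < r → z ≠ p → -(C1 * ‖a (z - p) + (1 / 2 : ℂ) * b (z - p - a (z - p) • ν) (z - p - a (z - p) • ν)‖ ^ 2) <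
      -(a (z - p) + (1 / 2 : ℂ) * b (z - p - a (z - p) • ν) (z - p - a (z - p) • ν)).re := by
  have key : ∀ z ∈ closure Ω, ‖z - p‖ < s1 → 2 * (a (z - p)).re + (b (z - p) (z - p)).re + ‖T (z - p)‖ ^ 2 ≤ A * (‖z - p‖ ^ 2 * ‖z - p‖ ^ ε) := by
    intro z hz hzs
    have hcl : IsClosed {z : E | 2 * (a (z - p)).re + (b (z - p) (z - p)).re + ‖T (z - p)‖ ^ 2 ≤ A * (‖z - p‖ ^ 2 * ‖z - p‖ ^ ε)} := by
      have hpow : Continuous fun z : E => ‖z - p‖ ^ ε := (by fun_prop : Continuous fun z : E => ‖z - p‖).rpow_const (fun _ => Or.inr hε.le)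
      have hre := Complex.continuous_re
      refine isClosed_le ?_ (continuous_const.mul (((by fun_prop : Continuous fun z : E => ‖z - p‖).pow 2).mul hpow))
      exact ((continuous_const.mul (hre.comp (by fun_prop))).add (hre.comp (by fun_prop))).add (by fun_prop)
    have h1 : z ∈ closure (ball p s1 ∩ Ω) := isOpen_ball.inter_closure ⟨by simpa [dist_eq_norm] using hzs, hz⟩
    refine closure_minimal ?_ hcl h1
    rintro y ⟨hy, hyΩ⟩
    have h2 := hT (y - p) (by simpa [dist_eq_norm] using hy)
    rw [add_sub_cancel, hr0, abs_le] at h2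
    have h3 := (hΩ y hy).1 hyΩ
    rw [mem_ofPred_eq]
    linarith [h2.1]
  obtain ⟨N, hN⟩ := ex_eq (1 + ‖a‖ * ‖ν‖)
  have hN0 : 1 ≤ N := by rw [hN]; have := mul_nonneg (norm_nonneg a) (norm_nonneg ν); linarith
  obtain ⟨M, hM⟩ := ex_eq (‖b‖ * N ^ 2 + 2 * ‖b‖ * N * ‖ν‖)
  have hM0 : 0 ≤ M := by rw [hM]; positivity
  obtain ⟨m, hm⟩ := ex_eq (1 / (A + 1) ^ 2)
  have hm0 : 0 < m := by rw [hm]; positivity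
  have hev : ∀ᶠ z in 𝓝 p, A * ‖z - p‖ ^ ε + M ^ 2 * ‖z - p‖ < m / 4 := by
    have hpow : Continuous fun z : E => ‖z - p‖ ^ ε := (by fun_prop : Continuous fun z : E => ‖z - p‖).rpow_const (fun _ => Or.inr hε.le)
    have : Continuous fun z => A * ‖z - p‖ ^ ε + M ^ 2 * ‖z - p‖ := (continuous_const.mul hpow).add (by fun_prop)
    refine this.continuousAt.eventually (gt_mem_nhds ?_)
    simp [Real.zero_rpow hε.ne']; positivity
  obtain ⟨r, hr, hev⟩ := Metric.eventually_nhds_iff.1 hev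
  refine ⟨min r s1, by positivity, M ^ 2 / (2 * m), fun z hz hzr hzp => ?_⟩
  have hx : 0 < ‖z - p‖ := norm_pos_iff.2 (sub_ne_zero.2 hzp)
  have k1 := key z hz (hzr.trans_le (min_le_right _ _))
  have k2 := hev (y := z) (by rw [dist_eq_norm]; exact hzr.trans_le (min_le_left _ _))
  obtain ⟨h, hh⟩ := ex_eq (z - p)
  rw [← hh] at hx k1 k2 ⊢
  have hπ : ‖h - a h • ν‖ ≤ N * ‖h‖ := by
    refine (norm_sub_le _ _).trans ?_
    rw [norm_smul, hN]
    nlinarith [mlr (a.le_opNorm h) (norm_nonneg ν)]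
  obtain ⟨k, hk⟩ := ex_eq (h - a h • ν)
  rw [← hk] at hπ ⊢
  have hhk : h = k + a h • ν := by rw [hk]; abel
  have hb0 := norm_nonneg b
  have e1 : b h h = b k k + a h * (b k ν + b ν h) := by
    have : b h h = b k h + a h * b ν h := by
      have := congrArg (fun u => b u h) hhk
      simpa using this
    rw [this]
    have : b k h = b k k + a h * b k ν := by
      conv_lhs => rw [hhk]
      rw [map_add, map_smul]; simp
    rw [this]; ring
  have e2 : ‖b k k‖ ≤ M * ‖h‖ ^ 2 := by
    have := (b.le_opNorm₂ k k).trans (mul_le_mul (mll hπ hb0) hπ (norm_nonneg _) p%)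
    rw [hM]
    have h0 : 0 ≤ 2 * ‖b‖ * N * ‖ν‖ * ‖h‖ ^ 2 := by positivity
    nlinarith
  have e3 : ‖b k ν + b ν h‖ ≤ M * ‖h‖ := by
    have h1 := (b.le_opNorm₂ k ν).trans (mlr (mll hπ hb0) (norm_nonneg ν))
    have h2 := b.le_opNorm₂ ν h
    have h3 := norm_add_le (b k ν) (b ν h)
    have h0 : 0 ≤ ‖b‖ * N ^ 2 * ‖h‖ := by positivity
    have h4 : ‖b‖ * ‖ν‖ * ‖h‖ * 1 ≤ ‖b‖ * ‖ν‖ * ‖h‖ * N := mll hN0 p%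
    rw [hM]; nlinarith
  have hre := Complex.abs_re_le_norm (a h * (b k ν + b ν h))
  rw [norm_mul] at hre
  have hre2 := hre.trans (mll e3 (norm_nonneg _))
  have e4 : (a h + 1 / 2 * b k k).re = (a h).re + (b k k).re / 2 := by simp; ring
  refine hloc_arith (A := A) (P := ‖h‖ ^ ε) (t := ‖T h‖ ^ 2) (al := ‖a h‖) hm0 hM0 hx ?_ (norm_nonneg _) ?_ ?_ k2
  · have h1 : ‖h‖ ≤ (A + 1) * ‖T h‖ := (hT2 h).trans (mlr l% (norm_nonneg _))
    have h2 := pow_le_pow_left₀ hx.le h1 2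
    rw [hm, one_div, inv_mul_le_iff₀ p%, ← mul_pow]; exact h2
  · rw [e4]
    rw [e1, Complex.add_re] at k1
    linarith [(abs_le.1 hre2).1]
  · have : a h = (a h + 1 / 2 * b k k) - 1 / 2 * b k k := by ring
    have h1 : ‖a h‖ ≤ ‖a h + 1 / 2 * b k k‖ + ‖(1 / 2 : ℂ) * b k k‖ := by
      conv_lhs => rw [this]
      exact norm_sub_le _ _
    have h2 : ‖(1 / 2 : ℂ) * b k k‖ = 1 / 2 * ‖b k k‖ := by rw [norm_mul]; norm_num
    have h3 := norm_nonneg (b k k)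
    linarith

theorem inv_exists {Φ : E → E} {p : E} (hΦ : ContDiffAt ℂ 3 Φ p) (hi : ∀ X, fderiv ℂ Φ p X = 0 → X = 0) :
    ∃ G : E → E, ContDiffAt ℂ 3 G (Φ p) ∧ G (Φ p) = p ∧ (∀ᶠ y in 𝓝 (Φ p), Φ (G y) = y) ∧ ∀ᶠ z in 𝓝 p, G (Φ z) = z := by
  haveI : CompleteSpace E := FiniteDimensional.complete ℂ E
  let e : E ≃L[ℂ] E := (LinearEquiv.ofInjectiveEndo (fderiv ℂ Φ p : E →ₗ[ℂ] E) ((injective_iff_map_eq_zero _).2 hi)).toContinuousLinearEquiv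
  have h1 : HasFDerivAt Φ (e : E →L[ℂ] E) p := (hΦ.differentiableAt n%).hasFDerivAt
  have h2 := hΦ.hasStrictFDerivAt' h1 n%
  exact ⟨hΦ.localInverse h1 n%, hΦ.to_localInverse h1 n%, hΦ.localInverse_apply_image h1 n%,
    h2.eventually_right_inverse, h2.eventually_left_inverse⟩

theorem G_derivs {G : E → E} {ys p ν X : E} {c : ℂ} (hG : ContDiffAt ℂ 3 G ys) (h : ∀ᶠ t : ℂ in 𝓝 0, G (ys + t • X) = p + t • X - ((1 / 2 : ℂ) * (t ^ 2 * c)) • ν) :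
    fderiv ℂ G ys X = X ∧ fderiv ℂ (fderiv ℂ G) ys X X = -(c • ν) := by
  have hl : ∀ t : ℂ, HasDerivAt (fun t : ℂ => ys + t • X) X t := fun t => by
    simpa using ((hasDerivAt_id t).smul_const X).const_add ys
  have hr : ∀ t : ℂ, HasDerivAt (fun t : ℂ => p + t • X - ((1 / 2 : ℂ) * (t ^ 2 * c)) • ν) (X - (t * c) • ν) t := fun t => by
    have h1 := ((hasDerivAt_id t).smul_const X).const_add p
    have h2 : HasDerivAt (fun t : ℂ => (1 / 2 : ℂ) * (t ^ 2 * c)) (t * c) t := by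
      have := ((hasDerivAt_pow 2 t).mul_const c).const_mul (1 / 2 : ℂ)
      refine this.congr_deriv ?_
      rw [pow_one]; push_cast; ring
    have h3 := h1.fun_sub (h2.smul_const ν)
    simpa using h3
  have ht : Tendsto (fun t : ℂ => ys + t • X) (𝓝 0) (𝓝 ys) := by simpa using (hl 0).continuousAt.tendsto
  have h1 : ∀ᶠ t : ℂ in 𝓝 0, fderiv ℂ G (ys + t • X) X = X - (t * c) • ν := by
    filter_upwards [h.eventually_nhds, ht.eventually (hG.eventually n%)] with t h1 h2
    have h3 := (h2.differentiableAt n%).hasFDerivAt.comp_hasDerivAt t (hl t)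
    exact h3.unique ((hr t).congr_of_eventuallyEq h1)
  have g1 : ContDiffAt ℂ 2 (fderiv ℂ G) ys := hG.fderiv_right n%
  refine ⟨by simpa using h1.self_of_nhds, ?_⟩
  have h2 : HasFDerivAt (fderiv ℂ G) (fderiv ℂ (fderiv ℂ G) ys) (ys + (0 : ℂ) • X) := by
    simpa using (g1.differentiableAt n%).hasFDerivAt
  have h3 := (h2.clm_apply (hasFDerivAt_const X (ys + (0 : ℂ) • X))).comp_hasDerivAt (0 : ℂ) (hl 0)
  have h4 : HasDerivAt (fun t : ℂ => X - (t * c) • ν) (-(c • ν)) 0 := by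
    simpa using ((((hasDerivAt_id (0 : ℂ)).mul_const c).smul_const ν).const_sub X)
  have := h3.unique (h4.congr_of_eventuallyEq h1)
  simpa using this
end

section
open Filter Topology Set Metric Module
open scoped NNReal ContDiff
variable {E : Type*} [NormedAddCommGroup E] [InnerProductSpace ℂ E] [FiniteDimensional ℂ E]

theorem core {Ω : Set E} (hb : Bornology.IsBounded Ω) (hSt : ∀ W, IsOpen W → closure Ω ⊆ W → ∃ U, IsOpen U ∧ closure Ω ⊆ U ∧ U ⊆ W ∧ PC U)
    {p : E} (hp : p ∈ closure Ω) {rh : E → ℝ} {a : E → E →L[ℂ] ℂ} {b : E → E →L[ℂ] E →L[ℂ] ℂ} {T : E → E →L[ℂ] E} {s1 A ε : ℝ}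
    (hs1 : 0 < s1) (hε : 0 < ε) (hε1 : ε ≤ 1) (hA : 0 ≤ A)
    (hT : ∀ y0 ∈ ball p s1, ∀ h, ‖h‖ < s1 → |rh (y0 + h) - rh y0 - (2 * (a y0 h).re + (b y0 h h).re) - ‖T y0 h‖ ^ 2| ≤ A * (‖h‖ ^ 2 * ‖h‖ ^ ε))
    (hT1 : ∀ y0 ∈ ball p s1, ∀ X, ‖T y0 X‖ ≤ A * ‖X‖) (hT2 : ∀ y0 ∈ ball p s1, ∀ X, ‖X‖ ≤ A * ‖T y0 X‖)
    (ca : ContinuousAt a p) (cb : ContinuousAt b p) (cr : ContinuousAt rh p) (hr0 : rh p = 0) (ha0 : a p ≠ 0)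
    (hΩ : ∀ z ∈ ball p s1, z ∈ Ω ↔ rh z < 0) :
    ∃ C > 0, ∃ t > 0, ∀ z ∈ Ω, ‖z - p‖ < t → ∃ f : E → E, DifferentiableOn ℂ f Ω ∧ InjOn f Ω ∧ MapsTo f Ω (ball 0 1) ∧ f z = 0 ∧
      ball 0 (1 - C * (-rh z) ^ (ε / 2)) ⊆ f '' Ω := by
  obtain ⟨ν0, hν0⟩ : ∃ ν, a p ν ≠ 0 := by
    by_contra h; push Not at h; exact ha0 (ContinuousLinearMap.ext h)
  obtain ⟨ν, hν⟩ : ∃ ν, a p ν = 1 := ⟨(a p ν0)⁻¹ • ν0, by simp [hν0]⟩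
  have hpm := mem_ball_self (x := p) hs1
  have hK : IsCompact (closure Ω) := by
    haveI := FiniteDimensional.proper ℂ E
    exact hb.isCompact_closure
  obtain ⟨r, hr, C1, hloc⟩ := mk_hloc hs1 hε hA (hT p hpm) (hT2 p hpm) hr0 hΩ (ν := ν)
  obtain ⟨Φ, f1, f2, f3, f4, f5, f6⟩ := mk_Phi hK hSt hp (a p) (b p) hν hr hloc
  obtain ⟨G, g1, g2, g3, g4⟩ := inv_exists f2 f5
  obtain ⟨ys, hys⟩ := ex_eq (Φ p)
  rw [← hys] at g1 g2 g3 f4 f6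
  have dΦ : HasFDerivAt Φ (fderiv ℂ Φ p) p := (f1 p hp).hasFDerivAt
  have dG : HasFDerivAt G (fderiv ℂ G ys) ys := (g1.differentiableAt n%).hasFDerivAt
  have cΦ : ContinuousOn Φ (closure Ω) := fun z hz => (f1 z hz).continuousAt.continuousWithinAt
  have c1 : ∀ X, fderiv ℂ Φ p (fderiv ℂ G ys X) = X := fun X => by
    have h1 : HasFDerivAt (fun y => Φ (G y)) ((fderiv ℂ Φ p).comp (fderiv ℂ G ys)) ys := HasFDerivAt.comp ys (by rw [g2]; exact dΦ) dG
    have h2 := h1.unique ((hasFDerivAt_id ys).congr_of_eventuallyEq g3)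
    exact congrArg (fun L : E →L[ℂ] E => L X) h2
  have c2 : ∀ X, fderiv ℂ G ys (fderiv ℂ Φ p X) = X := fun X => by
    have h1 : HasFDerivAt (fun z => G (Φ z)) ((fderiv ℂ G ys).comp (fderiv ℂ Φ p)) p := HasFDerivAt.comp p (by rw [← hys]; exact dG) dΦ
    have h2 := h1.unique ((hasFDerivAt_id p).congr_of_eventuallyEq g4)
    exact congrArg (fun L : E →L[ℂ] E => L X) h2
  have hder : ∀ X, a p X = 0 → fderiv ℂ G ys X = X ∧ fderiv ℂ (fderiv ℂ G) ys X X = -((b p X X) • ν) := fun X hX => by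
    have ht : Tendsto (fun t : ℂ => t • X) (𝓝 0) (𝓝 0) := by
      have : Continuous fun t : ℂ => t • X := by fun_prop
      simpa using this.tendsto 0
    have ht2 : Tendsto (fun t : ℂ => p + t • X - ((1 / 2 : ℂ) * b p (t • X) (t • X)) • ν) (𝓝 0) (𝓝 p) := by
      have : Continuous fun t : ℂ => p + t • X - ((1 / 2 : ℂ) * b p (t • X) (t • X)) • ν := by fun_prop
      simpa using this.tendsto 0
    refine G_derivs (p := p) g1 ?_
    filter_upwards [ht.eventually f6, ht2.eventually g4] with t h1 h2
    rw [h1 (by simp [hX]), add_comm] at h2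
    rw [h2]; simp; ring_nf
  have hqk : ∀ X, a p X = 0 → qa a G ys X = 0 := fun X hX => by
    rw [qa, ContinuousLinearMap.comp_apply, (hder X hX).1, g2, hX]
  obtain ⟨c', hc'⟩ := ex_eq (qa a G ys ν)
  have hq : ∀ X, qa a G ys X = a p X * c' := fun X => by
    have h1 := hqk (X - a p X • ν) (by simp [hν])
    rw [map_sub, map_smul, sub_eq_zero] at h1
    rw [h1, hc']; rfl
  have hc0 : c' ≠ 0 := fun h => by
    have h1 := hq (fderiv ℂ Φ p ν)
    rw [h, mul_zero, qa, ContinuousLinearMap.comp_apply, c2, g2, hν] at h1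
    exact one_ne_zero h1
  obtain ⟨s2, hs2, A', t1, t2, t3⟩ := transfer hs1 hε hε1 hA hT hT1 hT2 ca cb g1 g2 (B := ‖fderiv ℂ Φ p‖ + 1) p% (fun X => by
    have h1 := (fderiv ℂ Φ p).le_opNorm (fderiv ℂ G ys X)
    rw [c1] at h1
    exact h1.trans (mlr l% (norm_nonneg _)))
  have hinj : ∀ t > 0, ∀ᶠ y in 𝓝 ys, ∀ z ∈ closure Ω, Φ z = y → ‖z - p‖ < t := fun t ht => by
    have hc : IsCompact (Φ '' (closure Ω \ ball p t)) := (hK.diff isOpen_ball).image_of_continuousOn (cΦ.mono diff_subset)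
    have h1 : ys ∉ Φ '' (closure Ω \ ball p t) := by
      rintro ⟨z, ⟨hz, hzt⟩, hzy⟩
      exact f4 z hz (fun h => hzt (by rw [h]; exact mem_ball_self ht)) (by rw [hzy])
    filter_upwards [hc.isClosed.isOpen_compl.mem_nhds h1] with y hy z hz hzy
    by_contra h
    exact hy ⟨z, ⟨hz, fun h' => h (by simpa [dist_eq_norm] using h')⟩, hzy⟩
  obtain ⟨r4, hr4, g4'⟩ := Metric.eventually_nhds_iff.1 g4
  have hSr : ∀ᶠ y in 𝓝 ys, y ∈ Φ '' Ω ↔ rh (G y) < 0 := by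
    have cG : ∀ᶠ y in 𝓝 ys, G y ∈ ball p s1 := g1.continuousAt.eventually (by rw [g2]; exact ball_mem_nhds p hs1)
    filter_upwards [g3, cG, hinj r4 hr4] with y h1 h2 h3
    rw [← hΩ _ h2]
    constructor
    · rintro ⟨z, hz, rfl⟩
      rwa [g4' (by rw [dist_eq_norm]; exact h3 z (subset_closure hz) rfl)]
    · exact fun h => ⟨G y, h, h1⟩
  obtain ⟨s3, hs3, hSr'⟩ := Metric.eventually_nhds_iff.1 hSr
  have hΦK : IsCompact (Φ '' closure Ω) := hK.image_of_continuousOn cΦ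
  have hSb : Bornology.IsBounded (Φ '' Ω) := hΦK.isBounded.subset (image_mono subset_closure)
  have hbsub : ∀ y, y ∈ ball ys (min s2 s3) → y ∈ ball ys s2 := fun y hy => ball_subset_ball (min_le_left _ _) hy
  obtain ⟨q1, q2⟩ := q_cont g1 (g2.symm ▸ ca) (g2.symm ▸ cb)
  obtain ⟨C, hC, t, ht, hfin⟩ := exposed hSb (ys := ys) (rh := fun y => rh (G y)) (a := qa a G) (b := qb a b G)
    (T := fun y0 => (T (G y0)).comp (fderiv ℂ G y0)) (s1 := min s2 s3) (A := A') (ε := ε) (lt_min hs2 hs3) hε hε1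
    (fun y0 hy h hh => t1 y0 (hbsub _ hy) h (hh.trans_le (min_le_left _ _))) (fun y0 hy => t2 y0 (hbsub _ hy)) (fun y0 hy => t3 y0 (hbsub _ hy))
    q1 q2 (ContinuousAt.comp (g2.symm ▸ cr) g1.continuousAt) (by simp only [g2, hr0]) (fun h => hc0 (by rw [hc', h]; rfl))
    (fun X hX => by
      rw [hq] at hX
      have hX' := (mul_eq_zero.1 hX).resolve_right hc0
      rw [qb_apply, (hder X hX').1, (hder X hX').2, g2]; simp [hν])
    (fun y hy => hSr' ((mem_ball.1 hy).trans_le (min_le_right _ _)))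
    (fun t ht => by
      have hc : IsCompact (Φ '' closure Ω ∩ {y | t ≤ ‖y - ys‖}) := hΦK.inter_right (isClosed_le continuous_const (by fun_prop))
      obtain ⟨c, hc, hc2⟩ := hc.exists_forall_le' (f := fun y => ‖qa a G ys (y - ys)‖) (a := 0) (by fun_prop) (by
        rintro _ ⟨⟨z, hz, rfl⟩, hzt⟩
        simp only [mem_ofPred_eq] at hzt
        rw [norm_pos_iff, hq]
        refine mul_ne_zero ?_ hc0
        rw [map_sub, sub_ne_zero, hys]
        exact hys ▸ f4 z hz (fun h => by rw [h, ← hys, sub_self, norm_zero] at hzt; linarith))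
      exact ⟨c, hc, fun y hy hyt => hc2 y ⟨image_mono subset_closure hy, hyt⟩⟩)
  obtain ⟨t4, ht4, h4⟩ := Metric.eventually_nhds_iff.1 (g4.and ((f1 p hp).continuousAt.eventually (ball_mem_nhds _ ht)))
  refine ⟨C, hC, t4, ht4, fun z hz hzt => ?_⟩
  obtain ⟨e1, e2⟩ := h4 (y := z) (by rwa [dist_eq_norm])
  rw [← hys, dist_eq_norm] at e2
  obtain ⟨f, k1, k2, k3, k4, k5⟩ := hfin (Φ z) ⟨z, hz, rfl⟩ e2
  refine ⟨f ∘ Φ, fun x hx => ?_, ?_, ?_, k4, ?_⟩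
  · exact (k1 (Φ x) ⟨x, hx, rfl⟩).comp x (f1 x (subset_closure hx)).differentiableWithinAt (mapsTo_image Φ Ω)
  · exact k2.comp (f3.mono subset_closure) (mapsTo_image Φ Ω)
  · exact k3.comp (mapsTo_image Φ Ω)
  · rw [e1] at k5; rwa [image_comp]
end

section
open Filter Topology Set Metric Module
open scoped NNReal
section
variable {E : Type*} [NormedAddCommGroup E] [NormedSpace ℝ E]

noncomputable def rD1 (ρ : E → ℝ) (l : ℝ) (z : E) : E →L[ℝ] ℝ := (1 + 2 * l * ρ z) • fderiv ℝ ρ z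
noncomputable def rD2 (ρ : E → ℝ) (l : ℝ) (z : E) : E →L[ℝ] E →L[ℝ] ℝ :=
  (1 + 2 * l * ρ z) • fderiv ℝ (fderiv ℝ ρ) z + (2 * l) • (fderiv ℝ ρ z).smulRight (fderiv ℝ ρ z)

theorem real_arith {q d D e l x M H P r0 r1 : ℝ} (hl : 0 ≤ l) (hx : 0 ≤ x) (hx1 : x ≤ 1) (hM : 0 ≤ M) (hH : 0 ≤ H) (hP : x ≤ P) (hP1 : P ≤ 1)
    (hq : |q| ≤ M) (hq2 : q = 1 + 2 * l * r0) (hd : |d| ≤ M * x) (hD : |D| ≤ M * x ^ 2) (he : |r1 - r0 - d - 1 / 2 * D| ≤ e) (he2 : e ≤ H * (x ^ 2 * P)) (hr : |r1 - r0| ≤ M * x) :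
    |r1 + l * r1 ^ 2 - (r0 + l * r0 ^ 2) - q * d - 1 / 2 * (q * D + 2 * l * (d * d))| ≤ (M * H + l * (M + H) * (2 * M)) * (x ^ 2 * P) := by
  have h1 : r1 + l * r1 ^ 2 - (r0 + l * r0 ^ 2) - q * d - 1 / 2 * (q * D + 2 * l * (d * d)) = q * (r1 - r0 - d - 1 / 2 * D) + l * ((r1 - r0 - d) * (r1 - r0 + d)) := by rw [hq2]; ring
  have h2 : |q * (r1 - r0 - d - 1 / 2 * D)| ≤ M * (H * (x ^ 2 * P)) := by
    rw [abs_mul]; exact mul_le_mul hq (he.trans he2) (abs_nonneg _) hM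
  have h3 : |r1 - r0 - d| ≤ (M + H) * x ^ 2 := by
    have h4 : H * (x ^ 2 * P) ≤ H * x ^ 2 := mll (mul_le_of_le_one_right p% hP1) hH
    have := abs_le.1 (he.trans (he2.trans h4))
    have := abs_le.1 hD
    have : 0 ≤ M * x ^ 2 := by positivity
    rw [abs_le]; constructor <;> linarith
  have h5 : |r1 - r0 + d| ≤ 2 * M * x := (abs_add_le _ _).trans l%
  have h6 : |l * ((r1 - r0 - d) * (r1 - r0 + d))| ≤ l * ((M + H) * x ^ 2 * (2 * M * P)) := by
    rw [abs_mul, abs_mul, abs_of_nonneg hl]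
    exact mll (mul_le_mul h3 (h5.trans (mll hP p%)) (abs_nonneg _) p%) hl
  rw [h1]
  refine (abs_add_le _ _).trans ((add_le_add h2 h6).trans (le_of_eq (by ring)))

theorem real_taylor {ρ : E → ℝ} {W : Set E} (hW : IsOpen W) {p : E} (hp : p ∈ W) (hρ : ContDiffOn ℝ 2 ρ W) {ε : ℝ} (hε : 0 < ε) (hε1 : ε ≤ 1)
    {C : ℝ≥0} (hH : HolderOnWith C ε.toNNReal (iteratedFDeriv ℝ 2 ρ) W) {l : ℝ} (hl : 0 ≤ l) :
    ∃ s > 0, ∃ A ≥ 0, ∀ y0 ∈ ball p s, ∀ h, ‖h‖ < s →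
      |ρ (y0 + h) + l * ρ (y0 + h) ^ 2 - (ρ y0 + l * ρ y0 ^ 2) - rD1 ρ l y0 h - 1 / 2 * rD2 ρ l y0 h h| ≤ A * (‖h‖ ^ 2 * ‖h‖ ^ ε) := by
  have hc : ∀ z ∈ W, ContDiffAt ℝ 2 ρ z := fun z hz => hρ.contDiffAt (hW.mem_nhds hz)
  have hc1 : ∀ z ∈ W, ContDiffAt ℝ 1 (fderiv ℝ ρ) z := fun z hz => (hc z hz).fderiv_right n%
  have c2 : ContinuousAt (fun z => ‖fderiv ℝ (fderiv ℝ ρ) z‖) p := (((hc1 p hp).fderiv_right (m := 0) n%).continuousAt).norm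
  have c1 : ContinuousAt (fun z => ‖fderiv ℝ ρ z‖) p := (hc1 p hp).continuousAt.norm
  have c0 : ContinuousAt (fun z => |1 + 2 * l * ρ z|) p := ((continuousAt_const.mul (hc p hp).continuousAt).const_add 1).abs
  obtain ⟨K, t, ht, hK⟩ := ((hc p hp).of_le n% : ContDiffAt ℝ 1 ρ p).exists_lipschitzOnWith
  obtain ⟨r, hr, hev⟩ := Metric.eventually_nhds_iff.1 (((((show ∀ᶠ z in 𝓝 p, z ∈ t from ht).and (hW.eventually_mem hp)).and (c0.eventually (gt_mem_nhds (lt_add_one _)))).and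
    (c1.eventually (gt_mem_nhds (lt_add_one _)))).and (c2.eventually (gt_mem_nhds (lt_add_one _))))
  obtain ⟨M, hM⟩ := ex_eq (1 + K + |1 + 2 * l * ρ p| + ‖fderiv ℝ ρ p‖ + ‖fderiv ℝ (fderiv ℝ ρ) p‖ : ℝ)
  have n1 := norm_nonneg (fderiv ℝ ρ p)
  have n2 := norm_nonneg (fderiv ℝ (fderiv ℝ ρ) p)
  have n3 := abs_nonneg (1 + 2 * l * ρ p)
  have n4 := K.2
  have hM0 : 0 ≤ M := by rw [hM]; positivity
  refine ⟨min (r / 2) 1, by positivity, M * C + l * (M + C) * (2 * M), by positivity, fun y0 hy h hh => ?_⟩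
  have hh1 : ‖h‖ ≤ 1 := hh.le.trans (min_le_right _ _)
  have hh2 : ‖h‖ < r / 2 := hh.trans_le (min_le_left _ _)
  have hy2 : dist y0 p < r / 2 := (mem_ball.1 hy).trans_le (min_le_left _ _)
  have hcb : ∀ z ∈ closedBall y0 ‖h‖, dist z p < r := fun z hz => by
    linarith [dist_triangle z y0 p, mem_closedBall.1 hz]
  have hyr : dist y0 p < r := by linarith
  obtain ⟨⟨⟨⟨e1, e2⟩, e3⟩, e4⟩, e5⟩ := hev hyr
  have hcl := hev (hcb (y0 + h) s%)
  have hx := norm_nonneg h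
  have htay := taylor2 (𝕜 := ℝ) (f := ρ) (f' := fderiv ℝ ρ) (f'' := fderiv ℝ (fderiv ℝ ρ)) (z0 := y0) (h := h) (η := C * ‖h‖ ^ ε)
    (fun z hz => ((hc z (hev (hcb z hz)).1.1.1.2).differentiableAt n%).hasFDerivAt)
    (fun z hz => ((hc1 z (hev (hcb z hz)).1.1.1.2).differentiableAt n%).hasFDerivAt)
    (fun u v => (hc y0 e2).isSymmSndFDerivAt (by rw [minSmoothness_of_isRCLikeNormedField]) u v)
    (fun z hz => by
      have h1 := hH.dist_le_of_le (hev (hcb z hz)).1.1.1.2 e2 (mem_closedBall.1 hz)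
      rw [Real.coe_toNNReal _ hε.le, dist_eq_norm] at h1
      refine ContinuousLinearMap.opNorm_le_bound₂ _ p% fun u v => ?_
      have h2 := (iteratedFDeriv ℝ 2 ρ z - iteratedFDeriv ℝ 2 ρ y0).le_opNorm ![u, v]
      simp only [ContinuousMultilinearMap.sub_apply, iteratedFDeriv_two_apply, Fin.prod_univ_two, Matrix.cons_val_zero, Matrix.cons_val_one] at h2
      simp only [ContinuousLinearMap.sub_apply]
      rw [mul_assoc]
      exact h2.trans (mlr h1 p%))
  have hP : ‖h‖ ≤ ‖h‖ ^ ε := by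
    rcases hx.eq_or_lt with h0 | h0
    · rw [← h0, Real.zero_rpow hε.ne']
    · simpa using Real.rpow_le_rpow_of_exponent_ge h0 hh1 hε1
  have f1 : ‖fderiv ℝ ρ y0‖ ≤ M := by rw [hM]; linarith
  have f2 : ‖fderiv ℝ (fderiv ℝ ρ) y0‖ ≤ M := by rw [hM]; linarith
  have hlip := hK.dist_le_mul _ hcl.1.1.1.1 _ e1
  rw [dist_eq_norm, dist_eq_norm, add_sub_cancel_left] at hlip
  refine real_arith (d := fderiv ℝ ρ y0 h) (D := fderiv ℝ (fderiv ℝ ρ) y0 h h) hl hx hh1 hM0 C.2 hP (Real.rpow_le_one hx hh1 hε.le) (q := 1 + 2 * l * ρ y0) ?_ rfl ?_ ?_ htay (le_of_eq ?_) ?_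
  · rw [hM]; linarith
  · exact (ContinuousLinearMap.le_opNorm _ _).trans (mlr f1 hx)
  · rw [sq, ← mul_assoc]
    exact (ContinuousLinearMap.le_opNorm₂ _ _ _).trans (mlr (mlr f2 hx) hx)
  · push_cast; ring
  · exact hlip.trans (mlr (by rw [hM]; push_cast; linarith) hx)
end

theorem sqrt_pos {E : Type*} [NormedAddCommGroup E] [InnerProductSpace ℂ E] [CompleteSpace E] (A : E →L[ℂ] E) (h : A.IsPositive) :
    ∃ T : E →L[ℂ] E, ∀ X, ‖T X‖ ^ 2 = (inner ℂ (A X) X).re := by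
  have h0 := (ContinuousLinearMap.nonneg_iff_isPositive A).2 h
  refine ⟨CFC.sqrt A, fun X => ?_⟩
  have h1 := CFC.sqrt_mul_sqrt_self A h0
  have h2 : IsSelfAdjoint (CFC.sqrt A) := (CFC.sqrt_nonneg A).isSelfAdjoint
  conv_rhs => rw [← h1]
  rw [ContinuousLinearMap.mul_apply, ← ContinuousLinearMap.adjoint_inner_right, ContinuousLinearMap.isSelfAdjoint_iff'.1 h2, inner_self_eq_norm_sq_to_K]
  norm_cast

section
variable {E : Type*} [NormedAddCommGroup E] [InnerProductSpace ℂ E] [FiniteDimensional ℂ E] [NormedSpace ℝ E] [IsScalarTower ℝ ℂ E]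

theorem exists_cl (ℓ : E →L[ℝ] ℝ) : ∃ a : E →L[ℂ] ℂ, ∀ X, a X = ((ℓ X : ℂ) - Complex.I * (ℓ (Complex.I • X) : ℂ)) / 2 := by
  refine ⟨LinearMap.toContinuousLinearMap { toFun := fun X => ((ℓ X : ℂ) - Complex.I * (ℓ (Complex.I • X) : ℂ)) / 2, map_add' := fun X Y => by simp; ring, map_smul' := fun c X => ?_ }, fun X => rfl⟩
  have h1 : Complex.I • c • X = c.re • (Complex.I • X) - c.im • X := by
    rw [smul_split c X, smul_add, smul_comm Complex.I c.re X, smul_comm Complex.I c.im, smul_smul Complex.I Complex.I, Complex.I_mul_I]; simp; abel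
  rw [h1, smul_split c X]
  simp only [map_add, map_sub, map_smul, smul_eq_mul, RingHom.id_apply]
  apply Complex.ext <;> simp <;> ring

theorem exists_cb (B : E →L[ℝ] E →L[ℝ] ℝ) : ∃ b : E →L[ℂ] E →L[ℂ] ℂ, ∀ X Y, b X Y = ((B X Y : ℂ) - B (Complex.I • X) (Complex.I • Y) - Complex.I * (B (Complex.I • X) Y + B X (Complex.I • Y))) / 4 := by
  have h : ∀ X : E, ∃ a : E →L[ℂ] ℂ, ∀ Y, a Y = ((B X Y : ℂ) - B (Complex.I • X) (Complex.I • Y) - Complex.I * (B (Complex.I • X) Y + B X (Complex.I • Y))) / 4 := fun X => by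
    obtain ⟨a, ha⟩ := exists_cl (B X)
    obtain ⟨a', ha'⟩ := exists_cl (B (Complex.I • X))
    refine ⟨(1 / 2 : ℂ) • (a - Complex.I • a'), fun Y => ?_⟩
    simp only [ContinuousLinearMap.smul_apply, ContinuousLinearMap.sub_apply, ha, ha', smul_eq_mul]
    linear_combination (1 / 4 * (B (Complex.I • X) (Complex.I • Y) : ℂ)) * Complex.I_sq
  choose β hβ using h
  refine ⟨LinearMap.toContinuousLinearMap { toFun := β, map_add' := fun X Y => ?_, map_smul' := fun c X => ?_ }, fun X Y => hβ X Y⟩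
  · ext Z; simp [hβ]; ring
  · ext Z
    have h1 : Complex.I • c • X = c.re • (Complex.I • X) - c.im • X := by
      rw [smul_split c X, smul_add, smul_comm Complex.I c.re X, smul_comm Complex.I c.im, smul_smul Complex.I Complex.I, Complex.I_mul_I]; simp; abel
    rw [hβ, h1, smul_split c X]
    simp only [map_add, map_sub, map_smul, smul_eq_mul, RingHom.id_apply, ContinuousLinearMap.smul_apply, ContinuousLinearMap.add_apply, ContinuousLinearMap.sub_apply, hβ]
    apply Complex.ext <;> simp <;> ring

theorem factor {B : E →L[ℝ] E →L[ℝ] ℝ} (hs : ∀ X Y, B X Y = B Y X) (hp : ∀ X, 0 ≤ B X X + B (Complex.I • X) (Complex.I • X)) :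
    ∃ T : E →L[ℂ] E, ∀ X, ‖T X‖ ^ 2 = (B X X + B (Complex.I • X) (Complex.I • X)) / 4 := by
  haveI : CompleteSpace E := FiniteDimensional.complete ℂ E
  have h : ∀ Y : E, ∃ a : E →L[ℂ] ℂ, ∀ X, a X = ((B Y X : ℂ) + B (Complex.I • Y) (Complex.I • X) + Complex.I * (B (Complex.I • Y) X - B Y (Complex.I • X))) / 4 := fun Y => by
    obtain ⟨a, ha⟩ := exists_cl (B Y)
    obtain ⟨a', ha'⟩ := exists_cl (B (Complex.I • Y))
    refine ⟨(1 / 2 : ℂ) • (a + Complex.I • a'), fun X => ?_⟩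
    simp only [ContinuousLinearMap.smul_apply, ContinuousLinearMap.add_apply, ha, ha', smul_eq_mul]
    linear_combination (-1 / 4 * (B (Complex.I • Y) (Complex.I • X) : ℂ)) * Complex.I_sq
  choose S hS using h
  have hSa : ∀ Y Y' X, S (Y + Y') X = S Y X + S Y' X := fun Y Y' X => by simp [hS]; ring
  have hSc : ∀ (c : ℂ) Y X, S (c • Y) X = (starRingEnd ℂ) c * S Y X := fun c Y X => by
    have h1 : Complex.I • c • Y = c.re • (Complex.I • Y) - c.im • Y := by
      rw [smul_split c Y, smul_add, smul_comm Complex.I c.re Y, smul_comm Complex.I c.im, smul_smul Complex.I Complex.I, Complex.I_mul_I]; simp; abel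
    rw [hS, hS, h1, smul_split c Y]
    simp only [map_add, map_sub, map_smul, smul_eq_mul, ContinuousLinearMap.smul_apply, ContinuousLinearMap.add_apply, ContinuousLinearMap.sub_apply]
    apply Complex.ext <;> simp <;> ring
  have hSX : ∀ X, S X X = (((B X X + B (Complex.I • X) (Complex.I • X)) / 4 : ℝ) : ℂ) := fun X => by
    rw [hS, hs (Complex.I • X) X]; push_cast; ring
  let e := stdOrthonormalBasis ℂ E
  let A : E →L[ℂ] E := ∑ j, (S (e j)).smulRight (e j)
  have hSsum : ∀ (c : Fin (finrank ℂ E) → ℂ) X, S (∑ j, c j • e j) X = ∑ j, (starRingEnd ℂ) (c j) * S (e j) X := fun c X => by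
    let φ : E →+ ℂ := { toFun := fun Y => S Y X, map_zero' := by simp [hS], map_add' := fun Y Y' => hSa Y Y' X }
    have := map_sum φ (fun j => c j • e j) Finset.univ
    simp only [φ, AddMonoidHom.coe_mk, ZeroHom.coe_mk, hSc] at this
    exact this
  have hA : ∀ X, inner ℂ (A X) X = (((B X X + B (Complex.I • X) (Complex.I • X)) / 4 : ℝ) : ℂ) := fun X => by
    have h1 : inner ℂ X (A X) = S X X := by
      conv_rhs => rw [← e.sum_repr X]
      rw [hSsum, e.sum_repr X]
      simp only [A, ContinuousLinearMap.sum_apply, ContinuousLinearMap.smulRight_apply, inner_sum, inner_smul_right]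
      refine Finset.sum_congr rfl fun j _ => ?_
      rw [e.repr_apply_apply, inner_conj_symm, mul_comm]
    rw [← inner_conj_symm, h1, hSX, Complex.conj_ofReal]
  have hpos : A.IsPositive := by
    rw [ContinuousLinearMap.isPositive_iff_complex]
    intro X
    rw [hA]
    refine ⟨by simp, ?_⟩
    have := hp X
    simp only [RCLike.re_eq_complex_re, Complex.ofReal_re]
    linarith
  obtain ⟨T, hT⟩ := sqrt_pos A hpos
  exact ⟨T, fun X => by rw [hT, hA, Complex.ofReal_re]⟩
end
end

section
open Filter Topology Set Metric Module
open scoped NNReal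
variable {E : Type*} [NormedAddCommGroup E]

theorem lam [NormedSpace ℝ E] [ProperSpace E] {Q P : E → ℝ} (cQ : Continuous Q) (cP : Continuous P) (hP : ∀ X, 0 ≤ P X)
    (hQs : ∀ (t : ℝ) X, Q (t • X) = t ^ 2 * Q X) (hPs : ∀ (t : ℝ) X, P (t • X) = t ^ 2 * P X) (h : ∀ X, X ≠ 0 → P X = 0 → 0 < Q X) :
    ∃ l ≥ 0, ∃ m > 0, ∀ X, m * ‖X‖ ^ 2 ≤ Q X + l * P X := by
  have hne : ∀ X ∈ sphere (0 : E) 1, X ≠ 0 := fun X hX h0 => by simp [h0] at hX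
  obtain ⟨N, hN⟩ := (isCompact_sphere (0 : E) 1).elim_directed_cover (fun N : ℕ => {X | 0 < Q X + N * P X})
    (fun N => isOpen_lt continuous_const (cQ.add (continuous_const.mul cP)))
    (fun X hX => by
      rw [mem_iUnion]
      rcases (hP X).eq_or_lt with h0 | h0
      · exact ⟨0, by simpa using h X (hne X hX) h0.symm⟩
      · obtain ⟨k, hk⟩ := exists_nat_gt (-Q X / P X)
        rw [div_lt_iff₀ h0] at hk
        exact ⟨k, show 0 < Q X + k * P X by linarith⟩)
    (Monotone.directed_le fun i j hij X hX => lt_of_lt_of_le (show 0 < Q X + i * P X from hX)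
      (add_le_add le_rfl (mlr (Nat.cast_le.2 hij) (hP X))))
  obtain ⟨m, hm, hmS⟩ := (isCompact_sphere (0 : E) 1).exists_forall_le' (f := fun X => Q X + N * P X) (a := 0) (cQ.add (continuous_const.mul cP)).continuousOn (fun X hX => hN hX)
  refine ⟨N, N.cast_nonneg, m, hm, fun X => ?_⟩
  by_cases hX : X = 0
  · have h1 := hQs 0 0
    have h2 := hPs 0 0
    simp only [smul_zero] at h1 h2
    rw [hX, h1, h2]; simp
  · have h0 : ‖X‖ ≠ 0 := norm_ne_zero_iff.2 hX
    have h1 := hmS (‖X‖⁻¹ • X) (by simp [norm_smul, h0])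
    rw [hQs, hPs] at h1
    have h3 : (‖X‖⁻¹ ^ 2 * Q X + N * (‖X‖⁻¹ ^ 2 * P X)) * ‖X‖ ^ 2 = Q X + N * P X := by field_simp
    rw [← h3]
    exact mlr h1 p%

variable [InnerProductSpace ℂ E] [FiniteDimensional ℂ E] [NormedSpace ℝ E] [IsScalarTower ℝ ℂ E]

theorem ev_norm {F : Type*} [NormedAddCommGroup F] {g : E → F} {p : E} (h : ContinuousAt g p) {m : ℝ} (hm : 0 < m) : ∀ᶠ z in 𝓝 p, ‖g z - g p‖ < m := by
  filter_upwards [Metric.tendsto_nhds.1 h m hm] with z hz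
  rwa [dist_eq_norm] at hz

theorem gen_final {Ω : Set E} (ho : IsOpen Ω) (hb : Bornology.IsBounded Ω)
    (hSt : ∀ W, IsOpen W → closure Ω ⊆ W → ∃ U, IsOpen U ∧ closure Ω ⊆ U ∧ U ⊆ W ∧ PC U) {p : E} (hpf : p ∈ frontier Ω)
    {ρ : E → ℝ} {W : Set E} (hW : IsOpen W) (hp : p ∈ W) (hρ : ContDiffOn ℝ 2 ρ W) {ε : ℝ} (hε : 0 < ε) (hε1 : ε ≤ 1)
    {H : ℝ≥0} (hH : HolderOnWith H ε.toNNReal (iteratedFDeriv ℝ 2 ρ) W) (hΩ : Ω ∩ W = {z ∈ W | ρ z < 0}) (hd : fderiv ℝ ρ p ≠ 0)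
    (hL : ∀ X, X ≠ 0 → fderiv ℝ ρ p X = 0 → fderiv ℝ ρ p (Complex.I • X) = 0 →
      0 < (fderiv ℝ (fderiv ℝ ρ) p X X + fderiv ℝ (fderiv ℝ ρ) p (Complex.I • X) (Complex.I • X)) / 4) :
    ∃ C > 0, ∃ t > 0, ∀ z ∈ Ω, ‖z - p‖ < t → ∃ f : E → E, DifferentiableOn ℂ f Ω ∧ InjOn f Ω ∧ MapsTo f Ω (ball 0 1) ∧ f z = 0 ∧
      ball 0 (1 - C * infDist z (frontier Ω) ^ (ε / 2)) ⊆ f '' Ω := by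
  haveI : ProperSpace E := FiniteDimensional.proper ℂ E
  have hΩ' : ∀ z ∈ W, z ∈ Ω ↔ ρ z < 0 := fun z hz => by
    have := Set.ext_iff.1 hΩ z
    simp only [mem_inter_iff, hz, and_true] at this
    rw [this]; exact ⟨fun h => h.2, fun h => ⟨hz, h⟩⟩
  have hc : ∀ z ∈ W, ContDiffAt ℝ 2 ρ z := fun z hz => hρ.contDiffAt (hW.mem_nhds hz)
  have hc1 : ∀ z ∈ W, ContDiffAt ℝ 1 (fderiv ℝ ρ) z := fun z hz => (hc z hz).fderiv_right n%
  have c0 : ContinuousOn ρ W := hρ.continuousOn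
  have c1 : ContinuousOn (fderiv ℝ ρ) W := fun z hz => (hc1 z hz).continuousAt.continuousWithinAt
  have c2 : ContinuousOn (fderiv ℝ (fderiv ℝ ρ)) W := fun z hz => (((hc1 z hz).fderiv_right (m := 0) n%).continuousAt).continuousWithinAt
  have hf0 : ∀ q ∈ W, q ∈ frontier Ω → ρ q = 0 := fun q hq hqf => by
    refine le_antisymm ?_ ?_
    · by_contra! hcon
      obtain ⟨y, ⟨hy1, hy2⟩, hy3⟩ := mem_closure_iff_nhds.1 (frontier_subset_closure hqf) _ (inter_mem ((c0.continuousAt (hW.mem_nhds hq)).eventually (lt_mem_nhds hcon)) (hW.mem_nhds hq))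
      exact absurd ((hΩ' y hy2).1 hy3) (not_lt.2 (le_of_lt hy1))
    · by_contra! hcon
      have := (hΩ' q hq).2 hcon
      rw [ho.frontier_eq] at hqf
      exact hqf.2 this
  have hρp := hf0 p hp hpf
  have hI : ∀ X : E, ‖Complex.I • X‖ = ‖X‖ := fun X => by rw [norm_smul]; simp
  have hIc : Continuous fun X : E => Complex.I • X := continuous_const_smul _
  obtain ⟨D1, hD1⟩ := ex_eq (fderiv ℝ ρ p)
  obtain ⟨D2, hD2⟩ := ex_eq (fderiv ℝ (fderiv ℝ ρ) p)
  obtain ⟨l0, hl0, m, hm, hlm⟩ := lam (E := E) (Q := fun X => (D2 X X + D2 (Complex.I • X) (Complex.I • X)) / 4) (P := fun X => D1 X ^ 2 + D1 (Complex.I • X) ^ 2)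
    (((D2.continuous.clm_apply continuous_id).add ((D2.continuous.comp hIc).clm_apply hIc)).div_const 4)
    ((D1.continuous.pow 2).add ((D1.continuous.comp hIc).pow 2)) (fun X => by positivity)
    (fun t X => by simp only [smul_comm Complex.I t X, map_smul, ContinuousLinearMap.smul_apply, smul_eq_mul]; ring)
    (fun t X => by simp only [smul_comm Complex.I t X, map_smul, smul_eq_mul]; ring)
    (fun X hX hP => by
      rw [hD1] at hP; rw [hD2]
      exact hL X hX (by nlinarith [sq_nonneg (fderiv ℝ ρ p X), sq_nonneg (fderiv ℝ ρ p (Complex.I • X))]) (by nlinarith [sq_nonneg (fderiv ℝ ρ p X), sq_nonneg (fderiv ℝ ρ p (Complex.I • X))]))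
  obtain ⟨l, hl⟩ := ex_eq (2 * l0)
  have hl' : 0 ≤ l := by rw [hl]; positivity
  obtain ⟨s, hs, A, hA, hTay⟩ := real_taylor hW hp hρ hε hε1 hH hl'
  have d1 : ContinuousOn (rD1 ρ l) W := (continuousOn_const.add (continuousOn_const.mul c0)).smul c1
  have d2 : ContinuousOn (rD2 ρ l) W := by
    refine ((continuousOn_const.add (continuousOn_const.mul c0)).smul c2).add ((continuousOn_const (c := 2 * l)).smul ?_)
    exact ((ContinuousLinearMap.smulRightL ℝ E (E →L[ℝ] ℝ)).continuous.comp_continuousOn c1).clm_apply c1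
  have hsym : ∀ z ∈ W, ∀ X Y, rD2 ρ l z X Y = rD2 ρ l z Y X := fun z hz X Y => by
    have h1 : fderiv ℝ (fderiv ℝ ρ) z X Y = fderiv ℝ (fderiv ℝ ρ) z Y X := (hc z hz).isSymmSndFDerivAt (by rw [minSmoothness_of_isRCLikeNormedField]) X Y
    simp only [rD2, ContinuousLinearMap.add_apply, ContinuousLinearMap.smul_apply, ContinuousLinearMap.smulRight_apply, smul_eq_mul, h1]; ring
  choose a ha using fun z => exists_cl (rD1 ρ l z)
  choose b hb' using fun z => exists_cb (rD2 ρ l z)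
  have hTex : ∀ z, ∃ T : E →L[ℂ] E, z ∈ W → (∀ X, 0 ≤ rD2 ρ l z X X + rD2 ρ l z (Complex.I • X) (Complex.I • X)) →
      ∀ X, ‖T X‖ ^ 2 = (rD2 ρ l z X X + rD2 ρ l z (Complex.I • X) (Complex.I • X)) / 4 := fun z => by
    by_cases hz : z ∈ W ∧ ∀ X, 0 ≤ rD2 ρ l z X X + rD2 ρ l z (Complex.I • X) (Complex.I • X)
    · obtain ⟨T, hT⟩ := factor (hsym z hz.1) hz.2
      exact ⟨T, fun _ _ => hT⟩
    · exact ⟨0, fun h1 h2 => absurd ⟨h1, h2⟩ hz⟩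
  choose T hT using hTex
  have hlow : ∀ X, m * ‖X‖ ^ 2 ≤ (rD2 ρ l p X X + rD2 ρ l p (Complex.I • X) (Complex.I • X)) / 4 := fun X => by
    refine (hlm X).trans (le_of_eq ?_)
    simp only [rD2, hρp, ← hD1, ← hD2, hl, ContinuousLinearMap.add_apply, ContinuousLinearMap.smul_apply, ContinuousLinearMap.smulRight_apply, smul_eq_mul]; ring
  have hWp := hW.mem_nhds hp
  obtain ⟨K, t, ht, hK⟩ := ((hc p hp).of_le n% : ContDiffAt ℝ 1 ρ p).exists_lipschitzOnWith
  have q1 : ∀ᶠ z in 𝓝 p, ‖rD2 ρ l z - rD2 ρ l p‖ < m := ev_norm (F := E →L[ℝ] E →L[ℝ] ℝ) (d2.continuousAt hWp) hm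
  have q2 : ∀ᶠ z in 𝓝 p, 0 < 1 + l * ρ z := by
    have cq : ContinuousAt (fun z => 1 + l * ρ z) p := continuousAt_const.add (continuousAt_const.mul (c0.continuousAt hWp))
    exact cq.eventually (lt_mem_nhds (by simp [hρp]))
  obtain ⟨r, hr, hev⟩ := Metric.eventually_nhds_iff.1 ((((show ∀ᶠ z in 𝓝 p, z ∈ t from ht).and (hW.eventually_mem hp)).and q1).and q2)
  have key : ∀ z, dist z p < r → (∀ X, m / 2 * ‖X‖ ^ 2 ≤ ‖T z X‖ ^ 2) ∧ (∀ X, ‖T z X‖ ^ 2 ≤ (‖rD2 ρ l p‖ + m) * ‖X‖ ^ 2) ∧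
      ∀ X, ‖T z X‖ ^ 2 = (rD2 ρ l z X X + rD2 ρ l z (Complex.I • X) (Complex.I • X)) / 4 := fun z hz => by
    obtain ⟨⟨⟨e1, e2⟩, e3⟩, e4⟩ := hev hz
    have g : ∀ X, |(rD2 ρ l z - rD2 ρ l p) X X| ≤ m * ‖X‖ ^ 2 := fun X => by
      rw [← Real.norm_eq_abs]
      refine (ContinuousLinearMap.le_opNorm₂ _ _ _).trans ?_
      rw [mul_assoc, ← sq]; exact mlr e3.le p%
    have g2 : ∀ X, |rD2 ρ l p X X| ≤ ‖rD2 ρ l p‖ * ‖X‖ ^ 2 := fun X => by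
      rw [← Real.norm_eq_abs]
      refine (ContinuousLinearMap.le_opNorm₂ _ _ _).trans ?_
      rw [mul_assoc, ← sq]
    simp only [ContinuousLinearMap.sub_apply] at g
    have u1 : ∀ X, m / 2 * ‖X‖ ^ 2 ≤ (rD2 ρ l z X X + rD2 ρ l z (Complex.I • X) (Complex.I • X)) / 4 := fun X => by
      have h1 := abs_le.1 (g X)
      have h2 := abs_le.1 (g (Complex.I • X))
      rw [hI] at h2
      linarith [hlow X]
    have u2 : ∀ X, (rD2 ρ l z X X + rD2 ρ l z (Complex.I • X) (Complex.I • X)) / 4 ≤ (‖rD2 ρ l p‖ + m) * ‖X‖ ^ 2 := fun X => by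
      have h1 := abs_le.1 (g X)
      have h2 := abs_le.1 (g (Complex.I • X))
      have h3 := abs_le.1 (g2 X)
      have h4 := abs_le.1 (g2 (Complex.I • X))
      rw [hI] at h2 h4
      have : 0 ≤ m * ‖X‖ ^ 2 := by positivity
      have : 0 ≤ ‖rD2 ρ l p‖ * ‖X‖ ^ 2 := by positivity
      linarith
    have u3 := hT z e2 (fun X => by have := u1 X; have : 0 ≤ m / 2 * ‖X‖ ^ 2 := by positivity
                                    linarith)
    exact ⟨fun X => by rw [u3]; exact u1 X, fun X => by rw [u3]; exact u2 X, u3⟩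
  obtain ⟨B, hB⟩ := ex_eq (1 + A + (‖rD2 ρ l p‖ + m) + 2 / m)
  have nn := norm_nonneg (rD2 ρ l p)
  have nm : 0 < 2 / m := by positivity
  have hB1 : 1 ≤ B := by linarith
  have hBB : B ≤ B ^ 2 := by nlinarith
  have hmin : ∀ z, dist z p < min r s → dist z p < r := fun z hz => hz.trans_le (min_le_left _ _)
  have ca : ContinuousAt a p := by
    refine ContinuousOn.continuousAt ?_ hWp
    rw [continuousOn_clm_apply]
    intro X
    simp only [ha]
    have hh : ∀ X, ContinuousOn (fun z => (rD1 ρ l z X : ℂ)) W := fun X => Complex.continuous_ofReal.comp_continuousOn (d1.clm_apply continuousOn_const)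
    exact ((hh X).sub (continuousOn_const.mul (hh _))).div_const 2
  have cb : ContinuousAt b p := by
    refine ContinuousOn.continuousAt ?_ hWp
    rw [continuousOn_clm_apply]
    intro X
    rw [continuousOn_clm_apply]
    intro Y
    simp only [hb']
    have hh : ∀ X Y, ContinuousOn (fun z => (rD2 ρ l z X Y : ℂ)) W := fun X Y => Complex.continuous_ofReal.comp_continuousOn ((d2.clm_apply continuousOn_const).clm_apply continuousOn_const)
    exact (((hh X Y).sub (hh _ _)).sub (continuousOn_const.mul ((hh _ Y).add (hh X _)))).div_const 4
  have cr : ContinuousAt (fun z => ρ z + l * ρ z ^ 2) p := (c0.add (continuousOn_const.mul (c0.pow 2))).continuousAt hWp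
  have ha0 : a p ≠ 0 := fun h0 => hd (by
    ext X
    have h1 := congrArg Complex.re (ha p X)
    rw [h0] at h1
    simp [rD1, hρp] at h1
    simp only [ContinuousLinearMap.zero_apply]
    linarith)
  obtain ⟨C, hC, t1, ht1, hcore⟩ := core (rh := fun z => ρ z + l * ρ z ^ 2) (a := a) (b := b) (T := T) (s1 := min r s) (A := B) hb hSt (frontier_subset_closure hpf)
    (lt_min hr hs) hε hε1 l%
    (fun y0 hy h hh => by
      have h1 := hTay y0 ((mem_ball.1 hy).trans_le (min_le_right _ _)) h (hh.trans_le (min_le_right _ _))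
      have h2 := (key y0 (hmin _ (mem_ball.1 hy))).2.2 h
      have h3 : 2 * (a y0 h).re = rD1 ρ l y0 h := by rw [ha]; simp; ring
      have h4 : (b y0 h h).re = (rD2 ρ l y0 h h - rD2 ρ l y0 (Complex.I • h) (Complex.I • h)) / 4 := by
        rw [hb']; simp [Complex.sub_re]
      rw [h2, h3, h4]
      refine le_trans (le_of_eq ?_) (h1.trans (mlr (show A ≤ B by linarith) p%))
      congr 1; ring)
    (fun y0 hy X => by
      refine (pow_le_pow_iff_left₀ (norm_nonneg _) p% two_ne_zero).1 (((key y0 (hmin _ (mem_ball.1 hy))).2.1 X).trans ?_)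
      rw [mul_pow]
      exact mlr l% p%)
    (fun y0 hy X => by
      refine (pow_le_pow_iff_left₀ (norm_nonneg _) p% two_ne_zero).1 ?_
      have h1 := mll ((key y0 (hmin _ (mem_ball.1 hy))).1 X) nm.le
      have h2 : 2 / m * (m / 2 * ‖X‖ ^ 2) = ‖X‖ ^ 2 := by field_simp
      rw [h2] at h1
      rw [mul_pow]
      exact h1.trans (mlr l% p%))
    ca cb cr (by simp [hρp]) ha0
    (fun z hz => by
      obtain ⟨⟨⟨e1, e2⟩, e3⟩, e4⟩ := hev (hmin _ (mem_ball.1 hz))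
      rw [hΩ' z e2, show ρ z + l * ρ z ^ 2 = ρ z * (1 + l * ρ z) by ring]
      exact ⟨fun h => mul_neg_of_neg_of_pos h e4, fun h => by by_contra! h'; linarith [mul_nonneg h' e4.le]⟩)
  obtain ⟨G, hG⟩ := ex_eq (C * ((K : ℝ) + 1) ^ (ε / 2) : ℝ)
  have hG0 : 0 < G := by rw [hG]; positivity
  refine ⟨G, hG0, min t1 (r / 2), lt_min ht1 p%, fun z hz hzt => ?_⟩
  obtain ⟨f, f1, f2, f3, f4, f5⟩ := hcore z hz (hzt.trans_le (min_le_left _ _))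
  refine ⟨f, f1, f2, f3, f4, (ball_subset_ball ?_).trans f5⟩
  have hzr : dist z p < r / 2 := by rw [dist_eq_norm]; exact hzt.trans_le (min_le_right _ _)
  obtain ⟨q, hq, hqd⟩ := isClosed_frontier.exists_infDist_eq_dist ⟨p, hpf⟩ z
  have hqz : dist z q ≤ dist z p := hqd ▸ infDist_le_dist_of_mem hpf
  have hqr : dist q p < r := by linarith [dist_triangle_left q p z]
  have hzr' : dist z p < r := by linarith
  have hlip := hK.dist_le_mul _ (hev hzr').1.1.1 _ (hev hqr).1.1.1
  rw [hf0 q (hev hqr).1.1.2 hq, Real.dist_eq, sub_zero, ← hqd] at hlip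
  have hi0 : 0 ≤ infDist z (frontier Ω) := infDist_nonneg
  have hneg := (hΩ' z (hev hzr').1.1.2).1 hz
  have h1 : -(ρ z + l * ρ z ^ 2) ≤ ((K : ℝ) + 1) * infDist z (frontier Ω) := by
    have := neg_le_abs (ρ z)
    have : 0 ≤ l * ρ z ^ 2 := by positivity
    linarith
  have h2 : 0 ≤ -(ρ z + l * ρ z ^ 2) := by
    have := mul_neg_of_neg_of_pos hneg (hev hzr').2
    linarith
  have h3 := Real.rpow_le_rpow h2 h1 (show 0 ≤ ε / 2 by positivity)
  rw [Real.mul_rpow p% hi0] at h3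
  have h4 := mll h3 hC.le
  rw [← mul_assoc, ← hG] at h4
  linarith
end

section
open Metric MeasureTheory Set
open scoped NNReal ENNReal
theorem squeezing_estimate_C2eps (n : ℕ) (ε : ℝ) (hε : ε ∈ Set.Ioc (0 : ℝ) 1)
    (Ω : Set (Cn n)) (hopen : IsOpen Ω) (hconn : IsConnected Ω) (hbdd : Bornology.IsBounded Ω) (hStein : HasSteinBasis Ω)
    (p : Cn n) (hp : IsStrictPscPtHolder Ω p 2 ε) :
    ∃ (C : ℝ) (U : Set (Cn n)), 0 < C ∧ IsOpen U ∧ p ∈ U ∧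
      ∀ z ∈ Ω ∩ U, 1 - C * bdist Ω z ^ (ε / 2) ≤ squeezing Ω z := by
  obtain ⟨hpf, W, hW, hpW, ρ, hρ, ⟨H, hH⟩, hΩ, hd, hL⟩ := hp
  have hc1 : ContDiffAt ℝ 1 (fderiv ℝ ρ) p := (hρ.contDiffAt (hW.mem_nhds hpW)).fderiv_right n%
  have hdd : ∀ X : Cn n, fderiv ℝ (fun w => fderiv ℝ ρ w X) p = (fderiv ℝ (fderiv ℝ ρ) p).flip X := fun X =>
    ((ContinuousLinearMap.apply ℝ ℝ X).hasFDerivAt.comp p (hc1.differentiableAt n%).hasFDerivAt).fderiv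
  obtain ⟨C, hC, t, ht, h⟩ := gen_final hopen hbdd
    (fun V hV hc => by
      obtain ⟨U, hU, h1, h2⟩ := hStein V hV hc
      exact ⟨U, hU.1, h1, h2, hU.2.2⟩)
    hpf hW hpW hρ hε.1 hε.2 hH hΩ (hd p ⟨hpf, hpW⟩)
    (fun X hX h1 h2 => by
      have := hL p ⟨hpf, hpW⟩ X hX (by simp [cderiv, h1, h2])
      simpa only [leviForm, hdd, ContinuousLinearMap.flip_apply] using this)
  refine ⟨C, ball p t, hC, isOpen_ball, mem_ball_self ht, fun z hz => ?_⟩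
  obtain ⟨f, f1, f2, f3, f4, f5⟩ := h z hz.1 (by rw [← dist_eq_norm]; exact hz.2)
  by_cases hr : 0 < 1 - C * bdist Ω z ^ (ε / 2)
  · refine le_csSup ⟨1, ?_⟩ ⟨hr, f, f1, f2, f3, f4, f5⟩
    rintro r ⟨hr, g, g1, g2, g3, g4, g5⟩
    have hn : n ≠ 0 := by
      rintro rfl
      haveI : Subsingleton (Cn 0) := inferInstance
      rw [Set.eq_univ_of_forall (s := Ω) (fun x => Subsingleton.elim z x ▸ hz.1), frontier_univ] at hpf
      exact hpf
    by_contra! h1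
    have h2 : EuclideanSpace.single (⟨0, Nat.pos_of_ne_zero hn⟩ : Fin n) (1 : ℂ) ∈ ball (0 : Cn n) r := by
      rw [mem_ball_zero_iff, EuclideanSpace.norm_single]; simpa using h1
    obtain ⟨y, hy, hyy⟩ := g5 h2
    have h3 := g3 hy
    rw [hyy, mem_ball_zero_iff, EuclideanSpace.norm_single] at h3
    simp at h3
  · exact (not_lt.1 hr).trans (Real.sSup_nonneg fun r hr => hr.1.le)
end
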